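/- There exists a constant N > 0 such that every integer n > N with n ≡ 0 (mod 6) or n ≡ 2 (mod 6) can be written as n = q² + η, where q is a prime and η is a positive integer with at most 17 prime factors counted with multiplicity (i.e. Ω(η) ≤ 17). -/

import Mathlib

namespace PrimeSquareSieve

open Finset Real

local notation "ω" => ArithmeticFunction.cardDistinctFactors

section

open scoped ArithmeticFunction.vonMangoldt

lemma add_one_pow_omega_le {c d : ℕ} (hd : d ≠ 0) :
    ((c : ℝ) + 1) ^ ω d ≤ ∑ e ∈ d.divisors, (c : ℝ) ^ ω e := by
  have h1 : ((c : ℝ) + 1) ^ ω d = ∑ S ∈ d.primeFactors.powerset, (c : ℝ) ^ S.card := by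
    have := Finset.sum_pow_mul_eq_add_pow (c : ℝ) 1 d.primeFactors
    simp only [one_pow, mul_one] at this
    rw [this, ArithmeticFunction.cardDistinctFactors_apply]
    rfl
  rw [h1]
  have hinj : Set.InjOn (fun S : Finset ℕ => ∏ p ∈ S, p) d.primeFactors.powerset := by
    intro S hS T hT h
    have hS' := Finset.mem_powerset.1 hS
    have hT' := Finset.mem_powerset.1 hT
    have e1 := Nat.primeFactors_prod (s := S) fun p hp => Nat.prime_of_mem_primeFactors (hS' hp)
    have e2 := Nat.primeFactors_prod (s := T) fun p hp => Nat.prime_of_mem_primeFactors (hT' hp)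
    simp only at h
    rw [← e1, ← e2, h]
  calc ∑ S ∈ d.primeFactors.powerset, (c : ℝ) ^ S.card
      = ∑ S ∈ d.primeFactors.powerset, (c : ℝ) ^ ω (∏ p ∈ S, p) := by
        refine sum_congr rfl fun S hS => ?_
        have hS' := Finset.mem_powerset.1 hS
        have e1 := Nat.primeFactors_prod (s := S) fun p hp => Nat.prime_of_mem_primeFactors (hS' hp)
        congr 1
        change _ = (∏ p ∈ S, p).primeFactorsList.dedup.length
        rw [← List.card_toFinset]
        exact (congrArg card e1).symm
    _ = ∑ e ∈ d.primeFactors.powerset.image (fun S : Finset ℕ => ∏ p ∈ S, p), (c : ℝ) ^ ω e := by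
        rw [sum_image hinj]
    _ ≤ _ := by
        refine sum_le_sum_of_subset_of_nonneg ?_ fun _ _ _ => by positivity
        intro e he
        obtain ⟨S, hS, rfl⟩ := Finset.mem_image.1 he
        have hS' := Finset.mem_powerset.1 hS
        rw [Nat.mem_divisors]
        exact ⟨(Finset.prod_dvd_prod_of_subset _ _ _ hS').trans (Nat.prod_primeFactors_dvd d), hd⟩

lemma sum_Icc_inv_le (D : ℕ) : ∑ d ∈ Icc 1 D, (1 : ℝ) / d ≤ 1 + log D := by
  have := harmonic_le_one_add_log D
  rw [harmonic_eq_sum_Icc] at this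
  push_cast at this
  simpa [one_div] using this

/-- Sum over divisor pairs versus product of sums. -/
lemma sum_divisors_le_mul {f g : ℕ → ℝ} (hf : ∀ m, 0 ≤ f m) (hg : ∀ m, 0 ≤ g m) (D : ℕ) :
    ∑ d ∈ Icc 1 D, ∑ e ∈ d.divisors, f e * g (d / e) ≤
      (∑ e ∈ Icc 1 D, f e) * ∑ e ∈ Icc 1 D, g e := by
  rw [sum_mul_sum, ← sum_product', Finset.sum_sigma']
  set s := (Icc 1 D).sigma fun d => d.divisors
  set i : (Σ _ : ℕ, ℕ) → ℕ × ℕ := fun x => (x.2, x.1 / x.2)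
  have himg : s.image i ⊆ Icc 1 D ×ˢ Icc 1 D := by
    intro x hx
    obtain ⟨⟨d, e⟩, h, rfl⟩ := mem_image.1 hx
    simp only [s, i, mem_sigma, mem_Icc, Nat.mem_divisors, mem_product] at h ⊢
    obtain ⟨⟨h1, h2⟩, h3, h4⟩ := h
    have he := Nat.pos_of_dvd_of_pos h3 h1
    refine ⟨⟨he, (Nat.le_of_dvd h1 h3).trans h2⟩, Nat.div_pos (Nat.le_of_dvd h1 h3) he,
      (Nat.div_le_self _ _).trans h2⟩
  have hinj : Set.InjOn i s := by
    rintro ⟨d, e⟩ h ⟨d', e'⟩ h' heq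
    simp only [s, i, mem_coe, mem_sigma, mem_Icc, Nat.mem_divisors, Prod.mk.injEq]
      at h h' heq
    obtain ⟨rfl, h5⟩ := heq
    have : d = d' := by
      rw [← Nat.mul_div_cancel' h.2.1, ← Nat.mul_div_cancel' h'.2.1, h5]
    subst this; rfl
  calc _ = ∑ x ∈ s.image i, f x.1 * g x.2 := by rw [sum_image hinj]
    _ ≤ _ := sum_le_sum_of_subset_of_nonneg himg fun _ _ _ => mul_nonneg (hf _) (hg _)

lemma sum_pow_omega_div_le (c D : ℕ) :
    ∑ d ∈ Icc 1 D, (c : ℝ) ^ ω d / d ≤ (1 + log D) ^ c := by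
  rcases Nat.eq_zero_or_pos D with rfl | hD
  · simp
  have hL : 0 ≤ log (D : ℝ) := log_natCast_nonneg D
  induction c with
  | zero =>
    rw [pow_zero]
    calc ∑ d ∈ Icc 1 D, ((0 : ℕ) : ℝ) ^ ω d / d
        ≤ ∑ d ∈ Icc 1 D, if d = 1 then (1 : ℝ) else 0 := by
          refine sum_le_sum fun d hd => ?_
          have hd1 := (mem_Icc.1 hd).1
          split_ifs with h
          · subst h; simp
          · have : ω d ≠ 0 := by
              rw [Ne, ArithmeticFunction.cardDistinctFactors_eq_zero]
              omega
            simp [this]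
      _ ≤ 1 := by
        rw [sum_ite_eq']; split_ifs <;> norm_num
  | succ c ih =>
    calc ∑ d ∈ Icc 1 D, ((c + 1 : ℕ) : ℝ) ^ ω d / d
        ≤ ∑ d ∈ Icc 1 D, ∑ e ∈ d.divisors, (fun e : ℕ => (c : ℝ) ^ ω e / e) e *
            (fun e : ℕ => (1 : ℝ) / e) (d / e) := by
          refine sum_le_sum fun d hd => ?_
          have hd1 := (mem_Icc.1 hd).1
          have := add_one_pow_omega_le (c := c) (d := d) (by omega)
          push_cast
          calc ((c : ℝ) + 1) ^ ω d / d ≤ (∑ e ∈ d.divisors, (c : ℝ) ^ ω e) / d := by gcongr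
            _ = _ := by
              rw [sum_div]
              refine sum_congr rfl fun e he => ?_
              have hed := Nat.dvd_of_mem_divisors he
              have he0 : (e : ℝ) ≠ 0 := by
                have := Nat.pos_of_mem_divisors he
                positivity
              have hd0 : (d : ℝ) ≠ 0 := by positivity
              rw [Nat.cast_div hed he0]
              field_simp
      _ ≤ (∑ e ∈ Icc 1 D, (c : ℝ) ^ ω e / e) * ∑ e ∈ Icc 1 D, (1 : ℝ) / e :=
          sum_divisors_le_mul (f := fun e : ℕ => (c : ℝ) ^ ω e / e)
            (g := fun e : ℕ => (1 : ℝ) / e) (fun _ => by positivity) (fun _ => by positivity) D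
      _ ≤ (1 + log D) ^ c * (1 + log D) := by
          gcongr
          exact sum_Icc_inv_le D
      _ = _ := by rw [pow_succ]

lemma pow_omega_le (c : ℕ) {ε : ℝ} (hε : 0 < ε) :
    ∃ C : ℝ, 1 ≤ C ∧ ∀ m : ℕ, m ≠ 0 → (c : ℝ) ^ ω m ≤ C * (m : ℝ) ^ ε := by
  obtain ⟨P, hP⟩ := exists_nat_gt ((c : ℝ) ^ (1 / ε))
  refine ⟨((c : ℝ) + 1) ^ P, one_le_pow₀ (by linarith [(Nat.cast_nonneg c : (0:ℝ) ≤ c)]), fun m hm => ?_⟩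
  have e1 : (c : ℝ) ^ ω m = ∏ p ∈ m.primeFactors, (c : ℝ) := by
    rw [prod_const]; congr 1
  have hpp : ∀ p ∈ m.primeFactors, p.Prime := fun p hp => Nat.prime_of_mem_primeFactors hp
  have hc0 : (0:ℝ) ≤ c := Nat.cast_nonneg c
  calc (c : ℝ) ^ ω m = ∏ p ∈ m.primeFactors, (c : ℝ) := e1
    _ ≤ ∏ p ∈ m.primeFactors, ((if p < P then (c : ℝ) + 1 else 1) * (p : ℝ) ^ ε) := by
        refine prod_le_prod (fun _ _ => hc0) fun p hp => ?_
        have hp1 : (1 : ℝ) ≤ p := by exact_mod_cast (hpp p hp).one_le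
        split_ifs with h
        · have : (1:ℝ) ≤ (p : ℝ) ^ ε := one_le_rpow hp1 hε.le
          nlinarith
        · rw [one_mul]
          have h2 : (c : ℝ) ^ (1 / ε) ≤ p := hP.le.trans (by exact_mod_cast not_lt.1 h)
          calc (c : ℝ) = ((c : ℝ) ^ (1 / ε)) ^ ε := by
                rw [← rpow_mul hc0, one_div, inv_mul_cancel₀ hε.ne', rpow_one]
            _ ≤ _ := by gcongr
    _ = (∏ p ∈ m.primeFactors, (if p < P then (c : ℝ) + 1 else 1)) *
          ((∏ p ∈ m.primeFactors, p : ℕ) : ℝ) ^ ε := by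
        rw [prod_mul_distrib]
        congr 1
        rw [Nat.cast_prod, Real.finsetProd_rpow _ _ fun _ _ => Nat.cast_nonneg _]
    _ ≤ ((c : ℝ) + 1) ^ P * (m : ℝ) ^ ε := by
        gcongr
        · rw [← prod_filter, prod_const]
          refine pow_le_pow_right₀ (by linarith) ?_
          calc #{p ∈ m.primeFactors | p < P} ≤ #(range P) :=
                card_le_card fun p hp => mem_range.2 (mem_filter.1 hp).2
            _ = P := card_range P
        · exact Nat.le_of_dvd (Nat.pos_of_ne_zero hm) (Nat.prod_primeFactors_dvd m)

lemma sum_log_div_prime_le (N : ℕ) :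
    ∑ p ∈ Icc 1 N with p.Prime, log p / p ≤ log N + log 4 := by
  rcases Nat.eq_zero_or_pos N with rfl | hN
  · simp; positivity
  have hN' : (0 : ℝ) < N := by exact_mod_cast hN
  have h1 : ∑ p ∈ Icc 1 N with p.Prime, log p * ((N / p : ℕ) : ℝ) ≤ N * log N := by
    calc ∑ p ∈ Icc 1 N with p.Prime, log p * ((N / p : ℕ) : ℝ)
        = ∑ p ∈ Icc 1 N with p.Prime, ∑ m ∈ Icc 1 N, if p ∣ m then log (p : ℝ) else 0 := by
          refine sum_congr rfl fun p _ => ?_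
          rw [← sum_filter, sum_const, nsmul_eq_mul, mul_comm]
          congr 2
          exact (Nat.Ioc_filter_dvd_card_eq_div N p).symm
      _ = ∑ m ∈ Icc 1 N, ∑ p ∈ Icc 1 N with p.Prime, if p ∣ m then log (p : ℝ) else 0 := sum_comm
      _ ≤ ∑ m ∈ Icc 1 N, log N := by
          refine sum_le_sum fun m hm => ?_
          obtain ⟨hm1, hm2⟩ := mem_Icc.1 hm
          rw [← sum_filter]
          have e : filter (fun p => p ∣ m) {p ∈ Icc 1 N | p.Prime} = m.primeFactors := by
            ext p
            simp only [mem_filter, mem_Icc, Nat.mem_primeFactors]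
            constructor
            · rintro ⟨⟨_, h⟩, h'⟩; exact ⟨h, h', by omega⟩
            · rintro ⟨h, h', _⟩
              exact ⟨⟨⟨h.one_le, (Nat.le_of_dvd hm1 h').trans hm2⟩, h⟩, h'⟩
          rw [e, ← log_prod fun p hp =>
            Nat.cast_ne_zero.2 (Nat.prime_of_mem_primeFactors hp).ne_zero, ← Nat.cast_prod]
          refine log_le_log ?_ ?_
          · exact_mod_cast Finset.prod_pos fun p hp => (Nat.prime_of_mem_primeFactors hp).pos
          · exact_mod_cast (Nat.le_of_dvd hm1 (Nat.prod_primeFactors_dvd m)).trans hm2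
      _ = N * log N := by simp
  have h2 : ∑ p ∈ Icc 1 N with p.Prime, log p ≤ log 4 * N := by
    have := Chebyshev.theta_le_log4_mul_x (x := N) hN'.le
    rwa [Chebyshev.theta, Nat.floor_natCast] at this
  have h3 : N * ∑ p ∈ Icc 1 N with p.Prime, log p / p ≤ N * log N + log 4 * N := by
    calc N * ∑ p ∈ Icc 1 N with p.Prime, log p / p
        ≤ ∑ p ∈ Icc 1 N with p.Prime, (log p * ((N / p : ℕ) : ℝ) + log p) := by
          rw [mul_sum]
          refine sum_le_sum fun p hp => ?_
          have hp0 : (0 : ℝ) < p := by exact_mod_cast (mem_filter.1 hp).2.pos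
          have : (N : ℝ) / p ≤ ((N / p : ℕ) : ℝ) + 1 := by
            rw [← Nat.floor_div_eq_div (K := ℝ)]; exact (Nat.lt_floor_add_one _).le
          have hl : 0 ≤ log (p : ℝ) := log_natCast_nonneg p
          calc (N : ℝ) * (log p / p) = log p * (N / p) := by ring
            _ ≤ log p * (((N / p : ℕ) : ℝ) + 1) := by gcongr
            _ = _ := by ring
      _ ≤ _ := by rw [sum_add_distrib]; exact add_le_add h1 h2
  have h4 : N * ∑ p ∈ Icc 1 N with p.Prime, log p / p ≤ N * (log N + log 4) := by linarith
  exact le_of_mul_le_mul_left h4 hN'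

lemma exists_le_sum_log_div_prime (B : ℝ) :
    ∃ p₀ : ℕ, 100 ≤ p₀ ∧ B ≤ ∑ p ∈ Icc 1 p₀ with p.Prime, log p / p := by
  by_contra! hcon
  refine not_summable_one_div_on_primes (summable_of_sum_range_le (c := 2 * B) ?_ fun n => ?_)
  · intro n
    exact Set.indicator_nonneg (fun _ _ => by positivity) n
  · have hpos : ∀ p ∈ {p ∈ Icc 1 (n + 100) | p.Prime}, (1 : ℝ) / p ≤ 2 * (log p / p) := by
      intro p hp
      have hp2 : (2 : ℝ) ≤ p := by exact_mod_cast (mem_filter.1 hp).2.two_le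
      have h1 : log 2 ≤ log p := log_le_log (by norm_num) hp2
      have h2 := log_two_gt_d9
      rw [← mul_div_assoc]
      gcongr
      linarith
    calc ∑ i ∈ range n, Set.indicator {p : ℕ | p.Prime} (fun n : ℕ => (1 : ℝ) / n) i
        = ∑ i ∈ range n with i.Prime, (1 : ℝ) / i := by
          rw [sum_filter]; simp [Set.indicator_apply]
      _ ≤ ∑ p ∈ Icc 1 (n + 100) with p.Prime, (1 : ℝ) / p := by
          refine sum_le_sum_of_subset_of_nonneg ?_ fun _ _ _ => by positivity
          intro p hp
          simp only [mem_filter, mem_range, mem_Icc] at hp ⊢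
          exact ⟨⟨hp.2.one_le, by omega⟩, hp.2⟩
      _ ≤ ∑ p ∈ Icc 1 (n + 100) with p.Prime, 2 * (log p / p) := sum_le_sum hpos
      _ ≤ 2 * B := by
          rw [← mul_sum]
          have := hcon (n + 100) (by omega)
          linarith

/-- Beyond a suitable point, primes contribute at most as predicted by dimension two. -/
lemma exists_sum_two_log_div_le :
    ∃ p₀ : ℕ, 100 ≤ p₀ ∧ ∀ t : ℝ, 1 ≤ t →
      ∑ p ∈ Ioc p₀ ⌊t⌋₊ with p.Prime, 2 * log p / (p - 3) ≤ 2 * log t := by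
  have hs : Summable fun m : ℕ => 6 * log m / ((m : ℝ) ^ 2) := by
    have h1 : Summable fun m : ℕ => 12 * (1 / (m : ℝ) ^ (3 / 2 : ℝ)) :=
      (Real.summable_one_div_nat_rpow.2 (by norm_num)).mul_left 12
    refine Summable.of_nonneg_of_le (fun m => ?_) (fun m => ?_) h1
    · have := log_natCast_nonneg m
      positivity
    · rcases Nat.eq_zero_or_pos m with rfl | hm
      · simp
      have hm' : (0 : ℝ) < m := by exact_mod_cast hm
      have h2 := log_le_rpow_div hm'.le (ε := 1 / 2) (by norm_num)
      have h3 : (m : ℝ) ^ (2 : ℕ) = (m : ℝ) ^ (1 / 2 : ℝ) * (m : ℝ) ^ (3 / 2 : ℝ) := by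
        rw [← rpow_add hm', ← rpow_natCast]; norm_num
      rw [h3]
      have h4 : 0 < (m : ℝ) ^ (1 / 2 : ℝ) := by positivity
      have h5 : 0 < (m : ℝ) ^ (3 / 2 : ℝ) := by positivity
      rw [mul_one_div, div_le_div_iff₀ (by positivity) h5]
      nlinarith
  obtain ⟨p₀, hp₀, hB⟩ :=
    exists_le_sum_log_div_prime (log 4 + ∑' m : ℕ, 6 * log m / ((m : ℝ) ^ 2))
  refine ⟨p₀, hp₀, fun t ht => ?_⟩
  have hfl : log (⌊t⌋₊ : ℝ) ≤ log t :=
    log_le_log (by exact_mod_cast Nat.floor_pos.2 ht) (Nat.floor_le (by linarith))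
  rcases le_total ⌊t⌋₊ p₀ with hle | hle
  · rw [Ioc_eq_empty_of_le hle]
    simp only [filter_empty, sum_empty]
    have := log_nonneg ht
    positivity
  have hM := sum_log_div_prime_le ⌊t⌋₊
  have hsplit : ∑ p ∈ Icc 1 ⌊t⌋₊ with p.Prime, log p / p =
      ∑ p ∈ Icc 1 p₀ with p.Prime, log p / (p : ℝ) +
        ∑ p ∈ Ioc p₀ ⌊t⌋₊ with p.Prime, log p / (p : ℝ) := by
    rw [← sum_union]
    · congr 1
      ext p
      simp only [mem_filter, mem_union, mem_Icc, mem_Ioc]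
      constructor
      · rintro ⟨⟨h1, h2⟩, h3⟩
        by_cases h : p ≤ p₀
        · exact Or.inl ⟨⟨h1, h⟩, h3⟩
        · exact Or.inr ⟨⟨by omega, h2⟩, h3⟩
      · rintro (⟨⟨h1, h2⟩, h3⟩ | ⟨⟨h1, h2⟩, h3⟩)
        · exact ⟨⟨h1, by omega⟩, h3⟩
        · exact ⟨⟨by omega, h2⟩, h3⟩
    · rw [disjoint_left]
      intro p hp hp'
      simp only [mem_filter, mem_Icc, mem_Ioc] at hp hp'
      omega
  have hterm : ∑ p ∈ Ioc p₀ ⌊t⌋₊ with p.Prime, 2 * log p / ((p : ℝ) - 3) ≤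
      ∑ p ∈ Ioc p₀ ⌊t⌋₊ with p.Prime, (2 * (log p / p) + 2 * (6 * log p / (p : ℝ) ^ 2)) := by
    refine sum_le_sum fun p hp => ?_
    simp only [mem_filter, mem_Ioc] at hp
    have hp6 : (100 : ℝ) ≤ p := by exact_mod_cast (by omega : 100 ≤ p)
    have hl : 0 ≤ log (p : ℝ) := log_natCast_nonneg p
    have h1 : 1 / ((p : ℝ) - 3) ≤ 1 / p + 6 / (p : ℝ) ^ 2 := by
      have hp0 : (0 : ℝ) < p := by linarith
      rw [div_add_div _ _ hp0.ne' (by positivity), div_le_div_iff₀ (by linarith) (by positivity)]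
      nlinarith [mul_pos hp0 hp0]
    calc 2 * log p / ((p : ℝ) - 3) = 2 * log p * (1 / ((p : ℝ) - 3)) := by ring
      _ ≤ 2 * log p * (1 / p + 6 / (p : ℝ) ^ 2) := by gcongr
      _ = _ := by ring
  have htail : ∑ p ∈ Ioc p₀ ⌊t⌋₊ with p.Prime, 6 * log p / (p : ℝ) ^ 2 ≤
      ∑' m : ℕ, 6 * log m / ((m : ℝ) ^ 2) :=
    hs.sum_le_tsum _ fun m _ => div_nonneg (by have := log_natCast_nonneg m; positivity)
      (by positivity)
  rw [sum_add_distrib, ← mul_sum, ← mul_sum] at hterm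
  linarith

lemma summable_int_exp_neg {b : ℝ} (hb : 0 < b) {f : ℤ → ℂ}
    (hf : ∀ k : ℤ, ‖f k‖ ≤ exp (-b * (k : ℝ) ^ 2)) : Summable f := by
  have hg : Summable fun n : ℕ => exp (-b) ^ n :=
    summable_geometric_of_lt_one (exp_pos _).le (by rw [exp_lt_one_iff]; linarith)
  refine Summable.of_nat_of_neg_add_one ?_ ?_
  · refine Summable.of_norm_bounded hg fun n => (hf n).trans ?_
    rw [← exp_nat_mul]
    refine exp_le_exp.2 ?_
    have : (n : ℝ) ≤ (n : ℝ) ^ 2 := by exact_mod_cast Nat.le_self_pow (by norm_num) n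
    push_cast
    nlinarith
  · refine Summable.of_norm_bounded hg fun n => (hf _).trans ?_
    rw [← exp_nat_mul]
    refine exp_le_exp.2 ?_
    push_cast
    have : (0 : ℝ) ≤ n := Nat.cast_nonneg n
    nlinarith [mul_nonneg hb.le (mul_nonneg this this), mul_nonneg hb.le this]

lemma norm_tsum_int_sub_zero_le {b : ℝ} (hb : 3 ≤ b) {f : ℤ → ℂ}
    (hf : ∀ k : ℤ, ‖f k‖ ≤ exp (-b * (k : ℝ) ^ 2)) : ‖∑' k, f k - f 0‖ ≤ 4 * exp (-b) := by
  have hs := summable_int_exp_neg (by linarith) hf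
  have ht1 : exp (-b) ≤ 1 / 2 := by
    have := add_one_le_exp b
    rw [exp_neg, one_div]
    exact inv_anti₀ (by norm_num) (by linarith)
  have h1 : Summable fun n : ℕ => f n := hs.comp_injective Nat.cast_injective
  have h2 : Summable fun n : ℕ => f (-((n : ℤ) + 1)) :=
    hs.comp_injective fun a b h => by simpa using h
  have hgeo : HasSum (fun n : ℕ => exp (-b) ^ (n + 1)) (exp (-b) * (1 - exp (-b))⁻¹) := by
    have := (hasSum_geometric_of_lt_one (exp_pos (-b)).le (by linarith)).mul_left (exp (-b))
    refine this.congr_fun ?_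
    intro n; rw [pow_succ]; ring
  have hbd : exp (-b) * (1 - exp (-b))⁻¹ ≤ 2 * exp (-b) := by
    have : (1 - exp (-b))⁻¹ ≤ 2 := by
      rw [inv_le_comm₀ (by linarith) (by norm_num)]; linarith
    nlinarith [exp_pos (-b)]
  have key : ∀ n : ℕ, -b * ((n : ℝ) + 1) ^ 2 ≤ ((n + 1 : ℕ) : ℝ) * (-b) := by
    intro n
    push_cast
    have : (0 : ℝ) ≤ n := Nat.cast_nonneg n
    nlinarith [mul_nonneg (by linarith : 0 ≤ b) (mul_nonneg this this),
      mul_nonneg (by linarith : 0 ≤ b) this]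
  have e1 : ‖∑' n : ℕ, f ((n + 1 : ℕ) : ℤ)‖ ≤ exp (-b) * (1 - exp (-b))⁻¹ := by
    refine tsum_of_norm_bounded hgeo fun n => (hf _).trans ?_
    rw [← exp_nat_mul]
    refine exp_le_exp.2 ?_
    have := key n
    push_cast at this ⊢
    exact this
  have e2 : ‖∑' n : ℕ, f (-((n : ℤ) + 1))‖ ≤ exp (-b) * (1 - exp (-b))⁻¹ := by
    refine tsum_of_norm_bounded hgeo fun n => (hf _).trans ?_
    rw [← exp_nat_mul]
    refine exp_le_exp.2 ?_
    have := key n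
    push_cast at this ⊢
    linarith [neg_sq (-(n:ℝ) - 1), this, (by ring : (-1 + -(n:ℝ)) ^ 2 = ((n:ℝ) + 1) ^ 2), (by ring : (-((n:ℝ) + 1)) ^ 2 = ((n:ℝ) + 1) ^ 2)]
  rw [tsum_of_nat_of_neg_add_one h1 h2, h1.tsum_eq_zero_add]
  calc ‖f ((0 : ℕ) : ℤ) + ∑' n : ℕ, f ((n + 1 : ℕ) : ℤ) + ∑' n : ℕ, f (-((n : ℤ) + 1)) - f 0‖
      = ‖∑' n : ℕ, f ((n + 1 : ℕ) : ℤ) + ∑' n : ℕ, f (-((n : ℤ) + 1))‖ := by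
        congr 1; push_cast; ring
    _ ≤ _ := (norm_add_le _ _).trans (by linarith)

lemma gaussian_class {q N : ℝ} (hq : 0 < q) (hN : q ≤ N) (s : ℝ) :
    Summable (fun j : ℤ => ((exp (-π * ((q * j + s) / N) ^ 2) : ℝ) : ℂ)) ∧
    ‖∑' j : ℤ, ((exp (-π * ((q * j + s) / N) ^ 2) : ℝ) : ℂ) - ((N / q : ℝ) : ℂ)‖ ≤
      4 * (N / q) * exp (-π * (N / q) ^ 2) := by
  have hN0 : 0 < N := hq.trans_le hN
  have hqc : (q : ℂ) ≠ 0 := by exact_mod_cast hq.ne'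
  have hNc : (N : ℂ) ≠ 0 := by exact_mod_cast hN0.ne'
  set h : ℤ → ℂ := fun k =>
    Complex.exp (-π * ((N / q : ℝ) : ℂ) ^ 2 * k ^ 2 + 2 * π * Complex.I * (s / q : ℝ) * k) with hh
  have hnorm : ∀ k, ‖h k‖ ≤ exp (-(π * (N / q) ^ 2) * (k : ℝ) ^ 2) := by
    intro k
    rw [hh, Complex.norm_exp]
    refine exp_le_exp.2 (le_of_eq ?_)
    have e : (-π * ((N / q : ℝ) : ℂ) ^ 2 * k ^ 2 + 2 * π * Complex.I * (s / q : ℝ) * k : ℂ) =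
        ((-(π * (N / q) ^ 2) * (k : ℝ) ^ 2 : ℝ) : ℂ) + ((2 * π * (s / q) * k : ℝ) : ℂ) *
          Complex.I := by push_cast; ring
    rw [e, Complex.add_re, Complex.ofReal_re, Complex.re_ofReal_mul, Complex.I_re]
    ring
  have hx1 : 1 ≤ N / q := (one_le_div hq).2 hN
  have hb3 : 3 ≤ π * (N / q) ^ 2 := by nlinarith [pi_gt_three]
  have h0 : h 0 = 1 := by simp [hh]
  have hmain := norm_tsum_int_sub_zero_le hb3 hnorm
  have hexp : ∀ j : ℤ, ((exp (-π * ((q * j + s) / N) ^ 2) : ℝ) : ℂ) =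
      Complex.exp (-π * (s / N) ^ 2) * Complex.exp (-π * (((q / N) ^ 2 : ℝ) : ℂ) * j ^ 2 +
        2 * π * (-(q * s) / N ^ 2) * j) := by
    intro j
    rw [Complex.ofReal_exp, ← Complex.exp_add]
    congr 1
    push_cast
    field_simp
    ring
  have ha : 0 < ((((q / N) ^ 2 : ℝ) : ℂ)).re := by rw [Complex.ofReal_re]; positivity
  have hP := Complex.tsum_exp_neg_quadratic ha (-(q * s) / N ^ 2)
  have hsqrt : ((((q / N) ^ 2 : ℝ) : ℂ)) ^ (1 / 2 : ℂ) = (q / N : ℝ) := by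
    have : (1 / 2 : ℂ) = ((1 / 2 : ℝ) : ℂ) := by push_cast; ring
    rw [this, ← Complex.ofReal_cpow (by positivity), ← sqrt_eq_rpow, sqrt_sq (by positivity)]
  have hterm : ∀ k : ℤ, Complex.exp (-π / (((q / N) ^ 2 : ℝ) : ℂ) *
      (k + Complex.I * (-(q * s) / N ^ 2)) ^ 2) = Complex.exp (π * (s / N) ^ 2) * h k := by
    intro k
    rw [hh, ← Complex.exp_add]
    congr 1
    push_cast
    field_simp
    ring_nf
    rw [Complex.I_sq]
    ring
  have htot : ∑' j : ℤ, ((exp (-π * ((q * j + s) / N) ^ 2) : ℝ) : ℂ) =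
      ((N / q : ℝ) : ℂ) * ∑' k, h k := by
    simp_rw [hexp]
    rw [tsum_mul_left, hP, hsqrt]
    simp_rw [hterm]
    rw [tsum_mul_left]
    have e1 : Complex.exp (-π * (s / N) ^ 2) * Complex.exp (π * (s / N) ^ 2) = 1 := by
      rw [← Complex.exp_add]; ring_nf; simp
    calc _ = (Complex.exp (-π * (s / N) ^ 2) * Complex.exp (π * (s / N) ^ 2)) *
          (1 / ((q / N : ℝ) : ℂ)) * ∑' k, h k := by ring
      _ = _ := by rw [e1]; push_cast; field_simp
  constructor
  · have hs : Summable fun j : ℤ => ((exp (-π * ((q * j + s) / N) ^ 2) : ℝ) : ℂ) := by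
      by_contra hns
      have hz := tsum_eq_zero_of_not_summable hns
      rw [htot, mul_eq_zero] at hz
      rcases hz with hz | hz
      · have : N / q = 0 := by exact_mod_cast hz
        linarith
      · rw [hz, h0, zero_sub, norm_neg, norm_one] at hmain
        have h1 := add_one_lt_exp (show π * (N / q) ^ 2 ≠ 0 by positivity)
        rw [exp_neg, ← div_eq_mul_inv, le_div_iff₀ (exp_pos _)] at hmain
        linarith
    exact hs
  · rw [htot]
    have e : ((N / q : ℝ) : ℂ) * ∑' k, h k - ((N / q : ℝ) : ℂ) =
        ((N / q : ℝ) : ℂ) * (∑' k, h k - h 0) := by rw [h0]; ring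
    rw [e, norm_mul, Complex.norm_real, norm_of_nonneg (by positivity)]
    calc N / q * ‖∑' k, h k - h 0‖ ≤ N / q * (4 * exp (-(π * (N / q) ^ 2))) := by gcongr
      _ = _ := by rw [neg_mul]; ring

lemma gaussian_periodic (q : ℕ) [NeZero q] (N s : ℝ) (hN : q ≤ N) (F : ℤ → ℂ)
    (hF : ∀ m j : ℤ, F (j * q + m) = F m) (hF1 : ∀ m, ‖F m‖ ≤ 1) :
    Summable (fun m : ℤ => F m * ((exp (-π * ((m + s) / N) ^ 2) : ℝ) : ℂ)) ∧
    ‖∑' m : ℤ, F m * ((exp (-π * ((m + s) / N) ^ 2) : ℝ) : ℂ) -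
        ((N / q : ℝ) : ℂ) * ∑ i : Fin q, F (i : ℕ)‖ ≤
      4 * N * exp (-π * (N / q) ^ 2) := by
  have hq : (0 : ℝ) < q := by exact_mod_cast Nat.pos_of_neZero q
  set f : ℤ → ℂ := fun m => F m * ((exp (-π * ((m + s) / N) ^ 2) : ℝ) : ℂ) with hf
  have hval : ∀ (j : ℤ) (i : Fin q), f ((Int.divModEquiv q).symm (j, i)) =
      F (i : ℕ) * ((exp (-π * ((q * j + ((i : ℕ) + s)) / N) ^ 2) : ℝ) : ℂ) := by
    intro j i
    rw [Int.divModEquiv_symm_apply, hf]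
    simp only
    rw [hF]
    congr 4
    push_cast
    ring
  have hcls := fun i : Fin q => gaussian_class hq hN ((i : ℕ) + s)
  have hq1 : (1 : ℝ) ≤ q := by exact_mod_cast Nat.pos_of_neZero q
  have hsum : Summable f := by
    refine Summable.of_norm_bounded (gaussian_class one_pos (hq1.trans hN) s).1.norm fun m => ?_
    rw [hf, norm_mul, one_mul]
    exact mul_le_of_le_one_left (norm_nonneg _) (hF1 m)
  have htsum : ∑' m, f m = ∑ i : Fin q, F (i : ℕ) *
      ∑' j : ℤ, ((exp (-π * ((q * j + ((i : ℕ) + s)) / N) ^ 2) : ℝ) : ℂ) := by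
    set e := (Equiv.prodComm (Fin q) ℤ).trans (Int.divModEquiv q).symm with he
    have hs' : Summable (f ∘ e) := e.summable_iff.2 hsum
    rw [← e.tsum_eq f]
    have h1 := hs'.tsum_prod
    simp only [Function.comp_apply] at h1
    rw [h1, tsum_fintype]
    refine sum_congr rfl fun i _ => ?_
    rw [← tsum_mul_left]
    exact tsum_congr fun j => hval j i
  refine ⟨hsum, ?_⟩
  rw [htsum, mul_sum, ← sum_sub_distrib]
  calc _ ≤ ∑ i : Fin q, 4 * (N / q) * exp (-π * (N / q) ^ 2) := by
        refine norm_sum_le_of_le _ fun i _ => ?_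
        rw [mul_comm ((N / q : ℝ) : ℂ), ← mul_sub, norm_mul]
        exact (mul_le_of_le_one_left (norm_nonneg _) (hF1 _)).trans (hcls i).2
    _ = _ := by
        rw [sum_const, card_univ, Fintype.card_fin, nsmul_eq_mul]
        field_simp

/-- The primitive Dirichlet characters modulo `r`. -/
noncomputable def primChars (r : ℕ) : Finset (DirichletCharacter ℂ r) :=
  (Set.toFinite {χ : DirichletCharacter ℂ r | χ.IsPrimitive}).toFinset

@[simp]
lemma mem_primChars {r : ℕ} {χ : DirichletCharacter ℂ r} : χ ∈ primChars r ↔ χ.IsPrimitive := by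
  simp [primChars]

lemma card_primChars_le {r : ℕ} (hr : r ≠ 0) : (primChars r).card ≤ r := by
  have : NeZero r := ⟨hr⟩
  calc (primChars r).card ≤ Nat.card (DirichletCharacter ℂ r) := by
        rw [primChars, ← Nat.card_eq_card_finite_toFinset]
        exact Nat.card_le_card_of_injective _ Subtype.val_injective
    _ = r.totient := DirichletCharacter.card_eq_totient_of_hasEnoughRootsOfUnity ℂ r
    _ ≤ r := Nat.totient_le r

/-- All primitive characters of conductor in `[1, R]`. -/
noncomputable def primCharsUpTo (R : ℕ) : Finset (Σ r : ℕ, DirichletCharacter ℂ r) :=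
  (Icc 1 R).sigma primChars

lemma card_primCharsUpTo_le (R : ℕ) : (primCharsUpTo R).card ≤ R ^ 2 := by
  rw [primCharsUpTo, card_sigma]
  calc ∑ r ∈ Icc 1 R, (primChars r).card ≤ ∑ r ∈ Icc 1 R, R :=
        sum_le_sum fun r hr => (card_primChars_le (by have := mem_Icc.1 hr; omega)).trans
          (mem_Icc.1 hr).2
    _ = R ^ 2 := by simp [sq]

lemma sum_fin_zmod {q : ℕ} [NeZero q] (f : ZMod q → ℂ) :
    ∑ i : Fin q, f ((i : ℕ) : ZMod q) = ∑ a, f a := by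
  obtain ⟨n, rfl⟩ : ∃ n, q = n + 1 := ⟨q - 1, (Nat.succ_pred_eq_of_pos (Nat.pos_of_neZero q)).symm⟩
  refine Fintype.sum_congr _ _ fun i => ?_
  congr 1
  exact Fin.cast_val_eq_self i

lemma changeLevel_natCast {r q : ℕ} (χ : DirichletCharacter ℂ r) (h : r ∣ q) {a : ℕ}
    (ha : a.Coprime q) : DirichletCharacter.changeLevel h χ (a : ZMod q) = χ (a : ZMod r) := by
  have := DirichletCharacter.changeLevel_eq_cast_of_dvd χ h (ZMod.unitOfCoprime a ha)
  rw [ZMod.coe_unitOfCoprime] at this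
  rw [this, ZMod.cast_natCast h]

lemma apply_natCast_eq_zero {r : ℕ} (χ : DirichletCharacter ℂ r) {a : ℕ} (ha : ¬ a.Coprime r) :
    χ (a : ZMod r) = 0 :=
  χ.map_nonunit fun h => ha ((ZMod.isUnit_iff_coprime a r).1 h)

lemma sum_mul_inv_eq_zero {r s : ℕ} [NeZero r] [NeZero s] {χ : DirichletCharacter ℂ r}
    {ψ : DirichletCharacter ℂ s} (hχ : χ.IsPrimitive) (hψ : ψ.IsPrimitive)
    (hne : (⟨r, χ⟩ : Σ r : ℕ, DirichletCharacter ℂ r) ≠ ⟨s, ψ⟩) :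
    ∑ i : Fin (r * s), χ ((i : ℕ) : ZMod r) * ψ⁻¹ ((i : ℕ) : ZMod s) = 0 := by
  set χ' := DirichletCharacter.changeLevel (Dvd.intro s rfl : r ∣ r * s) χ with hχ'
  set ψ' := DirichletCharacter.changeLevel (Dvd.intro_left r rfl : s ∣ r * s) ψ with hψ'
  have hne' : χ' * ψ'⁻¹ ≠ 1 := by
    intro h
    have h1 : χ' = ψ' := by rwa [mul_inv_eq_one] at h
    have h2 : χ'.conductor = ψ'.conductor := by rw [h1]
    rw [hχ', hψ', DirichletCharacter.conductor_changeLevel,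
      DirichletCharacter.conductor_changeLevel] at h2
    have h3 : r = s := by
      rw [DirichletCharacter.IsPrimitive] at hχ hψ
      omega
    subst h3
    exact hne (by rw [DirichletCharacter.changeLevel_injective _ h1])
  rw [← MulChar.sum_eq_zero_of_ne_one hne', ← sum_fin_zmod]
  refine Fintype.sum_congr _ _ fun i => ?_
  by_cases hi : (i : ℕ).Coprime (r * s)
  · rw [MulChar.mul_apply, hχ', hψ', ← map_inv, changeLevel_natCast _ _ hi,
      changeLevel_natCast _ _ hi]
  · rw [apply_natCast_eq_zero (χ' * ψ'⁻¹) hi]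
    rw [Nat.coprime_mul_iff_right, not_and_or] at hi
    rcases hi with hi | hi
    · rw [apply_natCast_eq_zero _ hi, zero_mul]
    · rw [apply_natCast_eq_zero ψ⁻¹ hi, mul_zero]

/-- The value at an integer of a character of unspecified modulus. -/
noncomputable def charVal (x : Σ r : ℕ, DirichletCharacter ℂ r) (m : ℤ) : ℂ :=
  x.2 (m : ZMod x.1)

lemma norm_charVal_le (x : Σ r : ℕ, DirichletCharacter ℂ r) (m : ℤ) : ‖charVal x m‖ ≤ 1 :=
  DirichletCharacter.norm_le_one x.2 _

open scoped Classical in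
lemma gaussian_correlation {R : ℕ} {N : ℝ} (hR : 1 ≤ R) (hN : R ^ 2 * (1 + log R) ≤ N) (s : ℝ)
    {x y : Σ r : ℕ, DirichletCharacter ℂ r} (hx : x ∈ primCharsUpTo R) (hy : y ∈ primCharsUpTo R) :
    Summable (fun m : ℤ => charVal x m * star (charVal y m) *
      ((exp (-π * ((m + s) / N) ^ 2) : ℝ) : ℂ)) ∧
    ‖∑' m : ℤ, charVal x m * star (charVal y m) * ((exp (-π * ((m + s) / N) ^ 2) : ℝ) : ℂ)‖ ≤
      (if x = y then 5 * N else 0) + 4 * N / R ^ 2 := by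
  have hR1 : (1 : ℝ) ≤ R := by exact_mod_cast hR
  have hlog : 0 ≤ log (R : ℝ) := log_nonneg hR1
  have hN1 : (R : ℝ) ^ 2 ≤ N := by nlinarith [mul_nonneg (sq_nonneg (R : ℝ)) hlog]
  have hN0 : 1 ≤ N := by nlinarith
  have hw := gaussian_class one_pos hN0 s
  simp only [one_mul] at hw
  have hbd : ∀ m : ℤ, ‖charVal x m * star (charVal y m)‖ ≤ 1 := by
    intro m
    rw [norm_mul, norm_star]
    exact mul_le_one₀ (norm_charVal_le x m) (norm_nonneg _) (norm_charVal_le y m)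
  have hbd' : ∀ m : ℤ, ‖charVal x m * star (charVal y m) *
      ((exp (-π * ((m + s) / N) ^ 2) : ℝ) : ℂ)‖ ≤ exp (-π * ((m + s) / N) ^ 2) := by
    intro m
    rw [norm_mul, Complex.norm_real, norm_of_nonneg (exp_pos _).le]
    exact mul_le_of_le_one_left (exp_pos _).le (hbd m)
  have hws : Summable fun m : ℤ => exp (-π * ((m + s) / N) ^ 2) := by
    exact_mod_cast hw.1
  refine ⟨Summable.of_norm_bounded hws hbd', ?_⟩
  have hpos : 0 ≤ 4 * N / R ^ 2 := by positivity
  split_ifs with hxy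
  · have h1 := tsum_of_norm_bounded hws.hasSum hbd'
    have h2 : ∑' m : ℤ, exp (-π * ((m + s) / N) ^ 2) ≤ 5 * N := by
      have h3 := hw.2
      rw [← Complex.ofReal_tsum, ← Complex.ofReal_sub, Complex.norm_real, norm_eq_abs] at h3
      have h4 := (abs_le.1 h3).2
      have h5 : exp (-π * (N / 1) ^ 2) ≤ 1 := by
        rw [exp_le_one_iff]; nlinarith [pi_pos, sq_nonneg (N / 1)]
      rw [div_one] at h4 h5
      nlinarith
    linarith
  · obtain ⟨r, χ⟩ := x
    obtain ⟨t, ψ⟩ := y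
    simp only [primCharsUpTo, mem_sigma, mem_Icc, mem_primChars] at hx hy
    have hr0 : NeZero r := ⟨by omega⟩
    have ht0 : NeZero t := ⟨by omega⟩
    have hq0 : NeZero (r * t) := ⟨Nat.mul_ne_zero hr0.out ht0.out⟩
    have hqR : ((r * t : ℕ) : ℝ) ≤ R ^ 2 := by
      have : r * t ≤ R * R := Nat.mul_le_mul hx.1.2 hy.1.2
      rw [sq]; exact_mod_cast this
    have hq : (0 : ℝ) < ((r * t : ℕ) : ℝ) := by exact_mod_cast Nat.pos_of_neZero (r * t)
    have hper := (gaussian_periodic (r * t) N s (hqR.trans hN1)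
      (fun m => charVal ⟨r, χ⟩ m * star (charVal ⟨t, ψ⟩ m)) (fun m j => by simp [charVal]) hbd).2
    have hz : ∑ i : Fin (r * t), charVal ⟨r, χ⟩ ((i : ℕ) : ℤ) *
        star (charVal ⟨t, ψ⟩ ((i : ℕ) : ℤ)) = 0 := by
      rw [← sum_mul_inv_eq_zero hx.2 hy.2 hxy]
      refine Fintype.sum_congr _ _ fun i => ?_
      simp only [charVal, Int.cast_natCast]
      rw [← MulChar.star_apply']
    rw [hz, mul_zero, sub_zero] at hper
    rw [zero_add]
    refine hper.trans ?_
    have h1 : 1 + log R ≤ N / (r * t : ℕ) := by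
      rw [le_div_iff₀ hq]
      nlinarith
    have h2 : exp (-π * (N / (r * t : ℕ)) ^ 2) ≤ exp (-(2 * log R)) := by
      refine exp_le_exp.2 ?_
      have h3 : (1 + log R) ^ 2 ≤ (N / (r * t : ℕ)) ^ 2 := by gcongr
      nlinarith [pi_gt_three, sq_nonneg (log (R : ℝ))]
    have h3 : exp (-(2 * log R)) = 1 / (R : ℝ) ^ 2 := by
      rw [exp_neg, mul_comm, exp_mul, exp_log (by linarith), one_div]
      norm_num
    rw [h3] at h2
    calc 4 * N * exp (-π * (N / (r * t : ℕ)) ^ 2) ≤ 4 * N * (1 / R ^ 2) := by gcongr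
      _ = _ := by ring

open scoped Classical in
lemma dual_large_sieve {R : ℕ} {N : ℝ} (hR : 1 ≤ R) (M₀ H : ℕ)
    (hN : H + R ^ 2 * (1 + log R) ≤ N) (c : (Σ r : ℕ, DirichletCharacter ℂ r) → ℂ) :
    ∑ m ∈ Ioc M₀ (M₀ + H), ‖∑ x ∈ primCharsUpTo R, c x * charVal x m‖ ^ 2 ≤
      9 * exp π * N * ∑ x ∈ primCharsUpTo R, ‖c x‖ ^ 2 := by
  have hR1 : (1 : ℝ) ≤ R := by exact_mod_cast hR
  have hlog : 0 ≤ log (R : ℝ) := log_nonneg hR1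
  have hH : (0 : ℝ) ≤ H := Nat.cast_nonneg H
  have hN1 : R ^ 2 * (1 + log R) ≤ N := by linarith
  have hNpos : 0 < N := by nlinarith [mul_nonneg (sq_nonneg (R : ℝ)) hlog]
  set w : ℤ → ℝ := fun m => exp (-π * ((m + -(M₀ : ℝ)) / N) ^ 2) with hw
  set X := primCharsUpTo R with hX
  have hcorr := fun x (hx : x ∈ X) y (hy : y ∈ X) =>
    gaussian_correlation hR hN1 (-(M₀ : ℝ)) hx hy
  set B := fun x y => ∑' m : ℤ, charVal x m * star (charVal y m) * (w m : ℂ) with hB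
  have hexpand : ∀ m : ℤ, ((w m * ‖∑ x ∈ X, c x * charVal x m‖ ^ 2 : ℝ) : ℂ) =
      ∑ x ∈ X, ∑ y ∈ X, c x * star (c y) * (charVal x m * star (charVal y m) * (w m : ℂ)) := by
    intro m
    push_cast
    rw [← Complex.mul_conj', map_sum, sum_mul_sum, mul_sum]
    refine sum_congr rfl fun x _ => ?_
    rw [mul_sum]
    refine sum_congr rfl fun y _ => ?_
    rw [map_mul]
    simp only [Complex.star_def]
    ring
  have hHS : HasSum (fun m : ℤ => ((w m * ‖∑ x ∈ X, c x * charVal x m‖ ^ 2 : ℝ) : ℂ))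
      (∑ x ∈ X, ∑ y ∈ X, c x * star (c y) * B x y) := by
    simp_rw [hexpand]
    exact hasSum_sum fun x hx => hasSum_sum fun y hy => ((hcorr x hx y hy).1.hasSum).mul_left _
  have hsumm : Summable fun m : ℤ => w m * ‖∑ x ∈ X, c x * charVal x m‖ ^ 2 := by
    exact_mod_cast hHS.summable
  have htot : ∑' m : ℤ, w m * ‖∑ x ∈ X, c x * charVal x m‖ ^ 2 ≤
      9 * N * ∑ x ∈ X, ‖c x‖ ^ 2 := by
    have h1 : ∑' m : ℤ, w m * ‖∑ x ∈ X, c x * charVal x m‖ ^ 2 =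
        ‖∑ x ∈ X, ∑ y ∈ X, c x * star (c y) * B x y‖ := by
      rw [← hHS.tsum_eq, ← Complex.ofReal_tsum, Complex.norm_real, norm_of_nonneg]
      exact tsum_nonneg fun m => by positivity
    rw [h1]
    set b := fun x y : (Σ r : ℕ, DirichletCharacter ℂ r) =>
      (if x = y then 5 * N else 0) + 4 * N / R ^ 2 with hb
    have hbs : ∀ x ∈ X, ∑ y ∈ X, b x y ≤ 9 * N := by
      intro x hx
      rw [hb, sum_add_distrib, sum_ite_eq, if_pos hx, sum_const, nsmul_eq_mul]
      have : (X.card : ℝ) ≤ R ^ 2 := by exact_mod_cast card_primCharsUpTo_le R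
      have h2 : (X.card : ℝ) * (4 * N / R ^ 2) ≤ R ^ 2 * (4 * N / R ^ 2) := by gcongr
      have h3 : (R : ℝ) ^ 2 * (4 * N / R ^ 2) = 4 * N := by field_simp
      linarith
    have hbsymm : ∀ x y, b x y = b y x := fun x y => by simp only [hb, eq_comm]
    have hb0 : ∀ x y, 0 ≤ b x y := fun x y => by simp only [hb]; positivity
    calc ‖∑ x ∈ X, ∑ y ∈ X, c x * star (c y) * B x y‖
        ≤ ∑ x ∈ X, ∑ y ∈ X, (‖c x‖ ^ 2 / 2 * b x y + ‖c y‖ ^ 2 / 2 * b y x) := by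
          refine norm_sum_le_of_le _ fun x hx => norm_sum_le_of_le _ fun y hy => ?_
          rw [norm_mul, norm_mul, norm_star, ← hbsymm x y, ← add_mul]
          have h2 := (hcorr x hx y hy).2
          have h3 : ‖c x‖ * ‖c y‖ ≤ ‖c x‖ ^ 2 / 2 + ‖c y‖ ^ 2 / 2 := by
            nlinarith [sq_nonneg (‖c x‖ - ‖c y‖)]
          exact mul_le_mul h3 h2 (norm_nonneg _) (by positivity)
      _ = ∑ x ∈ X, ‖c x‖ ^ 2 * ∑ y ∈ X, b x y := by
          simp_rw [sum_add_distrib]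
          rw [sum_comm (f := fun x y => ‖c y‖ ^ 2 / 2 * b y x), ← sum_add_distrib]
          refine sum_congr rfl fun x _ => ?_
          rw [← mul_sum]; ring
      _ ≤ ∑ x ∈ X, ‖c x‖ ^ 2 * (9 * N) :=
          sum_le_sum fun x hx => mul_le_mul_of_nonneg_left (hbs x hx) (by positivity)
      _ = _ := by rw [← sum_mul]; ring
  have hwlow : ∀ m ∈ Ioc M₀ (M₀ + H), exp (-π) ≤ w m := by
    intro m hm
    obtain ⟨h1, h2⟩ := mem_Ioc.1 hm
    refine exp_le_exp.2 ?_
    have h3 : (M₀ : ℝ) ≤ m := by exact_mod_cast h1.le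
    have h4 : (m : ℝ) ≤ M₀ + H := by exact_mod_cast h2
    have h5 : |(((m : ℤ) : ℝ) + -(M₀ : ℝ)) / N| ≤ 1 := by
      rw [abs_div, abs_of_pos hNpos, div_le_one hNpos, abs_le]
      push_cast
      constructor <;> nlinarith [mul_nonneg (sq_nonneg (R : ℝ)) hlog, sq_nonneg (R : ℝ)]
    have h6 := (sq_le_one_iff_abs_le_one _).2 h5
    nlinarith [pi_pos]
  have hfin : ∑ m ∈ Ioc M₀ (M₀ + H), w m * ‖∑ x ∈ X, c x * charVal x m‖ ^ 2 ≤
      ∑' m : ℤ, w m * ‖∑ x ∈ X, c x * charVal x m‖ ^ 2 := by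
    have := hsumm.sum_le_tsum ((Ioc M₀ (M₀ + H)).map ⟨Nat.cast, Nat.cast_injective⟩)
      (fun m _ => by positivity)
    rwa [sum_map] at this
  calc ∑ m ∈ Ioc M₀ (M₀ + H), ‖∑ x ∈ X, c x * charVal x m‖ ^ 2
      ≤ ∑ m ∈ Ioc M₀ (M₀ + H), exp π * (w m * ‖∑ x ∈ X, c x * charVal x m‖ ^ 2) := by
        refine sum_le_sum fun m hm => ?_
        have h1 := hwlow m hm
        have h2 : 1 ≤ exp π * w m := by
          calc 1 = exp π * exp (-π) := by rw [← exp_add]; simp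
            _ ≤ _ := by gcongr
        rw [← mul_assoc]
        exact le_mul_of_one_le_left (by positivity) h2
    _ ≤ exp π * (9 * N * ∑ x ∈ X, ‖c x‖ ^ 2) := by
        rw [← mul_sum]
        exact mul_le_mul_of_nonneg_left (hfin.trans htot) (exp_pos _).le
    _ = _ := by ring

theorem large_sieve {R : ℕ} {N : ℝ} (hR : 1 ≤ R) (M₀ H : ℕ)
    (hN : H + R ^ 2 * (1 + log R) ≤ N) (a : ℕ → ℂ) :
    ∑ x ∈ primCharsUpTo R, ‖∑ m ∈ Ioc M₀ (M₀ + H), a m * charVal x m‖ ^ 2 ≤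
      9 * exp π * N * ∑ m ∈ Ioc M₀ (M₀ + H), ‖a m‖ ^ 2 := by
  set T := fun x => ∑ m ∈ Ioc M₀ (M₀ + H), a m * charVal x m with hT
  set S := ∑ x ∈ primCharsUpTo R, ‖T x‖ ^ 2 with hS
  have hdual := dual_large_sieve hR M₀ H hN fun x => star (T x)
  simp only [norm_star] at hdual
  have h1 : (S : ℂ) = ∑ m ∈ Ioc M₀ (M₀ + H),
      a m * ∑ x ∈ primCharsUpTo R, star (T x) * charVal x m := by
    rw [hS]
    push_cast
    simp_rw [mul_sum]
    rw [sum_comm]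
    refine sum_congr rfl fun x _ => ?_
    rw [← Complex.conj_mul']
    conv_lhs => rw [hT]
    simp only [mul_sum, hT, Complex.star_def]
    refine sum_congr rfl fun m _ => ?_
    ring
  have hS0 : 0 ≤ S := sum_nonneg fun _ _ => by positivity
  have h2 : S ≤ ∑ m ∈ Ioc M₀ (M₀ + H),
      ‖a m‖ * ‖∑ x ∈ primCharsUpTo R, star (T x) * charVal x m‖ := by
    calc S = ‖(S : ℂ)‖ := by rw [Complex.norm_real, norm_of_nonneg hS0]
      _ ≤ _ := by
        rw [h1]
        exact norm_sum_le_of_le _ fun m _ => (norm_mul _ _).le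
  have h3 : S ^ 2 ≤ (∑ m ∈ Ioc M₀ (M₀ + H), ‖a m‖ ^ 2) * (9 * exp π * N * S) := by
    calc S ^ 2 ≤ _ := pow_le_pow_left₀ hS0 h2 2
      _ ≤ _ := sum_mul_sq_le_sq_mul_sq _ _ _
      _ ≤ _ := mul_le_mul_of_nonneg_left hdual (sum_nonneg fun _ _ => by positivity)
  rcases hS0.eq_or_lt with h | h
  · rw [← h]
    have hR1 : (1 : ℝ) ≤ R := by exact_mod_cast hR
    have hlog : 0 ≤ log (R : ℝ) := log_nonneg hR1
    have : 0 ≤ N := by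
      refine le_trans ?_ hN
      positivity
    positivity
  · nlinarith

lemma charVal_mul (x : Σ r : ℕ, DirichletCharacter ℂ r) (a b : ℕ) :
    charVal x ((a * b : ℕ) : ℤ) = charVal x a * charVal x b := by
  simp [charVal]

/-- Large sieve combined with Cauchy's inequality over the characters. -/
lemma sum_norm_le_large_sieve {R : ℕ} {N S : ℝ} (hR : 1 ≤ R) (M₀ H : ℕ)
    (hN : H + R ^ 2 * (1 + log R) ≤ N) (a : ℕ → ℂ) (hS : ∑ m ∈ Ioc M₀ (M₀ + H), ‖a m‖ ^ 2 ≤ S) :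
    (∑ x ∈ primCharsUpTo R, ‖∑ m ∈ Ioc M₀ (M₀ + H), a m * charVal x m‖) ^ 2 ≤
      R ^ 2 * (9 * exp π * N * S) := by
  have hR1 : (1 : ℝ) ≤ R := by exact_mod_cast hR
  have hlog : 0 ≤ log (R : ℝ) := log_nonneg hR1
  have hN0 : 0 ≤ N := le_trans (by positivity) hN
  have hls := large_sieve hR M₀ H hN a
  calc _ ≤ ((primCharsUpTo R).card : ℝ) *
        ∑ x ∈ primCharsUpTo R, ‖∑ m ∈ Ioc M₀ (M₀ + H), a m * charVal x m‖ ^ 2 :=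
        sq_sum_le_card_mul_sum_sq
    _ ≤ R ^ 2 * (9 * exp π * N * ∑ m ∈ Ioc M₀ (M₀ + H), ‖a m‖ ^ 2) := by
        gcongr
        exact_mod_cast card_primCharsUpTo_le R
    _ ≤ _ := by gcongr

/-- Logarithmic block index of an integer, with mesh `1 / K`. -/
noncomputable def blockIndex (K a : ℕ) : ℕ := ⌊K * log a⌋₊

lemma exp_blockIndex_le {K a : ℕ} (hK : 1 ≤ K) (ha : 1 ≤ a) : exp (blockIndex K a / K) ≤ a := by
  have hK' : (0 : ℝ) < K := by exact_mod_cast hK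
  have ha' : (0 : ℝ) < a := by exact_mod_cast ha
  rw [← le_log_iff_exp_le ha', div_le_iff₀ hK', mul_comm]
  exact Nat.floor_le (by have := log_natCast_nonneg a; positivity)

lemma le_exp_blockIndex_mul {K a : ℕ} (hK : 1 ≤ K) (ha : 1 ≤ a) :
    (a : ℝ) ≤ exp (blockIndex K a / K) * (1 + 2 / K) := by
  have hK' : (1 : ℝ) ≤ K := by exact_mod_cast hK
  have ha' : (0 : ℝ) < a := by exact_mod_cast ha
  have h1 : log a ≤ blockIndex K a / K + 1 / K := by
    rw [← add_div, le_div_iff₀ (by linarith), mul_comm]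
    exact (Nat.lt_floor_add_one _).le
  have h2 : exp (1 / (K : ℝ)) ≤ 1 + 2 / K := by
    have hx : |1 / (K : ℝ)| ≤ 1 := by
      rw [abs_of_pos (by positivity), div_le_one (by linarith)]; exact hK'
    have h3 := abs_exp_sub_one_le hx
    rw [abs_of_pos (by positivity : 0 < 1 / (K : ℝ))] at h3
    have h4 := (abs_le.1 h3).2
    have : 2 * (1 / (K : ℝ)) = 2 / K := by ring
    linarith
  calc (a : ℝ) = exp (log a) := (exp_log ha').symm
    _ ≤ exp (blockIndex K a / K) * exp (1 / (K : ℝ)) := by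
        rw [← exp_add]; exact exp_le_exp.2 h1
    _ ≤ _ := by gcongr

lemma type_two_block_aux {T K 𝓛 N R : ℝ} (hT0 : 0 < T) (hK' : 1 ≤ K) (hL1 : 1 ≤ 𝓛) (hN' : 1 ≤ N)
    (hTlow : K ^ 2 ≤ 3 * T) (hThigh : K * T ≤ N) :
    (2 * T / K + 2 * R ^ 2 * 𝓛) * (N / T + R ^ 2 * 𝓛) ≤
      8 * 𝓛 ^ 2 * (N / K + R ^ 2 * N / K ^ 2 + R ^ 4) := by
  have e : (2 * T / K + 2 * R ^ 2 * 𝓛) * (N / T + R ^ 2 * 𝓛) =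
      2 * (N / K) + 2 * (R ^ 2 * 𝓛) * (T / K) + 2 * (R ^ 2 * 𝓛) * (N / T) +
        2 * R ^ 4 * 𝓛 ^ 2 := by
    field_simp
    ring
  have h1 : T / K ≤ N / K ^ 2 := by
    rw [div_le_div_iff₀ (by linarith) (by positivity)]
    nlinarith
  have h2 : N / T ≤ 3 * (N / K ^ 2) := by
    rw [mul_div_assoc', div_le_div_iff₀ hT0 (by positivity)]
    nlinarith
  have hL2 : 𝓛 ≤ 𝓛 ^ 2 := by nlinarith
  have hL3 : 1 ≤ 𝓛 ^ 2 := by nlinarith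
  rw [e]
  have h3 : 2 * (R ^ 2 * 𝓛) * (T / K) ≤ 2 * (R ^ 2 * 𝓛 ^ 2) * (N / K ^ 2) := by gcongr
  have h4 : 2 * (R ^ 2 * 𝓛) * (N / T) ≤ 2 * (R ^ 2 * 𝓛 ^ 2) * (3 * (N / K ^ 2)) := by gcongr
  have h5 : 2 * (N / K : ℝ) ≤ 2 * 𝓛 ^ 2 * (N / K) := by
    rw [mul_assoc]
    have : (N / K : ℝ) ≤ 𝓛 ^ 2 * (N / K) := le_mul_of_one_le_left (by positivity) hL3
    linarith
  have e2 : 8 * 𝓛 ^ 2 * (N / K + R ^ 2 * N / K ^ 2 + R ^ 4) =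
      2 * 𝓛 ^ 2 * (N / K) + 2 * (R ^ 2 * 𝓛 ^ 2) * (N / K ^ 2) +
      2 * (R ^ 2 * 𝓛 ^ 2) * (3 * (N / K ^ 2)) + 2 * R ^ 4 * 𝓛 ^ 2 +
      (6 * 𝓛 ^ 2 * (N / K) + 6 * R ^ 4 * 𝓛 ^ 2) := by ring
  have h6 : 0 ≤ 6 * 𝓛 ^ 2 * (N / K) + 6 * R ^ 4 * 𝓛 ^ 2 := by positivity
  rw [e2]
  linarith

lemma type_two_block {R N K : ℕ} (hR : 1 ≤ R) (hK : 1 ≤ K) (hN : 1 ≤ N) (hRN : R ≤ N)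
    {α β : ℕ → ℂ} (hα : ∀ a, ‖α a‖ ≤ 2 ^ ω a) (hα0 : ∀ a, a ≤ K ^ 2 → α a = 0)
    (hβ : ∀ b, ‖β b‖ ≤ Λ b) (hβ0 : ∀ b, b ≤ K → β b = 0) (j : ℕ) :
    (∑ x ∈ primCharsUpTo R,
      ‖∑ a ∈ Icc 1 N with blockIndex K a = j, α a * charVal x a‖ *
      ‖∑ b ∈ Icc 1 ⌊N / exp (j / K : ℝ)⌋₊, β b * charVal x b‖) ^ 2 ≤
    48 * (9 * exp π) ^ 2 * (1 + log N) ^ 4 * (N ^ 2 / K + R ^ 2 * N ^ 2 / K ^ 2 + R ^ 4 * N) *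
      ∑ a ∈ Icc 1 N with blockIndex K a = j, (4 : ℝ) ^ ω a / a := by
  have hK' : (1 : ℝ) ≤ K := by exact_mod_cast hK
  have hN' : (1 : ℝ) ≤ N := by exact_mod_cast hN
  have hR' : (1 : ℝ) ≤ R := by exact_mod_cast hR
  set T := exp (j / K : ℝ) with hT
  set 𝓛 := 1 + log (N : ℝ) with hLdef
  have hL1 : 1 ≤ 𝓛 := by have := log_natCast_nonneg N; linarith
  have hT1 : 1 ≤ T := one_le_exp (by positivity)
  have hT0 : 0 < T := by linarith
  have hlogR : 1 + log (R : ℝ) ≤ 𝓛 := by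
    have : log (R : ℝ) ≤ log N := log_le_log (by linarith) (by exact_mod_cast hRN)
    linarith
  set blk := {a ∈ Icc 1 N | blockIndex K a = j} with hblk
  set s := ∑ a ∈ blk, (4 : ℝ) ^ ω a / a with hs
  have hs0 : 0 ≤ s := sum_nonneg fun _ _ => by positivity
  have hblk1 : ∀ a ∈ blk, T ≤ a ∧ (a : ℝ) ≤ T * (1 + 2 / K) := by
    intro a ha
    obtain ⟨h1, h2⟩ := mem_filter.1 ha
    have h3 := (mem_Icc.1 h1).1
    have e1 := exp_blockIndex_le hK h3
    have e2 := le_exp_blockIndex_mul hK h3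
    rw [h2] at e1 e2
    exact ⟨e1, e2⟩
  have hK2 : 2 / (K : ℝ) ≤ 2 := by rw [div_le_iff₀ (by linarith)]; linarith
  have hrhs : 0 ≤ 48 * (9 * exp π) ^ 2 * 𝓛 ^ 4 *
      (N ^ 2 / K + R ^ 2 * N ^ 2 / K ^ 2 + R ^ 4 * N) * s := by positivity
  by_cases hA : ∀ a ∈ blk, a ≤ K ^ 2
  · refine le_trans (le_of_eq ?_) hrhs
    have : ∀ x : (Σ r : ℕ, DirichletCharacter ℂ r), ∑ a ∈ blk, α a * charVal x a = 0 :=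
      fun x => sum_eq_zero fun a ha => by rw [hα0 a (hA a ha), zero_mul]
    simp [this]
  push Not at hA
  obtain ⟨a₀, ha₀, ha₀K⟩ := hA
  have hTlow : (K : ℝ) ^ 2 ≤ 3 * T := by
    have h1 := (hblk1 a₀ ha₀).2
    have h2 : (K : ℝ) ^ 2 ≤ a₀ := by exact_mod_cast ha₀K.le
    nlinarith
  by_cases hB : ⌊N / T⌋₊ ≤ K
  · refine le_trans (le_of_eq ?_) hrhs
    have : ∀ x : (Σ r : ℕ, DirichletCharacter ℂ r),
        ∑ b ∈ Icc 1 ⌊N / T⌋₊, β b * charVal x b = 0 :=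
      fun x => sum_eq_zero fun b hb => by rw [hβ0 b ((mem_Icc.1 hb).2.trans hB), zero_mul]
    simp [this]
  push Not at hB
  have hThigh : K * T ≤ N := by
    have h1 : (K : ℝ) ≤ N / T :=
      (by exact_mod_cast hB.le : (K : ℝ) ≤ ⌊N / T⌋₊).trans (Nat.floor_le (by positivity))
    rwa [le_div_iff₀ hT0] at h1
  set M₀ := ⌈T⌉₊ - 1 with hM₀
  set H := ⌊2 * T / K⌋₊ + 1 with hH
  have hceil : 1 ≤ ⌈T⌉₊ := Nat.one_le_ceil_iff.2 hT0
  have hsub : blk ⊆ Ioc M₀ (M₀ + H) := by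
    intro a ha
    obtain ⟨h1, h2⟩ := hblk1 a ha
    have h3 : ⌈T⌉₊ ≤ a := Nat.ceil_le.2 h1
    have h4 : a - ⌈T⌉₊ ≤ ⌊2 * T / K⌋₊ := by
      refine Nat.le_floor ?_
      rw [Nat.cast_sub h3]
      have : T ≤ ⌈T⌉₊ := Nat.le_ceil T
      have e : T * (1 + 2 / K) = T + 2 * T / K := by ring
      linarith
    rw [mem_Ioc]
    omega
  have hAsum : ∀ x : (Σ r : ℕ, DirichletCharacter ℂ r), ∑ a ∈ blk, α a * charVal x a =
      ∑ a ∈ Ioc M₀ (M₀ + H), (if a ∈ blk then α a else 0) * charVal x a := by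
    intro x
    simp_rw [ite_mul, zero_mul]
    rw [← sum_filter, filter_mem_eq_inter, inter_eq_right.2 hsub]
  have hSA : ∑ a ∈ Ioc M₀ (M₀ + H), ‖if a ∈ blk then α a else 0‖ ^ 2 ≤ 3 * T * s := by
    have e : ∀ a, ‖if a ∈ blk then α a else 0‖ ^ 2 = if a ∈ blk then ‖α a‖ ^ 2 else 0 := by
      intro a; split_ifs <;> simp
    simp_rw [e]
    rw [← sum_filter, filter_mem_eq_inter, inter_eq_right.2 hsub, hs, mul_sum]
    refine sum_le_sum fun a ha => ?_
    have ha0 : (0 : ℝ) < a := hT0.trans_le (hblk1 a ha).1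
    have h1 : ‖α a‖ ^ 2 ≤ (4 : ℝ) ^ ω a := by
      calc ‖α a‖ ^ 2 ≤ (2 ^ ω a) ^ 2 := by gcongr; exact hα a
        _ = _ := by rw [← pow_mul, mul_comm, pow_mul]; norm_num
    have h2 : (a : ℝ) ≤ 3 * T := by nlinarith [(hblk1 a ha).2]
    calc ‖α a‖ ^ 2 ≤ 4 ^ ω a := h1
      _ = a * (4 ^ ω a / a) := by field_simp
      _ ≤ _ := by gcongr
  have hSB : ∑ b ∈ Ioc 0 (0 + ⌊N / T⌋₊), ‖β b‖ ^ 2 ≤ N / T * 𝓛 ^ 2 := by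
    calc ∑ b ∈ Ioc 0 (0 + ⌊N / T⌋₊), ‖β b‖ ^ 2 ≤ ∑ b ∈ Ioc 0 (0 + ⌊N / T⌋₊), 𝓛 ^ 2 := by
          refine sum_le_sum fun b hb => ?_
          obtain ⟨h1, h2⟩ := mem_Ioc.1 hb
          have h3 : (b : ℝ) ≤ N := by
            have h4 : (b : ℝ) ≤ N / T :=
              (by exact_mod_cast (by omega : b ≤ ⌊N / T⌋₊) : (b : ℝ) ≤ ⌊N / T⌋₊).trans
                (Nat.floor_le (by positivity))
            exact h4.trans (div_le_self (by linarith) hT1)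
          have h5 : Λ b ≤ 𝓛 := by
            refine ArithmeticFunction.vonMangoldt_le_log.trans ?_
            have := log_le_log (by exact_mod_cast h1) h3
            linarith
          have h6 := (hβ b).trans h5
          gcongr
      _ = ⌊N / T⌋₊ * 𝓛 ^ 2 := by simp
      _ ≤ _ := by gcongr; exact Nat.floor_le (by positivity)
  have hlsA := large_sieve (N := 2 * T / K + 2 * R ^ 2 * 𝓛) hR M₀ H (by
    have h1 : (H : ℝ) ≤ 2 * T / K + 1 := by
      rw [hH]; push_cast; gcongr; exact Nat.floor_le (by positivity)
    have h2 : (R : ℝ) ^ 2 * (1 + log R) ≤ R ^ 2 * 𝓛 := by gcongr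
    have h3 : 1 ≤ (R : ℝ) ^ 2 * 𝓛 := one_le_mul_of_one_le_of_one_le (one_le_pow₀ hR') hL1
    linarith) fun a => if a ∈ blk then α a else 0
  have hlsB := large_sieve (N := N / T + R ^ 2 * 𝓛) hR 0 ⌊N / T⌋₊ (by
    have h1 : (⌊N / T⌋₊ : ℝ) ≤ N / T := Nat.floor_le (by positivity)
    have h2 : (R : ℝ) ^ 2 * (1 + log R) ≤ R ^ 2 * 𝓛 := by gcongr
    linarith) β
  have hkey := type_two_block_aux hT0 hK' hL1 hN' (R := R) hTlow hThigh
  calc _ ≤ (∑ x ∈ primCharsUpTo R, ‖∑ a ∈ blk, α a * charVal x a‖ ^ 2) *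
        ∑ x ∈ primCharsUpTo R, ‖∑ b ∈ Icc 1 ⌊N / T⌋₊, β b * charVal x b‖ ^ 2 :=
        sum_mul_sq_le_sq_mul_sq _ _ _
    _ ≤ (9 * exp π * (2 * T / K + 2 * R ^ 2 * 𝓛) * (3 * T * s)) *
        (9 * exp π * (N / T + R ^ 2 * 𝓛) * (N / T * 𝓛 ^ 2)) := by
        refine mul_le_mul ?_ ?_ (sum_nonneg fun _ _ => by positivity) (by positivity)
        · simp_rw [hAsum]
          exact hlsA.trans (mul_le_mul_of_nonneg_left hSA (by positivity))
        · rw [zero_add] at hlsB hSB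
          exact hlsB.trans (mul_le_mul_of_nonneg_left hSB (by positivity))
    _ = 3 * (9 * exp π) ^ 2 * 𝓛 ^ 2 * N * s *
        ((2 * T / K + 2 * R ^ 2 * 𝓛) * (N / T + R ^ 2 * 𝓛)) := by
        have : N / T * T = N := div_mul_cancel₀ _ hT0.ne'
        linear_combination 3 * (9 * exp π) ^ 2 * 𝓛 ^ 2 * s *
          ((2 * T / K + 2 * R ^ 2 * 𝓛) * (N / T + R ^ 2 * 𝓛)) * this
    _ ≤ 3 * (9 * exp π) ^ 2 * 𝓛 ^ 2 * N * s *
        (8 * 𝓛 ^ 2 * (N / K + R ^ 2 * N / K ^ 2 + R ^ 4)) := by gcongr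
    _ = 1 / 2 * (48 * (9 * exp π) ^ 2 * 𝓛 ^ 4 *
      (N ^ 2 / K + R ^ 2 * N ^ 2 / K ^ 2 + R ^ 4 * N) * s) := by ring
    _ ≤ _ := by linarith

lemma omega_le_of_dvd {a z : ℕ} (h : a ∣ z) (hz : z ≠ 0) : ω a ≤ ω z :=
  card_le_card (Nat.primeFactors_mono h hz)

lemma norm_le_of_sq_le {S B : ℝ} (hB : 0 ≤ B) (h : S ^ 2 ≤ B ^ 2) : S ≤ B :=
  abs_le_of_sq_le_sq' h hB |>.2

lemma type_two {R N K : ℕ} (hR : 1 ≤ R) (hK : 1 ≤ K) (hN : 1 ≤ N) (hRN : R ≤ N) {E : ℝ}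
    (hE : ∀ z : ℕ, z ≤ 3 * N → (2 : ℝ) ^ ω z ≤ E) {α β : ℕ → ℂ} (hα : ∀ a, ‖α a‖ ≤ 2 ^ ω a)
    (hα0 : ∀ a, a ≤ K ^ 2 → α a = 0) (hβ : ∀ b, ‖β b‖ ≤ Λ b) (hβ0 : ∀ b, b ≤ K → β b = 0) :
    ∑ x ∈ primCharsUpTo R,
      ‖∑ a ∈ Icc 1 N, ∑ b ∈ Icc 1 (N / a), α a * charVal x a * (β b * charVal x b)‖ ≤
    63 * exp π * (1 + log N) ^ 5 * (√(N ^ 2 + R ^ 2 * N ^ 2 / K + R ^ 4 * N * K) +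
      E * R * (N / K + R ^ 2)) := by
  have hK' : (1 : ℝ) ≤ K := by exact_mod_cast hK
  have hN' : (1 : ℝ) ≤ N := by exact_mod_cast hN
  have hR' : (1 : ℝ) ≤ R := by exact_mod_cast hR
  have hlogN := log_natCast_nonneg N
  set 𝓛 := 1 + log (N : ℝ) with hLdef
  have hL1 : 1 ≤ 𝓛 := by linarith
  have hlogR : 1 + log (R : ℝ) ≤ 𝓛 := by
    have : log (R : ℝ) ≤ log N := log_le_log (by linarith) (by exact_mod_cast hRN)
    linarith
  have hE1 : 1 ≤ E := by have := hE 1 (by omega); simpa using this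
  have hexp1 : 1 ≤ exp π := one_le_exp pi_pos.le
  set T : ℕ → ℝ := fun j => exp (j / K : ℝ) with hT
  have hT0 : ∀ j, 0 < T j := fun j => exp_pos _
  set P' := (Icc 1 N).sigma fun a => Icc 1 ⌊N / T (blockIndex K a)⌋₊ with hP'
  set P := (Icc 1 N).sigma fun a => Icc 1 (N / a) with hP
  have hPP' : P ⊆ P' := by
    refine sigma_mono Subset.rfl fun a b hb => ?_
    obtain ⟨hb1, hb2⟩ := mem_Icc.1 hb
    have ha1 : 1 ≤ a := by
      by_contra! h
      obtain rfl : a = 0 := by omega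
      rw [Nat.div_zero] at hb2
      omega
    refine mem_Icc.2 ⟨hb1, Nat.le_floor ?_⟩
    rw [le_div_iff₀ (hT0 _)]
    calc (b : ℝ) * T (blockIndex K a) ≤ b * a := by gcongr; exact exp_blockIndex_le hK ha1
      _ ≤ N := by exact_mod_cast (Nat.le_div_iff_mul_le ha1).1 hb2
  have hmain : ∑ x ∈ primCharsUpTo R, ‖∑ p ∈ P', α p.1 * charVal x p.1 * (β p.2 * charVal x p.2)‖ ≤
      63 * exp π * 𝓛 ^ 5 * √(N ^ 2 + R ^ 2 * N ^ 2 / K + R ^ 4 * N * K) := by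
    set J := ⌊K * log N⌋₊ + 1 with hJ
    have hJle : (J : ℝ) ≤ K * 𝓛 := by
      rw [hJ]; push_cast
      have : (⌊K * log N⌋₊ : ℝ) ≤ K * log N := Nat.floor_le (by positivity)
      rw [hLdef]; linarith
    set A := fun (x : Σ r : ℕ, DirichletCharacter ℂ r) j =>
      ‖∑ a ∈ Icc 1 N with blockIndex K a = j, α a * charVal x a‖ with hA
    set B := fun (x : Σ r : ℕ, DirichletCharacter ℂ r) (j : ℕ) =>
      ‖∑ b ∈ Icc 1 ⌊N / exp (j / K : ℝ)⌋₊, β b * charVal x b‖ with hB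
    set s := fun j => ∑ a ∈ Icc 1 N with blockIndex K a = j, (4 : ℝ) ^ ω a / a with hs
    have hmaps : ∀ a ∈ Icc 1 N, blockIndex K a ∈ range J := by
      intro a ha
      obtain ⟨h1, h2⟩ := mem_Icc.1 ha
      rw [mem_range, hJ, Nat.lt_succ_iff]
      refine Nat.floor_le_floor ?_
      gcongr
    have h1 : ∀ x, ‖∑ p ∈ P', α p.1 * charVal x p.1 * (β p.2 * charVal x p.2)‖ ≤
        ∑ j ∈ range J, A x j * B x j := by
      intro x
      rw [hP', sum_sigma, ← sum_fiberwise_of_maps_to hmaps]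
      refine norm_sum_le_of_le _ fun j hj => ?_
      rw [← norm_mul, sum_mul]
      refine le_of_eq (congrArg _ (sum_congr rfl fun a ha => ?_))
      rw [mul_sum, (mem_filter.1 ha).2]
    have hssum : ∑ j ∈ range J, s j ≤ 𝓛 ^ 4 := by
      rw [hs, sum_fiberwise_of_maps_to hmaps]
      exact sum_pow_omega_div_le 4 N
    set G : ℝ := N ^ 2 / K + R ^ 2 * N ^ 2 / K ^ 2 + R ^ 4 * N with hG
    have h2 : (∑ j ∈ range J, ∑ x ∈ primCharsUpTo R, A x j * B x j) ^ 2 ≤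
        (63 * exp π * 𝓛 ^ 5 * √(N ^ 2 + R ^ 2 * N ^ 2 / K + R ^ 4 * N * K)) ^ 2 := by
      calc _ ≤ ((range J).card : ℝ) *
            ∑ j ∈ range J, (∑ x ∈ primCharsUpTo R, A x j * B x j) ^ 2 := sq_sum_le_card_mul_sum_sq
        _ ≤ (K * 𝓛) * ∑ j ∈ range J, 48 * (9 * exp π) ^ 2 * 𝓛 ^ 4 * G * s j := by
            rw [card_range]
            gcongr with j hj
            exact type_two_block hR hK hN hRN hα hα0 hβ hβ0 j
        _ ≤ (K * 𝓛) * (48 * (9 * exp π) ^ 2 * 𝓛 ^ 4 * G * 𝓛 ^ 4) := by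
            rw [← mul_sum]
            gcongr
        _ = 48 * 81 * exp π ^ 2 * 𝓛 ^ 9 * (N ^ 2 + R ^ 2 * N ^ 2 / K + R ^ 4 * N * K) := by
            rw [hG]; field_simp; ring
        _ ≤ 49 * 81 * exp π ^ 2 * 𝓛 ^ 10 * (N ^ 2 + R ^ 2 * N ^ 2 / K + R ^ 4 * N * K) := by
            gcongr <;> norm_num
        _ = _ := by
            rw [mul_pow _ (√_), sq_sqrt (by positivity)]; ring
    calc _ ≤ ∑ x ∈ primCharsUpTo R, ∑ j ∈ range J, A x j * B x j := sum_le_sum fun x _ => h1 x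
      _ = ∑ j ∈ range J, ∑ x ∈ primCharsUpTo R, A x j * B x j := sum_comm
      _ ≤ _ := norm_le_of_sq_le (by positivity) h2
  have herr : ∑ x ∈ primCharsUpTo R,
      ‖∑ p ∈ P' \ P, α p.1 * charVal x p.1 * (β p.2 * charVal x p.2)‖ ≤
      63 * exp π * 𝓛 ^ 5 * (E * R * (N / K + R ^ 2)) := by
    set H := ⌊(2 * N / K : ℝ)⌋₊ with hH
    have hmaps : ∀ p ∈ P' \ P, p.1 * p.2 ∈ Ioc N (N + H) := by
      rintro ⟨a, b⟩ hp
      obtain ⟨h1, h2⟩ := mem_sdiff.1 hp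
      obtain ⟨ha, hb⟩ := mem_sigma.1 h1
      obtain ⟨ha1, ha2⟩ := mem_Icc.1 ha
      obtain ⟨hb1, hb2⟩ := mem_Icc.1 hb
      refine mem_Ioc.2 ⟨?_, ?_⟩
      · by_contra! h
        exact h2 (mem_sigma.2 ⟨ha, mem_Icc.2
          ⟨hb1, (Nat.le_div_iff_mul_le ha1).2 (by rwa [mul_comm])⟩⟩)
      · have hb3 : (b : ℝ) ≤ N / T (blockIndex K a) := (Nat.le_floor_iff (by positivity)).1 hb2
        have h3 : (a : ℝ) * b ≤ N + 2 * N / K := by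
          calc (a : ℝ) * b ≤ T (blockIndex K a) * (1 + 2 / K) * (N / T (blockIndex K a)) := by
                gcongr
                exact le_exp_blockIndex_mul hK ha1
            _ = _ := by have := (hT0 (blockIndex K a)).ne'; field_simp
        have h4 : a * b - N ≤ H := by
          refine Nat.le_floor ?_
          rcases le_total N (a * b) with h | h
          · rw [Nat.cast_sub h]; push_cast; linarith
          · rw [Nat.sub_eq_zero_of_le h]; rw [Nat.cast_zero]; positivity
        show a * b ≤ N + H
        omega
    set e : ℕ → ℂ := fun z => ∑ p ∈ P' \ P with p.1 * p.2 = z, α p.1 * β p.2 with he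
    have h1 : ∀ x, ∑ p ∈ P' \ P, α p.1 * charVal x p.1 * (β p.2 * charVal x p.2) =
        ∑ z ∈ Ioc N (N + H), e z * charVal x (z : ℤ) := by
      intro x
      rw [← sum_fiberwise_of_maps_to hmaps]
      refine sum_congr rfl fun z _ => ?_
      rw [he, sum_mul]
      refine sum_congr rfl fun p hp => ?_
      rw [← (mem_filter.1 hp).2, charVal_mul]; ring
    have he1 : ∀ z ∈ Ioc N (N + H), ‖e z‖ ≤ 3 * E * 𝓛 := by
      intro z hz
      obtain ⟨hz1, hz2⟩ := mem_Ioc.1 hz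
      have hz0 : z ≠ 0 := by omega
      have hz3 : z ≤ 3 * N := by
        have : H ≤ 2 * N := by
          refine Nat.floor_le_of_le ?_
          push_cast
          exact div_le_self (by positivity) hK'
        omega
      have hlogz : log z ≤ 3 * 𝓛 := by
        have h1 : log (z : ℝ) ≤ log (3 * N) :=
          log_le_log (by exact_mod_cast Nat.pos_of_ne_zero hz0) (by exact_mod_cast hz3)
        rw [log_mul (by norm_num) (by linarith)] at h1
        have h2 := log_le_sub_one_of_pos (show (0 : ℝ) < 3 by norm_num)
        linarith
      calc ‖e z‖ ≤ ∑ p ∈ P' \ P with p.1 * p.2 = z, E * Λ p.2 := by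
            refine norm_sum_le_of_le _ fun p hp => ?_
            rw [norm_mul]
            have h1 : p.1 ∣ z := Dvd.intro _ (mem_filter.1 hp).2
            have h2 : (2 : ℝ) ^ ω p.1 ≤ 2 ^ ω z :=
              pow_le_pow_right₀ (by norm_num) (omega_le_of_dvd h1 hz0)
            exact mul_le_mul ((hα _).trans (h2.trans (hE z hz3))) (hβ _) (norm_nonneg _)
              (by linarith)
        _ = ∑ b ∈ (filter (fun p => p.1 * p.2 = z) (P' \ P)).image (fun p => p.2), E * Λ b := by
            rw [sum_image]
            rintro ⟨a, b⟩ hp ⟨a', b'⟩ hp' h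
            have h1 : a * b = z := (mem_filter.1 hp).2
            have h2 : a' * b' = z := (mem_filter.1 hp').2
            obtain rfl : b = b' := h
            have hb : b ≠ 0 := by rintro rfl; exact hz0 (by simpa using h1.symm)
            have : a = a' := Nat.eq_of_mul_eq_mul_right (Nat.pos_of_ne_zero hb) (h1.trans h2.symm)
            rw [this]
        _ ≤ ∑ b ∈ z.divisors, E * Λ b := by
            refine sum_le_sum_of_subset_of_nonneg ?_ fun b _ _ =>
              mul_nonneg (by linarith) ArithmeticFunction.vonMangoldt_nonneg
            intro b hb
            obtain ⟨p, hp, rfl⟩ := mem_image.1 hb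
            exact Nat.mem_divisors.2 ⟨Dvd.intro_left _ (mem_filter.1 hp).2, hz0⟩
        _ = E * log z := by rw [← mul_sum, ArithmeticFunction.vonMangoldt_sum]
        _ ≤ E * (3 * 𝓛) := by gcongr
        _ = _ := by ring
    have h2 : ∑ z ∈ Ioc N (N + H), ‖e z‖ ^ 2 ≤ 2 * N / K * (3 * E * 𝓛) ^ 2 := by
      calc _ ≤ ∑ z ∈ Ioc N (N + H), (3 * E * 𝓛) ^ 2 := by
            refine sum_le_sum fun z hz => ?_
            have := he1 z hz
            gcongr
        _ = H * (3 * E * 𝓛) ^ 2 := by simp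
        _ ≤ _ := by gcongr; exact Nat.floor_le (by positivity)
    have h3 := sum_norm_le_large_sieve (S := 2 * N / K * (3 * E * 𝓛) ^ 2)
        (N := 2 * N / K + R ^ 2 * 𝓛) hR N H (by
      have h1 : (H : ℝ) ≤ 2 * N / K := Nat.floor_le (by positivity)
      have h2 : (R : ℝ) ^ 2 * (1 + log R) ≤ R ^ 2 * 𝓛 := by gcongr
      linarith) e h2
    simp_rw [h1]
    refine norm_le_of_sq_le (by positivity) (h3.trans ?_)
    have h4 : 2 * N / K + R ^ 2 * 𝓛 ≤ 2 * 𝓛 * (N / K + R ^ 2) := by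
      have : (2 * N / K : ℝ) ≤ 𝓛 * (2 * N / K) := le_mul_of_one_le_left (by positivity) hL1
      have h5 : 0 ≤ (R : ℝ) ^ 2 * 𝓛 := by positivity
      calc _ ≤ 𝓛 * (2 * N / K) + 2 * (R ^ 2 * 𝓛) := by linarith
        _ = _ := by ring
    have h5 : (2 * N / K : ℝ) ≤ 2 * 𝓛 * (N / K + R ^ 2) := by
      have : 0 ≤ (R : ℝ) ^ 2 * 𝓛 := by positivity
      linarith
    calc (R : ℝ) ^ 2 * (9 * exp π * (2 * N / K + R ^ 2 * 𝓛) * (2 * N / K * (3 * E * 𝓛) ^ 2))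
        ≤ (R : ℝ) ^ 2 * (9 * exp π * (2 * 𝓛 * (N / K + R ^ 2)) *
          (2 * 𝓛 * (N / K + R ^ 2) * (3 * E * 𝓛) ^ 2)) := by gcongr
      _ = 324 * exp π * 𝓛 ^ 4 * (E * R * (N / K + R ^ 2)) ^ 2 := by ring
      _ ≤ 3969 * exp π ^ 2 * 𝓛 ^ 10 * (E * R * (N / K + R ^ 2)) ^ 2 := by
          gcongr
          · norm_num
          · nlinarith
          · norm_num
      _ = _ := by ring
  calc _ = ∑ x ∈ primCharsUpTo R, ‖∑ p ∈ P', α p.1 * charVal x p.1 * (β p.2 * charVal x p.2) -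
        ∑ p ∈ P' \ P, α p.1 * charVal x p.1 * (β p.2 * charVal x p.2)‖ := by
        refine sum_congr rfl fun x _ => ?_
        rw [← sum_sdiff hPP', add_sub_cancel_left, hP, sum_sigma]
    _ ≤ _ := sum_le_sum fun x _ => norm_sub_le _ _
    _ ≤ _ := by rw [sum_add_distrib, mul_add]; exact add_le_add hmain herr

section

lemma sum_range_mul_eq (g : ℕ → ℝ) (a : ℕ → ℂ) (t : ℕ) :
    ∑ b ∈ range t, (g b : ℂ) * a b = g t * ∑ i ∈ range t, a i -
      ∑ b ∈ range t, ((g (b + 1) : ℂ) - g b) * ∑ i ∈ range (b + 1), a i := by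
  induction t with
  | zero => simp
  | succ t ih =>
    rw [sum_range_succ, ih, sum_range_succ _ t, sum_range_succ (fun b => _ * _) t,
      sum_range_succ a t]
    ring

lemma norm_sum_range_mul_le {g : ℕ → ℝ} (hg : Monotone g) (h0 : g 0 = 0) {a : ℕ → ℂ} {B : ℝ}
    (ha : ∀ t, ‖∑ i ∈ range t, a i‖ ≤ B) (t : ℕ) :
    ‖∑ b ∈ range t, (g b : ℂ) * a b‖ ≤ 2 * g t * B := by
  have hgt : 0 ≤ g t := h0 ▸ hg (Nat.zero_le t)
  rw [sum_range_mul_eq]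
  refine (norm_sub_le _ _).trans ?_
  have h1 : ‖(g t : ℂ) * ∑ i ∈ range t, a i‖ ≤ g t * B := by
    rw [norm_mul, Complex.norm_of_nonneg hgt]
    gcongr
    exact ha t
  have h2 : ‖∑ b ∈ range t, ((g (b + 1) : ℂ) - g b) * ∑ i ∈ range (b + 1), a i‖ ≤
      ∑ b ∈ range t, (g (b + 1) - g b) * B := by
    refine norm_sum_le_of_le _ fun b _ => ?_
    have : 0 ≤ g (b + 1) - g b := sub_nonneg.2 (hg (Nat.le_succ b))
    rw [norm_mul, ← Complex.ofReal_sub, Complex.norm_of_nonneg this]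
    gcongr
    exact ha _
  rw [← sum_mul, sum_range_sub, h0, sub_zero] at h2
  linarith

lemma norm_sum_range_char_le {r : ℕ} [NeZero r] {χ : DirichletCharacter ℂ r} (hχ : χ ≠ 1) (n : ℕ) :
    ‖∑ i ∈ range n, χ (i : ZMod r)‖ ≤ r := by
  induction n using Nat.strong_induction_on with
  | _ n ih =>
    rcases lt_or_ge n r with h | h
    · calc _ ≤ ∑ i ∈ range n, (1 : ℝ) :=
            norm_sum_le_of_le _ fun i _ => DirichletCharacter.norm_le_one χ _
        _ ≤ r := by simpa using h.le
    · obtain ⟨m, rfl⟩ := Nat.exists_eq_add_of_le h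
      have h0 : ∑ i ∈ range r, χ (i : ZMod r) = 0 := by
        rw [← Fin.sum_univ_eq_sum_range (fun i => χ (i : ZMod r)), sum_fin_zmod,
          MulChar.sum_eq_zero_of_ne_one hχ]
      rw [sum_range_add, h0, zero_add]
      simpa using ih m (by have := NeZero.pos r; omega)

lemma primitive_ne_one {r : ℕ} (hr : 1 < r) {χ : DirichletCharacter ℂ r} (hχ : χ.IsPrimitive) :
    χ ≠ 1 := by
  rintro rfl
  have : NeZero r := ⟨by omega⟩
  rw [DirichletCharacter.isPrimitive_def, DirichletCharacter.conductor_one] at hχ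
  omega

lemma charVal_zero {x : Σ r : ℕ, DirichletCharacter ℂ r} (hx : 1 < x.1) : charVal x 0 = 0 := by
  have : Fact (1 < x.1) := ⟨hx⟩
  rw [charVal, Int.cast_zero, MulChar.map_zero]

lemma charVal_natCast (x : Σ r : ℕ, DirichletCharacter ℂ r) (m : ℕ) :
    charVal x m = x.2 (m : ZMod x.1) := by
  rw [charVal, Int.cast_natCast]

lemma mem_primCharsUpTo {R : ℕ} {x : Σ r : ℕ, DirichletCharacter ℂ r} :
    x ∈ primCharsUpTo R ↔ (1 ≤ x.1 ∧ x.1 ≤ R) ∧ x.2.IsPrimitive := by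
  rw [primCharsUpTo, mem_sigma, mem_Icc, mem_primChars]

lemma sum_Ioc_zero_eq_sum_range {M : Type*} [AddCommMonoid M] {f : ℕ → M} (hf : f 0 = 0) (t : ℕ) :
    ∑ b ∈ Ioc 0 t, f b = ∑ b ∈ range (t + 1), f b := by
  refine sum_subset (fun b hb => ?_) fun b hb hb' => ?_
  · rw [mem_Ioc] at hb
    exact mem_range.2 (by omega)
  · rw [mem_Ioc] at hb'
    rw [mem_range] at hb
    obtain rfl : b = 0 := by omega
    exact hf

lemma norm_sum_charVal_le {x : Σ r : ℕ, DirichletCharacter ℂ r} (hx : 1 < x.1)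
    (hp : x.2.IsPrimitive) (t : ℕ) : ‖∑ b ∈ Ioc 0 t, charVal x b‖ ≤ x.1 := by
  have : NeZero x.1 := ⟨by omega⟩
  rw [sum_Ioc_zero_eq_sum_range (by rw [Nat.cast_zero, charVal_zero hx])]
  simp_rw [charVal_natCast]
  exact norm_sum_range_char_le (primitive_ne_one hx hp) _

lemma norm_sum_log_charVal_le {x : Σ r : ℕ, DirichletCharacter ℂ r} (hx : 1 < x.1)
    (hp : x.2.IsPrimitive) (t : ℕ) :
    ‖∑ b ∈ Ioc 0 t, (log b : ℂ) * charVal x b‖ ≤ 2 * log (t + 1) * x.1 := by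
  have : NeZero x.1 := ⟨by omega⟩
  rw [sum_Ioc_zero_eq_sum_range (by simp)]
  have := norm_sum_range_mul_le (g := fun b : ℕ => log b) (a := fun b => charVal x b)
    (fun a b hab => ?_) (by simp) (B := x.1) (fun t => ?_) (t + 1)
  · simpa using this
  · rcases Nat.eq_zero_or_pos a with rfl | ha
    · simpa using log_natCast_nonneg b
    · exact log_le_log (by exact_mod_cast ha) (by exact_mod_cast hab)
  · simp_rw [charVal_natCast]
    exact norm_sum_range_char_le (primitive_ne_one hx hp) _

/-- The twist of an arithmetic function by a Dirichlet character. -/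
noncomputable def twist (x : Σ r : ℕ, DirichletCharacter ℂ r) (f : ArithmeticFunction ℂ) :
    ArithmeticFunction ℂ :=
  ⟨fun m => f m * charVal x m, by simp⟩

lemma twist_apply (x : Σ r : ℕ, DirichletCharacter ℂ r) (f : ArithmeticFunction ℂ) (m : ℕ) :
    twist x f m = f m * charVal x m := rfl

lemma twist_mul (x : Σ r : ℕ, DirichletCharacter ℂ r) (f g : ArithmeticFunction ℂ) :
    twist x (f * g) = twist x f * twist x g := by
  ext m
  rw [twist_apply, ArithmeticFunction.mul_apply, ArithmeticFunction.mul_apply, sum_mul]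
  refine sum_congr rfl fun p hp => ?_
  rw [twist_apply, twist_apply, ← (Nat.mem_divisorsAntidiagonal.1 hp).1, charVal_mul]
  ring

lemma sum_twist_mul (x : Σ r : ℕ, DirichletCharacter ℂ r) (f g : ArithmeticFunction ℂ) (N : ℕ) :
    ∑ m ∈ Ioc 0 N, (f * g) m * charVal x m =
      ∑ a ∈ Ioc 0 N, f a * charVal x a * ∑ b ∈ Ioc 0 (N / a), g b * charVal x b := by
  have := ArithmeticFunction.sum_Ioc_mul_eq_sum_sum (twist x f) (twist x g) N
  rw [← twist_mul] at this
  exact this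

/-- The restriction of an arithmetic function to `[1, U]`. -/
noncomputable def cutoff (U : ℕ) (f : ArithmeticFunction ℂ) : ArithmeticFunction ℂ :=
  ⟨fun m => if m ≤ U then f m else 0, by simp⟩

lemma cutoff_apply (U : ℕ) (f : ArithmeticFunction ℂ) (m : ℕ) :
    cutoff U f m = if m ≤ U then f m else 0 := rfl

/-- The von Mangoldt function with complex values. -/
noncomputable def mangoldt : ArithmeticFunction ℂ := ⟨fun m => (Λ m : ℂ), by simp⟩

lemma mangoldt_apply (m : ℕ) : mangoldt m = (Λ m : ℂ) := rfl

/-- The logarithm as an arithmetic function with complex values. -/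
noncomputable def cLog : ArithmeticFunction ℂ := ⟨fun m => (log m : ℂ), by simp⟩

lemma cLog_apply (m : ℕ) : cLog m = (log m : ℂ) := rfl

open scoped ArithmeticFunction.Moebius ArithmeticFunction.zeta

lemma zeta_mul_mangoldt : (ζ : ArithmeticFunction ℂ) * mangoldt = cLog := by
  ext m
  rw [ArithmeticFunction.coe_zeta_mul_apply, cLog_apply, ← ArithmeticFunction.vonMangoldt_sum]
  push_cast
  rfl

lemma vaughan_identity (μ₁ μ₂ Λ₁ Λ₂ : ArithmeticFunction ℂ)
    (h₂ : μ₂ = (μ : ArithmeticFunction ℂ) - μ₁) (h₄ : Λ₂ = mangoldt - Λ₁) :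
    mangoldt = Λ₁ + μ₁ * cLog - μ₁ * Λ₁ * ζ + μ₂ * ζ * Λ₂ := by
  have e : (μ₁ + μ₂) * (ζ : ArithmeticFunction ℂ) = 1 := by
    rw [h₂, add_sub_cancel, ArithmeticFunction.coe_moebius_mul_coe_zeta]
  have e₂ : (ζ : ArithmeticFunction ℂ) * (Λ₁ + Λ₂) = cLog := by
    rw [h₄, add_sub_cancel, zeta_mul_mangoldt]
  have e₃ : Λ₁ + Λ₂ = mangoldt := by rw [h₄, add_sub_cancel]
  rw [← e₃, ← e₂]
  linear_combination (-Λ₂) * e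

lemma arith_sub_apply (f g : ArithmeticFunction ℂ) (m : ℕ) : (f - g) m = f m - g m := by
  rw [sub_eq_add_neg, ArithmeticFunction.add_apply, ArithmeticFunction.neg_apply, sub_eq_add_neg]

lemma norm_sum_divisors_moebius_le {a : ℕ} (ha : a ≠ 0) (s : Finset ℕ) (hs : s ⊆ a.divisors) :
    ‖∑ d ∈ s, ((μ d : ℤ) : ℂ)‖ ≤ 2 ^ ω a := by
  calc _ ≤ ∑ d ∈ s, (if Squarefree d then (1 : ℝ) else 0) := by
        refine norm_sum_le_of_le _ fun d _ => ?_
        rw [Complex.norm_intCast, ← Int.cast_abs, ArithmeticFunction.abs_moebius]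
        split_ifs <;> simp
    _ ≤ ∑ d ∈ a.divisors, (if Squarefree d then (1 : ℝ) else 0) :=
        sum_le_sum_of_subset_of_nonneg hs fun d _ _ => by split_ifs <;> norm_num
    _ = 2 ^ ω a := by
        rw [← sum_filter, Nat.sum_divisors_filter_squarefree ha]
        rw [sum_const, card_powerset, Nat.factors_eq, nsmul_eq_mul, mul_one]
        push_cast
        rfl

lemma vaughan_bound {R N K : ℕ} (hR : 1 ≤ R) (hK : 1 ≤ K) (hN : 1 ≤ N) (hRN : R ≤ N) {E : ℝ}
    (hE : ∀ z : ℕ, z ≤ 3 * N → (2 : ℝ) ^ ω z ≤ E) :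
    ∑ x ∈ primCharsUpTo R with 1 < x.1, ‖∑ m ∈ Ioc 0 N, (Λ m : ℂ) * charVal x m‖ ≤
      63 * exp π * (1 + log N) ^ 5 * (√(N ^ 2 + R ^ 2 * N ^ 2 / K + R ^ 4 * N * K) +
        E * R * (N / K + R ^ 2)) + 4 * R ^ 3 * K ^ 3 * (1 + log N) := by
  have hK' : (1 : ℝ) ≤ K := by exact_mod_cast hK
  have hN' : (1 : ℝ) ≤ N := by exact_mod_cast hN
  have hR' : (1 : ℝ) ≤ R := by exact_mod_cast hR
  have hlogN := log_natCast_nonneg N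
  set 𝓛 := 1 + log (N : ℝ) with hLdef
  set μ₁ := cutoff (K ^ 2) (μ : ArithmeticFunction ℂ) with hμ₁
  set μ₂ := (μ : ArithmeticFunction ℂ) - μ₁ with hμ₂
  set Λ₁ := cutoff K mangoldt with hΛ₁
  set Λ₂ := mangoldt - Λ₁ with hΛ₂
  have hid := vaughan_identity μ₁ μ₂ Λ₁ Λ₂ hμ₂ hΛ₂
  have hΛ₁le : ∀ m, ‖Λ₁ m‖ ≤ Λ m := by
    intro m
    rw [hΛ₁, cutoff_apply, mangoldt_apply]
    split_ifs
    · rw [Complex.norm_of_nonneg ArithmeticFunction.vonMangoldt_nonneg]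
    · simp
  have hμ₁le : ∀ m, ‖μ₁ m‖ ≤ 1 := by
    intro m
    rw [hμ₁, cutoff_apply]
    split_ifs
    · rw [ArithmeticFunction.intCoe_apply, Complex.norm_intCast, ← Int.cast_abs]
      exact_mod_cast ArithmeticFunction.abs_moebius_le_one
    · simp
  have hα : ∀ a, ‖(μ₂ * ζ) a‖ ≤ 2 ^ ω a := by
    intro a
    rcases eq_or_ne a 0 with rfl | ha
    · simp
    rw [ArithmeticFunction.coe_mul_zeta_apply]
    have : ∑ d ∈ a.divisors, μ₂ d = ∑ d ∈ a.divisors with K ^ 2 < d, ((μ d : ℤ) : ℂ) := by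
      rw [sum_filter]
      refine sum_congr rfl fun d _ => ?_
      rw [hμ₂, arith_sub_apply, hμ₁, cutoff_apply, ArithmeticFunction.intCoe_apply]
      split_ifs with h1 h2 h2
      · omega
      · simp
      · simp
      · omega
    rw [this]
    exact norm_sum_divisors_moebius_le ha _ (filter_subset _ _)
  have hα0 : ∀ a, a ≤ K ^ 2 → (μ₂ * ζ) a = 0 := by
    intro a ha
    rw [ArithmeticFunction.coe_mul_zeta_apply]
    refine sum_eq_zero fun d hd => ?_
    rw [hμ₂, arith_sub_apply, hμ₁, cutoff_apply,
      if_pos ((Nat.divisor_le hd).trans ha), sub_self]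
  have hΛ₂apply : ∀ b, Λ₂ b = if b ≤ K then 0 else (Λ b : ℂ) := by
    intro b
    rw [hΛ₂, arith_sub_apply, hΛ₁, cutoff_apply, mangoldt_apply]
    split_ifs <;> simp
  have hβ : ∀ b, ‖Λ₂ b‖ ≤ Λ b := by
    intro b
    rw [hΛ₂apply]
    split_ifs
    · simp
    · rw [Complex.norm_of_nonneg ArithmeticFunction.vonMangoldt_nonneg]
  have hβ0 : ∀ b, b ≤ K → Λ₂ b = 0 := fun b hb => by rw [hΛ₂apply, if_pos hb]
  have hlogle : ∀ m, 1 ≤ m → m ≤ N → log (m : ℝ) ≤ 𝓛 := by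
    intro m hm hmN
    have : log (m : ℝ) ≤ log N := log_le_log (by exact_mod_cast hm) (by exact_mod_cast hmN)
    linarith
  have hsplit : ∀ x, ‖∑ m ∈ Ioc 0 N, (Λ m : ℂ) * charVal x m‖ ≤
      ‖∑ m ∈ Ioc 0 N, Λ₁ m * charVal x m‖ + ‖∑ m ∈ Ioc 0 N, (μ₁ * cLog) m * charVal x m‖ +
      ‖∑ m ∈ Ioc 0 N, (μ₁ * Λ₁ * ζ) m * charVal x m‖ +
      ‖∑ m ∈ Ioc 0 N, (μ₂ * ζ * Λ₂) m * charVal x m‖ := by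
    intro x
    have : ∑ m ∈ Ioc 0 N, (Λ m : ℂ) * charVal x m =
      ∑ m ∈ Ioc 0 N, Λ₁ m * charVal x m + ∑ m ∈ Ioc 0 N, (μ₁ * cLog) m * charVal x m -
      ∑ m ∈ Ioc 0 N, (μ₁ * Λ₁ * ζ) m * charVal x m +
      ∑ m ∈ Ioc 0 N, (μ₂ * ζ * Λ₂) m * charVal x m := by
      rw [← sum_add_distrib, ← sum_sub_distrib, ← sum_add_distrib]
      refine sum_congr rfl fun m _ => ?_
      rw [← mangoldt_apply, ← add_mul, ← sub_mul, ← add_mul]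
      conv_lhs => rw [hid]
      rfl
    rw [this]
    refine (norm_add_le _ _).trans (add_le_add_left ((norm_sub_le _ _).trans ?_) _)
    exact add_le_add_left (norm_add_le _ _) _
  have hsmall : ∀ {f : ArithmeticFunction ℂ} {B : ℝ} {M : ℕ} {u : ℕ → ℂ}, 0 ≤ B →
      (∀ m, 1 ≤ m → m ≤ N → ‖f m * u m‖ ≤ B) → (∀ m, M < m → f m = 0) →
      ‖∑ m ∈ Ioc 0 N, f m * u m‖ ≤ M * B := by
    intro f B M u hB h1 h2
    calc _ ≤ ∑ m ∈ Ioc 0 N, (if m ≤ M then B else 0) := by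
          refine norm_sum_le_of_le _ fun m hm => ?_
          obtain ⟨hm1, hm2⟩ := mem_Ioc.1 hm
          split_ifs with h
          · exact h1 m hm1 hm2
          · rw [h2 m (by omega), zero_mul, norm_zero]
      _ = ((Ioc 0 N).filter (· ≤ M)).card * B := by rw [← sum_filter, sum_const, nsmul_eq_mul]
      _ ≤ M * B := by
          gcongr
          calc _ ≤ (Ioc 0 M).card := card_le_card fun m hm => by
                rw [mem_filter, mem_Ioc] at hm
                exact mem_Ioc.2 ⟨hm.1.1, hm.2⟩
            _ = M := by simp
  have htypeone : ∀ x ∈ (primCharsUpTo R).filter (fun x => 1 < x.1),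
      ‖∑ m ∈ Ioc 0 N, Λ₁ m * charVal x m‖ + ‖∑ m ∈ Ioc 0 N, (μ₁ * cLog) m * charVal x m‖ +
      ‖∑ m ∈ Ioc 0 N, (μ₁ * Λ₁ * ζ) m * charVal x m‖ ≤ 4 * R * K ^ 3 * 𝓛 := by
    intro x hx
    obtain ⟨hx1, hx2⟩ := mem_filter.1 hx
    obtain ⟨⟨_, hxR⟩, hp⟩ := mem_primCharsUpTo.1 hx1
    have hxR' : (x.1 : ℝ) ≤ R := by exact_mod_cast hxR
    have t1 : ‖∑ m ∈ Ioc 0 N, Λ₁ m * charVal x m‖ ≤ K * 𝓛 := by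
      refine hsmall (by positivity) (fun m h1 h2 => ?_) fun m hm => by
        rw [hΛ₁, cutoff_apply, if_neg (by omega)]
      rw [norm_mul]
      calc _ ≤ Λ m * 1 := mul_le_mul (hΛ₁le m) (norm_charVal_le x m) (norm_nonneg _)
            ArithmeticFunction.vonMangoldt_nonneg
        _ ≤ 𝓛 := by
          rw [mul_one]
          exact ArithmeticFunction.vonMangoldt_le_log.trans (hlogle m h1 h2)
    have t2 : ‖∑ m ∈ Ioc 0 N, (μ₁ * cLog) m * charVal x m‖ ≤ (K ^ 2 : ℕ) * (2 * 𝓛 * R) := by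
      rw [sum_twist_mul]
      simp_rw [mul_assoc]
      refine hsmall (by positivity) (fun m h1 h2 => ?_) fun m hm => by
        rw [hμ₁, cutoff_apply, if_neg (by omega)]
      rw [norm_mul, norm_mul]
      have h3 := norm_sum_log_charVal_le hx2 hp (N / m)
      have h4 : log ((N / m : ℕ) + 1 : ℝ) ≤ 𝓛 := by
        have h5 : log ((N / m : ℕ) + 1 : ℝ) ≤ log (2 * N) := by
          refine log_le_log (by positivity) ?_
          have : ((N / m : ℕ) : ℝ) ≤ N := by exact_mod_cast Nat.div_le_self N m
          linarith
        rw [log_mul (by norm_num) (by linarith)] at h5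
        have := log_two_lt_d9
        linarith
      calc _ ≤ 1 * (1 * (2 * log ((N / m : ℕ) + 1 : ℝ) * x.1)) := by
            gcongr
            · exact hμ₁le m
            · exact norm_charVal_le x m
            · exact h3
        _ ≤ 1 * (1 * (2 * 𝓛 * R)) := by gcongr
        _ = _ := by ring
    have t3 : ‖∑ m ∈ Ioc 0 N, (μ₁ * Λ₁ * ζ) m * charVal x m‖ ≤ (K ^ 3 : ℕ) * (𝓛 * R) := by
      rw [sum_twist_mul]
      simp_rw [mul_assoc]
      refine hsmall (by positivity) (fun m h1 h2 => ?_) fun m hm => ?_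
      · rw [norm_mul, norm_mul]
        have h3 := norm_sum_charVal_le hx2 hp (N / m)
        have h4 : ‖(μ₁ * Λ₁) m‖ ≤ 𝓛 := by
          rw [ArithmeticFunction.mul_apply]
          calc _ ≤ ∑ p ∈ m.divisorsAntidiagonal, Λ p.2 := by
                refine norm_sum_le_of_le _ fun p _ => ?_
                rw [norm_mul]
                calc _ ≤ 1 * Λ p.2 :=
                      mul_le_mul (hμ₁le _) (hΛ₁le _) (norm_nonneg _) zero_le_one
                  _ = _ := one_mul _
            _ = log m := by
                rw [Nat.sum_divisorsAntidiagonal' (fun _ b => Λ b),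
                  ArithmeticFunction.vonMangoldt_sum]
            _ ≤ 𝓛 := hlogle m h1 h2
        have h5 : ‖∑ b ∈ Ioc 0 (N / m), (ζ : ArithmeticFunction ℂ) b * charVal x b‖ ≤ R := by
          refine le_trans (le_of_eq (congrArg _ (sum_congr rfl fun b hb => ?_))) (h3.trans hxR')
          have : b ≠ 0 := by have := mem_Ioc.1 hb; omega
          simp [ArithmeticFunction.natCoe_apply, this]
        calc _ ≤ 𝓛 * (1 * R) := by
              gcongr
              exact norm_charVal_le x m
          _ = _ := by rw [one_mul]
      · rw [ArithmeticFunction.mul_apply]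
        refine sum_eq_zero fun p hp => ?_
        have hpm := (Nat.mem_divisorsAntidiagonal.1 hp).1
        by_cases h1 : p.1 ≤ K ^ 2
        · have h2 : ¬ p.2 ≤ K := by
            intro h2
            have : p.1 * p.2 ≤ K ^ 2 * K := Nat.mul_le_mul h1 h2
            rw [hpm, ← pow_succ] at this
            exact absurd (this.trans_lt hm) (lt_irrefl _)
          have h3 : Λ₁ p.2 = 0 := by rw [hΛ₁, cutoff_apply, if_neg h2]
          rw [h3, mul_zero]
        · have h3 : μ₁ p.1 = 0 := by rw [hμ₁, cutoff_apply, if_neg h1]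
          rw [h3, zero_mul]
    push_cast at t2 t3
    have k1 : (K : ℝ) * 𝓛 ≤ R * K ^ 3 * 𝓛 := by
      gcongr
      calc (K : ℝ) = 1 * K ^ 1 := by ring
        _ ≤ R * K ^ 3 := by gcongr; norm_num
    have k2 : (K : ℝ) ^ 2 * (2 * 𝓛 * R) ≤ 2 * (R * K ^ 3 * 𝓛) := by
      calc (K : ℝ) ^ 2 * (2 * 𝓛 * R) = 2 * (R * K ^ 2 * 𝓛) := by ring
        _ ≤ _ := by gcongr; norm_num
    linarith
  have htypetwo : ∑ x ∈ (primCharsUpTo R).filter (fun x => 1 < x.1),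
      ‖∑ m ∈ Ioc 0 N, (μ₂ * ζ * Λ₂) m * charVal x m‖ ≤
      63 * exp π * 𝓛 ^ 5 * (√(N ^ 2 + R ^ 2 * N ^ 2 / K + R ^ 4 * N * K) +
        E * R * (N / K + R ^ 2)) := by
    refine le_trans ?_ (type_two hR hK hN hRN hE hα hα0 hβ hβ0)
    refine (sum_le_sum_of_subset_of_nonneg (filter_subset _ _) fun _ _ _ => norm_nonneg _).trans
      (sum_le_sum fun x _ => le_of_eq ?_)
    rw [sum_twist_mul]
    simp_rw [mul_sum]
    rfl
  calc _ ≤ ∑ x ∈ (primCharsUpTo R).filter (fun x => 1 < x.1), (4 * R * K ^ 3 * 𝓛 +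
        ‖∑ m ∈ Ioc 0 N, (μ₂ * ζ * Λ₂) m * charVal x m‖) :=
        sum_le_sum fun x hx => (hsplit x).trans (add_le_add_left (htypeone x hx) _)
    _ ≤ R ^ 2 * (4 * R * K ^ 3 * 𝓛) + 63 * exp π * 𝓛 ^ 5 *
        (√(N ^ 2 + R ^ 2 * N ^ 2 / K + R ^ 4 * N * K) + E * R * (N / K + R ^ 2)) := by
        rw [sum_add_distrib, sum_const, nsmul_eq_mul]
        gcongr
        exact_mod_cast (card_filter_le _ _).trans (card_primCharsUpTo_le R)
    _ = _ := by ring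

end

lemma exists_sum_prime_charVal_le :
    ∃ C : ℝ, 1 ≤ C ∧ ∀ (v : ℝ) (R N : ℕ), 1 ≤ v → 1 ≤ R → (R : ℝ) ≤ v ^ 445 →
      v ^ 980 ≤ N → (N : ℝ) ≤ v ^ 1000 →
      ∑ x ∈ primCharsUpTo R with 1 < x.1,
        ‖∑ q ∈ Ioc 0 N with q.Prime, (log q : ℂ) * charVal x q‖ ≤
      C * N * (1 + log N) ^ 5 * (1 + R / v ^ 8) := by
  obtain ⟨C, hC1, hC⟩ := pow_omega_le 2 (show (0 : ℝ) < 1 / 1000 by norm_num)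
  refine ⟨63 * exp π * (2 + 6 * C) + 32 + 2, by have := exp_pos π; nlinarith, ?_⟩
  intro v R N hv hR hRv hN1 hN2
  have hv0 : 0 < v := by linarith
  have hN1' : (1 : ℝ) ≤ N := (one_le_pow₀ hv).trans hN1
  have hN : 1 ≤ N := by exact_mod_cast hN1'
  have hR' : (1 : ℝ) ≤ R := by exact_mod_cast hR
  have hRN : R ≤ N := by
    have : (R : ℝ) ≤ N := hRv.trans ((pow_le_pow_right₀ hv (by norm_num)).trans hN1)
    exact_mod_cast this
  have hlogN := log_natCast_nonneg N
  set 𝓛 := 1 + log (N : ℝ) with hLdef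
  have hL1 : 1 ≤ 𝓛 := by linarith
  set K := ⌈v ^ 20⌉₊ with hK
  have hK1 : v ^ 20 ≤ K := Nat.le_ceil _
  have hv20 : 1 ≤ v ^ 20 := one_le_pow₀ hv
  have hK2 : (K : ℝ) ≤ 2 * v ^ 20 := by
    have := Nat.ceil_lt_add_one (show 0 ≤ v ^ 20 by positivity)
    linarith
  have hK0 : (1 : ℝ) ≤ K := hv20.trans hK1
  have hE : ∀ z : ℕ, z ≤ 3 * N → (2 : ℝ) ^ ω z ≤ C * (3 * v) := by
    intro z hz
    rcases eq_or_ne z 0 with rfl | hz0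
    · simp; nlinarith
    refine (by exact_mod_cast hC z hz0 : (2 : ℝ) ^ ω z ≤ C * (z : ℝ) ^ (1 / 1000 : ℝ)).trans ?_
    gcongr
    calc (z : ℝ) ^ (1 / 1000 : ℝ) ≤ ((3 * v) ^ 1000) ^ (1 / 1000 : ℝ) := by
          gcongr
          calc (z : ℝ) ≤ 3 * N := by exact_mod_cast hz
            _ ≤ 3 ^ 1000 * v ^ 1000 := by
              gcongr
              exact le_self_pow₀ (by norm_num) (by norm_num)
            _ = _ := by rw [mul_pow]
      _ = 3 * v := by
          rw [← rpow_natCast, ← rpow_mul (by positivity)]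
          norm_num
  have hvb := vaughan_bound hR (by exact_mod_cast hK0) hN hRN hE
  rw [← hLdef] at hvb
  set ρ : ℝ := R / v ^ 8 with hρ
  have hρ0 : 0 ≤ ρ := by positivity
  have hR2 : (R : ℝ) ^ 2 ≤ v ^ 890 := by
    calc (R : ℝ) ^ 2 ≤ (v ^ 445) ^ 2 := by gcongr
      _ = v ^ 890 := by ring
  have hRρ : (R : ℝ) = ρ * v ^ 8 := by rw [hρ]; field_simp
  have b1 : √((N : ℝ) ^ 2 + R ^ 2 * N ^ 2 / K + R ^ 4 * N * K) ≤ 2 * N * (1 + ρ) := by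
    refine sqrt_le_iff.2 ⟨by positivity, ?_⟩
    have h1 : (R : ℝ) ^ 2 * N ^ 2 / K ≤ N ^ 2 * ρ ^ 2 := by
      rw [div_le_iff₀ (by linarith)]
      calc (R : ℝ) ^ 2 * N ^ 2 = N ^ 2 * ρ ^ 2 * v ^ 16 := by rw [hRρ]; ring
        _ ≤ N ^ 2 * ρ ^ 2 * K := by
          gcongr
          exact (pow_le_pow_right₀ hv (by norm_num)).trans hK1
    have h2 : (R : ℝ) ^ 4 * N * K ≤ 2 * (N ^ 2 * ρ ^ 2) := by
      calc (R : ℝ) ^ 4 * N * K = R ^ 2 * R ^ 2 * N * K := by ring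
        _ ≤ R ^ 2 * v ^ 890 * N * (2 * v ^ 20) := by gcongr
        _ = 2 * (N * ρ ^ 2) * v ^ 926 := by rw [hRρ]; ring
        _ ≤ 2 * (N * ρ ^ 2) * N := by
          gcongr
          exact (pow_le_pow_right₀ hv (by norm_num)).trans hN1
        _ = _ := by ring
    nlinarith [mul_nonneg (sq_nonneg (N : ℝ)) hρ0, mul_nonneg (sq_nonneg (N : ℝ)) (sq_nonneg ρ)]
  have b2 : C * (3 * v) * R * (N / K + R ^ 2) ≤ 6 * C * N * (1 + ρ) := by
    have h1 : v * R * (N / K) ≤ N * ρ := by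
      rw [mul_div_assoc', div_le_iff₀ (by linarith)]
      calc v * R * N = N * ρ * v ^ 9 := by rw [hRρ]; ring
        _ ≤ N * ρ * K := by
          gcongr
          exact (pow_le_pow_right₀ hv (by norm_num)).trans hK1
    have h2 : v * R * R ^ 2 ≤ N * ρ := by
      calc v * R * R ^ 2 ≤ v * R * v ^ 890 := by gcongr
        _ = ρ * v ^ 899 := by rw [hRρ]; ring
        _ ≤ ρ * N := by
          gcongr
          exact (pow_le_pow_right₀ hv (by norm_num)).trans hN1
        _ = _ := by ring
    calc C * (3 * v) * R * (N / K + R ^ 2) = 3 * C * (v * R * (N / K) + v * R * R ^ 2) := by ring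
      _ ≤ 3 * C * (N * ρ + N * ρ) := by gcongr
      _ ≤ _ := by nlinarith
  have b3 : 4 * (R : ℝ) ^ 3 * K ^ 3 ≤ 32 * N * (1 + ρ) := by
    calc 4 * (R : ℝ) ^ 3 * K ^ 3 = 4 * R * R ^ 2 * K ^ 3 := by ring
      _ ≤ 4 * R * v ^ 890 * (2 * v ^ 20) ^ 3 := by gcongr
      _ = 32 * ρ * v ^ 958 := by rw [hRρ]; ring
      _ ≤ 32 * ρ * N := by
        gcongr
        exact (pow_le_pow_right₀ hv (by norm_num)).trans hN1
      _ ≤ _ := by nlinarith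
  have hpp : ∀ x, ‖∑ q ∈ Ioc 0 N with q.Prime, (log q : ℂ) * charVal x q‖ ≤
      ‖∑ m ∈ Ioc 0 N, (Λ m : ℂ) * charVal x m‖ + 2 * √N * log N := by
    intro x
    have h1 : ∑ m ∈ Ioc 0 N, (Λ m : ℂ) * charVal x m =
        ∑ q ∈ Ioc 0 N with q.Prime, (log q : ℂ) * charVal x q +
        ∑ m ∈ Ioc 0 N with ¬ m.Prime, (Λ m : ℂ) * charVal x m := by
      rw [← sum_filter_add_sum_filter_not _ (fun m : ℕ => m.Prime)]
      congr 1
      refine sum_congr rfl fun q hq => ?_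
      rw [ArithmeticFunction.vonMangoldt_apply_prime (mem_filter.1 hq).2]
    have h2 : ‖∑ m ∈ Ioc 0 N with ¬ m.Prime, (Λ m : ℂ) * charVal x m‖ ≤ 2 * √N * log N := by
      refine le_trans ?_ (Chebyshev.psi_sub_theta_le hN1')
      rw [Chebyshev.psi_sub_theta_eq_sum_not_prime, Nat.floor_natCast]
      refine norm_sum_le_of_le _ fun m _ => ?_
      rw [norm_mul, Complex.norm_of_nonneg ArithmeticFunction.vonMangoldt_nonneg]
      exact mul_le_of_le_one_right ArithmeticFunction.vonMangoldt_nonneg (norm_charVal_le x m)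
    calc _ = ‖∑ m ∈ Ioc 0 N, (Λ m : ℂ) * charVal x m -
          ∑ m ∈ Ioc 0 N with ¬ m.Prime, (Λ m : ℂ) * charVal x m‖ := by
          rw [h1, add_sub_cancel_right]
      _ ≤ _ := (norm_sub_le _ _).trans (by gcongr)
  have b4 : (R : ℝ) ^ 2 * (2 * √N * log N) ≤ 2 * N * (1 + ρ) * 𝓛 := by
    have h1 : v ^ 490 ≤ √N := by
      refine le_sqrt_of_sq_le (le_trans (le_of_eq ?_) hN1)
      ring
    calc (R : ℝ) ^ 2 * (2 * √N * log N) = R * R * (2 * √N * log N) := by ring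
      _ ≤ R * v ^ 445 * (2 * √N * 𝓛) := by gcongr; linarith
      _ = 2 * ρ * 𝓛 * √N * v ^ 453 := by rw [hRρ]; ring
      _ ≤ 2 * ρ * 𝓛 * √N * √N := by
        gcongr
        exact (pow_le_pow_right₀ hv (by norm_num)).trans h1
      _ = 2 * ρ * 𝓛 * N := by rw [mul_assoc _ √N, mul_self_sqrt (by positivity)]
      _ ≤ _ := by nlinarith [show 0 ≤ 𝓛 * N by positivity]
  have hL5 : 𝓛 ≤ 𝓛 ^ 5 := le_self_pow₀ hL1 (by norm_num)
  calc _ ≤ ∑ x ∈ primCharsUpTo R with 1 < x.1,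
        (‖∑ m ∈ Ioc 0 N, (Λ m : ℂ) * charVal x m‖ + 2 * √N * log N) :=
        sum_le_sum fun x _ => hpp x
    _ ≤ ∑ x ∈ primCharsUpTo R with 1 < x.1, ‖∑ m ∈ Ioc 0 N, (Λ m : ℂ) * charVal x m‖ +
        R ^ 2 * (2 * √N * log N) := by
        rw [sum_add_distrib, sum_const, nsmul_eq_mul]
        gcongr
        exact_mod_cast (card_filter_le _ _).trans (card_primCharsUpTo_le R)
    _ ≤ 63 * exp π * 𝓛 ^ 5 * (2 * N * (1 + ρ) + 6 * C * N * (1 + ρ)) + 32 * N * (1 + ρ) * 𝓛 +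
        2 * N * (1 + ρ) * 𝓛 := by
        refine add_le_add (hvb.trans ?_) b4
        gcongr
    _ ≤ 63 * exp π * 𝓛 ^ 5 * (2 * N * (1 + ρ) + 6 * C * N * (1 + ρ)) +
        32 * N * (1 + ρ) * 𝓛 ^ 5 + 2 * N * (1 + ρ) * 𝓛 ^ 5 := by gcongr
    _ = _ := by ring

lemma sum_Ioc_mul_eq (g : ℕ → ℝ) (c : ℕ → ℂ) {a b : ℕ} (hab : a < b) :
    ∑ m ∈ Ioc a b, (g m : ℂ) * c m = g b * ∑ m ∈ Ioc 0 b, c m -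
      g (a + 1) * ∑ m ∈ Ioc 0 a, c m +
      ∑ j ∈ Ico (a + 1) b, ((g j : ℂ) - g (j + 1)) * ∑ m ∈ Ioc 0 j, c m := by
  induction b, Nat.succ_le_of_lt hab using Nat.le_induction with
  | base => simp [Finset.sum_Ioc_succ_top]; ring
  | succ b hb ih =>
    rw [Finset.sum_Ioc_succ_top (by omega), ih hb, Finset.sum_Ico_succ_top hb,
      Finset.sum_Ioc_succ_top (Nat.zero_le _)]
    ring

/-- Partial summation for a family of sums with a common decreasing weight. -/
lemma sum_norm_sum_Ioc_le {ι : Type*} (s : Finset ι) (c : ι → ℕ → ℂ) {g : ℕ → ℝ} {a b : ℕ} {B : ℝ}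
    (hab : a < b) (hg0 : ∀ m, 0 ≤ g m) (hg : ∀ m, a < m → m < b → g (m + 1) ≤ g m)
    (hB : ∀ j, a ≤ j → j ≤ b → ∑ x ∈ s, ‖∑ m ∈ Ioc 0 j, c x m‖ ≤ B * j) :
    ∑ x ∈ s, ‖∑ m ∈ Ioc a b, (g m : ℂ) * c x m‖ ≤
      B * (2 * (g (a + 1) * a) + ∑ m ∈ Ioc a b, g m) := by
  have h1 : ∀ x ∈ s, ‖∑ m ∈ Ioc a b, (g m : ℂ) * c x m‖ ≤
      g b * ‖∑ m ∈ Ioc 0 b, c x m‖ + g (a + 1) * ‖∑ m ∈ Ioc 0 a, c x m‖ +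
      ∑ j ∈ Ico (a + 1) b, (g j - g (j + 1)) * ‖∑ m ∈ Ioc 0 j, c x m‖ := by
    intro x _
    rw [sum_Ioc_mul_eq g (c x) hab]
    refine (norm_add_le _ _).trans (add_le_add ((norm_sub_le _ _).trans (le_of_eq ?_))
      (norm_sum_le_of_le _ fun j hj => ?_))
    · rw [norm_mul, norm_mul, Complex.norm_of_nonneg (hg0 _), Complex.norm_of_nonneg (hg0 _)]
    · have : 0 ≤ g j - g (j + 1) := by
        have := mem_Ico.1 hj
        exact sub_nonneg.2 (hg j (by omega) this.2)
      rw [norm_mul, ← Complex.ofReal_sub, Complex.norm_of_nonneg this]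
  have h2 : ∑ m ∈ Ioc a b, g m = g b * b - g (a + 1) * a +
      ∑ j ∈ Ico (a + 1) b, (g j - g (j + 1)) * j := by
    have := sum_Ioc_mul_eq g (fun _ => 1) hab
    simp only [mul_one, sum_const, Nat.card_Ioc, tsub_zero, nsmul_eq_mul] at this
    exact_mod_cast this
  calc _ ≤ _ := sum_le_sum h1
    _ = g b * ∑ x ∈ s, ‖∑ m ∈ Ioc 0 b, c x m‖ + g (a + 1) * ∑ x ∈ s, ‖∑ m ∈ Ioc 0 a, c x m‖ +
      ∑ j ∈ Ico (a + 1) b, (g j - g (j + 1)) * ∑ x ∈ s, ‖∑ m ∈ Ioc 0 j, c x m‖ := by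
        simp_rw [sum_add_distrib, mul_sum]
        rw [sum_comm (s := s)]
    _ ≤ g b * (B * b) + g (a + 1) * (B * a) +
        ∑ j ∈ Ico (a + 1) b, (g j - g (j + 1)) * (B * j) := by
        refine add_le_add (add_le_add ?_ ?_) (sum_le_sum fun j hj => ?_)
        · exact mul_le_mul_of_nonneg_left (hB b hab.le le_rfl) (hg0 _)
        · exact mul_le_mul_of_nonneg_left (hB a le_rfl hab.le) (hg0 _)
        · have := mem_Ico.1 hj
          exact mul_le_mul_of_nonneg_left (hB j (by omega) (by omega))
            (sub_nonneg.2 (hg j (by omega) this.2))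
    _ = _ := by
        rw [h2, mul_add, mul_add, mul_sum]
        have : ∀ j : ℕ, (g j - g (j + 1)) * (B * j) = B * ((g j - g (j + 1)) * j) := by
          intro j; ring
        simp_rw [this]
        ring

lemma mul_exp_one_sub_le_one (t : ℝ) : t * exp (1 - t) ≤ 1 := by
  have h := add_one_le_exp (t - 1)
  have h2 : exp (t - 1) * exp (1 - t) = 1 := by rw [← exp_add]; simp
  calc t * exp (1 - t) ≤ exp (t - 1) * exp (1 - t) := by
        gcongr
        linarith
    _ = 1 := h2

/-- A smooth weight concentrated around `log m = ℓ`. -/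
noncomputable def wt (ℓ : ℝ) (k m : ℕ) : ℝ := (log m / ℓ * exp (1 - log m / ℓ)) ^ k / m

lemma wt_nonneg {ℓ : ℝ} (hℓ : 0 ≤ ℓ) (k m : ℕ) : 0 ≤ wt ℓ k m := by
  have := log_natCast_nonneg m
  unfold wt
  positivity

lemma wt_le {ℓ : ℝ} (hℓ : 0 ≤ ℓ) (k m : ℕ) : wt ℓ k m ≤ 1 / m := by
  have := log_natCast_nonneg m
  unfold wt
  gcongr
  exact pow_le_one₀ (by positivity) (mul_exp_one_sub_le_one _)

lemma wt_antitone {ℓ : ℝ} (hℓ : 0 < ℓ) {k m m' : ℕ} (hm : 1 ≤ m) (hk : k ≤ log m) (hmm : m ≤ m') :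
    wt ℓ k m' ≤ wt ℓ k m := by
  have hm0 : (0 : ℝ) < m := by exact_mod_cast hm
  have hm0' : (0 : ℝ) < m' := by exact_mod_cast hm.trans hmm
  have hlog : log (m : ℝ) ≤ log m' := log_le_log hm0 (by exact_mod_cast hmm)
  rcases Nat.eq_zero_or_pos k with rfl | hk0
  · simp only [wt, pow_zero]
    gcongr
  have hk0' : (0 : ℝ) < k := by exact_mod_cast hk0
  have hl0 : 0 < log (m : ℝ) := hk0'.trans_le hk
  unfold wt
  rw [div_le_div_iff₀ hm0' hm0]
  set s := log (m : ℝ) with hs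
  set t := log (m' : ℝ) with ht
  have e1 : (m : ℝ) = exp s := (exp_log hm0).symm
  have e2 : (m' : ℝ) = exp t := (exp_log hm0').symm
  have h1 : (t / s) ^ k ≤ exp (t - s) := by
    have h3 : t / s ≤ exp ((t - s) / s) := by
      have := add_one_le_exp ((t - s) / s)
      have e : (t - s) / s + 1 = t / s := by field_simp; ring
      linarith
    calc (t / s) ^ k ≤ exp ((t - s) / s) ^ k := by
          gcongr
      _ = exp (k * ((t - s) / s)) := by rw [← exp_nat_mul]
      _ ≤ exp (t - s) := by
          refine exp_le_exp.2 ?_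
          rw [mul_div_assoc', div_le_iff₀ hl0]
          nlinarith
  have h2 : exp (1 - t / ℓ) ≤ exp (1 - s / ℓ) := by gcongr
  have ht0 : 0 < t := by linarith
  calc (t / ℓ * exp (1 - t / ℓ)) ^ k * m = (t / s) ^ k * (s / ℓ * exp (1 - t / ℓ)) ^ k * m := by
        rw [← mul_pow]
        congr 2
        field_simp
    _ ≤ exp (t - s) * (s / ℓ * exp (1 - s / ℓ)) ^ k * m := by gcongr
    _ = (s / ℓ * exp (1 - s / ℓ)) ^ k * m' := by
        rw [e1, e2, exp_sub]
        field_simp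

/-- The primes `q` in the range under consideration. -/
noncomputable def primeRange (n : ℕ) : Finset ℕ :=
  (Ioc ⌈(n : ℝ) ^ (49 / 100 : ℝ)⌉₊ (Nat.sqrt (n - 1))).filter Nat.Prime

/-- The weight attached to a prime `q`. -/
noncomputable def W (n k q : ℕ) : ℝ := wt (99 / 200 * log n) k q * log q

lemma W_nonneg (n k q : ℕ) : 0 ≤ W n k q :=
  mul_nonneg (wt_nonneg (by have := log_natCast_nonneg n; positivity) _ _) (log_natCast_nonneg q)

/-- The weighted character sum over the primes in the range under consideration. -/
noncomputable def charSum (n k : ℕ) (x : Σ r : ℕ, DirichletCharacter ℂ r) : ℂ :=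
  ∑ q ∈ primeRange n, (W n k q : ℂ) * charVal x q

lemma exists_sum_charSum_le :
    ∃ C : ℝ, 1 ≤ C ∧ ∀ (v : ℝ) (R n k : ℕ), 1 ≤ v → (n : ℝ) = v ^ 2000 → 1 ≤ R →
      (R : ℝ) ≤ v ^ 445 → k ≤ 49 / 100 * log n →
      ∑ x ∈ primCharsUpTo R with 1 < x.1, ‖charSum n k x‖ ≤
        C * (1 + log n) ^ 6 * (1 + R / v ^ 8) := by
  obtain ⟨C, hC1, hC⟩ := exists_sum_prime_charVal_le
  refine ⟨3 * C, by linarith, ?_⟩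
  intro v R n k hv hn hR hRv hk
  have hn1 : (1 : ℝ) ≤ n := by rw [hn]; exact one_le_pow₀ hv
  have hn49 : (n : ℝ) ^ (49 / 100 : ℝ) = v ^ 980 := by
    rw [hn, ← rpow_natCast, ← rpow_mul (by linarith), ← rpow_natCast]
    norm_num
  have hlogn : 0 ≤ log (n : ℝ) := log_nonneg hn1
  set a := ⌈(n : ℝ) ^ (49 / 100 : ℝ)⌉₊ with ha
  set b := Nat.sqrt (n - 1) with hb
  have hva : v ^ 980 ≤ a := hn49 ▸ Nat.le_ceil _
  have ha1' : (1 : ℝ) ≤ a := (one_le_pow₀ hv).trans hva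
  have ha1 : 1 ≤ a := by exact_mod_cast ha1'
  have hbv : (b : ℝ) ≤ v ^ 1000 := by
    have h1 : b ^ 2 ≤ n := (Nat.sqrt_le' (n - 1)).trans (Nat.sub_le n 1)
    have h2 : (b : ℝ) ^ 2 ≤ n := by exact_mod_cast h1
    refine le_of_sq_le_sq ?_ (by positivity)
    calc (b : ℝ) ^ 2 ≤ n := h2
      _ = _ := by rw [hn]; ring
  have hρ : 0 ≤ (R : ℝ) / v ^ 8 := by positivity
  have hbn : (b : ℝ) ≤ n := hbv.trans (by rw [hn]; exact pow_le_pow_right₀ hv (by norm_num))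
  rcases le_or_gt b a with hab | hab
  · have : primeRange n = ∅ := by rw [primeRange, Ioc_eq_empty (by omega)]; rfl
    simp only [charSum, this, sum_empty, norm_zero, sum_const_zero]
    positivity
  set g := wt (99 / 200 * log n) k with hg
  have hg0 : ∀ m, 0 ≤ g m := fun m => wt_nonneg (by positivity) k m
  have hlogn0 : 0 < log (n : ℝ) := by
    have hb2 : (2 : ℝ) ≤ b := by exact_mod_cast (show 2 ≤ b by omega)
    exact log_pos (by linarith)
  have hlogle : ∀ m : ℕ, a ≤ m → m ≤ b → log (m : ℝ) ≤ log n := by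
    intro m h1 h2
    have h3 : (m : ℝ) ≤ b := by exact_mod_cast h2
    exact log_le_log (by exact_mod_cast ha1.trans h1) (h3.trans hbn)
  have key := sum_norm_sum_Ioc_le (s := (primCharsUpTo R).filter fun x => 1 < x.1)
    (c := fun x q => if q.Prime then (log q : ℂ) * charVal x q else 0) (g := g)
    (B := C * (1 + log n) ^ 5 * (1 + R / v ^ 8)) hab hg0 (fun m h1 _ => ?_) (fun j h1 h2 => ?_)
  · have e : ∀ x, charSum n k x =
        ∑ m ∈ Ioc a b, (g m : ℂ) * (if m.Prime then (log m : ℂ) * charVal x m else 0) := by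
      intro x
      rw [charSum, primeRange, sum_filter]
      refine sum_congr rfl fun m _ => ?_
      split_ifs
      · rw [W]; push_cast; ring
      · simp
    simp_rw [e]
    refine key.trans ?_
    have h1 : g (a + 1) * a ≤ 1 := by
      have h := wt_le (ℓ := 99 / 200 * log n) (by positivity) k (a + 1)
      calc g (a + 1) * a ≤ 1 / ((a + 1 : ℕ) : ℝ) * a := by gcongr
        _ ≤ 1 := by
          push_cast
          rw [div_mul_eq_mul_div, one_mul, div_le_one (by linarith)]
          linarith
    have h2 : ∑ m ∈ Ioc a b, g m ≤ 1 + log n := by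
      calc ∑ m ∈ Ioc a b, g m ≤ ∑ m ∈ Ioc a b, (1 : ℝ) / m :=
            sum_le_sum fun m _ => wt_le (by positivity) k m
        _ ≤ ∑ m ∈ Icc 1 b, (1 : ℝ) / m := by
            refine sum_le_sum_of_subset_of_nonneg (fun m hm => ?_) fun m _ _ => by positivity
            rw [mem_Ioc] at hm
            exact mem_Icc.2 ⟨by omega, hm.2⟩
        _ ≤ 1 + log b := sum_Icc_inv_le b
        _ ≤ _ := by have := hlogle b hab.le le_rfl; linarith
    calc _ ≤ C * (1 + log n) ^ 5 * (1 + R / v ^ 8) * (3 * (1 + log n)) := by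
          gcongr
          linarith
      _ = _ := by ring
  · refine wt_antitone (by positivity) (by omega) (hk.trans ?_) (Nat.le_succ m)
    have h3 : log ((n : ℝ) ^ (49 / 100 : ℝ)) ≤ log m := by
      refine log_le_log (by rw [hn49]; positivity) ((Nat.le_ceil _).trans ?_)
      exact_mod_cast h1.le
    rwa [log_rpow (by linarith)] at h3
  · have hj1 : (a : ℝ) ≤ j := by exact_mod_cast h1
    have hj2 : (j : ℝ) ≤ b := by exact_mod_cast h2
    simp_rw [← sum_filter]
    refine (hC v R j hv hR hRv (hva.trans hj1) (hj2.trans hbv)).trans ?_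
    have := hlogle j h1 h2
    have h0 := log_natCast_nonneg j
    calc C * j * (1 + log j) ^ 5 * (1 + R / v ^ 8) ≤
          C * j * (1 + log n) ^ 5 * (1 + R / v ^ 8) := by gcongr
      _ = _ := by ring

lemma norm_sum_Icc_char_le {r : ℕ} [NeZero r] {χ : DirichletCharacter ℂ r} (hχ : χ ≠ 1) (n : ℕ) :
    ‖∑ i ∈ Icc 1 n, χ (i : ZMod r)‖ ≤ r := by
  have hr : χ ((0 : ℕ) : ZMod r) = 0 := by
    have : Nontrivial (ZMod r) := by
      by_contra h
      rw [not_nontrivial_iff_subsingleton] at h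
      exact hχ (MulChar.ext fun a => by simp [Subsingleton.elim a 1])
    simp [χ.map_zero]
  have h := norm_sum_range_char_le hχ (n + 1)
  have h2 : ∑ i ∈ Icc 1 n, χ (i : ZMod r) = ∑ i ∈ range (n + 1), χ (i : ZMod r) := by
    rw [range_eq_Ico, sum_eq_sum_Ico_succ_bot (by omega), hr, zero_add]
    exact sum_congr (by ext; simp) fun x hx => rfl
  rw [h2]
  exact h

lemma norm_sum_Icc_char_le_rpow {r : ℕ} [NeZero r] {χ : DirichletCharacter ℂ r} (hχ : χ ≠ 1)
    {η : ℝ} (hη : 0 ≤ η) (hη1 : η ≤ 1) {t : ℝ} (ht : 0 < t) :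
    ‖∑ i ∈ Icc 1 ⌊t⌋₊, χ (i : ZMod r)‖ ≤ (r : ℝ) ^ η * t ^ (1 - η) := by
  have h1 := norm_sum_Icc_char_le hχ ⌊t⌋₊
  have h2 : ‖∑ i ∈ Icc 1 ⌊t⌋₊, χ (i : ZMod r)‖ ≤ t := by
    calc _ ≤ ∑ i ∈ Icc 1 ⌊t⌋₊, ‖χ (i : ZMod r)‖ := norm_sum_le _ _
      _ ≤ ∑ i ∈ Icc 1 ⌊t⌋₊, 1 := sum_le_sum fun i _ => χ.norm_le_one _
      _ = ⌊t⌋₊ := by simp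
      _ ≤ t := Nat.floor_le ht.le
  set A := ‖∑ i ∈ Icc 1 ⌊t⌋₊, χ (i : ZMod r)‖
  have hA : 0 ≤ A := norm_nonneg _
  calc A = A ^ η * A ^ (1 - η) := by
        rcases hA.eq_or_lt with h | h
        · rw [← h]
          rcases hη.eq_or_lt with h' | h'
          · simp [← h']
          · rw [zero_rpow h'.ne', zero_mul]
        · rw [← rpow_add h]
          simp
    _ ≤ (r : ℝ) ^ η * t ^ (1 - η) := by
        gcongr

lemma mellin_sum_char {r : ℕ} (χ : DirichletCharacter ℂ r) (s : ℂ) :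
    mellin (fun t : ℝ => ∑ i ∈ Icc 1 ⌊t⌋₊, χ (i : ZMod r)) (-s) =
      ∫ t in Set.Ioi (1 : ℝ), (∑ i ∈ Icc 1 ⌊t⌋₊, χ (i : ZMod r)) * (t : ℂ) ^ (-(s + 1)) := by
  rw [mellin]
  rw [← MeasureTheory.integral_Ici_eq_integral_Ioi (x := 1)]
  rw [MeasureTheory.setIntegral_eq_of_subset_of_forall_sdiff_eq_zero measurableSet_Ioi
    (Set.Ici_subset_Ioi.2 one_pos)]
  · refine MeasureTheory.setIntegral_congr_fun measurableSet_Ici fun t _ => ?_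
    simp only [smul_eq_mul]
    rw [mul_comm, neg_add, sub_eq_add_neg]
  · intro x hx
    have : ⌊x⌋₊ = 0 := Nat.floor_eq_zero.2 (by simpa using hx.2)
    simp [this]

lemma locallyIntegrableOn_sum_char {r : ℕ} (χ : DirichletCharacter ℂ r) :
    MeasureTheory.LocallyIntegrableOn (fun t : ℝ => ∑ i ∈ Icc 1 ⌊t⌋₊, χ (i : ZMod r))
      (Set.Ioi 0) := by
  have h := locallyIntegrableOn_mul_sum_Icc (fun i : ℕ => χ (i : ZMod r)) (m := 1) (a := 0)
    (g := fun _ => 1) le_rfl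
    (MeasureTheory.locallyIntegrableOn_const _)
  simpa using h.mono_set Set.Ioi_subset_Ici_self

lemma differentiableAt_mellin_sum_char {r : ℕ} [NeZero r] {χ : DirichletCharacter ℂ r}
    (hχ : χ ≠ 1) {s : ℂ} (hs : 0 < s.re) :
    DifferentiableAt ℂ
      (fun s => mellin (fun t : ℝ => ∑ i ∈ Icc 1 ⌊t⌋₊, χ (i : ZMod r)) (-s)) s := by
  have : DifferentiableAt ℂ (mellin (fun t : ℝ => ∑ i ∈ Icc 1 ⌊t⌋₊, χ (i : ZMod r))) (-s) := by
    refine mellin_differentiableAt_of_isBigO_rpow (a := 0) (b := -s.re - 1)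
      (locallyIntegrableOn_sum_char χ) ?_ (by simpa) ?_ (by simp)
    · refine Asymptotics.isBigO_of_le' (c := r) _ fun t => ?_
      simpa using norm_sum_Icc_char_le hχ ⌊t⌋₊
    · refine Asymptotics.IsBigO.of_bound 1 ?_
      have : ∀ᶠ t : ℝ in nhdsWithin 0 (Set.Ioi 0), t ∈ Set.Ioo (0 : ℝ) 1 :=
        Ioo_mem_nhdsGT one_pos
      filter_upwards [this] with t ht
      have : ⌊t⌋₊ = 0 := Nat.floor_eq_zero.2 ht.2
      simp [this]
  exact this.fun_comp' s differentiable_neg.differentiableAt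

lemma LFunction_eq_mul_mellin {r : ℕ} [NeZero r] {χ : DirichletCharacter ℂ r}
    (hχ : χ ≠ 1) {s : ℂ} (hs : 0 < s.re) :
    χ.LFunction s = s * mellin (fun t : ℝ => ∑ i ∈ Icc 1 ⌊t⌋₊, χ (i : ZMod r)) (-s) := by
  have hopen : IsOpen {s : ℂ | 0 < s.re} := isOpen_lt continuous_const Complex.continuous_re
  have hconn : IsPreconnected {s : ℂ | 0 < s.re} := (convex_halfSpace_re_gt 0).isPreconnected
  have h1 : AnalyticOnNhd ℂ χ.LFunction {s : ℂ | 0 < s.re} :=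
    (DirichletCharacter.differentiable_LFunction hχ).differentiableOn.analyticOnNhd hopen
  have h2 : AnalyticOnNhd ℂ
      (fun s => s * mellin (fun t : ℝ => ∑ i ∈ Icc 1 ⌊t⌋₊, χ (i : ZMod r)) (-s))
      {s : ℂ | 0 < s.re} := by
    refine DifferentiableOn.analyticOnNhd (fun s hs => ?_) hopen
    exact (differentiableAt_id.mul
      (differentiableAt_mellin_sum_char hχ hs)).differentiableWithinAt
  refine h1.eqOn_of_preconnected_of_eventuallyEq h2 hconn (z₀ := 2) (by simp) ?_ hs
  have : {s : ℂ | 1 < s.re} ∈ nhds (2 : ℂ) :=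
    (isOpen_lt continuous_const Complex.continuous_re).mem_nhds (by simp)
  filter_upwards [this] with s (hs : 1 < s.re)
  rw [mellin_sum_char, DirichletCharacter.LFunction_eq_LSeries χ hs]
  refine LSeries_eq_mul_integral _ le_rfl (by linarith)
    (DirichletCharacter.LSeriesSummable_of_one_lt_re χ hs) ?_
  refine Asymptotics.isBigO_of_le' (c := r) _ fun t => ?_
  simpa using norm_sum_Icc_char_le hχ t

/-- A bound for `L(s, χ)` near `s = 1`. -/
lemma norm_LFunction_le {r : ℕ} [NeZero r] {χ : DirichletCharacter ℂ r} (hχ : χ ≠ 1) {η : ℝ}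
    (hη : 0 < η) (hη1 : η ≤ 1 / 2) {s : ℂ} (hs : ‖s - 1‖ ≤ η) :
    ‖χ.LFunction s‖ ≤ 2 / η * (r : ℝ) ^ (2 * η) := by
  have hre : 1 - η ≤ s.re := by
    have := (Complex.abs_re_le_norm (s - 1)).trans hs
    rw [Complex.sub_re, Complex.one_re, abs_le] at this
    linarith
  have hn : ‖s‖ ≤ 2 := by
    have := norm_add_le (s - 1) 1
    rw [sub_add_cancel, norm_one] at this
    linarith
  rw [LFunction_eq_mul_mellin hχ (by linarith), mellin_sum_char, norm_mul]
  have : ‖∫ t in Set.Ioi (1 : ℝ), (∑ i ∈ Icc 1 ⌊t⌋₊, χ (i : ZMod r)) * (t : ℂ) ^ (-(s + 1))‖ ≤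
      ∫ t in Set.Ioi (1 : ℝ), (r : ℝ) ^ (2 * η) * t ^ (-1 - η) := by
    refine MeasureTheory.norm_integral_le_of_norm_le
      ((integrableOn_Ioi_rpow_of_lt (by linarith) one_pos).const_mul _) ?_
    filter_upwards [MeasureTheory.ae_restrict_mem measurableSet_Ioi] with t (ht : 1 < t)
    have ht0 : 0 < t := by linarith
    rw [norm_mul, Complex.norm_cpow_eq_rpow_re_of_pos ht0]
    calc _ ≤ ((r : ℝ) ^ (2 * η) * t ^ (1 - 2 * η)) * t ^ (-2 + η) := by
          gcongr
          · exact norm_sum_Icc_char_le_rpow hχ (by linarith) (by linarith) ht0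
          · exact ht.le
          · simp
            linarith
      _ = _ := by
          rw [mul_assoc, ← rpow_add ht0]
          ring_nf
  rw [MeasureTheory.integral_const_mul, integral_Ioi_rpow_of_lt (by linarith) one_pos] at this
  calc _ ≤ 2 * ((r : ℝ) ^ (2 * η) * (-1 ^ (-1 - η + 1) / (-1 - η + 1))) := by gcongr
    _ = _ := by
      rw [one_rpow, show -1 - η + 1 = -η by ring, neg_div_neg_eq]
      ring

lemma three_add_two_mul_re_nonneg {z w : ℂ} (hz : z = 0 ∨ ‖z‖ = 1) (hw : w = 0 ∨ ‖w‖ = 1) :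
    0 ≤ 3 + 2 * z.re + 2 * w.re + 2 * (z * star w).re := by
  rcases hz with rfl | hz
  · rcases hw with rfl | hw
    · simp
    · have := (abs_le.1 (Complex.abs_re_le_norm w)).1
      simp
      linarith
  rcases hw with rfl | hw
  · have := (abs_le.1 (Complex.abs_re_le_norm z)).1
    simp
    linarith
  have h1 : z.re * z.re + z.im * z.im = 1 := by
    rw [← Complex.normSq_apply, Complex.normSq_eq_norm_sq, hz, one_pow]
  have h2 : w.re * w.re + w.im * w.im = 1 := by
    rw [← Complex.normSq_apply, Complex.normSq_eq_norm_sq, hw, one_pow]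
  simp only [Complex.mul_re, Complex.star_def, Complex.conj_re, Complex.conj_im]
  nlinarith [sq_nonneg (1 + z.re + w.re), sq_nonneg (z.im + w.im)]

lemma neg_log_comb_nonneg {a : ℝ} (ha₀ : 0 ≤ a) (ha₁ : a < 1) {z w : ℂ} (hz : z = 0 ∨ ‖z‖ = 1)
    (hw : w = 0 ∨ ‖w‖ = 1) :
    0 ≤ 3 * (-Complex.log (1 - a)).re + 2 * (-Complex.log (1 - z * a)).re +
      2 * (-Complex.log (1 - w * a)).re + 2 * (-Complex.log (1 - z * star w * a)).re := by
  have hn : ∀ u : ℂ, u = 0 ∨ ‖u‖ = 1 → ‖u * a‖ < 1 := by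
    rintro u (rfl | hu)
    · simp
    · rwa [norm_mul, hu, one_mul, Complex.norm_of_nonneg ha₀]
  have hac₀ : ‖(a : ℂ)‖ < 1 := by simp only [Complex.norm_of_nonneg ha₀, ha₁]
  have hzw : z * star w = 0 ∨ ‖z * star w‖ = 1 := by
    rcases hz with rfl | hz
    · simp
    rcases hw with rfl | hw
    · simp
    simp [hz, hw]
  rw [← ((((Complex.hasSum_re <| Complex.hasSum_taylorSeries_neg_log hac₀).mul_left 3).add
    ((Complex.hasSum_re <| Complex.hasSum_taylorSeries_neg_log (hn z hz)).mul_left 2)).add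
    ((Complex.hasSum_re <| Complex.hasSum_taylorSeries_neg_log (hn w hw)).mul_left 2)).add
    ((Complex.hasSum_re <| Complex.hasSum_taylorSeries_neg_log (hn _ hzw)).mul_left 2)
    |>.tsum_eq]
  refine tsum_nonneg fun n => ?_
  rcases n.eq_zero_or_pos with rfl | hnpos
  · simp
  have hpow : ∀ u : ℂ, u = 0 ∨ ‖u‖ = 1 → u ^ n = 0 ∨ ‖u ^ n‖ = 1 := by
    rintro u (rfl | hu)
    · simp [hnpos.ne']
    · simp [hu]
  have key := three_add_two_mul_re_nonneg (hpow z hz) (hpow w hw)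
  have hre : ∀ u : ℂ, ((u * a) ^ n / n).re = u.re * 0 + (u ^ n).re * (a ^ n / n) := by
    intro u
    rw [mul_pow, Complex.div_natCast_re, ← Complex.ofReal_pow, Complex.re_mul_ofReal]
    ring
  have h0 : ((a : ℂ) ^ n / n).re = a ^ n / n := by
    rw [Complex.div_natCast_re, ← Complex.ofReal_pow, Complex.ofReal_re]
  rw [h0, hre, hre, hre, mul_pow, ← star_pow]
  have ha : 0 ≤ a ^ n / n := by positivity
  nlinarith [mul_nonneg ha key]

lemma char_eq_zero_or_norm_eq_one {r : ℕ} (χ : DirichletCharacter ℂ r) (a : ZMod r) :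
    χ a = 0 ∨ ‖χ a‖ = 1 := by
  by_cases h : IsUnit a
  · obtain ⟨u, rfl⟩ := h
    exact Or.inr (χ.unit_norm_eq_one u)
  · exact Or.inl (χ.map_nonunit h)

lemma one_le_norm_zeta_mul_LSeries {r₁ r₂ r₃ : ℕ} (χ₁ : DirichletCharacter ℂ r₁)
    (χ₂ : DirichletCharacter ℂ r₂) (χ₃ : DirichletCharacter ℂ r₃)
    (h : ∀ p : ℕ, χ₃ (p : ZMod r₃) = χ₁ (p : ZMod r₁) * star (χ₂ (p : ZMod r₂))) {σ : ℝ}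
    (hσ : 1 < σ) :
    1 ≤ ‖riemannZeta σ‖ ^ 3 * ‖LSeries (fun n => χ₁ n) σ‖ ^ 2 * ‖LSeries (fun n => χ₂ n) σ‖ ^ 2 *
      ‖LSeries (fun n => χ₃ n) σ‖ ^ 2 := by
  have hs : 1 < (σ : ℂ).re := by simpa
  have H₀ := DirichletCharacter.summable_neg_log_one_sub_mul_prime_cpow
    (1 : DirichletCharacter ℂ 1) hs
  simp only [MulChar.one_apply (isUnit_of_subsingleton _), one_mul] at H₀
  have H₁ := DirichletCharacter.summable_neg_log_one_sub_mul_prime_cpow χ₁ hs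
  have H₂ := DirichletCharacter.summable_neg_log_one_sub_mul_prime_cpow χ₂ hs
  have H₃ := DirichletCharacter.summable_neg_log_one_sub_mul_prime_cpow χ₃ hs
  have G₀ := (Complex.hasSum_re H₀.hasSum).mul_left 3
  have G₁ := (Complex.hasSum_re H₁.hasSum).mul_left 2
  have G₂ := (Complex.hasSum_re H₂.hasSum).mul_left 2
  have G₃ := (Complex.hasSum_re H₃.hasSum).mul_left 2
  rw [← riemannZeta_eulerProduct_exp_log hs, ← DirichletCharacter.LSeries_eulerProduct_exp_log _ hs,
    ← DirichletCharacter.LSeries_eulerProduct_exp_log _ hs,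
    ← DirichletCharacter.LSeries_eulerProduct_exp_log _ hs]
  simp only [Complex.norm_exp, ← exp_nat_mul, ← exp_add, Nat.cast_ofNat]
  rw [one_le_exp_iff, ← (((G₀.add G₁).add G₂).add G₃).tsum_eq]
  refine tsum_nonneg fun p => ?_
  have hp : (1 : ℝ) < (p : ℕ) := by exact_mod_cast p.prop.one_lt
  have ha : ((((p : ℕ) : ℝ) ^ (-σ) : ℝ) : ℂ) = ((p : ℕ) : ℂ) ^ (-(σ : ℂ)) := by
    rw [Complex.ofReal_cpow (by positivity)]
    simp
  have := neg_log_comb_nonneg (a := ((p : ℕ) : ℝ) ^ (-σ)) (by positivity)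
    (rpow_lt_one_of_one_lt_of_neg hp (by linarith))
    (char_eq_zero_or_norm_eq_one χ₁ ((p : ℕ) : ZMod r₁))
    (char_eq_zero_or_norm_eq_one χ₂ ((p : ℕ) : ZMod r₂))
  rw [ha, ← h] at this
  exact this

lemma norm_riemannZeta_le {σ : ℝ} (hσ : 1 < σ) : ‖riemannZeta σ‖ ≤ 1 + 1 / (σ - 1) := by
  have h := ZetaAsymptotics.zeta_limit_aux1 hσ
  have h2 : 0 ≤ ZetaAsymptotics.termTSum σ :=
    tsum_nonneg fun n => ZetaAsymptotics.term_nonneg _ _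
  have h3 : (∑' n : ℕ, 1 / (n + 1 : ℝ) ^ σ) ≤ 1 + 1 / (σ - 1) := by nlinarith
  have h4 : riemannZeta σ = ((∑' n : ℕ, 1 / (n + 1 : ℝ) ^ σ : ℝ) : ℂ) := by
    rw [zeta_eq_tsum_one_div_nat_add_one_cpow (by simpa), Complex.ofReal_tsum]
    refine tsum_congr fun n => ?_
    push_cast
    rw [Complex.ofReal_cpow (by positivity)]
    simp
  rw [h4, Complex.norm_real, norm_of_nonneg (tsum_nonneg fun n => by positivity)]
  exact h3

/-- The character `χ₁ * conj χ₂` modulo the product of the moduli. -/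
noncomputable def quotChar {r₁ r₂ : ℕ} (χ₁ : DirichletCharacter ℂ r₁)
    (χ₂ : DirichletCharacter ℂ r₂) : DirichletCharacter ℂ (r₁ * r₂) :=
  DirichletCharacter.changeLevel (dvd_mul_right r₁ r₂) χ₁ *
    (DirichletCharacter.changeLevel (dvd_mul_left r₂ r₁) χ₂)⁻¹

lemma quotChar_natCast {r₁ r₂ : ℕ} [NeZero r₁] [NeZero r₂] (χ₁ : DirichletCharacter ℂ r₁)
    (χ₂ : DirichletCharacter ℂ r₂) (a : ℕ) :
    quotChar χ₁ χ₂ (a : ZMod (r₁ * r₂)) = χ₁ (a : ZMod r₁) * star (χ₂ (a : ZMod r₂)) := by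
  by_cases ha : a.Coprime (r₁ * r₂)
  · rw [quotChar, MulChar.mul_apply, changeLevel_natCast _ _ ha, ← MulChar.star_apply',
      changeLevel_natCast _ _ ha]
  · rw [apply_natCast_eq_zero _ ha]
    rw [Nat.coprime_mul_iff_right, not_and_or] at ha
    rcases ha with ha | ha <;> simp [apply_natCast_eq_zero _ ha]

lemma quotChar_ne_one {r₁ r₂ : ℕ} [NeZero r₁] [NeZero r₂] {χ₁ : DirichletCharacter ℂ r₁}
    {χ₂ : DirichletCharacter ℂ r₂} (h₁ : χ₁.IsPrimitive) (h₂ : χ₂.IsPrimitive)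
    (hne : (⟨r₁, χ₁⟩ : Σ r : ℕ, DirichletCharacter ℂ r) ≠ ⟨r₂, χ₂⟩) : quotChar χ₁ χ₂ ≠ 1 := by
  intro h
  have h0 := sum_mul_inv_eq_zero h₁ h₂ hne
  have h3 : ∑ i : Fin (r₁ * r₂), χ₁ ((i : ℕ) : ZMod r₁) * χ₂⁻¹ ((i : ℕ) : ZMod r₂) =
      ∑ a, (1 : DirichletCharacter ℂ (r₁ * r₂)) a := by
    rw [← sum_fin_zmod]
    refine sum_congr rfl fun i _ => ?_
    rw [← h, quotChar_natCast, ← MulChar.star_apply']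
  rw [h0, MulChar.sum_one_eq_card_units] at h3
  rw [ZMod.card_units_eq_totient] at h3
  have := Nat.totient_pos.2 (Nat.pos_of_neZero (r₁ * r₂))
  exact this.ne (by exact_mod_cast h3)

lemma exists_LFunction_bounds (B : ℕ) : ∃ η w₀ : ℝ, 0 < η ∧ 1 ≤ w₀ ∧ ∀ w : ℝ, w₀ ≤ w →
    ∀ (r : ℕ) [NeZero r] (χ : DirichletCharacter ℂ r), χ ≠ 1 → (r : ℝ) ≤ w ^ B → ∀ s : ℂ, ‖s - 1‖ ≤ η →
    ‖χ.LFunction s‖ ≤ w ^ 2 ∧ ‖deriv χ.LFunction s‖ ≤ w ^ 4 := by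
  set η : ℝ := 1 / (2 * (B + 1)) with hη
  have hη0 : 0 < η := by positivity
  have hη1 : η ≤ 1 / 2 := by
    rw [hη]
    gcongr
    linarith [(Nat.cast_nonneg B : (0 : ℝ) ≤ B)]
  have hB1 : (1 : ℝ) ≤ B + 1 := by linarith [(Nat.cast_nonneg B : (0 : ℝ) ≤ B)]
  refine ⟨η / 2, 4 * (B + 1), by positivity, by linarith, fun w hw r _ χ hχ hrw => ?_⟩
  have hw1 : 1 ≤ w := by linarith
  have hb : ∀ s : ℂ, ‖s - 1‖ ≤ η → ‖χ.LFunction s‖ ≤ w ^ 2 := by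
    intro s hs
    calc _ ≤ 2 / η * (r : ℝ) ^ (2 * η) := norm_LFunction_le hχ hη0 hη1 hs
      _ ≤ w * w := by
        gcongr
        · rw [hη]
          field_simp
          linarith
        · calc (r : ℝ) ^ (2 * η) ≤ (w ^ B) ^ (2 * η) := by gcongr
            _ = w ^ (B * (2 * η)) := by rw [rpow_mul (by positivity) (B : ℝ), rpow_natCast]
            _ ≤ w ^ (1 : ℝ) := by
              apply rpow_le_rpow_of_exponent_le hw1
              rw [hη]
              field_simp
              linarith
            _ = w := rpow_one w
      _ = w ^ 2 := by ring
  refine fun s hs => ⟨hb s (by linarith), ?_⟩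
  have hd := DirichletCharacter.differentiable_LFunction hχ
  calc _ ≤ w ^ 2 / (η / 2) := by
        refine Complex.norm_deriv_le_of_forall_mem_sphere_norm_le (by positivity)
          hd.diffContOnCl fun z hz => hb z ?_
        rw [mem_sphere_iff_norm] at hz
        calc ‖z - 1‖ = ‖(z - s) + (s - 1)‖ := by ring_nf
          _ ≤ ‖z - s‖ + ‖s - 1‖ := norm_add_le _ _
          _ ≤ η := by linarith
    _ = w ^ 2 * (4 * (B + 1)) := by
        rw [hη]
        field_simp
        norm_num
    _ ≤ w ^ 2 * w := by gcongr
    _ = w ^ 3 := by ring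
    _ ≤ w ^ 4 := pow_le_pow_right₀ hw1 (by norm_num)

lemma norm_LFunction_sub_le {r : ℕ} [NeZero r] {χ : DirichletCharacter ℂ r} (hχ : χ ≠ 1)
    {η M : ℝ} (h : ∀ s : ℂ, ‖s - 1‖ ≤ η → ‖deriv χ.LFunction s‖ ≤ M) {s : ℂ}
    (hs : ‖s - 1‖ ≤ η) : ‖χ.LFunction s - χ.LFunction 1‖ ≤ M * ‖s - 1‖ := by
  refine (convex_closedBall (1 : ℂ) η).norm_image_sub_le_of_norm_deriv_le
    (fun z _ => DirichletCharacter.differentiable_LFunction hχ z)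
    (fun z hz => h z (mem_closedBall_iff_norm.1 hz)) ?_ (mem_closedBall_iff_norm.2 hs)
  simpa using (norm_nonneg _).trans hs

/-- At most one primitive character has a very small `L`-value at `1`. -/
lemma exists_exceptional_unique (B : ℕ) : ∃ w₀ : ℝ, 1 ≤ w₀ ∧ ∀ w : ℝ, w₀ ≤ w →
    ∀ (r₁ r₂ : ℕ) [NeZero r₁] [NeZero r₂] (χ₁ : DirichletCharacter ℂ r₁) (χ₂ : DirichletCharacter ℂ r₂),
    χ₁.IsPrimitive → χ₂.IsPrimitive → 1 < r₁ → 1 < r₂ → (r₁ : ℝ) ≤ w ^ B → (r₂ : ℝ) ≤ w ^ B →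
    w ^ 25 * ‖χ₁.LFunction 1‖ < 1 → w ^ 25 * ‖χ₂.LFunction 1‖ < 1 →
    (⟨r₁, χ₁⟩ : Σ r : ℕ, DirichletCharacter ℂ r) = ⟨r₂, χ₂⟩ := by
  obtain ⟨η, w₀, hη, hw₀, H⟩ := exists_LFunction_bounds (2 * B)
  refine ⟨max w₀ (max (1 / η) 200), by simp [hw₀], fun w hw r₁ r₂ _ _ χ₁ χ₂ hp₁ hp₂ h₁ h₂ hr₁ hr₂
    he₁ he₂ => ?_⟩
  rw [max_le_iff, max_le_iff] at hw
  obtain ⟨hw0, hwη, hw200⟩ := hw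
  by_contra hne
  have hw1 : 1 ≤ w := by linarith
  have hwpos : 0 < w := by linarith
  set δ : ℝ := (w ^ 25)⁻¹ with hδ
  have hδ0 : 0 < δ := by positivity
  have hwδ : w ^ 25 * δ = 1 := mul_inv_cancel₀ (by positivity)
  have hδη : δ ≤ η := by
    rw [hδ, inv_le_comm₀ (by positivity) hη]
    calc η⁻¹ ≤ w := by rwa [← one_div]
      _ ≤ w ^ 25 := le_self_pow₀ hw1 (by norm_num)
  have hs : ‖((1 + δ : ℝ) : ℂ) - 1‖ = δ := by
    rw [Complex.ofReal_add, Complex.ofReal_one, add_sub_cancel_left, Complex.norm_real,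
      norm_of_nonneg hδ0.le]
  have hone : (1 : ℝ) < 1 + δ := by linarith
  have hre : 1 < ((1 + δ : ℝ) : ℂ).re := by simpa
  have hle : w ^ B ≤ w ^ (2 * B) := pow_le_pow_right₀ hw1 (by omega)
  have key : ∀ (r : ℕ) [NeZero r] (χ : DirichletCharacter ℂ r), χ.IsPrimitive → 1 < r → (r : ℝ) ≤ w ^ B →
      w ^ 25 * ‖χ.LFunction 1‖ < 1 →
      w ^ 21 * ‖LSeries (fun n => χ n) ((1 + δ : ℝ) : ℂ)‖ ≤ 2 := by
    intro r _ χ hp h1 hr he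
    have hχ := primitive_ne_one h1 hp
    have hd := norm_LFunction_sub_le hχ (fun s hs => (H w hw0 r χ hχ (hr.trans hle) s hs).2)
      (hs.le.trans hδη)
    rw [hs] at hd
    rw [← DirichletCharacter.LFunction_eq_LSeries χ hre]
    have htri : ‖χ.LFunction ((1 + δ : ℝ) : ℂ)‖ ≤ ‖χ.LFunction 1‖ + w ^ 4 * δ := by
      have := norm_add_le (χ.LFunction 1) (χ.LFunction ((1 + δ : ℝ) : ℂ) - χ.LFunction 1)
      rw [add_sub_cancel] at this
      linarith
    calc _ ≤ w ^ 21 * (‖χ.LFunction 1‖ + w ^ 4 * δ) := by gcongr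
      _ = w ^ 21 * ‖χ.LFunction 1‖ + w ^ 25 * δ := by ring
      _ ≤ w ^ 25 * ‖χ.LFunction 1‖ + w ^ 25 * δ := by
        gcongr
        norm_num
      _ ≤ 2 := by linarith
  have k₁ := key r₁ χ₁ hp₁ h₁ hr₁ he₁
  have k₂ := key r₂ χ₂ hp₂ h₂ hr₂ he₂
  have k₃ : ‖LSeries (fun n => quotChar χ₁ χ₂ n) ((1 + δ : ℝ) : ℂ)‖ ≤ w ^ 2 := by
    rw [← DirichletCharacter.LFunction_eq_LSeries _ hre]
    refine (H w hw0 _ _ (quotChar_ne_one hp₁ hp₂ hne) ?_ _ (hs.le.trans hδη)).1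
    push_cast
    calc _ ≤ w ^ B * w ^ B := by gcongr
      _ = _ := by ring
  have k₀ : ‖riemannZeta ((1 + δ : ℝ) : ℂ)‖ ≤ 2 * w ^ 25 := by
    have := norm_riemannZeta_le hone
    rw [add_sub_cancel_left, hδ, one_div, inv_inv] at this
    linarith [one_le_pow₀ hw1 (n := 25)]
  have main := one_le_norm_zeta_mul_LSeries χ₁ χ₂ (quotChar χ₁ χ₂) (quotChar_natCast χ₁ χ₂) hone
  set a := ‖LSeries (fun n => χ₁ n) ((1 + δ : ℝ) : ℂ)‖
  set b := ‖LSeries (fun n => χ₂ n) ((1 + δ : ℝ) : ℂ)‖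
  set c := ‖LSeries (fun n => quotChar χ₁ χ₂ n) ((1 + δ : ℝ) : ℂ)‖
  set z := ‖riemannZeta ((1 + δ : ℝ) : ℂ)‖
  have hfin : w ^ 84 * 1 ≤ 128 * w ^ 79 := by
    calc w ^ 84 * 1 ≤ w ^ 84 * (z ^ 3 * a ^ 2 * b ^ 2 * c ^ 2) := by gcongr
      _ = z ^ 3 * (w ^ 21 * a) ^ 2 * (w ^ 21 * b) ^ 2 * c ^ 2 := by ring
      _ ≤ (2 * w ^ 25) ^ 3 * 2 ^ 2 * 2 ^ 2 * (w ^ 2) ^ 2 := by gcongr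
      _ = 128 * w ^ 79 := by ring
  have : w ^ 5 ≤ 128 := by
    have : w ^ 79 * w ^ 5 ≤ w ^ 79 * 128 := by
      calc _ = w ^ 84 * 1 := by ring
        _ ≤ _ := by linarith
    exact le_of_mul_le_mul_left this (by positivity)
  have := le_self_pow₀ hw1 (n := 5) (by norm_num)
  linarith

/-- The von Mangoldt function twisted by a Dirichlet character. -/
noncomputable def twistedMangoldt {r : ℕ} (χ : DirichletCharacter ℂ r) : ℕ → ℂ :=
  (fun n : ℕ => χ (n : ZMod r)) * (fun n : ℕ => (Λ n : ℂ))

lemma LSeries_logMul_iterate {r : ℕ} (χ : DirichletCharacter ℂ r) {s : ℂ} (hs : 1 < s.re)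
    (k : ℕ) : ‖LSeries (LSeries.logMul^[k] (twistedMangoldt χ)) s‖ =
      ‖iteratedDeriv k (LSeries (twistedMangoldt χ)) s‖ := by
  rw [LSeries_iteratedDeriv]
  · simp
  · refine lt_of_le_of_lt (b := ((1 : ℝ) : EReal)) ?_ (by exact_mod_cast hs)
    exact LSeries.abscissaOfAbsConv_le_of_forall_lt_LSeriesSummable fun y hy =>
      DirichletCharacter.LSeriesSummable_twist_vonMangoldt χ (by simpa using hy)

/-- Cauchy's estimate for the derivatives of `L'/L` to the right of `1`. -/
lemma norm_LSeries_logMul_iterate_le {r : ℕ} [NeZero r] {χ : DirichletCharacter ℂ r} (hχ : χ ≠ 1)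
    {ρ M σ : ℝ} (hρ : 0 < ρ) (hσ : 1 < σ) (hσ2 : σ ≤ 1 + ρ)
    (h : ∀ s : ℂ, ‖s - 1‖ ≤ 2 * ρ → χ.LFunction s ≠ 0 ∧
      ‖deriv χ.LFunction s / χ.LFunction s‖ ≤ M) (k : ℕ) :
    ‖LSeries (LSeries.logMul^[k] (twistedMangoldt χ)) σ‖ ≤
      k.factorial * M / ρ ^ k := by
  have hre : 1 < (σ : ℂ).re := by simpa
  rw [LSeries_logMul_iterate χ hre]
  have hd := DirichletCharacter.differentiable_LFunction hχ
  have hball : ∀ z ∈ Metric.closedBall (σ : ℂ) ρ, ‖z - 1‖ ≤ 2 * ρ := by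
    intro z hz
    rw [mem_closedBall_iff_norm] at hz
    have hσ1 : ‖(σ : ℂ) - 1‖ ≤ ρ := by
      rw [← Complex.ofReal_one, ← Complex.ofReal_sub, Complex.norm_real,
        norm_of_nonneg (by linarith)]
      linarith
    calc ‖z - 1‖ = ‖(z - σ) + (σ - 1)‖ := by ring_nf
      _ ≤ ‖z - σ‖ + ‖(σ : ℂ) - 1‖ := norm_add_le _ _
      _ ≤ _ := by linarith
  have heq : LSeries (twistedMangoldt χ) =ᶠ[nhds (σ : ℂ)]
      fun s => -(deriv χ.LFunction s / χ.LFunction s) := by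
    have : {s : ℂ | 1 < s.re} ∈ nhds (σ : ℂ) :=
      (isOpen_lt continuous_const Complex.continuous_re).mem_nhds hre
    filter_upwards [this] with s (hs : 1 < s.re)
    rw [DirichletCharacter.LFunction_eq_LSeries χ hs,
      DirichletCharacter.deriv_LFunction_eq_deriv_LSeries χ hs,
      twistedMangoldt,
      DirichletCharacter.LSeries_twist_vonMangoldt_eq χ hs, neg_div]
  rw [heq.iteratedDeriv_eq]
  refine Complex.norm_iteratedDeriv_le_of_forall_mem_sphere_norm_le k hρ ?_ fun z hz => ?_
  · refine DifferentiableOn.diffContOnCl_ball (U := Metric.closedBall (σ : ℂ) ρ) ?_ le_rfl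
    intro z hz
    refine DifferentiableAt.differentiableWithinAt ?_
    exact ((hd.contDiff (n := 2)).differentiable_deriv_two z |>.div (hd z)
      (h z (hball z hz)).1).neg
  · rw [norm_neg]
    exact (h z (hball z (Metric.sphere_subset_closedBall hz))).2

lemma logMul_iterate (f : ℕ → ℂ) (k m : ℕ) :
    LSeries.logMul^[k] f m = (log m : ℝ) ^ k * f m := by
  induction k with
  | zero => simp
  | succ k ih =>
    rw [Function.iterate_succ_apply', LSeries.logMul, ih, pow_succ, Complex.ofReal_log (by simp)]
    push_cast
    ring

lemma wt_eq_rpow (ℓ : ℝ) (k : ℕ) {m : ℕ} (hm : m ≠ 0) :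
    wt ℓ k m = (exp 1 / ℓ) ^ k * (log m ^ k * (m : ℝ) ^ (-(1 + k / ℓ))) := by
  have hm0 : (0 : ℝ) < m := by positivity
  rw [wt, mul_pow, ← exp_nat_mul, neg_add, rpow_add hm0, rpow_neg_one, div_pow, div_pow,
    rpow_def_of_pos hm0, ← exp_nat_mul, show (k : ℝ) * (1 - log m / ℓ) =
      k * 1 + log m * -(k / ℓ) by ring, exp_add]
  field_simp

lemma tsum_twistedMangoldt_wt {r : ℕ} (χ : DirichletCharacter ℂ r) (ℓ : ℝ) (k : ℕ) :
    ∑' m, twistedMangoldt χ m * (wt ℓ k m : ℂ) =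
      (exp 1 / ℓ : ℝ) ^ k *
        LSeries (LSeries.logMul^[k] (twistedMangoldt χ)) ((1 + k / ℓ : ℝ) : ℂ) := by
  rw [LSeries, ← tsum_mul_left]
  refine tsum_congr fun m => ?_
  rcases eq_or_ne m 0 with rfl | hm
  · simp [twistedMangoldt]
  · rw [LSeries.term_of_ne_zero hm, logMul_iterate, wt_eq_rpow ℓ k hm, Complex.ofReal_mul,
      Complex.ofReal_mul, Complex.ofReal_cpow (by positivity), Complex.ofReal_neg,
      Complex.cpow_neg]
    push_cast
    ring

/-- Smoothed sums of `Λ χ` are tiny when `L(1, χ)` is not too small. -/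
lemma exists_norm_tsum_twistedMangoldt_wt_le (B : ℕ) : ∃ w₀ : ℝ, 1 ≤ w₀ ∧ ∀ w : ℝ, w₀ ≤ w →
    ∀ (r : ℕ) [NeZero r] (χ : DirichletCharacter ℂ r), χ ≠ 1 → (r : ℝ) ≤ w ^ B →
    1 ≤ w ^ 25 * ‖χ.LFunction 1‖ → ∀ (ℓ : ℝ) (k : ℕ), w ^ 200 / 4 ≤ ℓ → 1 ≤ k → (k : ℝ) ≤ w ^ 25 →
    ‖∑' m, twistedMangoldt χ m * (wt ℓ k m : ℂ)‖ ≤ w ^ 30 * ((w ^ 100)⁻¹) ^ k := by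
  obtain ⟨η, w₀, hη, hw₀, H⟩ := exists_LFunction_bounds B
  refine ⟨max w₀ (max (2 / η) 12), by simp [hw₀], fun w hw r _ χ hχ hr hL ℓ k hℓ hk hkw => ?_⟩
  rw [max_le_iff, max_le_iff] at hw
  obtain ⟨hw0, hwη, hw12⟩ := hw
  have hw1 : 1 ≤ w := by linarith
  have hwpos : 0 < w := by linarith
  have hℓ0 : 0 < ℓ := lt_of_lt_of_le (by positivity) hℓ
  set ρ : ℝ := (w ^ 50)⁻¹ with hρ
  have hρ0 : 0 < ρ := by positivity
  have hwρ : w ^ 50 * ρ = 1 := mul_inv_cancel₀ (by positivity)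
  have hρη : 2 * ρ ≤ η := by
    rw [hρ, ← div_eq_mul_inv, div_le_iff₀ (by positivity)]
    rw [div_le_iff₀ hη] at hwη
    calc 2 ≤ w * η := hwη
      _ ≤ w ^ 50 * η := by
        gcongr
        exact le_self_pow₀ hw1 (by norm_num)
      _ = η * w ^ 50 := mul_comm _ _
  have hk0 : (0 : ℝ) < k := by exact_mod_cast hk
  have hkℓ : exp 1 * k / (ℓ * ρ) ≤ (w ^ 100)⁻¹ := by
    rw [div_le_iff₀ (by positivity), hρ]
    calc exp 1 * k ≤ 3 * w ^ 25 := by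
          gcongr
          exact exp_one_lt_three.le
      _ ≤ (w ^ 100)⁻¹ * (w ^ 200 / 4 * (w ^ 50)⁻¹) := by
          rw [show (w ^ 100)⁻¹ * (w ^ 200 / 4 * (w ^ 50)⁻¹) = w ^ 50 / 4 by field_simp]
          have : w ^ 50 = w ^ 25 * w ^ 25 := by ring
          rw [this, le_div_iff₀ (by norm_num)]
          have h1 : 12 ≤ w ^ 25 := hw12.trans (le_self_pow₀ hw1 (by norm_num))
          nlinarith
      _ ≤ _ := by gcongr
  have hlow : ∀ s : ℂ, ‖s - 1‖ ≤ 2 * ρ → 1 ≤ 2 * w ^ 25 * ‖χ.LFunction s‖ := by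
    intro s hs
    have hd := norm_LFunction_sub_le hχ (fun s hs => (H w hw0 r χ hχ hr s hs).2) (hs.trans hρη)
    have htri : ‖χ.LFunction 1‖ ≤ ‖χ.LFunction s‖ + w ^ 4 * (2 * ρ) := by
      have h1 := norm_sub_norm_le (χ.LFunction 1) (χ.LFunction s)
      rw [norm_sub_rev] at h1
      have h2 : w ^ 4 * ‖s - 1‖ ≤ w ^ 4 * (2 * ρ) := by gcongr
      linarith
    have h3 : w ^ 25 * (w ^ 4 * (2 * ρ)) ≤ 1 / 2 := by
      rw [show w ^ 25 * (w ^ 4 * (2 * ρ)) = 2 * (w ^ 29 * ρ) by ring]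
      have : 4 * w ^ 29 ≤ w ^ 50 := by
        calc 4 * w ^ 29 ≤ w * w ^ 29 := by
              gcongr
              linarith
          _ = w ^ 30 := by ring
          _ ≤ w ^ 50 := pow_le_pow_right₀ hw1 (by norm_num)
      nlinarith
    have h4 : w ^ 25 * ‖χ.LFunction 1‖ ≤
        w ^ 25 * (‖χ.LFunction s‖ + w ^ 4 * (2 * ρ)) := by gcongr
    rw [mul_add] at h4
    linarith
  have hquot : ∀ s : ℂ, ‖s - 1‖ ≤ 2 * ρ → χ.LFunction s ≠ 0 ∧
      ‖deriv χ.LFunction s / χ.LFunction s‖ ≤ w ^ 30 := by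
    intro s hs
    have h1 := hlow s hs
    have h2 : χ.LFunction s ≠ 0 := fun h => by
      rw [h] at h1
      norm_num at h1
    refine ⟨h2, ?_⟩
    rw [norm_div, div_le_iff₀ (by positivity)]
    calc _ ≤ w ^ 4 * 1 := by
          rw [mul_one]
          exact (H w hw0 r χ hχ hr s (hs.trans hρη)).2
      _ ≤ w ^ 4 * (2 * w ^ 25 * ‖χ.LFunction s‖) := by gcongr
      _ ≤ w ^ 4 * (w * w ^ 25 * ‖χ.LFunction s‖) := by
          gcongr
          linarith
      _ = _ := by ring
  have hσ : (1 : ℝ) < 1 + k / ℓ := by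
    have : 0 < k / ℓ := by positivity
    linarith
  have hσ2 : 1 + k / ℓ ≤ 1 + ρ := by
    gcongr
    have h1 : k / ℓ = k / (ℓ * ρ) * ρ := by field_simp
    rw [h1]
    have h2 : k / (ℓ * ρ) ≤ 1 := by
      calc k / (ℓ * ρ) ≤ exp 1 * k / (ℓ * ρ) := by
            gcongr
            have := add_one_le_exp (1 : ℝ)
            nlinarith
        _ ≤ (w ^ 100)⁻¹ := hkℓ
        _ ≤ 1 := inv_le_one_of_one_le₀ (one_le_pow₀ hw1)
    nlinarith
  rw [tsum_twistedMangoldt_wt, norm_mul, norm_pow, Complex.norm_real,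
    norm_of_nonneg (by positivity)]
  calc _ ≤ (exp 1 / ℓ) ^ k * (k.factorial * w ^ 30 / ρ ^ k) := by
        gcongr
        exact norm_LSeries_logMul_iterate_le hχ hρ0 hσ hσ2 hquot k
    _ ≤ (exp 1 / ℓ) ^ k * ((k : ℝ) ^ k * w ^ 30 / ρ ^ k) := by
        gcongr
        exact_mod_cast Nat.factorial_le_pow k
    _ = w ^ 30 * (exp 1 * k / (ℓ * ρ)) ^ k := by
        rw [div_pow, div_pow, mul_pow, mul_pow]
        field_simp
    _ ≤ _ := by gcongr

lemma mul_exp_one_sub_le {t : ℝ} (ht : 0 ≤ t) (h : 1 / 200 ≤ |t - 1|) :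
    t * exp (1 - t) ≤ exp (-1 / 360000) := by
  obtain ⟨u, hu, rfl⟩ : ∃ u : ℝ, 0 ≤ u ∧ u ^ 2 = t := ⟨√t, sqrt_nonneg t, sq_sqrt ht⟩
  have h1 : u ≤ exp (u - 1) := by linarith [add_one_le_exp (u - 1)]
  have h2 : 1 / 600 ≤ |u - 1| := by
    by_contra! h3
    rw [abs_lt] at h3
    rcases le_abs.1 h with h | h <;> nlinarith
  have h3 : (1 / 600) ^ 2 ≤ (u - 1) ^ 2 := by
    rw [← sq_abs (u - 1)]
    gcongr
  calc u ^ 2 * exp (1 - u ^ 2) ≤ exp (u - 1) ^ 2 * exp (1 - u ^ 2) := by gcongr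
    _ = exp (-(u - 1) ^ 2) := by
      rw [← exp_nat_mul, ← exp_add]
      congr 1
      push_cast
      ring
    _ ≤ _ := by
      gcongr
      linarith

lemma wt_le_of_far {ℓ : ℝ} (hℓ : 0 < ℓ) (k : ℕ) {m : ℕ} (hm : m ≠ 0)
    (h : 1 / 200 ≤ |log m / ℓ - 1|) :
    wt ℓ (k + 2) m ≤ 4 * exp (-1 / 360000) ^ k * (m : ℝ) ^ (-(1 + 1 / ℓ)) := by
  have hm0 : (0 : ℝ) < m := by positivity
  have hlog : 0 ≤ log m := log_natCast_nonneg m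
  set t := log m / ℓ with ht
  have ht0 : 0 ≤ t := by positivity
  have h1 : (t * exp (1 - t)) ^ 2 ≤ 4 * exp (-t) := by
    have h2 : t / 2 * exp (1 - t / 2) ≤ 1 := mul_exp_one_sub_le_one _
    have h3 : (t / 2 * exp (1 - t / 2)) ^ 2 ≤ 1 := pow_le_one₀ (by positivity) h2
    have h4 : (t * exp (1 - t)) ^ 2 = 4 * (t / 2 * exp (1 - t / 2)) ^ 2 * exp (-t) := by
      rw [mul_pow, mul_pow, ← exp_nat_mul, ← exp_nat_mul,
        show ((2 : ℕ) : ℝ) * (1 - t) = (2 : ℕ) * (1 - t / 2) + -t by push_cast; ring, exp_add]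
      ring
    rw [h4]
    nlinarith [exp_pos (-t)]
  have h5 : (m : ℝ) ^ (-(1 + 1 / ℓ)) = exp (-t) / m := by
    rw [neg_add, rpow_add hm0, rpow_neg_one, rpow_def_of_pos hm0, ht]
    rw [show log m * -(1 / ℓ) = -(log m / ℓ) by ring]
    ring
  rw [wt, ← ht, pow_add, h5]
  calc _ ≤ exp (-1 / 360000) ^ k * (4 * exp (-t)) / m := by
        gcongr
        exact mul_exp_one_sub_le ht0 h
    _ = _ := by ring

lemma tsum_one_div_rpow_le {σ : ℝ} (hσ : 1 < σ) : ∑' m : ℕ, (m : ℝ) ^ (-σ) ≤ 1 + 1 / (σ - 1) := by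
  have h := ZetaAsymptotics.zeta_limit_aux1 hσ
  have h2 : 0 ≤ ZetaAsymptotics.termTSum σ :=
    tsum_nonneg fun n => ZetaAsymptotics.term_nonneg _ _
  have hs : Summable fun m : ℕ => (m : ℝ) ^ (-σ) := summable_nat_rpow.2 (by linarith)
  rw [hs.tsum_eq_zero_add]
  have h3 : ∑' m : ℕ, ((m + 1 : ℕ) : ℝ) ^ (-σ) = ∑' n : ℕ, 1 / (n + 1 : ℝ) ^ σ := by
    refine tsum_congr fun m => ?_
    rw [rpow_neg (by positivity)]
    push_cast
    ring
  rw [h3, Nat.cast_zero, zero_rpow (by linarith)]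
  nlinarith

lemma mangoldt_mul_rpow_le {ℓ : ℝ} (hℓ : 0 < ℓ) (m : ℕ) :
    Λ m * (m : ℝ) ^ (-(1 + 1 / ℓ)) ≤ 2 * ℓ * (m : ℝ) ^ (-(1 + 1 / (2 * ℓ))) := by
  rcases eq_or_ne m 0 with rfl | hm
  · simp
    positivity
  have hm0 : (0 : ℝ) < m := by positivity
  have h1 : Λ m ≤ 2 * ℓ * (m : ℝ) ^ (1 / (2 * ℓ)) := by
    have h := add_one_le_exp (log m * (1 / (2 * ℓ)))
    rw [← rpow_def_of_pos hm0] at h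
    calc Λ m ≤ log m := ArithmeticFunction.vonMangoldt_le_log
      _ = 2 * ℓ * (log m * (1 / (2 * ℓ))) := by field_simp
      _ ≤ _ := by
        gcongr
        linarith
  calc _ ≤ 2 * ℓ * (m : ℝ) ^ (1 / (2 * ℓ)) * (m : ℝ) ^ (-(1 + 1 / ℓ)) := by gcongr
    _ = _ := by
      rw [mul_assoc, ← rpow_add hm0]
      congr 2
      field_simp
      ring

lemma summable_mangoldt_rpow {ℓ : ℝ} (hℓ : 0 < ℓ) :
    Summable fun m : ℕ => Λ m * (m : ℝ) ^ (-(1 + 1 / ℓ)) := by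
  have h : 0 < 1 / (2 * ℓ) := by positivity
  refine Summable.of_nonneg_of_le (fun m => ?_) (fun m => mangoldt_mul_rpow_le hℓ m)
    ((summable_nat_rpow.2 (by linarith)).mul_left _)
  have := @ArithmeticFunction.vonMangoldt_nonneg m
  positivity

lemma tsum_mangoldt_rpow_le {ℓ : ℝ} (hℓ : 1 ≤ ℓ) :
    ∑' m : ℕ, Λ m * (m : ℝ) ^ (-(1 + 1 / ℓ)) ≤ 6 * ℓ ^ 2 := by
  have hℓ0 : 0 < ℓ := by linarith
  have h : 0 < 1 / (2 * ℓ) := by positivity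
  calc _ ≤ ∑' m : ℕ, 2 * ℓ * (m : ℝ) ^ (-(1 + 1 / (2 * ℓ))) :=
        (summable_mangoldt_rpow hℓ0).tsum_le_tsum (mangoldt_mul_rpow_le hℓ0)
          ((summable_nat_rpow.2 (by linarith)).mul_left _)
    _ = 2 * ℓ * ∑' m : ℕ, (m : ℝ) ^ (-(1 + 1 / (2 * ℓ))) := tsum_mul_left
    _ ≤ 2 * ℓ * (1 + 1 / (1 + 1 / (2 * ℓ) - 1)) := by
        gcongr
        exact tsum_one_div_rpow_le (by linarith)
    _ = 2 * ℓ * (1 + 2 * ℓ) := by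
        rw [add_sub_cancel_left]
        field_simp
    _ ≤ _ := by nlinarith

lemma far_of_notMem_Ioc {n : ℕ} (hn : 400 ≤ log n) {m : ℕ} (hm : m ≠ 0)
    (h : m ∉ Ioc ⌈(n : ℝ) ^ (49 / 100 : ℝ)⌉₊ (Nat.sqrt (n - 1))) :
    1 / 200 ≤ |log m / (99 / 200 * log n) - 1| := by
  have hT : 0 < log n := by linarith
  have hn1 : 1 ≤ n := by
    by_contra! h0
    rw [Nat.lt_one_iff.1 h0] at hT
    simp at hT
  have hn0 : (0 : ℝ) < n := by exact_mod_cast hn1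
  rw [mem_Ioc, not_and_or] at h
  rcases h with h | h
  · refine le_abs.2 (Or.inr ?_)
    have h1 : (m : ℝ) ≤ 2 * (n : ℝ) ^ (49 / 100 : ℝ) := by
      have h2 : (m : ℝ) ≤ ⌈(n : ℝ) ^ (49 / 100 : ℝ)⌉₊ := by exact_mod_cast not_lt.1 h
      have h3 := Nat.ceil_lt_add_one (rpow_nonneg hn0.le (49 / 100 : ℝ))
      have h4 : (1 : ℝ) ≤ (n : ℝ) ^ (49 / 100 : ℝ) :=
        one_le_rpow (by exact_mod_cast hn1) (by norm_num)
      linarith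
    have h5 := log_le_log (by positivity) h1
    rw [log_mul (by norm_num) (by positivity), log_rpow hn0] at h5
    have h6 : log m / (99 / 200 * log n) ≤ 199 / 200 := by
      rw [div_le_iff₀ (by positivity)]
      linarith [log_two_lt_d9]
    linarith
  · refine le_abs.2 (Or.inl ?_)
    have h1 : n ≤ m * m := by
      have h2 := Nat.lt_succ_sqrt (n - 1)
      have h3 : (n - 1).sqrt.succ ≤ m := not_le.1 h
      have := Nat.mul_le_mul h3 h3
      omega
    have h5 : log n ≤ log m + log m := by
      rw [← log_mul (by positivity) (by positivity)]
      exact log_le_log hn0 (by exact_mod_cast h1)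
    have h6 : 201 / 200 ≤ log m / (99 / 200 * log n) := by
      rw [le_div_iff₀ (by positivity)]
      linarith
    linarith

lemma sum_mangoldt_not_prime_le {n : ℕ} (hn : 1 < n) :
    ∑ m ∈ Ioc 0 (Nat.sqrt (n - 1)) with ¬ m.Prime, Λ m ≤ 2 * (n : ℝ) ^ (1 / 4 : ℝ) * log n := by
  set b := Nat.sqrt (n - 1) with hb
  have hb1 : 1 ≤ b := by
    rw [hb, Nat.one_le_iff_ne_zero, Ne, Nat.sqrt_eq_zero]
    omega
  have hbn : (b : ℝ) ^ 2 ≤ n := by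
    have : b * b ≤ n - 1 := Nat.sqrt_le (n - 1)
    have h2 : b ^ 2 ≤ n := by
      rw [sq]
      omega
    exact_mod_cast h2
  have hb1' : (1 : ℝ) ≤ b := by exact_mod_cast hb1
  have h := Chebyshev.psi_sub_theta_le (x := b) hb1'
  rw [Chebyshev.psi_sub_theta_eq_sum_not_prime, Nat.floor_natCast] at h
  refine h.trans ?_
  have h3 : √(b : ℝ) ≤ (n : ℝ) ^ (1 / 4 : ℝ) := by
    calc √(b : ℝ) = ((b : ℝ) ^ 2) ^ (1 / 4 : ℝ) := by
          rw [sqrt_eq_rpow, ← rpow_natCast, ← rpow_mul (by positivity)]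
          norm_num
      _ ≤ _ := by gcongr
  have h4 : log b ≤ log n := by
    apply log_le_log (by positivity)
    nlinarith
  gcongr

lemma tsum_indicator_eq_charSum {r : ℕ} (χ : DirichletCharacter ℂ r) (n k : ℕ) :
    charSum n k ⟨r, χ⟩ =
      ∑ m ∈ primeRange n, twistedMangoldt χ m * (wt (99 / 200 * log n) k m : ℂ) := by
  rw [charSum]
  refine sum_congr rfl fun q hq => ?_
  have hp : q.Prime := (mem_filter.1 hq).2
  rw [charVal_natCast, W, twistedMangoldt, Pi.mul_apply,
    ArithmeticFunction.vonMangoldt_apply_prime hp]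
  push_cast
  ring

lemma norm_charSum_le {r : ℕ} (χ : DirichletCharacter ℂ r) {n : ℕ} (hn : 400 ≤ log n) (k : ℕ) :
    ‖charSum n (k + 2) ⟨r, χ⟩‖ ≤
      ‖∑' m, twistedMangoldt χ m * (wt (99 / 200 * log n) (k + 2) m : ℂ)‖ +
        24 * log n ^ 2 * exp (-1 / 360000) ^ k + 2 * log n * (n : ℝ) ^ (-(24 / 100) : ℝ) := by
  have hT : 0 < log n := by linarith
  have hn1 : 1 < n := by
    by_contra! h0
    interval_cases n <;> simp at hT
  have hn0 : (0 : ℝ) < n := by positivity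
  set ℓ := 99 / 200 * log n with hℓ
  have hℓ0 : 0 < ℓ := by positivity
  set a := ⌈(n : ℝ) ^ (49 / 100 : ℝ)⌉₊ with ha
  set b := Nat.sqrt (n - 1) with hb
  have haR : (n : ℝ) ^ (49 / 100 : ℝ) ≤ a := Nat.le_ceil _
  set f : ℕ → ℂ := fun m => twistedMangoldt χ m * (wt ℓ (k + 2) m : ℂ) with hf
  set P : Finset ℕ := (Ioc a b).filter (fun m => ¬ m.Prime) with hP
  set θ := exp (-1 / 360000) with hθ
  set g : ℕ → ℝ := fun m => 4 * θ ^ k * (Λ m * (m : ℝ) ^ (-(1 + 1 / ℓ))) +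
    (P : Set ℕ).indicator (fun m => Λ m * (n : ℝ) ^ (-(49 / 100) : ℝ)) m with hg
  have hg1 := (summable_mangoldt_rpow hℓ0).hasSum.mul_left (4 * θ ^ k)
  have hg2 : HasSum ((P : Set ℕ).indicator fun m => Λ m * (n : ℝ) ^ (-(49 / 100) : ℝ))
      (∑ m ∈ P, Λ m * (n : ℝ) ^ (-(49 / 100) : ℝ)) :=
    hasSum_subtype_iff_indicator.1 (P.hasSum _)
  have hΛ : ∀ m, 0 ≤ Λ m := fun m => ArithmeticFunction.vonMangoldt_nonneg
  have hfn : ∀ m, ‖f m‖ ≤ Λ m * wt ℓ (k + 2) m := by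
    intro m
    rw [hf]
    simp only [twistedMangoldt, Pi.mul_apply, norm_mul, Complex.norm_real]
    rw [norm_of_nonneg (hΛ m), norm_of_nonneg (wt_nonneg hℓ0.le _ _)]
    have := χ.norm_le_one (m : ZMod r)
    have h2 := mul_nonneg (hΛ m) (wt_nonneg hℓ0.le (k + 2) m)
    rw [mul_assoc]
    nlinarith
  have hbound : ∀ m, ‖f m - (primeRange n : Set ℕ).indicator f m‖ ≤ g m := by
    intro m
    have hg0 : 0 ≤ 4 * θ ^ k * (Λ m * (m : ℝ) ^ (-(1 + 1 / ℓ))) := by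
      have := hΛ m
      positivity
    have hi0 : 0 ≤ (P : Set ℕ).indicator (fun m => Λ m * (n : ℝ) ^ (-(49 / 100) : ℝ)) m :=
      Set.indicator_nonneg (fun m _ => by have := hΛ m; positivity) m
    by_cases h1 : m ∈ primeRange n
    · rw [Set.indicator_of_mem (by simpa using h1), sub_self, norm_zero]
      exact add_nonneg hg0 hi0
    rw [Set.indicator_of_notMem (by simpa using h1), sub_zero]
    refine (hfn m).trans ?_
    rcases eq_or_ne m 0 with rfl | hm
    · simp only [ArithmeticFunction.map_zero, zero_mul]
      exact add_nonneg hg0 hi0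
    by_cases h2 : m ∈ Ioc a b
    · have h3 : ¬ m.Prime := fun h => h1 (mem_filter.2 ⟨h2, h⟩)
      have h4 : m ∈ P := mem_filter.2 ⟨h2, h3⟩
      rw [hg]
      simp only
      rw [Set.indicator_of_mem (by simpa using h4)]
      refine le_add_of_nonneg_of_le hg0 (mul_le_mul_of_nonneg_left ?_ (hΛ m))
      refine (wt_le hℓ0.le _ _).trans ?_
      rw [rpow_neg hn0.le, ← one_div]
      have : (a : ℝ) ≤ m := by exact_mod_cast (mem_Ioc.1 h2).1.le
      gcongr
      linarith
    · have h3 := wt_le_of_far hℓ0 k hm (far_of_notMem_Ioc hn hm h2)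
      refine le_add_of_le_of_nonneg ?_ hi0
      calc _ ≤ Λ m * (4 * θ ^ k * (m : ℝ) ^ (-(1 + 1 / ℓ))) := by
            gcongr
        _ = _ := by ring
  have htot := tsum_of_norm_bounded (hg1.add hg2) hbound
  have hs1 : HasSum ((primeRange n : Set ℕ).indicator f) (∑ m ∈ primeRange n, f m) :=
    hasSum_subtype_iff_indicator.1 ((primeRange n).hasSum f)
  have hs2 : Summable fun m => f m - (primeRange n : Set ℕ).indicator f m :=
    Summable.of_norm_bounded (hg1.add hg2).summable hbound
  have hs3 : Summable f := by
    simpa using hs2.add hs1.summable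
  rw [hs3.tsum_sub hs1.summable, hs1.tsum_eq, ← tsum_indicator_eq_charSum] at htot
  have hA : 4 * θ ^ k * ∑' m : ℕ, Λ m * (m : ℝ) ^ (-(1 + 1 / ℓ)) ≤ 24 * log n ^ 2 * θ ^ k := by
    have := tsum_mangoldt_rpow_le (ℓ := ℓ) (by linarith)
    calc _ ≤ 4 * θ ^ k * (6 * ℓ ^ 2) := by gcongr
      _ ≤ 4 * θ ^ k * (6 * log n ^ 2) := by
        gcongr
        linarith
      _ = _ := by ring
  have hB : ∑ m ∈ P, Λ m * (n : ℝ) ^ (-(49 / 100) : ℝ) ≤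
      2 * log n * (n : ℝ) ^ (-(24 / 100) : ℝ) := by
    rw [← sum_mul]
    calc _ ≤ (2 * (n : ℝ) ^ (1 / 4 : ℝ) * log n) * (n : ℝ) ^ (-(49 / 100) : ℝ) := by
          gcongr
          refine le_trans (sum_le_sum_of_subset_of_nonneg ?_ fun m _ _ => hΛ m)
            (sum_mangoldt_not_prime_le hn1)
          exact filter_subset_filter _ (Ioc_subset_Ioc_left (Nat.zero_le _))
      _ = 2 * log n * ((n : ℝ) ^ (1 / 4 : ℝ) * (n : ℝ) ^ (-(49 / 100) : ℝ)) := by ring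
      _ = _ := by
          rw [← rpow_add hn0]
          norm_num
  have htri := norm_sub_norm_le (charSum n (k + 2) ⟨r, χ⟩) (∑' m, f m)
  rw [norm_sub_rev] at htri
  linarith

end

open Filter

theorem norm_LFunction_inv_one {r : ℕ} [NeZero r] {χ : DirichletCharacter ℂ r} (hχ : χ ≠ 1) :
    ‖(χ⁻¹).LFunction 1‖ = ‖χ.LFunction 1‖ := by
  have hχ' : χ⁻¹ ≠ 1 := by simpa using hχ
  rw [LFunction_eq_mul_mellin hχ (s := 1) (by simp), LFunction_eq_mul_mellin hχ' (s := 1) (by simp),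
    mellin_sum_char, mellin_sum_char, one_mul, one_mul, ← RCLike.norm_conj, ← integral_conj]
  congr 1
  refine MeasureTheory.setIntegral_congr_fun measurableSet_Ioi fun t ht => ?_
  have ht0 : (0 : ℝ) ≤ t := zero_le_one.trans (le_of_lt ht)
  simp only [map_mul, map_sum]
  congr 1
  · refine sum_congr rfl fun i _ => ?_
    rw [← MulChar.star_apply', starRingEnd_apply, star_star]
  · have : (-(1 + 1) : ℂ) = ((-(1 + 1) : ℝ) : ℂ) := by push_cast; rfl
    rw [this, ← Complex.ofReal_cpow ht0, Complex.conj_ofReal]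

theorem exists_exceptional (B : ℕ) : ∃ w₀ : ℝ, 1 ≤ w₀ ∧ ∀ w, w₀ ≤ w →
    ∃ x₁ : Σ r, DirichletCharacter ℂ r, (1 ≤ x₁.1 ∧ x₁.2.IsPrimitive ∧ x₁.1 ≠ 5 ∧
      (x₁.1 : ℝ) ≤ w ^ B ∧ ∀ m, star (charVal x₁ m) = charVal x₁ m) ∧
      ∀ (r : ℕ) [NeZero r] (χ : DirichletCharacter ℂ r), χ.IsPrimitive → 1 < r →
        (r : ℝ) ≤ w ^ B → (⟨r, χ⟩ : Σ r, DirichletCharacter ℂ r) ≠ x₁ →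
        1 ≤ w ^ 25 * ‖χ.LFunction 1‖ := by
  obtain ⟨w₀, hw₀, H⟩ := exists_exceptional_unique B
  obtain ⟨w₁, hw₁⟩ : ∃ w₁ : ℝ, ∀ w, w₁ ≤ w → ∀ χ : DirichletCharacter ℂ 5, χ ≠ 1 →
      1 ≤ w ^ 25 * ‖χ.LFunction 1‖ := by
    have : ∀ᶠ w : ℝ in atTop, ∀ χ : DirichletCharacter ℂ 5, χ ≠ 1 →
        1 ≤ w ^ 25 * ‖χ.LFunction 1‖ := by
      rw [eventually_all]
      intro χ
      by_cases h : χ = 1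
      · simp [h]
      have h1 : 0 < ‖χ.LFunction 1‖ :=
        norm_pos_iff.2 (DirichletCharacter.LFunction_apply_one_ne_zero h)
      filter_upwards [((tendsto_pow_atTop (by norm_num : 25 ≠ 0)).atTop_mul_const h1).eventually_ge_atTop
        1] with w hw _ using hw
    exact eventually_atTop.1 this
  refine ⟨max w₀ w₁, hw₀.trans (le_max_left _ _), fun w hw => ?_⟩
  by_cases hex : ∃ (r : ℕ) (_ : NeZero r) (χ : DirichletCharacter ℂ r), χ.IsPrimitive ∧ 1 < r ∧
        (r : ℝ) ≤ w ^ B ∧ w ^ 25 * ‖χ.LFunction 1‖ < 1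
  · obtain ⟨r, _, χ, hp, hr, hB, hL⟩ := hex
    have hw0 := (le_max_left _ _).trans hw
    have h1 := primitive_ne_one hr hp
    refine ⟨⟨r, χ⟩, ⟨hr.le, hp, ?_, hB, ?_⟩, ?_⟩
    · rintro h5
      simp only at h5
      subst h5
      exact absurd (hw₁ w ((le_max_right _ _).trans hw) χ h1) (not_le.2 hL)
    · have hinv : (χ⁻¹).IsPrimitive := by
        rw [DirichletCharacter.isPrimitive_def, DirichletCharacter.conductor_inv]
        exact hp
      have := H w hw0 r r χ⁻¹ χ hinv hp hr hr hB hB (by rwa [norm_LFunction_inv_one h1]) hL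
      have h2 : χ⁻¹ = χ := by simpa using this
      intro m
      simp only [charVal]
      rw [MulChar.star_apply', h2]
    · intro s _ ψ hψ hs hsB hne
      by_contra! hlt
      exact hne (H w hw0 s r ψ χ hψ hp hs hr hsB hB hlt hL)
  · refine ⟨⟨1, 1⟩, ⟨le_rfl, DirichletCharacter.isPrimitive_one_level_one, by norm_num, ?_, ?_⟩, ?_⟩
    · simpa using one_le_pow₀ (hw₀.trans ((le_max_left _ _).trans hw))
    · intro m
      simp only [charVal]
      rw [MulChar.star_apply', inv_one]
    · intro r _ χ hp hr hB _
      by_contra! hlt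
      exact hex ⟨r, inferInstance, χ, hp, hr, hB, hlt⟩

theorem exists_small_conductor (A B : ℕ) : ∀ᶠ n : ℕ in atTop, ∃ k : ℕ,
    (k : ℝ) ≤ 49 / 100 * log n ∧ ∃ x₁ : Σ r, DirichletCharacter ℂ r,
      (1 ≤ x₁.1 ∧ x₁.2.IsPrimitive ∧ x₁.1 ≠ 5 ∧
      (x₁.1 : ℝ) ≤ log n ^ B ∧ ∀ m, star (charVal x₁ m) = charVal x₁ m) ∧
      ∀ x : Σ r, DirichletCharacter ℂ r, x.2.IsPrimitive → 1 < x.1 → (x.1 : ℝ) ≤ log n ^ B →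
        x ≠ x₁ → ‖charSum n k x‖ ≤ (log n ^ A)⁻¹ := by
  obtain ⟨w₀, -, hexc⟩ := exists_exceptional (200 * B)
  obtain ⟨w₁, -, hzero⟩ := exists_norm_tsum_twistedMangoldt_wt_le (200 * B)
  have hlog : Tendsto (fun n : ℕ => log n) atTop atTop :=
    tendsto_log_atTop.comp tendsto_natCast_atTop_atTop
  have hw : Tendsto (fun n : ℕ => log n ^ (1 / 200 : ℝ)) atTop atTop :=
    (tendsto_rpow_atTop (by norm_num)).comp hlog
  set E : ℝ := 360000 * (A + 4) with hE
  have hE0 : 0 < E := by positivity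
  have hll : ∀ᶠ n : ℕ in atTop, E * log (log n) + 3 ≤ log n ^ (1 / 8 : ℝ) := by
    have h1 := (isLittleO_log_rpow_atTop (by norm_num : (0 : ℝ) < 1 / 8)).bound
      (c := 1 / (2 * E)) (by positivity)
    have h2 := (tendsto_rpow_atTop (by norm_num : (0 : ℝ) < 1 / 8)).eventually_ge_atTop 6
    filter_upwards [hlog.eventually h1, hlog.eventually h2, hlog.eventually_ge_atTop 1]
      with n h1 h2 h3
    rw [norm_of_nonneg (log_nonneg h3), norm_of_nonneg (by positivity)] at h1
    have : E * log (log n) ≤ 1 / 2 * log n ^ (1 / 8 : ℝ) := by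
      calc _ ≤ E * (1 / (2 * E) * log n ^ (1 / 8 : ℝ)) := by gcongr
        _ = _ := by field_simp
    linarith
  have hexp : ∀ᶠ n : ℕ in atTop, 6 * log n ^ (A + 1) ≤ exp (24 / 100 * log n) := by
    have h1 := (isLittleO_pow_exp_pos_mul_atTop (k := A + 1) (by norm_num : (0 : ℝ) < 24 / 100)).bound
      (c := 1 / 6) (by positivity)
    filter_upwards [hlog.eventually h1, hlog.eventually_ge_atTop 1] with n h1 h3
    rw [norm_of_nonneg (by positivity), norm_of_nonneg (by positivity)] at h1
    linarith
  have hllA : ∀ᶠ n : ℕ in atTop, (2 * A : ℝ) ≤ E * log (log n) :=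
    ((tendsto_log_atTop.comp hlog).const_mul_atTop hE0).eventually_ge_atTop _
  filter_upwards [hw.eventually_ge_atTop w₀, hw.eventually_ge_atTop w₁, hw.eventually_ge_atTop 3,
    hlog.eventually_ge_atTop 400, hll, hexp, hllA] with n h0 h1 h3 h400 hll hexp hllA
  set w := log n ^ (1 / 200 : ℝ) with hwd
  have hL0 : 0 < log n := by linarith
  have hn0 : (0 : ℝ) < n := by
    by_contra! h
    have : (n : ℝ) = 0 := le_antisymm h (Nat.cast_nonneg n)
    rw [this] at hL0
    simp at hL0
  have hpow : ∀ j : ℕ, w ^ (200 * j) = log n ^ j := by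
    intro j
    rw [pow_mul, hwd, ← rpow_natCast (log n ^ (1 / 200 : ℝ)) 200, ← rpow_mul hL0.le]
    norm_num
  have h25 : w ^ 25 = log n ^ (1 / 8 : ℝ) := by
    rw [hwd, ← rpow_natCast (log n ^ (1 / 200 : ℝ)) 25, ← rpow_mul hL0.le]
    norm_num
  obtain ⟨x₁, hx₁, hexc⟩ := hexc w h0
  rw [hpow] at hx₁ hexc
  have hll0 : 0 ≤ log (log n) := log_nonneg (by linarith)
  set k' := ⌈E * log (log n)⌉₊ with hk'
  have hk1 : E * log (log n) ≤ k' := Nat.le_ceil _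
  have hk2 : (k' : ℝ) < E * log (log n) + 1 := Nat.ceil_lt_add_one (by positivity)
  have hkw : ((k' + 2 : ℕ) : ℝ) ≤ w ^ 25 := by
    push_cast
    rw [h25]
    linarith
  have hL200 : log n = w ^ 200 := by simpa using (hpow 1).symm
  refine ⟨k' + 2, ?_, x₁, hx₁, fun x hxp hx1 hxB hxne => ?_⟩
  · refine hkw.trans ?_
    rw [hL200]
    calc w ^ 25 ≤ 49 / 100 * (3 ^ 175 * w ^ 25) := by
          have : 0 ≤ w ^ 25 := by positivity
          norm_num
          linarith
      _ ≤ 49 / 100 * (w ^ 175 * w ^ 25) := by gcongr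
      _ = _ := by ring
  · obtain ⟨r, χ⟩ := x
    simp only at hxp hx1 hxB
    have : NeZero r := ⟨by lia⟩
    have hχ1 := primitive_ne_one hx1 hxp
    have hA1 := hzero w h1 r χ hχ1 (by rwa [hpow]) (hexc r χ hxp hx1 hxB hxne)
      (99 / 200 * log n) (k' + 2) (by rw [← hL200]; linarith) (by lia) hkw
    have hA2 := norm_charSum_le χ h400 k'
    have hB1 : w ^ 30 * ((w ^ 100)⁻¹) ^ (k' + 2) ≤ 1 / 3 * (log n ^ A)⁻¹ := by
      have hkA : 2 * A ≤ k' := by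
        have : ((2 * A : ℕ) : ℝ) ≤ k' := by push_cast; linarith
        exact_mod_cast this
      have h4 : (((w ^ 100)⁻¹) ^ (k' + 2) : ℝ) ≤ ((w ^ 100)⁻¹) ^ (2 * A + 2) :=
        pow_le_pow_of_le_one (by positivity)
          (inv_le_one_of_one_le₀ (one_le_pow₀ (by linarith))) (by lia)
      calc _ ≤ w ^ 30 * ((w ^ 100)⁻¹) ^ (2 * A + 2) := by gcongr
        _ = (w ^ 170)⁻¹ * (log n ^ A)⁻¹ := by
          rw [← hpow, inv_pow, ← pow_mul]
          field_simp
          ring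
        _ ≤ _ := by
          gcongr
          rw [one_div]
          gcongr
          exact h3.trans (le_self_pow₀ (by linarith) (by norm_num))
    have hB2 : 24 * log n ^ 2 * exp (-1 / 360000) ^ k' ≤ 1 / 3 * (log n ^ A)⁻¹ := by
      have h4 : exp (-1 / 360000) ^ k' ≤ (log n ^ (A + 4))⁻¹ := by
        rw [← exp_nat_mul]
        calc _ ≤ exp (-((A + 4 : ℕ) * log (log n))) := by
              gcongr
              push_cast
              rw [hE] at hk1
              linarith
          _ = _ := by rw [exp_neg, exp_nat_mul, exp_log hL0]
      calc _ ≤ 24 * log n ^ 2 * (log n ^ (A + 4))⁻¹ := by gcongr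
        _ = 24 * (log n ^ 2)⁻¹ * (log n ^ A)⁻¹ := by
          field_simp
          ring
        _ ≤ _ := by
          gcongr
          rw [← div_eq_mul_inv, div_le_iff₀ (by positivity)]
          nlinarith
    have hB3 : 2 * log n * (n : ℝ) ^ (-(24 / 100) : ℝ) ≤ 1 / 3 * (log n ^ A)⁻¹ := by
      rw [rpow_neg hn0.le, rpow_def_of_pos hn0, mul_comm (log n) (24 / 100)]
      rw [← div_eq_mul_inv, div_le_iff₀ (by positivity)]
      rw [mul_assoc, inv_mul_eq_div, mul_div_assoc', le_div_iff₀ (by positivity)]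
      rw [pow_succ] at hexp
      linarith
    linarith

theorem eventually_le_sum_log_prime : ∀ᶠ a : ℕ in atTop,
    (a : ℝ) ≤ ∑ q ∈ Ioc a (4 * a) with q.Prime, log q := by
  have h1 : ∀ᶠ x : ℝ in atTop, log (4 * x + 1) + 2 * √(4 * x) * log (4 * x) ≤ x / 3 := by
    have hlo := (isLittleO_log_rpow_atTop (by norm_num : (0 : ℝ) < 1 / 4)).bound
      (c := 1) (by positivity)
    have ht : Tendsto (fun x : ℝ => 4 * x + 1) atTop atTop :=
      tendsto_atTop_add_const_right _ _ (tendsto_id.const_mul_atTop (by norm_num))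
    filter_upwards [ht.eventually hlo, eventually_ge_atTop (10 ^ 10)] with x hx hx1
    have hx0 : 0 < x := by linarith
    rw [norm_of_nonneg (log_nonneg (by linarith)), norm_of_nonneg (by positivity), one_mul] at hx
    have h2 : log (4 * x) ≤ log (4 * x + 1) := log_le_log (by linarith) (by linarith)
    set y := (5 * x) ^ (1 / 4 : ℝ) with hy
    have hy4 : y ^ 4 = 5 * x := by
      rw [hy, ← rpow_natCast, ← rpow_mul (by positivity)]
      norm_num
    have hy0 : 0 ≤ y := by positivity
    have h3 : log (4 * x + 1) ≤ y := by
      exact hx.trans (rpow_le_rpow (by positivity) (by linarith) (by norm_num))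
    have h4 : √(4 * x) ≤ y ^ 2 := by
      rw [sqrt_le_left (by positivity)]
      nlinarith
    have h5 : 100 ≤ y := by
      by_contra! h
      have : y ^ 4 ≤ 100 ^ 4 := by gcongr
      linarith
    have h6 : 0 ≤ log (4 * x) := log_nonneg (by linarith)
    calc _ ≤ y + 2 * y ^ 2 * y := by
          gcongr
          linarith
      _ ≤ y ^ 4 / 15 := by nlinarith [pow_le_pow_left₀ (by norm_num) h5 2, pow_nonneg hy0 3]
      _ = _ := by rw [hy4]; ring
  filter_upwards [tendsto_natCast_atTop_atTop.eventually h1] with a ha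
  have h2 := Chebyshev.theta_ge (4 * a)
  have h3 := Chebyshev.theta_le_log4_mul_x (x := (a : ℝ)) (by positivity)
  have h4 : Chebyshev.theta ((4 * a : ℕ) : ℝ) =
      Chebyshev.theta a + ∑ q ∈ Ioc a (4 * a) with q.Prime, log q := by
    rw [Chebyshev.theta, Chebyshev.theta, Nat.floor_natCast, Nat.floor_natCast,
      ← Ioc_union_Ioc_eq_Ioc (Nat.zero_le a) (by lia : a ≤ 4 * a), filter_union, sum_union]
    refine disjoint_filter_filter (Ioc_disjoint_Ioc_of_le le_rfl)
  have h5 : log 4 = 2 * log 2 := by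
    rw [show (4 : ℝ) = 2 ^ 2 by norm_num, log_pow]
    norm_num
  rw [h5] at h3
  push_cast at h2 h4
  rw [h4] at h2
  nlinarith [log_two_gt_d9, (Nat.cast_nonneg a : (0 : ℝ) ≤ a)]

theorem eventually_le_sum_W : ∀ᶠ n : ℕ in atTop, ∀ k : ℕ, (k : ℝ) ≤ 49 / 100 * log n →
    1 / 8 ≤ ∑ q ∈ primeRange n, W n k q := by
  have hlog : Tendsto (fun n : ℕ => log n) atTop atTop :=
    tendsto_log_atTop.comp tendsto_natCast_atTop_atTop
  have hx : Tendsto (fun n : ℕ => ⌈(n : ℝ) ^ (99 / 200 : ℝ)⌉₊) atTop atTop :=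
    tendsto_nat_ceil_atTop.comp ((tendsto_rpow_atTop (by norm_num)).comp
      tendsto_natCast_atTop_atTop)
  have hn : ∀ᶠ n : ℕ in atTop, (100 : ℝ) ≤ (n : ℝ) ^ (1 / 200 : ℝ) :=
    ((tendsto_rpow_atTop (by norm_num)).comp tendsto_natCast_atTop_atTop).eventually_ge_atTop _
  filter_upwards [hx.eventually eventually_le_sum_log_prime, hn, hlog.eventually_ge_atTop 100]
    with n ha hn hL k hk
  have hn1 : (1 : ℝ) < n := by
    by_contra! h
    have := log_nonpos (Nat.cast_nonneg n) h
    linarith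
  have hn0 : (0 : ℝ) < n := by linarith
  set x := (n : ℝ) ^ (99 / 200 : ℝ) with hxd
  set v := (n : ℝ) ^ (1 / 200 : ℝ) with hvd
  have hxv : x = v ^ 99 := by
    rw [hxd, hvd, ← rpow_natCast, ← rpow_mul hn0.le]; norm_num
  have hyv : (n : ℝ) ^ (49 / 100 : ℝ) = v ^ 98 := by
    rw [hvd, ← rpow_natCast, ← rpow_mul hn0.le]; norm_num
  have hnv : (n : ℝ) = v ^ 200 := by
    rw [hvd, ← rpow_natCast, ← rpow_mul hn0.le]; norm_num
  have hx1 : 1 ≤ x := by rw [hxv]; exact one_le_pow₀ (by linarith)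
  have hx0 : 0 < x := by linarith
  set a := ⌈x⌉₊ with had
  have hax : x ≤ a := Nat.le_ceil _
  have hax2 : (a : ℝ) ≤ 2 * x := by
    have := Nat.ceil_lt_add_one hx0.le
    linarith
  have hlx : log x = 99 / 200 * log n := log_rpow hn0 _
  set ℓ := 99 / 200 * log n with hℓ
  have hℓ0 : 0 < ℓ := by positivity
  have hsub : (Ioc a (4 * a)).filter Nat.Prime ⊆ primeRange n := by
    refine filter_subset_filter _ (Ioc_subset_Ioc ?_ ?_)
    · refine Nat.ceil_mono ?_
      exact rpow_le_rpow_of_exponent_le hn1.le (by norm_num)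
    · rw [Nat.le_sqrt']
      have h1 : (((4 * a) ^ 2 + 1 : ℕ) : ℝ) ≤ n := by
        push_cast
        calc (4 * (a : ℝ)) ^ 2 + 1 ≤ (4 * (2 * x)) ^ 2 + x ^ 2 := by
              gcongr
              exact one_le_pow₀ hx1
          _ = 65 * v ^ 198 := by rw [hxv]; ring
          _ ≤ v * v ^ 198 := by gcongr; linarith
          _ ≤ v ^ 2 * v ^ 198 := by
              gcongr
              exact le_self_pow₀ (by linarith) (by norm_num)
          _ = n := by rw [hnv]; ring
      have : (4 * a) ^ 2 + 1 ≤ n := by exact_mod_cast h1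
      lia
  have hW : ∀ q ∈ (Ioc a (4 * a)).filter Nat.Prime, 1 / (8 * a) * log q ≤ W n k q := by
    intro q hq
    obtain ⟨hq, hqp⟩ := mem_filter.1 hq
    obtain ⟨hq1, hq2⟩ := mem_Ioc.1 hq
    have hq0 : (0 : ℝ) < q := by exact_mod_cast hqp.pos
    have hxq : x ≤ q := hax.trans (by exact_mod_cast hq1.le)
    have hq8 : (q : ℝ) ≤ 4 * a := by exact_mod_cast hq2
    set t := log q / ℓ with ht
    have ht1 : 1 ≤ t := by
      rw [ht, one_le_div hℓ0, ← hlx]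
      exact log_le_log hx0 hxq
    have ht2 : t - 1 ≤ 3 / ℓ := by
      have h2 : log q ≤ log 8 + log x := by
        rw [← log_mul (by norm_num) hx0.ne']
        exact log_le_log hq0 (by linarith)
      have h3 : log 8 ≤ 3 := by
        rw [show (8 : ℝ) = 2 ^ 3 by norm_num, log_pow]
        have := log_two_lt_d9
        push_cast
        linarith
      rw [ht, sub_le_iff_le_add, div_add_one hℓ0.ne']
      gcongr
      linarith
    have hφ : 1 - (t - 1) ^ 2 ≤ t * exp (1 - t) := by
      have := add_one_le_exp (1 - t)
      nlinarith
    have hsmall : (t - 1) ^ 2 ≤ (3 / ℓ) ^ 2 := by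
      have : 0 ≤ t - 1 := by linarith
      gcongr
    have hℓ40 : 40 ≤ ℓ := by linarith
    have h10 : (3 / ℓ) ^ 2 ≤ 1 := by
      rw [sq_le_one_iff₀ (by positivity), div_le_one hℓ0]
      linarith
    have hkl : (k : ℝ) * (3 / ℓ) ^ 2 ≤ 1 / 2 := by
      rw [div_pow, mul_div_assoc', div_le_iff₀ (by positivity)]
      nlinarith
    have hpow : 1 / 2 ≤ (t * exp (1 - t)) ^ k := by
      have hb := one_add_mul_le_pow (a := -(3 / ℓ) ^ 2) (by linarith) k
      calc (1 / 2 : ℝ) ≤ 1 + k * (-(3 / ℓ) ^ 2) := by linarith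
        _ ≤ _ := hb
        _ ≤ _ := by
          gcongr
          · linarith
          · linarith
    rw [W, wt]
    have hlq : 0 ≤ log q := log_natCast_nonneg q
    refine mul_le_mul_of_nonneg_right ?_ hlq
    calc 1 / (8 * (a : ℝ)) = 1 / 2 / (4 * a) := by field_simp; norm_num
      _ ≤ _ := by gcongr
  have ha0 : (0 : ℝ) < a := by linarith
  calc (1 / 8 : ℝ) = 1 / (8 * a) * a := by field_simp
    _ ≤ 1 / (8 * a) * ∑ q ∈ Ioc a (4 * a) with q.Prime, log q := by gcongr
    _ = ∑ q ∈ Ioc a (4 * a) with q.Prime, 1 / (8 * a) * log q := by rw [mul_sum]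
    _ ≤ ∑ q ∈ Ioc a (4 * a) with q.Prime, W n k q := sum_le_sum hW
    _ ≤ _ := sum_le_sum_of_subset_of_nonneg hsub fun q _ _ => W_nonneg n k q

lemma exists_primitive_mul {M d : ℕ} [NeZero M] [NeZero d] (χ : DirichletCharacter ℂ M)
    (ψ : DirichletCharacter ℂ d) : ∃ x : Σ r, DirichletCharacter ℂ r, 1 ≤ x.1 ∧ x.2.IsPrimitive ∧
      x.1 ∣ M * d ∧ ∀ m : ℕ, m.Coprime (M * d) → charVal x m = χ m * ψ m := by
  set θ := DirichletCharacter.changeLevel (Nat.dvd_mul_right M d) χ *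
    DirichletCharacter.changeLevel (Nat.dvd_mul_left d M) ψ with hθ
  have : NeZero (M * d) := ⟨mul_ne_zero (NeZero.ne M) (NeZero.ne d)⟩
  refine ⟨⟨θ.conductor, θ.primitiveCharacter⟩, ?_, θ.primitiveCharacter_isPrimitive,
    θ.conductor_dvd_level, fun m hm => ?_⟩
  · exact Nat.one_le_iff_ne_zero.2 fun h =>
      NeZero.ne (M * d) (Nat.eq_zero_of_zero_dvd (h ▸ θ.conductor_dvd_level))
  · rw [charVal_natCast, ← changeLevel_natCast _ θ.conductor_dvd_level hm,
      DirichletCharacter.changeLevel_primitiveCharacter, hθ, MulChar.mul_apply,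
      changeLevel_natCast _ _ hm, changeLevel_natCast _ _ hm]

lemma exists_natCast_eq_one {M d : ℕ} [NeZero M] (hMd : M.Coprime d) [NeZero d] (u : (ZMod d)ˣ) :
    ∃ m : ℕ, m.Coprime (M * d) ∧ (m : ZMod M) = 1 ∧ (m : ZMod d) = u := by
  obtain ⟨m, h1, h2⟩ := Nat.chineseRemainder hMd 1 (u : ZMod d).val
  have h1' : (m : ZMod M) = 1 := by simpa using (ZMod.natCast_eq_natCast_iff _ _ _).2 h1
  have h2' : (m : ZMod d) = u := by simpa using (ZMod.natCast_eq_natCast_iff _ _ _).2 h2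
  refine ⟨m, Nat.Coprime.mul_right ?_ ?_, h1', h2'⟩
  · rw [← ZMod.isUnit_iff_coprime, h1']
    exact isUnit_one
  · rw [← ZMod.isUnit_iff_coprime, h2']
    exact u.isUnit

lemma coprime_of_mem_primeRange {n q N : ℕ} (hq : q ∈ primeRange n) (hN0 : N ≠ 0)
    (hN : (N : ℝ) ≤ (n : ℝ) ^ (49 / 100 : ℝ)) : q.Coprime N := by
  obtain ⟨hq, hqp⟩ := mem_filter.1 hq
  have h1 : N < q := by
    have : (N : ℝ) ≤ ⌈(n : ℝ) ^ (49 / 100 : ℝ)⌉₊ := hN.trans (Nat.le_ceil _)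
    exact lt_of_le_of_lt (by exact_mod_cast this) (mem_Ioc.1 hq).1
  exact Nat.coprime_of_lt_prime hN0 h1 hqp

theorem sum_norm_mul_char_le {n k M d D : ℕ} [NeZero M] [NeZero d] (hMd : M.Coprime d)
    (hD : M * d ≤ D) (hn : ((M * d : ℕ) : ℝ) ≤ (n : ℝ) ^ (49 / 100 : ℝ)) :
    ∑ χ : DirichletCharacter ℂ M, ∑ ψ ∈ ({1}ᶜ : Finset (DirichletCharacter ℂ d)),
      ‖∑ q ∈ primeRange n, (W n k q : ℂ) * (χ q * ψ q)‖ ≤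
      ∑ x ∈ primCharsUpTo D with x.1 ∣ M * d ∧ ¬ x.1 ∣ M, ‖charSum n k x‖ := by
  have h0 : M * d ≠ 0 := mul_ne_zero (NeZero.ne M) (NeZero.ne d)
  choose F hF1 hFp hFd hF using
    fun c : DirichletCharacter ℂ M × DirichletCharacter ℂ d => exists_primitive_mul c.1 c.2
  rw [← sum_product']
  have heq : ∀ c : DirichletCharacter ℂ M × DirichletCharacter ℂ d,
      ‖∑ q ∈ primeRange n, (W n k q : ℂ) * (c.1 q * c.2 q)‖ = ‖charSum n k (F c)‖ := by
    intro c
    rw [charSum]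
    congr 1
    refine sum_congr rfl fun q hq => ?_
    rw [hF c q (coprime_of_mem_primeRange hq h0 hn)]
  have hψ : ∀ c (u : (ZMod d)ˣ), ∃ m : ℕ, (m : ZMod M) = 1 ∧ m.Coprime (M * d) ∧
      (m : ZMod d) = u ∧ charVal (F c) m = c.2 u := by
    intro c u
    obtain ⟨m, h1, h2, h3⟩ := exists_natCast_eq_one hMd u
    refine ⟨m, h2, h1, h3, ?_⟩
    rw [hF c m h1, h2, h3, map_one, one_mul]
  have hinj : Set.InjOn F
      ((univ ×ˢ {1}ᶜ : Finset (DirichletCharacter ℂ M × DirichletCharacter ℂ d)) : Set _) := by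
    rintro c - c' - h
    refine Prod.ext ?_ ?_
    · refine MulChar.ext fun u => ?_
      obtain ⟨m, h1, h2, h3⟩ := exists_natCast_eq_one hMd.symm u
      rw [mul_comm] at h1
      have h4 := hF c m h1
      rw [h, hF c' m h1, h2, h3, map_one, map_one, mul_one, mul_one] at h4
      exact h4.symm
    · refine MulChar.ext fun u => ?_
      obtain ⟨m, h1, h2, h3⟩ := exists_natCast_eq_one hMd u
      have h4 := hF c m h1
      rw [h, hF c' m h1, h2, h3, map_one, map_one, one_mul, one_mul] at h4
      exact h4.symm
  classical
  calc _ = ∑ c ∈ univ ×ˢ {1}ᶜ, ‖charSum n k (F c)‖ := sum_congr rfl fun c _ => heq c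
    _ = ∑ x ∈ (univ ×ˢ {1}ᶜ).image F, ‖charSum n k x‖ :=
      (sum_image (f := fun x => ‖charSum n k x‖) hinj).symm
    _ ≤ _ := by
      refine sum_le_sum_of_subset_of_nonneg ?_ fun _ _ _ => norm_nonneg _
      intro x hx
      obtain ⟨c, hc, rfl⟩ := mem_image.1 hx
      have hc1 : c.2 ≠ 1 := by simpa using hc
      refine mem_filter.2 ⟨mem_primCharsUpTo.2 ⟨⟨hF1 c, ?_⟩, hFp c⟩, hFd c, fun hM => hc1 ?_⟩
      · exact (Nat.le_of_dvd (Nat.pos_of_ne_zero h0) (hFd c)).trans hD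
      · refine MulChar.ext fun u => ?_
        obtain ⟨m, h1, -, -, h2⟩ := hψ c u
        rw [← h2, charVal_natCast, MulChar.one_apply_coe]
        have : (m : ZMod (F c).1) = 1 := by
          have h5 : m ≡ 1 [MOD M] := (ZMod.natCast_eq_natCast_iff _ _ _).1 (by simpa using h1)
          simpa using (ZMod.natCast_eq_natCast_iff _ _ _).2 (h5.of_dvd hM)
        rw [this, map_one]

/-- The number of square roots of `n` modulo `d`. -/
noncomputable def rootCount (n d : ℕ) : ℕ := Nat.card {a : ZMod d // a ^ 2 = (n : ZMod d)}

/-- The weight of the primes `q ≡ b` modulo `M` for which `d` divides `n - q ^ 2`. -/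
noncomputable def classSum (n k M b d : ℕ) : ℝ :=
  ∑ q ∈ primeRange n with ((q : ℕ) : ZMod M) = (b : ZMod M) ∧ d ∣ n - q ^ 2, W n k q

lemma sq_lt_of_mem_primeRange {n q : ℕ} (hq : q ∈ primeRange n) : q ^ 2 < n := by
  obtain ⟨hq, hqp⟩ := mem_filter.1 hq
  have h := Nat.le_sqrt'.1 (mem_Ioc.1 hq).2
  have := pow_pos hqp.pos 2
  lia

lemma dvd_sub_sq_iff {n q d : ℕ} (hq : q ^ 2 ≤ n) :
    d ∣ n - q ^ 2 ↔ (q : ZMod d) ^ 2 = (n : ZMod d) := by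
  rw [← CharP.cast_eq_zero_iff (ZMod d) d, Nat.cast_sub hq, sub_eq_zero, eq_comm]
  push_cast
  rfl

open Classical in
theorem abs_classSum_sub_le {n k M b d D : ℕ} [NeZero M] [NeZero d] (hMd : M.Coprime d)
    (hb : b.Coprime M) (hnd : n.Coprime d)
    (hD : M * d ≤ D) (hn : ((M * d : ℕ) : ℝ) ≤ (n : ℝ) ^ (49 / 100 : ℝ)) :
    |classSum n k M b d - rootCount n d / d.totient * classSum n k M b 1| ≤
      rootCount n d / d.totient *
      ∑ x ∈ primCharsUpTo D with x.1 ∣ M * d ∧ ¬ x.1 ∣ M, ‖charSum n k x‖ := by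
  set A := (univ : Finset (ZMod d)).filter fun a => a ^ 2 = (n : ZMod d) with hA
  have hcard : (rootCount n d : ℂ) = A.card := by
    rw [rootCount, Nat.card_eq_fintype_card, Fintype.card_subtype]
  have hcardR : (rootCount n d : ℝ) = A.card := by exact_mod_cast hcard
  have hd0 : 0 < d := Nat.pos_of_ne_zero (NeZero.ne d)
  have hM0 : 0 < M := Nat.pos_of_ne_zero (NeZero.ne M)
  have hφd : (0 : ℝ) < d.totient := by exact_mod_cast Nat.totient_pos.2 hd0
  have hφM : (1 : ℝ) ≤ M.totient := by exact_mod_cast Nat.totient_pos.2 hM0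
  have hunit : ∀ a ∈ A, IsUnit a := by
    intro a ha
    have h1 := (mem_filter.1 ha).2
    have h2 : IsUnit (a ^ 2) := by
      rw [h1]
      exact (ZMod.isUnit_iff_coprime _ _).2 hnd
    exact (isUnit_pow_iff two_ne_zero).1 h2
  have hbu : IsUnit (b : ZMod M) := (ZMod.isUnit_iff_coprime _ _).2 hb
  set T : ℕ → ℂ := fun q => (∑ χ : DirichletCharacter ℂ M, χ (b : ZMod M)⁻¹ * χ q) *
    ∑ a ∈ A, ∑ ψ ∈ ({1}ᶜ : Finset (DirichletCharacter ℂ d)), ψ a⁻¹ * ψ q with hT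
  have hTq : ∀ q ∈ primeRange n, T q = (M.totient : ℂ) * d.totient *
      ((if (q : ZMod M) = b ∧ d ∣ n - q ^ 2 then 1 else 0) -
        rootCount n d / d.totient * if (q : ZMod M) = b ∧ 1 ∣ n - q ^ 2 then 1 else 0) := by
    intro q hq
    have hcop := coprime_of_mem_primeRange hq (mul_ne_zero hM0.ne' hd0.ne') hn
    have hqd : IsUnit (q : ZMod d) := (ZMod.isUnit_iff_coprime _ _).2 (Nat.Coprime.coprime_mul_left_right hcop)
    have h1 : ∀ a ∈ A, ∑ ψ ∈ ({1}ᶜ : Finset (DirichletCharacter ℂ d)), ψ a⁻¹ * ψ q =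
        (if a = q then (d.totient : ℂ) else 0) - 1 := by
      intro a ha
      rw [← DirichletCharacter.sum_char_inv_mul_char_eq ℂ (hunit a ha),
        ← sum_add_sum_compl ({1} : Finset (DirichletCharacter ℂ d)), sum_singleton,
        ← map_mul, MulChar.one_apply]
      · ring
      · obtain ⟨u, rfl⟩ := hunit a ha
        rw [ZMod.inv_coe_unit]
        exact u⁻¹.isUnit.mul hqd
    have hdφ : (d.totient : ℂ) ≠ 0 := by exact_mod_cast hφd.ne'
    have hmem : (q : ZMod d) ∈ A ↔ d ∣ n - q ^ 2 := by
      rw [dvd_sub_sq_iff (sq_lt_of_mem_primeRange hq).le, hA, mem_filter]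
      simp
    rw [hT]
    simp only
    rw [sum_congr rfl h1, sum_sub_distrib, sum_const, nsmul_one, sum_ite_eq',
      DirichletCharacter.sum_char_inv_mul_char_eq ℂ hbu, hcard]
    by_cases h2 : d ∣ n - q ^ 2 <;> by_cases h3 : (q : ZMod M) = b
    · simp only [hmem, h2, h3, if_true, one_dvd, and_self]
      field_simp
    · simp [h3, Ne.symm h3]
    · simp only [hmem, h2, h3, if_true, if_false, one_dvd, and_self, and_false]
      field_simp
      ring
    · simp [h3, Ne.symm h3]
  have hsum : (M.totient : ℂ) * d.totient * ((classSum n k M b d -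
      rootCount n d / d.totient * classSum n k M b 1 : ℝ) : ℂ) =
      ∑ q ∈ primeRange n, (W n k q : ℂ) * T q := by
    rw [sum_congr rfl fun q hq => by rw [hTq q hq], classSum, classSum]
    push_cast
    rw [sum_filter, sum_filter, mul_sum, ← sum_sub_distrib, mul_sum]
    refine sum_congr rfl fun q _ => ?_
    split_ifs <;> ring
  have hnorm : ‖∑ q ∈ primeRange n, (W n k q : ℂ) * T q‖ ≤ A.card *
      ∑ x ∈ primCharsUpTo D with x.1 ∣ M * d ∧ ¬ x.1 ∣ M, ‖charSum n k x‖ := by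
    have hex : ∑ q ∈ primeRange n, (W n k q : ℂ) * T q = ∑ a ∈ A,
        ∑ χ : DirichletCharacter ℂ M, ∑ ψ ∈ ({1}ᶜ : Finset (DirichletCharacter ℂ d)),
        χ (b : ZMod M)⁻¹ * ψ a⁻¹ * ∑ q ∈ primeRange n, (W n k q : ℂ) * (χ q * ψ q) := by
      have hq : ∀ q, (W n k q : ℂ) * T q = ∑ a ∈ A, ∑ χ : DirichletCharacter ℂ M,
          ∑ ψ ∈ ({1}ᶜ : Finset (DirichletCharacter ℂ d)),
          χ (b : ZMod M)⁻¹ * ψ a⁻¹ * ((W n k q : ℂ) * (χ q * ψ q)) := by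
        intro q
        simp only [hT]
        rw [sum_mul_sum, sum_comm, mul_sum]
        refine sum_congr rfl fun a _ => ?_
        rw [mul_sum]
        refine sum_congr rfl fun χ _ => ?_
        rw [mul_sum, mul_sum]
        exact sum_congr rfl fun ψ _ => by ring
      rw [sum_congr rfl fun q _ => hq q, sum_comm]
      refine sum_congr rfl fun a _ => ?_
      rw [sum_comm]
      refine sum_congr rfl fun χ _ => ?_
      rw [sum_comm]
      exact sum_congr rfl fun ψ _ => by rw [mul_sum]
    rw [hex, ← nsmul_eq_mul]
    refine norm_sum_le_of_le _ (fun a _ => ?_) |>.trans (by rw [sum_const])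
    refine le_trans ?_ (sum_norm_mul_char_le hMd hD hn)
    refine norm_sum_le_of_le _ fun χ _ => norm_sum_le_of_le _ fun ψ _ => ?_
    rw [norm_mul, norm_mul]
    have h1 := χ.norm_le_one (b : ZMod M)⁻¹
    have h2 := ψ.norm_le_one a⁻¹
    exact mul_le_of_le_one_left (norm_nonneg _) (mul_le_one₀ h1 (norm_nonneg _) h2)
  rw [← hsum, norm_mul, norm_mul, Complex.norm_natCast, Complex.norm_natCast, Complex.norm_real,
    norm_eq_abs] at hnorm
  rw [← hcardR] at hnorm
  rw [div_mul_eq_mul_div (rootCount n d : ℝ) _ (∑ x ∈ _, _), le_div_iff₀ hφd]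
  refine le_trans ?_ hnorm
  have := mul_nonneg hφd.le (abs_nonneg
    (classSum n k M b d - rootCount n d / d.totient * classSum n k M b 1))
  nlinarith

lemma rootCount_one (n : ℕ) : rootCount n 1 = 1 := by
  have : Unique {a : ZMod 1 // a ^ 2 = (n : ZMod 1)} :=
    { default := ⟨0, Subsingleton.elim _ _⟩
      uniq := fun a => Subsingleton.elim _ _ }
  rw [rootCount, Nat.card_unique]

lemma rootCount_mul {n c d : ℕ} (h : c.Coprime d) :
    rootCount n (c * d) = rootCount n c * rootCount n d := by
  rw [rootCount, rootCount, rootCount, ← Nat.card_prod]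
  refine Nat.card_congr (((ZMod.chineseRemainder h).toEquiv.subtypeEquiv
    (q := fun x => x.1 ^ 2 = (n : ZMod c) ∧ x.2 ^ 2 = (n : ZMod d)) fun a => ?_).trans
    (Equiv.subtypeProdEquivProd (p := fun a : ZMod c => a ^ 2 = (n : ZMod c))
      (q := fun a : ZMod d => a ^ 2 = (n : ZMod d))))
  rw [← (ZMod.chineseRemainder h).injective.eq_iff, map_pow, map_natCast, Prod.ext_iff]
  rfl

lemma rootCount_prime_le (n : ℕ) {p : ℕ} (hp : p.Prime) : rootCount n p ≤ 2 := by
  have : Fact p.Prime := ⟨hp⟩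
  by_cases h : ∃ a : ZMod p, a ^ 2 = (n : ZMod p)
  · obtain ⟨a, ha⟩ := h
    have hsub : {b : ZMod p | b ^ 2 = (n : ZMod p)} ⊆ {a, -a} := by
      intro b hb
      rw [Set.mem_ofPred_eq, ← ha] at hb
      rcases sq_eq_sq_iff_eq_or_eq_neg.1 hb with h | h <;> simp [h]
    calc rootCount n p = Set.ncard {b : ZMod p | b ^ 2 = (n : ZMod p)} := rfl
      _ ≤ Set.ncard {a, -a} := Set.ncard_le_ncard hsub (Set.toFinite _)
      _ ≤ 2 := (Set.ncard_insert_le _ _).trans (by rw [Set.ncard_singleton])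
  · have : IsEmpty {a : ZMod p // a ^ 2 = (n : ZMod p)} := ⟨fun a => h ⟨a.1, a.2⟩⟩
    rw [rootCount, Nat.card_of_isEmpty]
    exact Nat.zero_le _

lemma coprime_prod_of_notMem {S : Finset ℕ} {p : ℕ} (hp : p.Prime) (hS : ∀ q ∈ S, q.Prime)
    (h : p ∉ S) : p.Coprime (∏ q ∈ S, q) :=
  Nat.Coprime.prod_right fun q hq => (Nat.coprime_primes hp (hS q hq)).2 fun e => h (e ▸ hq)

lemma rootCount_prod (n : ℕ) {S : Finset ℕ} (hS : ∀ p ∈ S, p.Prime) :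
    rootCount n (∏ p ∈ S, p) = ∏ p ∈ S, rootCount n p := by
  induction S using Finset.induction_on with
  | empty => simp [rootCount_one]
  | insert p S hp ih =>
    have h1 := fun q hq => hS q (mem_insert_of_mem hq)
    rw [prod_insert hp, prod_insert hp, ← ih h1,
      rootCount_mul (coprime_prod_of_notMem (hS p (mem_insert_self p S)) h1 hp)]

lemma totient_prod {S : Finset ℕ} (hS : ∀ p ∈ S, p.Prime) :
    (∏ p ∈ S, p).totient = ∏ p ∈ S, (p - 1) := by
  induction S using Finset.induction_on with
  | empty => simp
  | insert p S hp ih =>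
    have h1 := fun q hq => hS q (mem_insert_of_mem hq)
    rw [prod_insert hp, prod_insert hp, ← ih h1,
      Nat.totient_mul (coprime_prod_of_notMem (hS p (mem_insert_self p S)) h1 hp),
      Nat.totient_prime (hS p (mem_insert_self p S))]

lemma omega_eq_card_primeFactors (d : ℕ) : ω d = d.primeFactors.card := by
  rw [ArithmeticFunction.cardDistinctFactors_apply, Nat.primeFactors, List.card_toFinset]

lemma rootCount_div_totient_le (n : ℕ) {d : ℕ} (hd : Squarefree d) :
    (rootCount n d : ℝ) / d.totient ≤ 4 ^ ω d / d := by
  have hp : ∀ p ∈ d.primeFactors, p.Prime := fun p hp => Nat.prime_of_mem_primeFactors hp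
  have hd' := Nat.prod_primeFactors_of_squarefree hd
  rw [omega_eq_card_primeFactors]
  nth_rw 1 2 4 [← hd']
  rw [rootCount_prod n hp, totient_prod hp]
  push_cast
  rw [← prod_const, ← prod_div_distrib, ← prod_div_distrib]
  refine prod_le_prod (fun p _ => by positivity) fun p hq => ?_
  have h2 := (hp p hq).two_le
  have h2' : (2 : ℝ) ≤ p := by exact_mod_cast h2
  rw [Nat.cast_sub (by lia), Nat.cast_one, div_le_div_iff₀ (by linarith) (by linarith)]
  have h3 : (rootCount n p : ℝ) ≤ 2 := by exact_mod_cast rootCount_prime_le n (hp p hq)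
  nlinarith

lemma omega_mul_le {a b : ℕ} : ω (a * b) ≤ ω a + ω b := by
  rcases eq_or_ne a 0 with rfl | ha
  · simp
  rcases eq_or_ne b 0 with rfl | hb
  · simp
  rw [omega_eq_card_primeFactors, omega_eq_card_primeFactors, omega_eq_card_primeFactors,
    Nat.primeFactors_mul ha hb]
  exact card_union_le _ _

lemma sum_pow_omega_div_multiples_le {c r M D : ℕ} (hc : 1 ≤ c) (hr : r ≠ 0) (hM : M ≠ 0) :
    ∑ d ∈ Icc 1 D with r ∣ M * d, (c : ℝ) ^ ω d / d ≤
      (c : ℝ) ^ ω r * M / r * (1 + log D) ^ c := by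
  have hc1 : (1 : ℝ) ≤ c := by exact_mod_cast hc
  set g := r.gcd M with hg
  have hg0 : 0 < g := Nat.gcd_pos_of_pos_right _ (Nat.pos_of_ne_zero hM)
  obtain ⟨s, hs⟩ : g ∣ r := Nat.gcd_dvd_left _ _
  have hs0 : s ≠ 0 := by rintro rfl; exact hr (by simpa using hs)
  have hdvd : ∀ d, r ∣ M * d → s ∣ d := by
    intro d hd
    have h1 : (r / g) ∣ (M / g) * d := by
      have : g ∣ M := Nat.gcd_dvd_right _ _
      rw [← Nat.mul_dvd_mul_iff_left hg0, ← mul_assoc, Nat.mul_div_cancel' (Nat.gcd_dvd_left r M),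
        Nat.mul_div_cancel' this]
      exact hd
    have h2 : (r / g).Coprime (M / g) := Nat.coprime_div_gcd_div_gcd hg0
    have h3 := h2.dvd_of_dvd_mul_left h1
    rwa [show r / g = s by rw [hs, Nat.mul_div_cancel_left _ hg0]] at h3
  have hsr : s ∣ r := ⟨g, by rw [mul_comm]; exact hs⟩
  have hgM : g ≤ M := Nat.le_of_dvd (Nat.pos_of_ne_zero hM) (Nat.gcd_dvd_right _ _)
  have hinj : Set.InjOn (fun e => s * e) (Icc 1 D : Set ℕ) := fun a _ b _ h =>
    Nat.eq_of_mul_eq_mul_left (Nat.pos_of_ne_zero hs0) h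
  have hs0' : (0 : ℝ) < s := by exact_mod_cast Nat.pos_of_ne_zero hs0
  have hr0' : (0 : ℝ) < r := by exact_mod_cast Nat.pos_of_ne_zero hr
  have hrsg : (r : ℝ) = g * s := by exact_mod_cast hs
  have hg0' : (0 : ℝ) < g := by exact_mod_cast hg0
  calc _ ≤ ∑ d ∈ (Icc 1 D).image (fun e => s * e), (c : ℝ) ^ ω d / d := by
        refine sum_le_sum_of_subset_of_nonneg ?_ fun _ _ _ => by positivity
        intro d hd
        obtain ⟨hd1, hd2⟩ := mem_filter.1 hd
        obtain ⟨e, rfl⟩ := hdvd d hd2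
        have h1 := mem_Icc.1 hd1
        refine mem_image.2 ⟨e, mem_Icc.2 ⟨?_, ?_⟩, rfl⟩
        · exact Nat.pos_of_mul_pos_left (a := s) (by lia)
        · exact (Nat.le_mul_of_pos_left e (Nat.pos_of_ne_zero hs0)).trans h1.2
    _ = ∑ e ∈ Icc 1 D, (c : ℝ) ^ ω (s * e) / ((s * e : ℕ) : ℝ) := sum_image hinj
    _ ≤ ∑ e ∈ Icc 1 D, (c : ℝ) ^ ω r / s * ((c : ℝ) ^ ω e / e) := by
        refine sum_le_sum fun e he => ?_
        have h1 : (c : ℝ) ^ ω (s * e) ≤ c ^ (ω r + ω e) :=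
          pow_le_pow_right₀ hc1 (omega_mul_le.trans
            (Nat.add_le_add_right (omega_le_of_dvd hsr hr) _))
        rw [div_mul_div_comm, ← pow_add]
        push_cast
        gcongr
    _ = (c : ℝ) ^ ω r / s * ∑ e ∈ Icc 1 D, (c : ℝ) ^ ω e / e := by rw [mul_sum]
    _ ≤ (c : ℝ) ^ ω r / s * (1 + log D) ^ c := by
        gcongr
        exact sum_pow_omega_div_le c D
    _ ≤ _ := by
        have : 0 ≤ log D := log_natCast_nonneg D
        gcongr ?_ * _
        rw [div_le_div_iff₀ hs0' hr0', hrsg, mul_assoc]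
        gcongr

theorem sum_abs_classSum_sub_le {n k M b D D₁ : ℕ} (hM : M ≠ 0) (hb : b.Coprime M)
    (hD : M * D ≤ D₁) (hn : (D₁ : ℝ) ≤ (n : ℝ) ^ (49 / 100 : ℝ)) :
    ∑ d ∈ Icc 1 D with Squarefree d ∧ d.Coprime (M * n), (18 : ℝ) ^ ω d *
      |classSum n k M b d - rootCount n d / d.totient * classSum n k M b 1| ≤
      M * (1 + log D) ^ 72 * ∑ x ∈ primCharsUpTo D₁ with ¬ x.1 ∣ M,
        ‖charSum n k x‖ * (72 ^ ω x.1 / x.1) := by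
  classical
  have : NeZero M := ⟨hM⟩
  set P := (primCharsUpTo D₁).filter fun x => ¬ x.1 ∣ M with hP
  calc _ ≤ ∑ d ∈ Icc 1 D with Squarefree d ∧ d.Coprime (M * n), (72 : ℝ) ^ ω d / d *
        ∑ x ∈ P with x.1 ∣ M * d, ‖charSum n k x‖ := by
        refine sum_le_sum fun d hd => ?_
        obtain ⟨hd1, hd2, hd3⟩ := mem_filter.1 hd
        have hd0 : 0 < d := (mem_Icc.1 hd1).1
        have : NeZero d := ⟨hd0.ne'⟩
        have hMdD : M * d ≤ D₁ := (Nat.mul_le_mul_left M (mem_Icc.1 hd1).2).trans hD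
        have h1 := abs_classSum_sub_le (k := k) (Nat.Coprime.coprime_mul_right_right hd3).symm hb
          (Nat.Coprime.coprime_mul_left_right hd3).symm hMdD
          (le_trans (by exact_mod_cast hMdD) hn)
        have h2 : ∑ x ∈ primCharsUpTo D₁ with x.1 ∣ M * d ∧ ¬ x.1 ∣ M, ‖charSum n k x‖ =
            ∑ x ∈ P with x.1 ∣ M * d, ‖charSum n k x‖ := by
          rw [hP, filter_filter]
          exact sum_congr (filter_congr fun x _ => and_comm) fun _ _ => rfl
        rw [h2] at h1
        have h3 : (0 : ℝ) ≤ ∑ x ∈ P with x.1 ∣ M * d, ‖charSum n k x‖ :=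
          sum_nonneg fun _ _ => norm_nonneg _
        calc _ ≤ (18 : ℝ) ^ ω d * (4 ^ ω d / d * ∑ x ∈ P with x.1 ∣ M * d, ‖charSum n k x‖) := by
              gcongr
              exact h1.trans (mul_le_mul_of_nonneg_right (rootCount_div_totient_le n hd2) h3)
          _ = _ := by
              rw [show (72 : ℝ) = 18 * 4 by norm_num, mul_pow]
              ring
    _ ≤ ∑ d ∈ Icc 1 D, (72 : ℝ) ^ ω d / d * ∑ x ∈ P with x.1 ∣ M * d, ‖charSum n k x‖ :=
        sum_le_sum_of_subset_of_nonneg (filter_subset _ _) fun d _ _ =>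
          mul_nonneg (by positivity) (sum_nonneg fun _ _ => norm_nonneg _)
    _ = ∑ x ∈ P, ‖charSum n k x‖ * ∑ d ∈ Icc 1 D with x.1 ∣ M * d, (72 : ℝ) ^ ω d / d := by
        simp only [sum_filter, mul_sum, mul_ite, mul_zero]
        rw [sum_comm]
        exact sum_congr rfl fun x _ => sum_congr rfl fun d _ => by
          rw [mul_comm (_ / _) ‖charSum n k x‖]
    _ ≤ ∑ x ∈ P, ‖charSum n k x‖ * ((72 : ℝ) ^ ω x.1 * M / x.1 * (1 + log D) ^ 72) := by
        refine sum_le_sum fun x hx => ?_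
        have hx1 : x.1 ≠ 0 := by
          have := (mem_primCharsUpTo.1 (mem_filter.1 hx).1).1.1
          lia
        have := sum_pow_omega_div_multiples_le (c := 72) (D := D) (by norm_num) hx1 hM
        push_cast at this
        gcongr
    _ = _ := by
        rw [mul_sum]
        exact sum_congr rfl fun x _ => by ring

theorem exists_sum_large_conductor : ∃ C : ℝ, 1 ≤ C ∧ ∀ (v Q : ℝ) (R n k : ℕ), 1 ≤ v →
    (n : ℝ) = v ^ 2000 → 1 ≤ Q → (R : ℝ) ≤ v ^ 445 → k ≤ 49 / 100 * log n →
    ∑ x ∈ primCharsUpTo R with Q < x.1, ‖charSum n k x‖ * ((72 : ℝ) ^ ω x.1 / x.1) ≤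
      C * (1 + log n) ^ 7 * (Q ^ (-(99 / 100) : ℝ) + v⁻¹) := by
  obtain ⟨C₁, hC₁, hω⟩ := pow_omega_le 72 (ε := 1 / 100) (by norm_num)
  obtain ⟨C₂, hC₂, hS⟩ := exists_sum_charSum_le
  push_cast at hω
  refine ⟨12 * C₁ * C₂, by nlinarith, fun v Q R n k hv hn hQ hR hk => ?_⟩
  have hL : 0 ≤ log n := log_natCast_nonneg n
  have hv0 : 0 < v := by linarith
  have hv1 : v⁻¹ ≤ 1 := inv_le_one_of_one_le₀ hv
  set J := Nat.clog 2 R with hJ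
  set e : ℝ := -(99 / 100) with he
  have hJR : ((2 ^ J : ℕ) : ℝ) ≤ 2 * v ^ 445 := by
    rcases le_or_gt R 1 with h | h
    · rw [hJ, Nat.clog_of_right_le_one h]
      have := one_le_pow₀ hv (n := 445)
      push_cast
      linarith
    · have h1 := Nat.pow_pred_clog_lt_self (b := 2) (by norm_num) h
      have h2 : J.pred + 1 = J := Nat.succ_pred_eq_of_pos (Nat.clog_pos (by norm_num) h)
      rw [← h2, pow_succ]
      push_cast
      have : ((2 ^ J.pred : ℕ) : ℝ) ≤ R := by exact_mod_cast h1.le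
      push_cast at this
      linarith
  have hJL : (J : ℝ) + 1 ≤ 3 * (1 + log n) := by
    have h1 : (J : ℝ) * log 2 ≤ log 2 + log n := by
      rw [← log_pow, hn, ← log_mul (by norm_num) (by positivity)]
      push_cast at hJR
      refine log_le_log (by positivity) (hJR.trans ?_)
      gcongr
      norm_num
    have h2 := log_two_gt_d9
    have h3 : (J : ℝ) * (1 / 2) ≤ (J : ℝ) * log 2 := by gcongr; linarith
    have h4 := log_two_lt_d9
    linarith
  have hterm : ∀ r : ℕ, 1 ≤ r → r ≤ R → Q < r → (72 : ℝ) ^ ω r / r ≤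
      ∑ j ∈ range (J + 1) with Q < ((2 ^ j : ℕ) : ℝ),
        if r ≤ min (2 ^ j) R then 2 * C₁ * ((2 ^ j : ℕ) : ℝ) ^ e else 0 := by
    intro r hr hrR hQr
    have hr0 : (0 : ℝ) < r := by exact_mod_cast hr
    set j := Nat.clog 2 r with hj
    have hrj : r ≤ 2 ^ j := Nat.le_pow_clog (by norm_num) r
    have hj2 : ((2 ^ j : ℕ) : ℝ) ≤ 2 * r := by
      rcases eq_or_lt_of_le hr with h | h
      · rw [hj, ← h, Nat.clog_of_right_le_one le_rfl]
        norm_num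
      · have h1 := Nat.pow_pred_clog_lt_self (b := 2) (by norm_num) h
        have h2 : j.pred + 1 = j := Nat.succ_pred_eq_of_pos (Nat.clog_pos (by norm_num) h)
        rw [← h2, pow_succ]
        push_cast
        have : ((2 ^ j.pred : ℕ) : ℝ) ≤ r := by exact_mod_cast h1.le
        push_cast at this
        linarith
    have hjJ : j ≤ J := Nat.clog_mono_right 2 hrR
    have hmem : j ∈ (range (J + 1)).filter fun j => Q < ((2 ^ j : ℕ) : ℝ) :=
      mem_filter.2 ⟨mem_range.2 (by lia), hQr.trans_le (by exact_mod_cast hrj)⟩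
    refine le_trans ?_ (single_le_sum (f := fun j =>
      if r ≤ min (2 ^ j) R then 2 * C₁ * ((2 ^ j : ℕ) : ℝ) ^ e else 0) (fun i _ => ?_) hmem)
    · rw [if_pos (le_min hrj hrR)]
      have h2j : (0 : ℝ) < ((2 ^ j : ℕ) : ℝ) := by positivity
      calc (72 : ℝ) ^ ω r / r ≤ C₁ * (r : ℝ) ^ (1 / 100 : ℝ) / r := by
            gcongr
            exact hω r (by lia)
        _ = C₁ * (r : ℝ) ^ e := by
            rw [mul_div_assoc, ← rpow_sub_one hr0.ne']
            norm_num [he]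
        _ ≤ C₁ * (((2 ^ j : ℕ) : ℝ) / 2) ^ e := by
            refine mul_le_mul_of_nonneg_left ?_ (by linarith)
            exact rpow_le_rpow_of_nonpos (by positivity) (by linarith) (by norm_num [he])
        _ = C₁ * (((2 ^ j : ℕ) : ℝ) ^ e * 2 ^ (-e)) := by
            rw [div_rpow h2j.le (by norm_num), rpow_neg (by norm_num) e, div_eq_mul_inv]
        _ ≤ C₁ * (((2 ^ j : ℕ) : ℝ) ^ e * 2 ^ (1 : ℝ)) := by
            gcongr
            · norm_num
            · norm_num [he]
        _ = _ := by rw [rpow_one]; ring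
    · split_ifs <;> positivity
  have hblock : ∀ j ∈ (range (J + 1)).filter fun j => Q < ((2 ^ j : ℕ) : ℝ),
      2 * C₁ * ((2 ^ j : ℕ) : ℝ) ^ e * (C₂ * (1 + log n) ^ 6 * (1 + ((2 ^ j : ℕ) : ℝ) / v ^ 8)) ≤
      4 * C₁ * C₂ * (1 + log n) ^ 6 * (Q ^ e + v⁻¹) := by
    intro j hj
    obtain ⟨hjJ, hQj⟩ := mem_filter.1 hj
    set t := ((2 ^ j : ℕ) : ℝ) with ht
    have ht0 : 0 < t := by linarith
    have htR : t ≤ 2 * v ^ 445 := by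
      refine le_trans ?_ hJR
      rw [ht]
      have := mem_range.1 hjJ
      exact_mod_cast Nat.pow_le_pow_right (by norm_num) (by lia)
    have h1 : t ^ e ≤ Q ^ e :=
      rpow_le_rpow_of_nonpos (by linarith) hQj.le (by norm_num [he])
    have h2 : t ^ e * (t / v ^ 8) ≤ 2 * v⁻¹ := by
      calc t ^ e * (t / v ^ 8) = t ^ (1 / 100 : ℝ) / v ^ 8 := by
            rw [mul_div_assoc', ← rpow_add_one ht0.ne']
            norm_num [he]
        _ ≤ (2 * v ^ 500) ^ (1 / 100 : ℝ) / v ^ 8 := by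
            gcongr
            refine htR.trans ?_
            gcongr
            norm_num
        _ = 2 ^ (1 / 100 : ℝ) * v ^ 5 / v ^ 8 := by
            rw [mul_rpow (by norm_num) (by positivity), ← rpow_natCast v 500, ← rpow_mul hv0.le,
              ← rpow_natCast v 5]
            norm_num
        _ ≤ 2 ^ (1 : ℝ) * v ^ 5 / v ^ 8 := by
            gcongr
            · norm_num
            · norm_num
        _ = 2 * (v⁻¹ * (v⁻¹ * v⁻¹)) := by
            rw [rpow_one]
            field_simp
        _ ≤ 2 * (v⁻¹ * (1 * 1)) := by gcongr
        _ = _ := by ring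
    have hK : 0 ≤ C₁ * C₂ * (1 + log n) ^ 6 := by positivity
    calc _ = 2 * (C₁ * C₂ * (1 + log n) ^ 6) * (t ^ e + t ^ e * (t / v ^ 8)) := by ring
      _ ≤ 2 * (C₁ * C₂ * (1 + log n) ^ 6) * (2 * Q ^ e + 2 * v⁻¹) := by
          have : 0 ≤ Q ^ e := by positivity
          gcongr
          linarith
      _ = _ := by ring
  calc _ ≤ ∑ x ∈ primCharsUpTo R with Q < x.1, ‖charSum n k x‖ *
        ∑ j ∈ range (J + 1) with Q < ((2 ^ j : ℕ) : ℝ),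
          if x.1 ≤ min (2 ^ j) R then 2 * C₁ * ((2 ^ j : ℕ) : ℝ) ^ e else 0 := by
        refine sum_le_sum fun x hx => ?_
        obtain ⟨h1, h2⟩ := mem_filter.1 hx
        have h3 := (mem_primCharsUpTo.1 h1).1
        gcongr
        exact hterm x.1 h3.1 h3.2 h2
    _ = ∑ j ∈ range (J + 1) with Q < ((2 ^ j : ℕ) : ℝ), 2 * C₁ * ((2 ^ j : ℕ) : ℝ) ^ e *
        ∑ x ∈ primCharsUpTo R with Q < x.1 ∧ x.1 ≤ min (2 ^ j) R, ‖charSum n k x‖ := by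
        simp only [mul_sum]
        rw [sum_comm]
        refine sum_congr rfl fun j _ => ?_
        rw [← filter_filter, sum_filter (s := filter _ _)]
        refine sum_congr rfl fun x _ => ?_
        split_ifs
        · ring
        · ring
    _ ≤ ∑ j ∈ range (J + 1) with Q < ((2 ^ j : ℕ) : ℝ), 2 * C₁ * ((2 ^ j : ℕ) : ℝ) ^ e *
        (C₂ * (1 + log n) ^ 6 * (1 + ((2 ^ j : ℕ) : ℝ) / v ^ 8)) := by
        refine sum_le_sum fun j hj => ?_
        rcases Nat.eq_zero_or_pos R with h0 | h0
        · have : primCharsUpTo R = ∅ := by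
            rw [h0, primCharsUpTo]
            simp
          rw [this, filter_empty, sum_empty, mul_zero]
          positivity
        refine mul_le_mul_of_nonneg_left ?_ (by positivity)
        have h1 := hS v (min (2 ^ j) R) n k hv hn (le_min (Nat.one_le_two_pow) h0)
          (le_trans (by exact_mod_cast min_le_right _ _) hR) hk
        refine le_trans (sum_le_sum_of_subset_of_nonneg ?_ fun _ _ _ => norm_nonneg _)
          (h1.trans ?_)
        · intro x hx
          obtain ⟨h2, h3, h4⟩ := mem_filter.1 hx
          obtain ⟨h5, h6⟩ := mem_primCharsUpTo.1 h2
          exact mem_filter.2 ⟨mem_primCharsUpTo.2 ⟨⟨h5.1, h4⟩, h6⟩,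
            by exact_mod_cast hQ.trans_lt h3⟩
        · gcongr
          exact min_le_left _ _
    _ ≤ ∑ j ∈ range (J + 1) with Q < ((2 ^ j : ℕ) : ℝ),
        4 * C₁ * C₂ * (1 + log n) ^ 6 * (Q ^ e + v⁻¹) := sum_le_sum hblock
    _ ≤ ((J : ℝ) + 1) * (4 * C₁ * C₂ * (1 + log n) ^ 6 * (Q ^ e + v⁻¹)) := by
        rw [sum_const, nsmul_eq_mul]
        gcongr
        calc _ ≤ ((#(range (J + 1)) : ℕ) : ℝ) := by exact_mod_cast card_filter_le _ _
          _ = _ := by rw [card_range]; push_cast; rfl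
    _ ≤ (3 * (1 + log n)) * (4 * C₁ * C₂ * (1 + log n) ^ 6 * (Q ^ e + v⁻¹)) := by gcongr
    _ = _ := by ring

/-- The residue class of `b` modulo `p` is nonzero and not a square root of `n`. -/
def IsGood (n p b : ℕ) : Prop := (b : ZMod p) ≠ 0 ∧ (b : ZMod p) ^ 2 ≠ (n : ZMod p)

lemma IsGood.congr {n p b b' : ℕ} (h : IsGood n p b) (hb : b' ≡ b [MOD p]) : IsGood n p b' := by
  have := (ZMod.natCast_eq_natCast_iff b' b p).2 hb
  rwa [IsGood, this]

lemma isGood_of_lt_five {n p b : ℕ} (hn : n % 6 = 0 ∨ n % 6 = 2) (hp : p = 2 ∨ p = 3)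
    (hb : (b : ZMod p) ≠ 0) : IsGood n p b := by
  refine ⟨hb, ?_⟩
  have hsq : (b : ZMod p) ^ 2 = 1 := by
    rcases hp with rfl | rfl
    · generalize (b : ZMod 2) = c at hb
      revert hb
      revert c
      decide
    · generalize (b : ZMod 3) = c at hb
      revert hb
      revert c
      decide
  rw [hsq]
  intro h
  have h1 : 1 ≡ n [MOD p] := (ZMod.natCast_eq_natCast_iff _ _ _).1 (by simpa using h)
  unfold Nat.ModEq at h1
  rcases hp with rfl | rfl <;> lia

lemma exists_isGood {n p : ℕ} (hn : n % 6 = 0 ∨ n % 6 = 2) (hp : p.Prime) : ∃ b, IsGood n p b := by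
  have : Fact p.Prime := ⟨hp⟩
  by_contra! h
  by_cases h5 : p = 2 ∨ p = 3
  · exact h 1 (isGood_of_lt_five hn h5 (by simp))
  have h2 : (2 : ZMod p) ≠ 0 := by
    intro h0
    have : p ∣ 2 := (ZMod.natCast_eq_zero_iff 2 p).1 (by exact_mod_cast h0)
    exact h5 (Or.inl ((Nat.prime_dvd_prime_iff_eq hp Nat.prime_two).1 this))
  have h1' : ((1 : ℕ) : ZMod p) ^ 2 = n := by
    by_contra h0
    exact h 1 ⟨by simp, h0⟩
  have h2' : ((2 : ℕ) : ZMod p) ^ 2 = n := by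
    by_contra h0
    exact h 2 ⟨by exact_mod_cast h2, h0⟩
  have h3 : ((3 : ℕ) : ZMod p) = 0 := by
    push_cast at h1' h2' ⊢
    linear_combination h2' - h1'
  have : p ∣ 3 := (ZMod.natCast_eq_zero_iff 3 p).1 h3
  exact h5 (Or.inr ((Nat.prime_dvd_prime_iff_eq hp Nat.prime_three).1 this))

lemma exists_modEq_isGood {n : ℕ} (hn : n % 6 = 0 ∨ n % 6 = 2) (m β : ℕ) {S : Finset ℕ}
    (hS : ∀ p ∈ S, p.Prime ∧ ¬ p ∣ m) : ∃ b, b ≡ β [MOD m] ∧ ∀ p ∈ S, IsGood n p b := by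
  induction S using Finset.induction_on with
  | empty => exact ⟨β, rfl, by simp⟩
  | insert p S hpS ih =>
    obtain ⟨b₀, h0, h1⟩ := ih fun q hq => hS q (mem_insert_of_mem hq)
    obtain ⟨hp, hpm⟩ := hS p (mem_insert_self p S)
    obtain ⟨c, hc⟩ := exists_isGood hn hp
    have hcop : (m * ∏ q ∈ S, q).Coprime p := Nat.Coprime.symm
      (Nat.Coprime.mul_right ((Nat.Prime.coprime_iff_not_dvd hp).2 hpm)
      (coprime_prod_of_notMem hp (fun q hq => (hS q (mem_insert_of_mem hq)).1) hpS))
    obtain ⟨b, hb1, hb2⟩ := Nat.chineseRemainder hcop b₀ c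
    refine ⟨b, (hb1.of_dvd (Nat.dvd_mul_right _ _)).trans h0, fun q hq => ?_⟩
    rcases mem_insert.1 hq with rfl | hq
    · exact hc.congr hb2
    · exact (h1 q hq).congr (hb1.of_dvd ((dvd_prod_of_mem _ hq).mul_left m))

lemma exists_apply_ne_one {r p m : ℕ} {χ : DirichletCharacter ℂ r} (hχ : χ.IsPrimitive)
    (hr : r = p * m) (hp : 1 < p) (hr0 : r ≠ 0) :
    ∃ u : ℕ, u.Coprime r ∧ u ≡ 1 [MOD m] ∧ χ u ≠ 1 := by
  have : NeZero r := ⟨hr0⟩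
  have hmr : m ∣ r := ⟨p, by rw [hr, mul_comm]⟩
  have hm0 : 0 < m := Nat.pos_of_ne_zero (by rintro rfl; simp at hr; exact hr0 hr)
  have hnot : ¬ χ.FactorsThrough m := by
    intro h
    have h1 : χ.conductor ≤ m := Nat.sInf_le ((DirichletCharacter.mem_conductorSet_iff χ).2 h)
    rw [DirichletCharacter.isPrimitive_def] at hχ
    rw [hχ, hr] at h1
    nlinarith
  rw [DirichletCharacter.factorsThrough_iff_ker_unitsMap hmr, SetLike.not_le_iff_exists] at hnot
  obtain ⟨u, hu1, hu2⟩ := hnot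
  refine ⟨(u : ZMod r).val, ZMod.val_coe_unit_coprime u, ?_, ?_⟩
  · rw [MonoidHom.mem_ker, Units.ext_iff, ZMod.unitsMap_val, Units.val_one] at hu1
    rw [← ZMod.natCast_eq_natCast_iff, Nat.cast_one, ← hu1, ← ZMod.cast_eq_val]
  · rw [MonoidHom.mem_ker, Units.ext_iff, MulChar.coe_toUnitHom, Units.val_one] at hu2
    rwa [ZMod.natCast_zmod_val]

lemma eq_one_or_neg_one_of_star_eq {r b : ℕ} {χ : DirichletCharacter ℂ r} (hb : b.Coprime r)
    (h : star (χ b) = χ b) : χ b = 1 ∨ χ b = -1 := by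
  have h1 : ‖χ b‖ = 1 := by
    have := χ.unit_norm_eq_one (ZMod.unitOfCoprime b hb)
    rwa [ZMod.coe_unitOfCoprime] at this
  have h2 : χ b * χ b = 1 := by
    nth_rw 1 [← h]
    rw [Complex.star_def, mul_comm, Complex.mul_conj, Complex.normSq_eq_norm_sq, h1]
    simp
  exact mul_self_eq_one_iff.1 h2

lemma coprime_of_isGood {n b r : ℕ} (h : ∀ p, p.Prime → p ∣ r → IsGood n p b) : b.Coprime r := by
  refine Nat.coprime_of_dvd fun p hp hb hr => (h p hp hr).1 ?_
  exact (ZMod.natCast_eq_zero_iff b p).2 hb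

theorem exists_isGood_opposite {n r : ℕ} (hn : n % 6 = 0 ∨ n % 6 = 2)
    {χ : DirichletCharacter ℂ r} (hχ : χ.IsPrimitive) (hr : 1 < r) (hr5 : r ≠ 5)
    (hreal : ∀ b : ℕ, star (χ b) = χ b) :
    ∃ b b' : ℕ, (∀ p, p.Prime → p ∣ r → IsGood n p b) ∧ (∀ p, p.Prime → p ∣ r → IsGood n p b') ∧
      χ b + χ b' = 0 := by
  have hr0 : r ≠ 0 := by lia
  obtain ⟨b₀, -, hb₀⟩ := exists_modEq_isGood hn 1 0 (S := r.primeFactors) fun p hp =>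
    ⟨Nat.prime_of_mem_primeFactors hp, (Nat.prime_of_mem_primeFactors hp).one_lt.ne' ∘
      Nat.dvd_one.1⟩
  have hb₀' : ∀ p, p.Prime → p ∣ r → IsGood n p b₀ := fun p hp h =>
    hb₀ p (Nat.mem_primeFactors.2 ⟨hp, h, hr0⟩)
  have hpick : ∃ p, p.Prime ∧ p ∣ r ∧ (p = 2 ∨ p = 3 ∨ p ^ 2 ∣ r ∨ 7 ≤ p) := by
    by_contra! h
    have h5 : ∀ p, p.Prime → p ∣ r → p = 5 := by
      intro p hp hpr
      obtain ⟨h2, h3, -, h7⟩ := h p hp hpr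
      have := hp.two_le
      interval_cases p <;> simp_all +decide
    obtain ⟨p, hp, hpr⟩ := Nat.exists_prime_and_dvd hr.ne'
    obtain rfl := h5 p hp hpr
    obtain ⟨m, hm⟩ := hpr
    have hm1 : m ≠ 1 := by rintro rfl; exact hr5 (by lia)
    obtain ⟨q, hq, hqm⟩ := Nat.exists_prime_and_dvd hm1
    obtain rfl := h5 q hq (hqm.trans ⟨5, by lia⟩)
    obtain ⟨t, rfl⟩ := hqm
    exact (h 5 hp ⟨5 * t, hm⟩).2.2.1 ⟨t, by rw [hm]; ring⟩
  obtain ⟨p, hp, hpr, hcase⟩ := hpick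
  obtain ⟨m, hm⟩ := hpr
  obtain ⟨u, hu, hum, huχ⟩ := exists_apply_ne_one hχ hm hp.one_lt hr0
  have hmdvd : ∀ q, q.Prime → q ∣ r → q ≠ p → q ∣ m := fun q hq hqr hne =>
    (Nat.Coprime.dvd_of_dvd_mul_left ((Nat.coprime_primes hq hp).2 hne) (hm ▸ hqr))
  have huχ' : χ u = -1 := (eq_one_or_neg_one_of_star_eq hu (hreal u)).resolve_left huχ
  have hsq : ∀ b : ℕ, b * u ≡ b [MOD m] := fun b => by simpa using hum.mul_left b
  by_cases hA : p = 2 ∨ p = 3 ∨ p ^ 2 ∣ r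
  · refine ⟨b₀, b₀ * u, hb₀', fun q hq hqr => ?_, ?_⟩
    · by_cases hqm : q ∣ m
      · exact (hb₀' q hq hqr).congr ((hsq b₀).of_dvd hqm)
      · obtain rfl : q = p := by
          by_contra hne
          exact hqm (hmdvd q hq hqr hne)
        have hq23 : q = 2 ∨ q = 3 := by
          rcases hA with h | h | h
          · exact Or.inl h
          · exact Or.inr h
          · rw [hm, sq] at h
            exact absurd (Nat.dvd_of_mul_dvd_mul_left hq.pos h) hqm
        refine isGood_of_lt_five hn hq23 fun h0 => ?_
        have h1 : q ∣ b₀ * u := (ZMod.natCast_eq_zero_iff _ _).1 h0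
        have h2 := (Nat.Coprime.mul_left (coprime_of_isGood hb₀') hu)
        exact Nat.Prime.not_coprime_iff_dvd.2 ⟨q, hq, h1, hqr⟩ h2
    · push_cast
      rw [map_mul, huχ']
      ring
  · have hp7 : 7 ≤ p := by tauto
    have hpm : p.Coprime m := (Nat.Prime.coprime_iff_not_dvd hp).2 fun h => by
      refine hA (Or.inr (Or.inr ?_))
      rw [hm, sq]
      exact Nat.mul_dvd_mul_left p h
    have : Fact p.Prime := ⟨hp⟩
    have hex : ∀ c : ZMod p, ∃ z, z ≡ c.val [MOD p] ∧ z ≡ b₀ [MOD m] := fun c =>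
      ⟨_, (Nat.chineseRemainder hpm c.val b₀).2⟩
    choose z hz1 hz2 using hex
    have hzc : ∀ c : ZMod p, ((z c : ℕ) : ZMod p) = c := fun c => by
      have := (ZMod.natCast_eq_natCast_iff _ _ _).2 (hz1 c)
      simpa using this
    set G := (univ : Finset (ZMod p)).filter fun c => c ≠ 0 ∧ c ^ 2 ≠ (n : ZMod p) with hG
    have hGgood : ∀ c ∈ G, ∀ q, q.Prime → q ∣ r → IsGood n q (z c) := by
      intro c hc q hq hqr
      by_cases hqp : q = p
      · subst hqp
        have := (mem_filter.1 hc).2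
        rwa [IsGood, hzc]
      · exact (hb₀' q hq hqr).congr ((hz2 c).of_dvd (hmdvd q hq hqr hqp))
    by_contra! hno
    have hconst : ∀ c ∈ G, ∀ c' ∈ G, χ (z c) = χ (z c') := by
      intro c hc c' hc'
      have h1 := hno (z c) (z c') (hGgood c hc) (hGgood c' hc')
      rcases eq_one_or_neg_one_of_star_eq (coprime_of_isGood (hGgood c hc)) (hreal _) with h | h <;>
      rcases eq_one_or_neg_one_of_star_eq (coprime_of_isGood (hGgood c' hc')) (hreal _) with h' | h'
      · rw [h, h']
      · rw [h, h'] at h1; simp at h1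
      · rw [h, h'] at h1; simp at h1
      · rw [h, h']
    have hup : (u : ZMod p) ≠ 0 := fun h0 => by
      have h1 : p ∣ u := (ZMod.natCast_eq_zero_iff _ _).1 h0
      exact Nat.Prime.not_coprime_iff_dvd.2 ⟨p, hp, h1, ⟨m, hm⟩⟩ hu
    have hmul : ∀ c : ZMod p, χ (z (c * u)) = -χ (z c) := by
      intro c
      have h1 : z (c * u) ≡ z c * u [MOD p] := by
        rw [← ZMod.natCast_eq_natCast_iff]
        push_cast
        rw [hzc, hzc]
      have h2 : z (c * u) ≡ z c * u [MOD m] :=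
        (hz2 _).trans ((hsq b₀).symm.trans (Nat.ModEq.mul_right u (hz2 c).symm))
      have h3 := (Nat.modEq_and_modEq_iff_modEq_mul hpm).1 ⟨h1, h2⟩
      rw [← hm, ← ZMod.natCast_eq_natCast_iff] at h3
      rw [h3]
      push_cast
      rw [map_mul, huχ']
      ring
    have hsum : ∑ c : ZMod p, χ (z c) = 0 := by
      have h1 : ∑ c : ZMod p, χ (z c) = ∑ c : ZMod p, -χ (z c) := by
        rw [← Equiv.sum_comp (Equiv.mulRight₀ (u : ZMod p) hup) (fun c => χ (z c))]
        exact sum_congr rfl fun c _ => hmul c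
      rw [sum_neg_distrib] at h1
      exact self_eq_neg.1 h1
    have hGc : Gᶜ.card ≤ 3 := by
      have hsub : Gᶜ ⊆ {0} ∪ univ.filter fun c : ZMod p => c ^ 2 = (n : ZMod p) := by
        intro c hc
        by_cases h0 : c = 0
        · simp [h0]
        · have : c ^ 2 = (n : ZMod p) := by
            by_contra h1
            exact (mem_compl.1 hc) (mem_filter.2 ⟨mem_univ c, h0, h1⟩)
          simp [this]
      have h2 := rootCount_prime_le n hp
      rw [rootCount, Nat.card_eq_fintype_card, Fintype.card_subtype] at h2
      calc _ ≤ _ := card_le_card hsub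
        _ ≤ _ := card_union_le _ _
        _ ≤ 1 + 2 := by
          gcongr
          rw [card_singleton]
    have hGcard : 4 ≤ G.card := by
      have := card_add_card_compl G
      rw [ZMod.card] at this
      lia
    obtain ⟨c₀, hc₀⟩ : G.Nonempty := card_pos.1 (by lia)
    have hn1 : ‖χ (z c₀)‖ = 1 := by
      rcases eq_one_or_neg_one_of_star_eq (coprime_of_isGood (hGgood c₀ hc₀)) (hreal _) with h | h <;>
      rw [h] <;> simp
    rw [← sum_add_sum_compl G, sum_congr rfl fun c hc => hconst c hc c₀ hc₀, sum_const,
      nsmul_eq_mul] at hsum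
    have h4 : (G.card : ℝ) ≤ Gᶜ.card := by
      calc (G.card : ℝ) = ‖(G.card : ℂ) * χ (z c₀)‖ := by
            rw [norm_mul, hn1, Complex.norm_natCast, mul_one]
        _ = ‖∑ c ∈ Gᶜ, χ (z c)‖ := by
            rw [eq_neg_of_add_eq_zero_left hsum, norm_neg]
        _ ≤ ∑ c ∈ Gᶜ, (1 : ℝ) := norm_sum_le_of_le _ fun c _ => χ.norm_le_one _
        _ = _ := by simp
    have h5 : G.card ≤ Gᶜ.card := by exact_mod_cast h4
    lia

theorem le_totient_mul_classSum {n k M b : ℕ} [NeZero M] (hb : b.Coprime M)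
    (hM : (M : ℝ) ≤ (n : ℝ) ^ (49 / 100 : ℝ)) {x₁ : Σ r, DirichletCharacter ℂ r} {ε : ℝ}
    (hε : 0 ≤ ε) (hx₁ : 1 < x₁.1 → 0 ≤ (star (charVal x₁ b) * charSum n k x₁).re)
    (hsmall : ∀ x : Σ r, DirichletCharacter ℂ r, x.2.IsPrimitive → 1 < x.1 → x.1 ≤ M → x ≠ x₁ →
      ‖charSum n k x‖ ≤ ε) :
    ∑ q ∈ primeRange n, W n k q - M * ε ≤ M.totient * classSum n k M b 1 := by
  classical
  have hM0 : 0 < M := Nat.pos_of_ne_zero (NeZero.ne M)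
  have hbu : IsUnit (b : ZMod M) := (ZMod.isUnit_iff_coprime _ _).2 hb
  choose F hF1 hFp hFd hF using
    fun c : DirichletCharacter ℂ M => exists_primitive_mul c (1 : DirichletCharacter ℂ 1)
  have hF' : ∀ χ (m : ℕ), m.Coprime M → charVal (F χ) m = χ m := fun χ m hm => by
    rw [hF χ m (by simpa using hm)]
    simp [Subsingleton.elim (m : ZMod 1) 1]
  have hsum : ∀ χ : DirichletCharacter ℂ M, ∑ q ∈ primeRange n, (W n k q : ℂ) * χ q =
      charSum n k (F χ) := fun χ => sum_congr rfl fun q hq => by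
    rw [hF' χ q (coprime_of_mem_primeRange hq hM0.ne' hM)]
  have hinv : ∀ χ : DirichletCharacter ℂ M, χ (b : ZMod M)⁻¹ = star (χ b) := fun χ => by
    have h1 : χ (b : ZMod M)⁻¹ * χ b = 1 := by
      rw [← map_mul, ZMod.inv_mul_of_unit _ hbu, map_one]
    have h2 : ‖χ b‖ = 1 := by
      have := χ.unit_norm_eq_one (ZMod.unitOfCoprime b hb)
      rwa [ZMod.coe_unitOfCoprime] at this
    rw [eq_inv_of_mul_eq_one_left h1, Complex.inv_eq_conj h2]
    rfl
  have hmain : ((M.totient * classSum n k M b 1 : ℝ) : ℂ) =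
      ∑ χ : DirichletCharacter ℂ M, star (χ b) * charSum n k (F χ) := by
    have h1 : ∀ χ : DirichletCharacter ℂ M, star (χ b) * charSum n k (F χ) =
        ∑ q ∈ primeRange n, (W n k q : ℂ) * (χ (b : ZMod M)⁻¹ * χ q) := fun χ => by
      rw [← hsum, ← hinv, mul_sum]
      exact sum_congr rfl fun q _ => by ring
    rw [sum_congr rfl fun χ _ => h1 χ, sum_comm, classSum]
    push_cast
    rw [sum_filter, mul_sum]
    refine sum_congr rfl fun q _ => ?_
    rw [← mul_sum, DirichletCharacter.sum_char_inv_mul_char_eq ℂ hbu]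
    by_cases h : (q : ZMod M) = b
    · simp [h, mul_comm]
    · simp [h, Ne.symm h]
  have hone : ∀ (x : Σ r, DirichletCharacter ℂ r) (m : ℕ), x.1 = 1 → charVal x m = 1 := by
    rintro ⟨r, χ⟩ m rfl
    rw [charVal_natCast]
    simp [Subsingleton.elim (m : ZMod 1) 1]
  have hterm : ∀ χ : DirichletCharacter ℂ M, -ε ≤ (star (χ b) * charSum n k (F χ)).re := by
    intro χ
    rcases (hF1 χ).eq_or_lt with h1 | h1
    · have h2 : star (χ b) * charSum n k (F χ) = ((∑ q ∈ primeRange n, W n k q : ℝ) : ℂ) := by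
        rw [← hF' χ b hb, hone _ _ h1.symm, charSum, star_one, one_mul]
        push_cast
        exact sum_congr rfl fun q _ => by rw [hone _ _ h1.symm, mul_one]
      rw [h2, Complex.ofReal_re]
      have := sum_nonneg fun q (_ : q ∈ primeRange n) => W_nonneg n k q
      linarith
    · by_cases h2 : F χ = x₁
      · have h3 := hx₁ (h2 ▸ h1)
        rw [← h2, hF' χ b hb] at h3
        linarith
      · have h3 := hsmall (F χ) (hFp χ) h1 (Nat.le_of_dvd hM0 (by simpa using hFd χ)) h2
        have h4 : ‖star (χ b) * charSum n k (F χ)‖ ≤ ε := by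
          rw [norm_mul, norm_star]
          exact (mul_le_of_le_one_left (norm_nonneg _) (χ.norm_le_one _)).trans h3
        have := Complex.abs_re_le_norm (star (χ b) * charSum n k (F χ))
        have := abs_le.1 (this.trans h4)
        linarith
  have hre := congr_arg Complex.re hmain
  rw [Complex.ofReal_re, Complex.re_sum, ← add_sum_erase _ _ (mem_univ 1)] at hre
  have h1 : (star ((1 : DirichletCharacter ℂ M) b) * charSum n k (F 1)).re =
      ∑ q ∈ primeRange n, W n k q := by
    rw [← hsum, MulChar.one_apply hbu, star_one, one_mul, Complex.re_sum]
    refine sum_congr rfl fun q hq => ?_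
    have : IsUnit (q : ZMod M) :=
      (ZMod.isUnit_iff_coprime _ _).2 (coprime_of_mem_primeRange hq hM0.ne' hM)
    rw [MulChar.one_apply this, mul_one, Complex.ofReal_re]
  have h2 : -(M * ε) ≤ ∑ χ ∈ univ.erase (1 : DirichletCharacter ℂ M),
      (star (χ b) * charSum n k (F χ)).re := by
    have h3 := card_nsmul_le_sum (univ.erase (1 : DirichletCharacter ℂ M)) _ _ fun χ _ => hterm χ
    have h4 : ((univ.erase (1 : DirichletCharacter ℂ M)).card : ℝ) ≤ M := by
      have h5 : (univ : Finset (DirichletCharacter ℂ M)).card = M.totient := by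
        rw [card_univ, ← Nat.card_eq_fintype_card,
          DirichletCharacter.card_eq_totient_of_hasEnoughRootsOfUnity]
      exact_mod_cast (card_erase_le.trans h5.le).trans (Nat.totient_le M)
    rw [nsmul_eq_mul] at h3
    nlinarith
  rw [hre, h1]
  linarith

theorem eventually_exists_exceptional (A E : ℕ) : ∀ᶠ n : ℕ in atTop, ∃ k : ℕ,
    (k : ℝ) ≤ 49 / 100 * log n ∧ ∃ (x₁ : Σ r, DirichletCharacter ℂ r) (Q : ℝ),
      (1 ≤ x₁.1 ∧ x₁.2.IsPrimitive ∧ x₁.1 ≠ 5 ∧ (x₁.1 : ℝ) ≤ log n ^ (2 * E) ∧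
        ∀ m, star (charVal x₁ m) = charVal x₁ m) ∧
      (x₁.1 : ℝ) ^ 4 * log n ^ (2 * E) ≤ Q ∧ Q ≤ log n ^ (10 * E) ∧
      ∀ x : Σ r, DirichletCharacter ℂ r, x.2.IsPrimitive → 1 < x.1 → (x.1 : ℝ) ≤ Q → x ≠ x₁ →
        ‖charSum n k x‖ ≤ (log n ^ A)⁻¹ := by
  have hlog := tendsto_log_atTop.comp (tendsto_natCast_atTop_atTop (R := ℝ))
  filter_upwards [exists_small_conductor A (10 * E), hlog.eventually_ge_atTop 1] with n hn hL
  have hL : 1 ≤ log n := hL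
  obtain ⟨k, hk, x₁, ⟨h1, h2, h3, h4, h5⟩, hs⟩ := hn
  refine ⟨k, hk, ?_⟩
  by_cases hx : (x₁.1 : ℝ) ≤ log n ^ (2 * E)
  · refine ⟨x₁, log n ^ (10 * E), ⟨h1, h2, h3, hx, h5⟩, ?_, le_rfl, hs⟩
    calc (x₁.1 : ℝ) ^ 4 * log n ^ (2 * E) ≤ (log n ^ (2 * E)) ^ 4 * log n ^ (2 * E) := by gcongr
      _ = _ := by rw [← pow_mul, ← pow_add]; congr 1; ring
  · refine ⟨⟨1, 1⟩, log n ^ (2 * E), ⟨le_rfl, DirichletCharacter.isPrimitive_one_level_one,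
      by simp, by simpa using one_le_pow₀ hL, ?_⟩, by simp, pow_le_pow_right₀ hL (by lia), ?_⟩
    · intro m
      simp [charVal, Subsingleton.elim (m : ZMod 1) 1]
    · intro x hxp hx1 hxQ _
      refine hs x hxp hx1 (hxQ.trans (pow_le_pow_right₀ hL (by lia))) ?_
      rintro rfl
      exact hx hxQ

lemma exists_modulus {n : ℕ} (hn : n % 6 = 0 ∨ n % 6 = 2) {x₁ : Σ r, DirichletCharacter ℂ r}
    (h1 : 1 ≤ x₁.1) (hp : x₁.2.IsPrimitive) (h5 : x₁.1 ≠ 5)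
    (hreal : ∀ m, star (charVal x₁ m) = charVal x₁ m) (p₀ : ℕ) (z : ℂ) :
    ∃ M b : ℕ, M ≠ 0 ∧ x₁.1 ∣ M ∧ M ≤ (∏ p ∈ Icc 1 p₀, p) * x₁.1 ∧
      (∀ p, p.Prime → p ≤ p₀ → p ∣ M) ∧ (∀ p, p.Prime → p ∣ M → IsGood n p b) ∧
      (1 < x₁.1 → 0 ≤ (star (charVal x₁ b) * z).re) := by
  obtain ⟨r, χ⟩ := x₁
  simp only at h1 hp h5 ⊢
  have hreal' : ∀ b : ℕ, star (χ b) = χ b := fun b => by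
    have := hreal b
    rwa [charVal_natCast] at this
  have hbr : ∃ b₀ : ℕ, (∀ p, p.Prime → p ∣ r → IsGood n p b₀) ∧
      (1 < r → 0 ≤ (star (χ b₀) * z).re) := by
    rcases h1.eq_or_lt with rfl | hr
    · exact ⟨0, fun p hp h => absurd (Nat.dvd_one.1 h) hp.one_lt.ne', by simp⟩
    · obtain ⟨b, b', hb, hb', hbb⟩ := exists_isGood_opposite hn hp hr h5 hreal'
      by_cases h0 : 0 ≤ (star (χ b) * z).re
      · exact ⟨b, hb, fun _ => h0⟩
      · refine ⟨b', hb', fun _ => ?_⟩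
        rw [eq_neg_of_add_eq_zero_right hbb, star_neg, neg_mul, Complex.neg_re]
        linarith
  obtain ⟨b₀, hb₀, hsign⟩ := hbr
  set S := (Icc 1 p₀).filter fun p => p.Prime ∧ ¬ p ∣ r with hS
  have hSp : ∀ p ∈ S, p.Prime ∧ ¬ p ∣ r := fun p hp => (mem_filter.1 hp).2
  obtain ⟨b, hb, hbS⟩ := exists_modEq_isGood hn r b₀ hSp
  refine ⟨r * ∏ p ∈ S, p, b, ?_, Nat.dvd_mul_right _ _, ?_, ?_, ?_, ?_⟩
  · exact mul_ne_zero (by lia) (prod_ne_zero_iff.2 fun p hp => (hSp p hp).1.ne_zero)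
  · rw [mul_comm]
    refine Nat.mul_le_mul_right r (prod_le_prod_of_subset_of_one_le' (filter_subset _ _) ?_)
    exact fun p hp _ => (mem_Icc.1 hp).1
  · intro p hp hpp
    by_cases hpr : p ∣ r
    · exact hpr.mul_right _
    · exact (dvd_prod_of_mem _ (mem_filter.2 ⟨mem_Icc.2 ⟨hp.one_le, hpp⟩, hp, hpr⟩)).mul_left _
  · intro p hp hpM
    rcases (Nat.Prime.dvd_mul hp).1 hpM with h | h
    · exact (hb₀ p hp h).congr (hb.of_dvd h)
    · obtain ⟨q, hq, hpq⟩ := (Prime.dvd_finsetProd_iff hp.prime _).1 h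
      rw [(Nat.prime_dvd_prime_iff_eq hp (hSp q hq).1).1 hpq]
      exact hbS q hq
  · intro hr
    rw [charVal_natCast, (ZMod.natCast_eq_natCast_iff _ _ _).2 hb]
    exact hsign hr

theorem exists_sum_conductor_le : ∃ C : ℝ, 1 ≤ C ∧ ∀ (v Q ε : ℝ) (R n k M : ℕ)
    (x₁ : Σ r, DirichletCharacter ℂ r), 1 ≤ v → (n : ℝ) = v ^ 2000 → 1 ≤ Q → 0 ≤ ε →
      (R : ℝ) ≤ v ^ 445 → k ≤ 49 / 100 * log n → x₁.1 ∣ M →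
      (∀ x : Σ r, DirichletCharacter ℂ r, x.2.IsPrimitive → 1 < x.1 → (x.1 : ℝ) ≤ Q → x ≠ x₁ →
        ‖charSum n k x‖ ≤ ε) →
      ∑ x ∈ primCharsUpTo R with ¬ x.1 ∣ M, ‖charSum n k x‖ * ((72 : ℝ) ^ ω x.1 / x.1) ≤
        C * (Q ^ 2 * ε + (1 + log n) ^ 7 * (Q ^ (-(99 / 100) : ℝ) + v⁻¹)) := by
  obtain ⟨C₁, hC₁, h1⟩ := exists_sum_large_conductor
  obtain ⟨C₂, hC₂, h2⟩ := pow_omega_le 72 one_pos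
  push_cast at h2
  refine ⟨C₁ + C₂, by linarith, fun v Q ε R n k M x₁ hv hn hQ hε hR hk hM hs => ?_⟩
  have hlog : 0 ≤ log n := log_natCast_nonneg n
  have hpos : 0 ≤ (1 + log n) ^ 7 * (Q ^ (-(99 / 100) : ℝ) + v⁻¹) := by positivity
  have hsmall : ∑ x ∈ primCharsUpTo R with ¬ x.1 ∣ M ∧ (x.1 : ℝ) ≤ Q,
      ‖charSum n k x‖ * ((72 : ℝ) ^ ω x.1 / x.1) ≤ C₂ * (Q ^ 2 * ε) := by
    have hterm : ∀ x ∈ (primCharsUpTo R).filter fun x => ¬ x.1 ∣ M ∧ (x.1 : ℝ) ≤ Q,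
        ‖charSum n k x‖ * ((72 : ℝ) ^ ω x.1 / x.1) ≤ ε * C₂ := by
      intro x hx
      obtain ⟨hx1, hx2, hx3⟩ := mem_filter.1 hx
      obtain ⟨⟨hx4, -⟩, hx5⟩ := mem_primCharsUpTo.1 hx1
      have hx6 : 1 < x.1 := lt_of_le_of_ne hx4 fun h => hx2 (h ▸ one_dvd M)
      have hx0 : (0 : ℝ) < x.1 := by exact_mod_cast hx4
      refine mul_le_mul (hs x hx5 hx6 hx3 fun h => hx2 (h ▸ hM)) ?_ (by positivity) hε
      rw [div_le_iff₀ hx0]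
      simpa using h2 x.1 (by lia)
    have hcard : ((primCharsUpTo R).filter fun x => ¬ x.1 ∣ M ∧ (x.1 : ℝ) ≤ Q).card ≤
        (⌊Q⌋₊ : ℝ) ^ 2 := by
      have := card_primCharsUpTo_le ⌊Q⌋₊
      refine le_trans (b := ((primCharsUpTo ⌊Q⌋₊).card : ℝ)) ?_ (by exact_mod_cast this)
      norm_cast
      refine card_le_card fun x hx => ?_
      obtain ⟨hx1, hx2, hx3⟩ := mem_filter.1 hx
      obtain ⟨⟨hx4, -⟩, hx5⟩ := mem_primCharsUpTo.1 hx1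
      exact mem_primCharsUpTo.2 ⟨⟨hx4, Nat.le_floor hx3⟩, hx5⟩
    calc _ ≤ _ := sum_le_card_nsmul _ _ _ hterm
      _ ≤ Q ^ 2 * (ε * C₂) := by
        rw [nsmul_eq_mul]
        gcongr
        refine hcard.trans ?_
        gcongr
        exact Nat.floor_le (by linarith)
      _ = _ := by ring
  have hlarge : ∑ x ∈ primCharsUpTo R with ¬ x.1 ∣ M ∧ ¬ (x.1 : ℝ) ≤ Q,
      ‖charSum n k x‖ * ((72 : ℝ) ^ ω x.1 / x.1) ≤
        C₁ * (1 + log n) ^ 7 * (Q ^ (-(99 / 100) : ℝ) + v⁻¹) := by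
    refine le_trans (sum_le_sum_of_subset_of_nonneg ?_ fun _ _ _ => by positivity)
      (h1 v Q R n k hv hn hQ hR hk)
    intro x hx
    obtain ⟨hx1, hx2, hx3⟩ := mem_filter.1 hx
    exact mem_filter.2 ⟨hx1, not_le.1 hx3⟩
  rw [← sum_filter_add_sum_filter_not _ (fun x => (x.1 : ℝ) ≤ Q), filter_filter, filter_filter]
  have h3 : 0 ≤ Q ^ 2 * ε := by positivity
  nlinarith

set_option maxHeartbeats 800000 in
theorem eventually_exists_class (p₀ A : ℕ) : ∀ᶠ n : ℕ in atTop, (n % 6 = 0 ∨ n % 6 = 2) →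
    ∃ M b k : ℕ, M ≠ 0 ∧ (∀ p, p.Prime → p ≤ p₀ → p ∣ M) ∧
      (∀ p, p.Prime → p ∣ M → IsGood n p b) ∧
      1 ≤ classSum n k M b 1 * (n : ℝ) ^ (1 / 2000 : ℝ) ∧
      (∑ d ∈ Icc 1 ⌊((n : ℝ) ^ (1 / 2000 : ℝ)) ^ 444⌋₊ with Squarefree d ∧ d.Coprime (M * n),
        (18 : ℝ) ^ ω d * |classSum n k M b d - rootCount n d / d.totient * classSum n k M b 1|) *
        log n ^ A ≤ classSum n k M b 1 := by
  set C₀ : ℝ := ((∏ p ∈ Icc 1 p₀, p : ℕ) : ℝ) with hC₀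
  have hC₀1 : 1 ≤ C₀ := by
    rw [hC₀]
    exact_mod_cast Nat.one_le_iff_ne_zero.2 (prod_ne_zero_iff.2 fun p hp => by
      have := (mem_Icc.1 hp).1
      lia)
  obtain ⟨C, hC, hsum⟩ := exists_sum_conductor_le
  obtain ⟨E, hE⟩ : ∃ E, E = A + 80 := ⟨_, rfl⟩
  obtain ⟨K, hK⟩ : ∃ K : ℝ, K = 16 * 2 ^ 79 * 3 * C₀ ^ 2 * C := ⟨_, rfl⟩
  have hlog := tendsto_log_atTop.comp (tendsto_natCast_atTop_atTop (R := ℝ))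
  have hv : ∀ᶠ n : ℕ in atTop, log n ^ (21 * E) ≤ (n : ℝ) ^ (1 / 2000 : ℝ) := by
    have h1 := (isLittleO_pow_exp_pos_mul_atTop (k := 21 * E)
      (by norm_num : (0 : ℝ) < 1 / 2000)).bound one_pos
    filter_upwards [hlog.eventually h1, hlog.eventually_ge_atTop 1, eventually_ge_atTop 1]
      with n h h2 hn
    simp only [Function.comp_apply] at h h2
    rw [norm_of_nonneg (by positivity), norm_of_nonneg (by positivity), one_mul, mul_comm _ (log _),
      ← rpow_def_of_pos (by exact_mod_cast hn)] at h
    exact h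
  filter_upwards [eventually_exists_exceptional (41 * E) E, hlog.eventually_ge_atTop 16,
    hlog.eventually_ge_atTop C₀, hlog.eventually_ge_atTop K, hv, eventually_ge_atTop 1,
    eventually_le_sum_W] with n hex hT hTC hTK hv hn hW h6
  simp only [Function.comp_apply] at hT hTC hTK
  obtain ⟨k, hk, x₁, Q, ⟨h1, h2, h3, h4, h5⟩, hQ1, hQ2, hs⟩ := hex
  obtain ⟨M, b, hM0, hxM, hMle, hMp, hgood, hsign⟩ := exists_modulus h6 h1 h2 h3 h5 p₀ (charSum n k x₁)
  have hn1 : (1 : ℝ) ≤ n := by exact_mod_cast hn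
  set v := (n : ℝ) ^ (1 / 2000 : ℝ) with hvdef
  have hv2000 : (n : ℝ) = v ^ 2000 := by
    rw [hvdef, ← rpow_natCast, ← rpow_mul (by positivity)]
    norm_num
  have hv1 : 1 ≤ v := one_le_rpow hn1 (by norm_num)
  set T := log n with hTdef
  set r : ℝ := (x₁.1 : ℝ) with hr
  have hr1 : 1 ≤ r := by rw [hr]; exact_mod_cast h1
  have hMr : (M : ℝ) ≤ C₀ * r := by
    rw [hC₀, hr]
    exact_mod_cast hMle
  have hT1 : 1 ≤ T := by linarith
  have hE1 : 1 ≤ 2 * E := by lia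
  have hM1 : (1 : ℝ) ≤ M := by exact_mod_cast Nat.one_le_iff_ne_zero.2 hM0
  have hMQ : M ≤ Q := calc
    (M : ℝ) ≤ T ^ 1 * r ^ 1 := by
      rw [pow_one, pow_one]
      exact hMr.trans (by gcongr)
    _ ≤ T ^ (2 * E) * r ^ 4 := by
      gcongr
      norm_num
    _ ≤ Q := by linarith
  have hQone : 1 ≤ Q := hM1.trans hMQ
  have hMv : 16 * (M : ℝ) ≤ v := calc
    16 * (M : ℝ) ≤ T * T ^ (10 * E) := by gcongr; exact hMQ.trans hQ2
    _ = T ^ (10 * E + 1) := by ring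
    _ ≤ T ^ (21 * E) := pow_le_pow_right₀ hT1 (by lia)
    _ ≤ v := hv
  have hn49 : ∀ N : ℕ, N ≤ 980 → v ^ N ≤ (n : ℝ) ^ (49 / 100 : ℝ) := fun N hN => by
    have : (n : ℝ) ^ (49 / 100 : ℝ) = v ^ 980 := by
      rw [hvdef, ← rpow_natCast, ← rpow_mul (by positivity)]
      norm_num
    rw [this]
    exact pow_le_pow_right₀ hv1 hN
  have hbM : b.Coprime M := coprime_of_isGood hgood
  have : NeZero M := ⟨hM0⟩
  set ε := (T ^ (41 * E))⁻¹ with hε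
  have hε0 : 0 ≤ ε := by positivity
  have hεeq : ∀ a, a ≤ 41 * E → T ^ a * ε = (T ^ (41 * E - a))⁻¹ := fun a ha => by
    rw [hε, ← Nat.sub_add_cancel ha, pow_add, Nat.add_sub_cancel]
    field_simp
  have hMε : M * ε ≤ 1 / 16 := calc
    M * ε ≤ T ^ (10 * E) * ε := by gcongr; exact hMQ.trans hQ2
    _ = (T ^ (41 * E - 10 * E))⁻¹ := hεeq _ (by lia)
    _ ≤ (T ^ 1)⁻¹ := by exact inv_anti₀ (by positivity) (pow_le_pow_right₀ hT1 (by lia))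
    _ ≤ 1 / 16 := by rw [pow_one, one_div]; gcongr
  have hX := le_totient_mul_classSum (k := k) hbM (((by linarith : (M : ℝ) ≤ v ^ 1)).trans (hn49 1 (by norm_num))) hε0
    hsign fun x hx hx1 hxM hne => hs x hx hx1 (le_trans (by exact_mod_cast hxM) hMQ) hne
  set X := classSum n k M b 1 with hXdef
  have hX0 : 0 ≤ X := sum_nonneg fun _ _ => W_nonneg _ _ _
  have hMX : 1 ≤ 16 * M * X := by
    have h7 := hW k hk
    have h8 : (M.totient : ℝ) ≤ M := by exact_mod_cast Nat.totient_le M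
    nlinarith [mul_le_mul_of_nonneg_right h8 hX0]
  refine ⟨M, b, k, hM0, hMp, hgood, ?_, ?_⟩
  · nlinarith
  set D := ⌊v ^ 444⌋₊ with hD
  have hDle : (D : ℝ) ≤ v ^ 444 := Nat.floor_le (by positivity)
  have hD1 : M * D ≤ ⌊v ^ 445⌋₊ := by
    refine Nat.le_floor ?_
    push_cast
    rw [show v ^ 445 = v * v ^ 444 by ring]
    gcongr
    linarith
  have hR : ((⌊v ^ 445⌋₊ : ℕ) : ℝ) ≤ v ^ 445 := Nat.floor_le (by positivity)
  have h7 := sum_abs_classSum_sub_le (k := k) hM0 hbM hD1 (hR.trans (hn49 445 (by norm_num)))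
  have h8 := hsum v Q ε ⌊v ^ 445⌋₊ n k M x₁ hv1 hv2000 hQone hε0 hR hk hxM hs
  have hlogD : log D ≤ T := by
    rcases Nat.eq_zero_or_pos D with h | h
    · rw [h]
      simp
      linarith
    · refine log_le_log (by exact_mod_cast h) (hDle.trans ?_)
      rw [hv2000]
      exact pow_le_pow_right₀ hv1 (by norm_num)
  have hQr : (M : ℝ) ^ 2 * Q ^ (-(99 / 100) : ℝ) ≤ C₀ ^ 2 * (T ^ E)⁻¹ := by
    have h9 : Q ^ (-(99 / 100) : ℝ) ≤ (r ^ 2 * T ^ E)⁻¹ := by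
      calc Q ^ (-(99 / 100) : ℝ) ≤ Q ^ (-(1 / 2) : ℝ) :=
            rpow_le_rpow_of_exponent_le hQone (by norm_num)
        _ = (sqrt Q)⁻¹ := by rw [rpow_neg (by linarith), sqrt_eq_rpow]
        _ ≤ _ := by
            gcongr
            refine le_sqrt_of_sq_le (le_trans (le_of_eq ?_) hQ1)
            ring
    calc (M : ℝ) ^ 2 * Q ^ (-(99 / 100) : ℝ) ≤ (C₀ * r) ^ 2 * (r ^ 2 * T ^ E)⁻¹ := by gcongr
      _ = _ := by field_simp
  have hQε : (M : ℝ) ^ 2 * (Q ^ 2 * ε) ≤ C₀ ^ 2 * (T ^ E)⁻¹ := by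
    calc (M : ℝ) ^ 2 * (Q ^ 2 * ε) ≤ Q ^ 2 * (Q ^ 2 * ε) := by gcongr
      _ = Q ^ 4 * ε := by ring
      _ ≤ (T ^ (10 * E)) ^ 4 * ε := by gcongr
      _ = T ^ (40 * E) * ε := by rw [← pow_mul]; congr 2; ring
      _ = (T ^ E)⁻¹ := by rw [hεeq _ (by lia)]; congr 2; lia
      _ ≤ _ := le_mul_of_one_le_left (by positivity) (one_le_pow₀ hC₀1)
  have hMv2 : (M : ℝ) ^ 2 * v⁻¹ ≤ C₀ ^ 2 * (T ^ E)⁻¹ := by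
    calc (M : ℝ) ^ 2 * v⁻¹ ≤ (T ^ (10 * E)) ^ 2 * (T ^ (21 * E))⁻¹ := by
          gcongr
          exact hMQ.trans hQ2
      _ = (T ^ E)⁻¹ := by
          rw [← pow_mul, show 21 * E = 10 * E * 2 + E by ring, pow_add]
          field_simp
      _ ≤ _ := le_mul_of_one_le_left (by positivity) (one_le_pow₀ hC₀1)
  set S := ∑ d ∈ Icc 1 D with Squarefree d ∧ d.Coprime (M * n), (18 : ℝ) ^ ω d *
    |classSum n k M b d - rootCount n d / d.totient * X| with hS
  set q := (T ^ E)⁻¹ with hq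
  have hq0 : 0 ≤ q := by positivity
  have hfin : M * S ≤ (2 * T) ^ 79 * (3 * C₀ ^ 2 * C) * q := by
    have hlD : 0 ≤ log D := log_natCast_nonneg D
    calc M * S ≤ M * (M * (1 + log D) ^ 72 *
          (C * (Q ^ 2 * ε + (1 + T) ^ 7 * (Q ^ (-(99 / 100) : ℝ) + v⁻¹)))) := by
          gcongr
          exact h7.trans (mul_le_mul_of_nonneg_left h8 (by positivity))
      _ ≤ M * (M * (2 * T) ^ 72 * (C * ((2 * T) ^ 7 * (Q ^ 2 * ε) +
          (2 * T) ^ 7 * (Q ^ (-(99 / 100) : ℝ) + v⁻¹)))) := by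
          have h9 : Q ^ 2 * ε ≤ (2 * T) ^ 7 * (Q ^ 2 * ε) :=
            le_mul_of_one_le_left (by positivity) (one_le_pow₀ (by linarith))
          have h10 : 1 + log D ≤ 2 * T := by linarith
          have h11 : 1 + T ≤ 2 * T := by linarith
          gcongr
      _ = (2 * T) ^ 79 * C * ((M : ℝ) ^ 2 * (Q ^ 2 * ε) + (M : ℝ) ^ 2 * Q ^ (-(99 / 100) : ℝ) +
          (M : ℝ) ^ 2 * v⁻¹) := by ring
      _ ≤ (2 * T) ^ 79 * C * (C₀ ^ 2 * q + C₀ ^ 2 * q + C₀ ^ 2 * q) := by gcongr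
      _ = _ := by ring
  have hS0 : 0 ≤ S := sum_nonneg fun _ _ => by positivity
  have hone : 16 * M * S * T ^ A ≤ 1 := by
    calc 16 * M * S * T ^ A = 16 * (M * S) * T ^ A := by ring
      _ ≤ 16 * ((2 * T) ^ 79 * (3 * C₀ ^ 2 * C) * q) * T ^ A := by gcongr
      _ = K * (T ^ (A + 79) * q) := by rw [hK, pow_add, mul_pow]; ring
      _ = K * T⁻¹ := by
          rw [hq, hE, show A + 80 = A + 79 + 1 by ring, pow_succ T (A + 79)]
          congr 1
          field_simp
      _ ≤ T * T⁻¹ := by gcongr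
      _ = 1 := mul_inv_cancel₀ (by linarith)
  have : 16 * M * (S * T ^ A) ≤ 16 * M * X := by linarith
  exact le_of_mul_le_mul_left this (by positivity)

/-- Expectation of `F` over the random subset of `P` containing each `p` independently with
probability `g p`. -/
noncomputable def expect (P : Finset ℕ) (g : ℕ → ℝ) (F : Finset ℕ → ℝ) : ℝ :=
  ∑ H ∈ P.powerset, (∏ p ∈ H, g p) * (∏ p ∈ P \ H, (1 - g p)) * F H

lemma expect_sum {P : Finset ℕ} {g : ℕ → ℝ} {α : Type*} (s : Finset α)
    (F : α → Finset ℕ → ℝ) :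
    expect P g (fun H => ∑ i ∈ s, F i H) = ∑ i ∈ s, expect P g (F i) := by
  simp only [expect, mul_sum]
  exact sum_comm

lemma expect_const_mul {P : Finset ℕ} {g : ℕ → ℝ} (c : ℝ) (F : Finset ℕ → ℝ) :
    expect P g (fun H => c * F H) = c * expect P g F := by
  simp only [expect, mul_sum]
  exact sum_congr rfl fun _ _ => by ring

lemma expect_congr {P : Finset ℕ} {g : ℕ → ℝ} {F F' : Finset ℕ → ℝ}
    (h : ∀ H ⊆ P, F H = F' H) : expect P g F = expect P g F' :=
  sum_congr rfl fun H hH => by rw [h H (mem_powerset.1 hH)]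

lemma expect_prod (P : Finset ℕ) (g f₁ f₀ : ℕ → ℝ) :
    expect P g (fun H => ∏ p ∈ P, if p ∈ H then f₁ p else f₀ p) =
      ∏ p ∈ P, (g p * f₁ p + (1 - g p) * f₀ p) := by
  rw [prod_add, expect]
  refine sum_congr rfl fun H hH => ?_
  rw [← prod_sdiff (mem_powerset.1 hH), prod_mul_distrib, prod_mul_distrib,
    prod_congr rfl fun p hp => if_neg (mem_sdiff.1 hp).2, prod_congr rfl fun p hp => if_pos hp]
  ring

lemma expect_subset {P D : Finset ℕ} (hD : D ⊆ P) (g : ℕ → ℝ) :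
    expect P g (fun H => if D ⊆ H then 1 else 0) = ∏ p ∈ D, g p := by
  have h1 : ∀ H, (if D ⊆ H then (1 : ℝ) else 0) =
      ∏ p ∈ P, if p ∈ H then 1 else if p ∈ D then 0 else 1 := by
    intro H
    split_ifs with h
    · refine (prod_eq_one fun p _ => ?_).symm
      split_ifs with h1 h2 <;> first | rfl | exact absurd (h h2) h1
    · obtain ⟨p, hp, hpH⟩ := not_subset.1 h
      exact (prod_eq_zero (hD hp) (by simp [hpH, hp])).symm
  rw [expect_congr fun H _ => h1 H, expect_prod, ← prod_sdiff hD,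
    prod_eq_one fun p hp => by simp [(mem_sdiff.1 hp).2], one_mul]
  exact prod_congr rfl fun p hp => by simp [hp]

/-- The orthogonal system attached to the random subset with inclusion probabilities `g`. -/
noncomputable def basisFn (g : ℕ → ℝ) (S H : Finset ℕ) : ℝ :=
  ∏ p ∈ S, if p ∈ H then 1 - 1 / g p else 1

/-- The odds `g / (1 - g)`. -/
noncomputable def odds (g : ℕ → ℝ) (p : ℕ) : ℝ := g p / (1 - g p)

lemma expect_basisFn_mul {P K S T : Finset ℕ} {g : ℕ → ℝ} (hg : ∀ p ∈ P, 0 < g p ∧ g p < 1)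
    (hK : K ⊆ P) (hS : S ⊆ P \ K) (hT : T ⊆ P \ K) :
    expect P g (fun H => (if K ⊆ H then 1 else 0) * (basisFn g S H * basisFn g T H)) =
      (∏ p ∈ K, g p) * if S = T then ∏ p ∈ S, (odds g p)⁻¹ else 0 := by
  have hSP := hS.trans sdiff_subset
  have hTP := hT.trans sdiff_subset
  have hfun : ∀ H, (if K ⊆ H then 1 else 0) * (basisFn g S H * basisFn g T H) =
      ∏ p ∈ P, if p ∈ H then (if p ∈ S then 1 - 1 / g p else 1) * (if p ∈ T then 1 - 1 / g p else 1)
        else if p ∈ K then 0 else 1 := by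
    intro H
    split_ifs with h
    · have h1 : ∀ U ⊆ P, basisFn g U H =
          ∏ p ∈ P, if p ∈ U then (if p ∈ H then 1 - 1 / g p else 1) else 1 := fun U hU => by
        rw [← prod_filter (fun p => p ∈ U), filter_mem_eq_inter, inter_eq_right.2 hU, basisFn]
      rw [one_mul, h1 S hSP, h1 T hTP, ← prod_mul_distrib]
      refine prod_congr rfl fun p _ => ?_
      by_cases hpH : p ∈ H
      · simp [hpH]
      · have : p ∉ K := fun h2 => hpH (h h2)
        simp [hpH, this]
    · obtain ⟨p, hp, hpH⟩ := not_subset.1 h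
      rw [zero_mul]
      exact (prod_eq_zero (hK hp) (by simp [hpH, hp])).symm
  rw [expect_congr fun H _ => hfun H, expect_prod]
  have hval : ∀ p ∈ P, g p * ((if p ∈ S then 1 - 1 / g p else 1) * (if p ∈ T then 1 - 1 / g p else 1))
      + (1 - g p) * (if p ∈ K then 0 else 1) = (if p ∈ K then g p else 1) *
        if p ∈ S then (if p ∈ T then (odds g p)⁻¹ else 0) else (if p ∈ T then 0 else 1) := by
    intro p hp
    obtain ⟨h0, h1⟩ := hg p hp
    have h2 : 1 - g p ≠ 0 := by linarith
    have h3 : p ∈ K → p ∉ S ∧ p ∉ T := fun h =>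
      ⟨fun hS' => (mem_sdiff.1 (hS hS')).2 h, fun hT' => (mem_sdiff.1 (hT hT')).2 h⟩
    by_cases hpK : p ∈ K
    · simp [hpK, h3 hpK]
    · by_cases hpS : p ∈ S <;> by_cases hpT : p ∈ T <;> simp only [hpK, hpS, hpT, if_true, if_false,
        odds] <;> field_simp <;> ring
  rw [prod_congr rfl hval, prod_mul_distrib]
  congr 1
  · rw [← prod_filter, filter_mem_eq_inter, inter_eq_right.2 hK]
  · split_ifs with h
    · subst h
      rw [prod_congr rfl (g := fun p => if p ∈ S then (odds g p)⁻¹ else 1)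
        (fun p _ => by split_ifs <;> rfl), ← prod_filter, filter_mem_eq_inter,
        inter_eq_right.2 hSP]
    · have h1 : ¬ ∀ p, p ∈ S ↔ p ∈ T := fun h2 => h (ext h2)
      push Not at h1
      obtain ⟨p, h2 | h2⟩ := h1
      · exact prod_eq_zero (hSP h2.1) (by simp [h2])
      · exact prod_eq_zero (hTP h2.2) (by simp [h2])

lemma expect_sq {P K : Finset ℕ} {g : ℕ → ℝ} (hg : ∀ p ∈ P, 0 < g p ∧ g p < 1) (hK : K ⊆ P)
    (a : Finset ℕ → ℝ) :
    expect P g (fun H => (if K ⊆ H then 1 else 0) *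
      (∑ S ∈ (P \ K).powerset, (∏ p ∈ S, odds g p) * a S * basisFn g S H) ^ 2) =
      (∏ p ∈ K, g p) * ∑ S ∈ (P \ K).powerset, (∏ p ∈ S, odds g p) * a S ^ 2 := by
  have h1 : ∀ H, (if K ⊆ H then (1 : ℝ) else 0) *
      (∑ S ∈ (P \ K).powerset, (∏ p ∈ S, odds g p) * a S * basisFn g S H) ^ 2 =
      ∑ S ∈ (P \ K).powerset, ∑ T ∈ (P \ K).powerset,
        ((∏ p ∈ S, odds g p) * a S * ((∏ p ∈ T, odds g p) * a T)) *
        ((if K ⊆ H then 1 else 0) * (basisFn g S H * basisFn g T H)) := by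
    intro H
    rw [sq, sum_mul_sum, mul_sum]
    refine sum_congr rfl fun S _ => ?_
    rw [mul_sum]
    exact sum_congr rfl fun T _ => by ring
  rw [expect_congr fun H _ => h1 H, expect_sum, mul_sum]
  refine sum_congr rfl fun S hS => ?_
  rw [expect_sum]
  have h2 : ∀ T ∈ (P \ K).powerset, expect P g (fun H =>
      ((∏ p ∈ S, odds g p) * a S * ((∏ p ∈ T, odds g p) * a T)) *
        ((if K ⊆ H then 1 else 0) * (basisFn g S H * basisFn g T H))) =
      if S = T then (∏ p ∈ S, odds g p) * a S * ((∏ p ∈ T, odds g p) * a T) *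
        ((∏ p ∈ K, g p) * ∏ p ∈ S, (odds g p)⁻¹) else 0 := by
    intro T hT
    rw [expect_const_mul, expect_basisFn_mul hg hK (mem_powerset.1 hS) (mem_powerset.1 hT)]
    split_ifs <;> simp
  rw [sum_congr rfl h2, sum_ite_eq, if_pos hS, prod_inv_distrib]
  have h3 : ∏ p ∈ S, odds g p ≠ 0 := prod_ne_zero_iff.2 fun p hp => by
    obtain ⟨h4, h5⟩ := hg p ((mem_sdiff.1 (mem_powerset.1 hS hp)).1)
    have : 1 - g p ≠ 0 := by linarith
    exact div_ne_zero h4.ne' this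
  field_simp

/-- The sieve weight `∑ h(S) y_S ψ_S`. -/
noncomputable def sieveFn (P : Finset ℕ) (g : ℕ → ℝ) (y : Finset ℕ → ℝ) (H : Finset ℕ) : ℝ :=
  ∑ S ∈ P.powerset, (∏ p ∈ S, odds g p) * y S * basisFn g S H

lemma expect_sieveFn_sq {P : Finset ℕ} {g : ℕ → ℝ} (hg : ∀ p ∈ P, 0 < g p ∧ g p < 1)
    (y : Finset ℕ → ℝ) : expect P g (fun H => sieveFn P g y H ^ 2) =
      ∑ S ∈ P.powerset, (∏ p ∈ S, odds g p) * y S ^ 2 := by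
  simpa [sieveFn] using expect_sq hg (empty_subset P) y

lemma expect_mem_mul_sieveFn_sq {P : Finset ℕ} {g : ℕ → ℝ} (hg : ∀ p ∈ P, 0 < g p ∧ g p < 1)
    (y : Finset ℕ → ℝ) {p : ℕ} (hp : p ∈ P) :
    expect P g (fun H => (if {p} ⊆ H then 1 else 0) * sieveFn P g y H ^ 2) =
      g p * ∑ S ∈ (P \ {p}).powerset, (∏ p ∈ S, odds g p) * (y S - y (insert p S)) ^ 2 := by
  have h := expect_sq hg (singleton_subset_iff.2 hp) fun S => y S - y (insert p S)
  rw [prod_singleton] at h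
  rw [← h]
  refine expect_congr fun H _ => ?_
  split_ifs with hpH
  swap
  · simp
  congr 2
  have hpH' : p ∈ H := singleton_subset_iff.1 hpH
  obtain ⟨h0, h1⟩ := hg p hp
  have hno : p ∉ P \ {p} := by simp
  have hins : insert p (P \ {p}) = P := by
    rw [sdiff_singleton_eq_erase, insert_erase hp]
  rw [sieveFn]
  conv_lhs => rw [← hins]
  rw [sum_powerset_insert hno, ← sum_add_distrib]
  refine sum_congr rfl fun S hS => ?_
  have hpS : p ∉ S := fun h => hno (mem_powerset.1 hS h)
  have h2 : 1 - g p ≠ 0 := by linarith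
  rw [prod_insert hpS, basisFn, basisFn, prod_insert hpS, if_pos hpH', odds]
  field_simp
  ring

/-- The coefficient of the indicator of `D ⊆ H` in `sieveFn P g y H`. -/
noncomputable def coef (P : Finset ℕ) (g : ℕ → ℝ) (y : Finset ℕ → ℝ) (D : Finset ℕ) : ℝ :=
  (∏ p ∈ D, (-(1 / g p))) * ∑ S ∈ P.powerset with D ⊆ S, (∏ p ∈ S, odds g p) * y S

lemma basisFn_eq {P S : Finset ℕ} (hS : S ⊆ P) (g : ℕ → ℝ) (H : Finset ℕ) :
    basisFn g S H = ∑ D ∈ P.powerset, if D ⊆ S then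
      (∏ p ∈ D, (-(1 / g p))) * (if D ⊆ H then 1 else 0) else 0 := by
  have h1 : ∀ p ∈ S, (if p ∈ H then 1 - 1 / g p else 1) =
      1 + if p ∈ H then -(1 / g p) else 0 := fun p _ => by split_ifs <;> ring
  have h2 : P.powerset.filter (fun D => D ⊆ S) = S.powerset := by
    ext D
    simp only [mem_filter, mem_powerset]
    exact ⟨fun h => h.2, fun h => ⟨h.trans hS, h⟩⟩
  rw [basisFn, prod_congr rfl h1, prod_one_add, ← sum_filter, h2]
  refine sum_congr rfl fun D _ => ?_
  split_ifs with h
  · rw [mul_one]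
    exact prod_congr rfl fun p hp => if_pos (h hp)
  · obtain ⟨p, hp, hpH⟩ := not_subset.1 h
    rw [mul_zero]
    exact prod_eq_zero hp (if_neg hpH)

lemma sieveFn_eq (P : Finset ℕ) (g : ℕ → ℝ) (y : Finset ℕ → ℝ) (H : Finset ℕ) :
    sieveFn P g y H = ∑ D ∈ P.powerset, coef P g y D * if D ⊆ H then 1 else 0 := by
  have h1 : ∀ S ∈ P.powerset, (∏ p ∈ S, odds g p) * y S * basisFn g S H =
      ∑ D ∈ P.powerset, if D ⊆ S then (∏ p ∈ S, odds g p) * y S *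
        ((∏ p ∈ D, (-(1 / g p))) * (if D ⊆ H then 1 else 0)) else 0 := fun S hS => by
    rw [basisFn_eq (mem_powerset.1 hS), mul_sum]
    exact sum_congr rfl fun D _ => by rw [mul_ite, mul_zero]
  rw [sieveFn, sum_congr rfl h1, sum_comm]
  refine sum_congr rfl fun D _ => ?_
  rw [coef, ← sum_filter, mul_sum, sum_mul]
  exact sum_congr rfl fun S _ => by ring

lemma abs_sum_sub_expect_le {α : Type*} {P K : Finset ℕ} (hK : K ⊆ P) (g : ℕ → ℝ)
    (y : Finset ℕ → ℝ) (I : Finset α) (W : α → ℝ) (Hf : α → Finset ℕ) (X : ℝ) :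
    |∑ q ∈ I, W q * ((if K ⊆ Hf q then 1 else 0) * sieveFn P g y (Hf q) ^ 2) -
      X * expect P g fun H => (if K ⊆ H then 1 else 0) * sieveFn P g y H ^ 2| ≤
    ∑ D ∈ P.powerset, ∑ D' ∈ P.powerset, |coef P g y D| * |coef P g y D'| *
      |∑ q ∈ I with D ∪ D' ∪ K ⊆ Hf q, W q - X * ∏ p ∈ D ∪ D' ∪ K, g p| := by
  have h1 : ∀ H, (if K ⊆ H then 1 else 0) * sieveFn P g y H ^ 2 = ∑ D ∈ P.powerset,
      ∑ D' ∈ P.powerset, coef P g y D * coef P g y D' * if D ∪ D' ∪ K ⊆ H then 1 else 0 := by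
    intro H
    rw [sieveFn_eq, sq, sum_mul_sum, mul_sum]
    refine sum_congr rfl fun D _ => ?_
    rw [mul_sum]
    refine sum_congr rfl fun D' _ => ?_
    by_cases h2 : D ⊆ H <;> by_cases h3 : D' ⊆ H <;> by_cases h4 : K ⊆ H <;>
      simp [union_subset_iff, h2, h3, h4]
  have h2 : ∑ q ∈ I, W q * ((if K ⊆ Hf q then 1 else 0) * sieveFn P g y (Hf q) ^ 2) =
      ∑ D ∈ P.powerset, ∑ D' ∈ P.powerset, coef P g y D * coef P g y D' *
        ∑ q ∈ I with D ∪ D' ∪ K ⊆ Hf q, W q := by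
    simp only [h1, mul_sum]
    rw [sum_comm]
    refine sum_congr rfl fun D _ => ?_
    rw [sum_comm]
    refine sum_congr rfl fun D' _ => ?_
    rw [sum_filter]
    refine sum_congr rfl fun q _ => ?_
    split_ifs <;> ring
  have h3 : (expect P g fun H => (if K ⊆ H then 1 else 0) * sieveFn P g y H ^ 2) =
      ∑ D ∈ P.powerset, ∑ D' ∈ P.powerset, coef P g y D * coef P g y D' *
        ∏ p ∈ D ∪ D' ∪ K, g p := by
    rw [expect_congr fun H _ => h1 H, expect_sum]
    refine sum_congr rfl fun D hD => ?_
    rw [expect_sum]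
    refine sum_congr rfl fun D' hD' => ?_
    rw [expect_const_mul, expect_subset (union_subset (union_subset (mem_powerset.1 hD)
      (mem_powerset.1 hD')) hK)]
  rw [h2, h3, mul_sum, ← sum_sub_distrib]
  refine (abs_sum_le_sum_abs _ _).trans (sum_le_sum fun D _ => ?_)
  rw [mul_sum, ← sum_sub_distrib]
  refine (abs_sum_le_sum_abs _ _).trans (sum_le_sum fun D' _ => ?_)
  rw [← abs_mul, ← abs_mul]
  exact (congr_arg _ (by ring)).le

/-- The truncated linear weight attached to additive sizes `u`. -/
noncomputable def taper (u : ℕ → ℝ) (S : Finset ℕ) : ℝ := max 0 (1 - ∑ p ∈ S, u p)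

/-- The total mass of the odds on the sets of size less than one. -/
noncomputable def mass (P : Finset ℕ) (g u : ℕ → ℝ) : ℝ :=
  ∑ S ∈ P.powerset with ∑ p ∈ S, u p < 1, ∏ p ∈ S, odds g p

section

variable {P : Finset ℕ} {g u : ℕ → ℝ}

lemma odds_pos (hg : ∀ p ∈ P, 0 < g p ∧ g p ≤ 1 / 2) {p : ℕ} (hp : p ∈ P) : 0 < odds g p := by
  obtain ⟨h0, h1⟩ := hg p hp
  exact div_pos h0 (by linarith)

lemma prod_odds_pos (hg : ∀ p ∈ P, 0 < g p ∧ g p ≤ 1 / 2) {S : Finset ℕ} (hS : S ⊆ P) :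
    0 < ∏ p ∈ S, odds g p :=
  prod_pos fun _ hp => odds_pos hg (hS hp)

lemma taper_nonneg (S : Finset ℕ) : 0 ≤ taper u S := le_max_left _ _

lemma taper_le_one (hu : ∀ p ∈ P, 0 ≤ u p) {S : Finset ℕ} (hS : S ⊆ P) : taper u S ≤ 1 := by
  have := sum_nonneg fun p (hp : p ∈ S) => hu p (hS hp)
  exact max_le zero_le_one (by linarith)

lemma taper_eq_zero {S : Finset ℕ} (h : 1 ≤ ∑ p ∈ S, u p) : taper u S = 0 :=
  max_eq_left (by linarith)

lemma mass_nonneg (hg : ∀ p ∈ P, 0 < g p ∧ g p ≤ 1 / 2) : 0 ≤ mass P g u :=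
  sum_nonneg fun _ hS => (prod_odds_pos hg (mem_powerset.1 (mem_filter.1 hS).1)).le

lemma abs_coef_le (hg : ∀ p ∈ P, 0 < g p ∧ g p ≤ 1 / 2) (hu : ∀ p ∈ P, 0 ≤ u p) {D : Finset ℕ}
    (hD : D ⊆ P) : |coef P g (taper u) D| ≤
      if ∑ p ∈ D, u p < 1 then 2 ^ D.card * mass P g u else 0 := by
  have hmono : ∀ S ∈ P.powerset.filter (fun S => D ⊆ S), ∀ T ⊆ S, ∑ p ∈ T, u p ≤ ∑ p ∈ S, u p :=
    fun S hS T hT => sum_le_sum_of_subset_of_nonneg hT fun p hp _ =>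
      hu p (mem_powerset.1 (mem_filter.1 hS).1 hp)
  split_ifs with hD1
  swap
  · rw [coef, sum_eq_zero, mul_zero, abs_zero]
    intro S hS
    rw [taper_eq_zero ((not_lt.1 hD1).trans (hmono S hS D (mem_filter.1 hS).2)), mul_zero]
  have hsum : ∑ S ∈ P.powerset with D ⊆ S, (∏ p ∈ S, odds g p) * taper u S ≤
      (∏ p ∈ D, odds g p) * mass P g u := by
    have hterm : ∀ S ∈ P.powerset.filter (fun S => D ⊆ S), (∏ p ∈ S, odds g p) * taper u S ≤
        (∏ p ∈ D, odds g p) * (if ∑ p ∈ S \ D, u p < 1 then ∏ p ∈ S \ D, odds g p else 0) := by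
      intro S hS
      obtain ⟨hSP, hDS⟩ := mem_filter.1 hS
      have hSP := mem_powerset.1 hSP
      have h1 := prod_odds_pos hg hSP
      split_ifs with h2
      · rw [mul_comm (∏ p ∈ D, _), prod_sdiff hDS]
        exact mul_le_of_le_one_right h1.le (taper_le_one hu hSP)
      · rw [taper_eq_zero ((not_lt.1 h2).trans (hmono S hS _ sdiff_subset)), mul_zero, mul_zero]
    refine (sum_le_sum hterm).trans ?_
    rw [← mul_sum]
    refine mul_le_mul_of_nonneg_left ?_ (prod_odds_pos hg hD).le
    have hinj : Set.InjOn (fun S => S \ D) (P.powerset.filter fun S => D ⊆ S : Finset (Finset ℕ)) := by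
      intro S hS T hT h
      have hS := (mem_filter.1 hS).2
      have hT := (mem_filter.1 hT).2
      simp only at h
      rw [← sdiff_union_of_subset hS, h, sdiff_union_of_subset hT]
    rw [← sum_image (f := fun T => if ∑ p ∈ T, u p < 1 then ∏ p ∈ T, odds g p else 0) hinj, mass,
      sum_filter (fun S => ∑ p ∈ S, u p < 1)]
    refine sum_le_sum_of_subset_of_nonneg ?_ ?_
    · intro T hT
      obtain ⟨S, hS, rfl⟩ := mem_image.1 hT
      exact mem_powerset.2 (sdiff_subset.trans (mem_powerset.1 (mem_filter.1 hS).1))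
    · intro T hT _
      split_ifs
      · exact (prod_odds_pos hg (mem_powerset.1 hT)).le
      · exact le_rfl
  have h0 : 0 ≤ ∑ S ∈ P.powerset with D ⊆ S, (∏ p ∈ S, odds g p) * taper u S :=
    sum_nonneg fun S hS => mul_nonneg
      (prod_odds_pos hg (mem_powerset.1 (mem_filter.1 hS).1)).le (taper_nonneg S)
  rw [coef, abs_mul, abs_of_nonneg h0, abs_prod]
  calc _ ≤ (∏ p ∈ D, |-(1 / g p)|) * ((∏ p ∈ D, odds g p) * mass P g u) :=
        mul_le_mul_of_nonneg_left hsum (prod_nonneg fun _ _ => abs_nonneg _)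
    _ = (∏ p ∈ D, |-(1 / g p)| * odds g p) * mass P g u := by rw [prod_mul_distrib, mul_assoc]
    _ ≤ (∏ p ∈ D, 2) * mass P g u := by
        refine mul_le_mul_of_nonneg_right (prod_le_prod (fun p hp =>
          mul_nonneg (abs_nonneg _) (odds_pos hg (hD hp)).le) fun p hp => ?_) (mass_nonneg hg)
        obtain ⟨h3, h4⟩ := hg p (hD hp)
        rw [abs_neg, abs_of_pos (by positivity), odds, ← mul_div_assoc, one_div,
          inv_mul_cancel₀ h3.ne', div_le_iff₀ (by linarith)]
        linarith
    _ = _ := by rw [prod_const]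

lemma sum_powerset_pow (d : Finset ℕ) (c : ℝ) : ∑ D ∈ d.powerset, c ^ D.card = (1 + c) ^ d.card := by
  rw [← prod_const, prod_one_add]
  exact sum_congr rfl fun D _ => by rw [prod_const]

lemma abs_sieveFn_le (hg : ∀ p ∈ P, 0 < g p ∧ g p ≤ 1 / 2) (hu : ∀ p ∈ P, 0 ≤ u p) {H : Finset ℕ}
    (hH : H ⊆ P) : |sieveFn P g (taper u) H| ≤ mass P g u * 3 ^ H.card := by
  have h2 : P.powerset.filter (fun D => D ⊆ H) = H.powerset := by
    ext D
    simp only [mem_filter, mem_powerset]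
    exact ⟨fun h => h.2, fun h => ⟨h.trans hH, h⟩⟩
  have h3 := mass_nonneg (u := u) hg
  simp only [sieveFn_eq, mul_ite, mul_one, mul_zero]
  rw [← sum_filter, h2]
  calc _ ≤ ∑ D ∈ H.powerset, |coef P g (taper u) D| := abs_sum_le_sum_abs _ _
    _ ≤ ∑ D ∈ H.powerset, mass P g u * 2 ^ D.card := by
        refine sum_le_sum fun D hD => (abs_coef_le hg hu ((mem_powerset.1 hD).trans hH)).trans ?_
        split_ifs
        · rw [mul_comm]
        · positivity
    _ = _ := by rw [← mul_sum, sum_powerset_pow]; norm_num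

lemma sum_union_le (hu : ∀ p ∈ P, 0 ≤ u p) {S : Finset ℕ} (hS : S ⊆ P) (T : Finset ℕ) :
    ∑ p ∈ S ∪ T, u p ≤ ∑ p ∈ S, u p + ∑ p ∈ T, u p := by
  rw [← sum_union_inter]
  have := sum_nonneg fun p (hp : p ∈ S ∩ T) => hu p (hS (mem_inter.1 hp).1)
  linarith

theorem sum_coef_mul_le (hg : ∀ p ∈ P, 0 < g p ∧ g p ≤ 1 / 2) (hu : ∀ p ∈ P, 0 ≤ u p)
    {𝒦 : Finset (Finset ℕ)} (h𝒦 : ∀ K ∈ 𝒦, K ⊆ P ∧ ∑ p ∈ K, u p < 1) {f : Finset ℕ → ℝ}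
    (hf : ∀ d, 0 ≤ f d) :
    ∑ K ∈ 𝒦, ∑ D ∈ P.powerset, ∑ D' ∈ P.powerset,
      |coef P g (taper u) D| * |coef P g (taper u) D'| * f (D ∪ D' ∪ K) ≤
      mass P g u ^ 2 * ∑ d ∈ P.powerset with ∑ p ∈ d, u p < 3, 18 ^ d.card * f d := by
  set G := mass P g u with hG
  have hG0 : 0 ≤ G := mass_nonneg hg
  set 𝒟 := P.powerset.filter (fun S => ∑ p ∈ S, u p < 1) with h𝒟
  set 𝒯 := P.powerset.filter (fun S => ∑ p ∈ S, u p < 3) with h𝒯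
  have hc : ∀ D ∈ P.powerset, |coef P g (taper u) D| ≤ if ∑ p ∈ D, u p < 1 then 2 ^ D.card * G else 0 :=
    fun D hD => abs_coef_le hg hu (mem_powerset.1 hD)
  have hmaps : ∀ x ∈ 𝒦 ×ˢ 𝒟 ×ˢ 𝒟, x.2.1 ∪ x.2.2 ∪ x.1 ∈ 𝒯 := by
    intro x hx
    obtain ⟨hx1, hx2⟩ := mem_product.1 hx
    obtain ⟨hx2, hx3⟩ := mem_product.1 hx2
    obtain ⟨h1, h2⟩ := h𝒦 _ hx1
    obtain ⟨h3, h4⟩ := mem_filter.1 hx2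
    obtain ⟨h5, h6⟩ := mem_filter.1 hx3
    have h3 := mem_powerset.1 h3
    have h5 := mem_powerset.1 h5
    refine mem_filter.2 ⟨mem_powerset.2 (union_subset (union_subset h3 h5) h1), ?_⟩
    have := sum_union_le hu (union_subset h3 h5) x.1
    have := sum_union_le hu h3 x.2.2
    linarith
  calc _ ≤ ∑ K ∈ 𝒦, ∑ D ∈ 𝒟, ∑ D' ∈ 𝒟, (2 ^ D.card * G) * (2 ^ D'.card * G) * f (D ∪ D' ∪ K) := by
        refine sum_le_sum fun K _ => ?_
        rw [h𝒟, sum_filter]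
        refine sum_le_sum fun D hD => ?_
        have h1 := hc D hD
        split_ifs at h1 ⊢
        · rw [sum_filter]
          refine sum_le_sum fun D' hD' => ?_
          have h2 := hc D' hD'
          split_ifs at h2 ⊢
          · exact mul_le_mul_of_nonneg_right
              (mul_le_mul h1 h2 (abs_nonneg _) (by positivity)) (hf _)
          · rw [le_antisymm h2 (abs_nonneg _)]
            simp
        · rw [le_antisymm h1 (abs_nonneg _)]
          simp
    _ = ∑ x ∈ 𝒦 ×ˢ 𝒟 ×ˢ 𝒟, (2 ^ x.2.1.card * G) * (2 ^ x.2.2.card * G) *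
          f (x.2.1 ∪ x.2.2 ∪ x.1) := by
        rw [sum_product]
        exact sum_congr rfl fun K _ => by rw [sum_product]
    _ = ∑ d ∈ 𝒯, ∑ x ∈ 𝒦 ×ˢ 𝒟 ×ˢ 𝒟 with x.2.1 ∪ x.2.2 ∪ x.1 = d,
          (2 ^ x.2.1.card * G) * (2 ^ x.2.2.card * G) * f (x.2.1 ∪ x.2.2 ∪ x.1) :=
        (sum_fiberwise_of_maps_to hmaps _).symm
    _ ≤ ∑ d ∈ 𝒯, G ^ 2 * (18 ^ d.card * f d) := by
        refine sum_le_sum fun d _ => ?_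
        calc _ = ∑ x ∈ 𝒦 ×ˢ 𝒟 ×ˢ 𝒟 with x.2.1 ∪ x.2.2 ∪ x.1 = d,
                G ^ 2 * f d * (2 ^ x.2.1.card * 2 ^ x.2.2.card) :=
              sum_congr rfl fun x hx => by
                rw [(mem_filter.1 hx).2]
                ring
          _ ≤ ∑ x ∈ d.powerset ×ˢ d.powerset ×ˢ d.powerset,
                G ^ 2 * f d * (2 ^ x.2.1.card * 2 ^ x.2.2.card) := by
              refine sum_le_sum_of_subset_of_nonneg ?_ fun x _ _ =>
                mul_nonneg (mul_nonneg (sq_nonneg _) (hf d)) (by positivity)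
              intro x hx
              obtain ⟨-, rfl⟩ := mem_filter.1 hx
              simp only [mem_product, mem_powerset]
              exact ⟨subset_union_right, subset_union_left.trans subset_union_left,
                subset_union_right.trans subset_union_left⟩
          _ = G ^ 2 * f d * (2 ^ d.card * ((1 + 2) ^ d.card * (1 + 2) ^ d.card)) := by
              rw [← mul_sum, sum_product, ← sum_powerset_pow, sum_mul_sum]
              simp only [sum_product]
              rw [sum_const, card_powerset, nsmul_eq_mul]
              push_cast
              rfl
          _ = _ := by
              rw [← mul_pow, ← mul_pow]
              norm_num
              ring
    _ = _ := (mul_sum _ _ _).symm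

end

section

variable {P : Finset ℕ} {g u : ℕ → ℝ}

/-- The normalising sum of the sieve with tapered weights. -/
noncomputable def sqMass (P : Finset ℕ) (g u : ℕ → ℝ) : ℝ :=
  ∑ S ∈ P.powerset, (∏ p ∈ S, odds g p) * taper u S ^ 2

lemma one_le_sqMass (hg : ∀ p ∈ P, 0 < g p ∧ g p ≤ 1 / 2) : 1 ≤ sqMass P g u := by
  have h := single_le_sum (f := fun S => (∏ p ∈ S, odds g p) * taper u S ^ 2)
    (fun S hS => mul_nonneg (prod_odds_pos hg (mem_powerset.1 hS)).le (sq_nonneg _))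
    (empty_mem_powerset P)
  simpa [taper, sqMass] using h

lemma sum_odds_mul_weight_le (hg : ∀ p ∈ P, 0 < g p ∧ g p ≤ 1 / 2) (hu : ∀ p ∈ P, 0 ≤ u p)
    (hkey : ∀ t, 0 ≤ t → t ≤ 1 → ∑ p ∈ P with u p ≤ t, odds g p * u p ≤ 2 * t) :
    ∑ S ∈ P.powerset with ∑ p ∈ S, u p < 1, (∏ p ∈ S, odds g p) * ∑ p ∈ S, u p ≤
      2 * ∑ S ∈ P.powerset with ∑ p ∈ S, u p < 1, (∏ p ∈ S, odds g p) * (1 - ∑ p ∈ S, u p) := by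
  set F := P.powerset.filter (fun S => ∑ p ∈ S, u p < 1) with hF
  have hFP : ∀ S ∈ F, S ⊆ P := fun S hS => mem_powerset.1 (mem_filter.1 hS).1
  have hinner : ∀ p ∈ P, ∑ S ∈ F with p ∈ S, (∏ p ∈ S, odds g p) * u p ≤
      ∑ T ∈ F with u p ≤ 1 - ∑ q ∈ T, u q, (∏ q ∈ T, odds g q) * (odds g p * u p) := by
    intro p hp
    have hinj : Set.InjOn (fun S : Finset ℕ => S.erase p)
        (F.filter fun S => p ∈ S : Finset (Finset ℕ)) := by
      intro S hS T hT h
      rw [← insert_erase (mem_filter.1 hS).2, ← insert_erase (mem_filter.1 hT).2]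
      exact congrArg _ h
    rw [show ∑ S ∈ F with p ∈ S, (∏ p ∈ S, odds g p) * u p =
        ∑ S ∈ F with p ∈ S, (∏ q ∈ S.erase p, odds g q) * (odds g p * u p) from
      sum_congr rfl fun S hS => by
        rw [← mul_assoc, prod_erase_mul _ _ (mem_filter.1 hS).2],
      ← sum_image (f := fun T => (∏ q ∈ T, odds g q) * (odds g p * u p)) hinj]
    refine sum_le_sum_of_subset_of_nonneg ?_ fun T hT _ => mul_nonneg
      (prod_odds_pos hg (hFP T (mem_filter.1 hT).1)).le
      (mul_nonneg (odds_pos hg hp).le (hu p hp))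
    intro T hT
    obtain ⟨S, hS, rfl⟩ := mem_image.1 hT
    obtain ⟨hSF, hpS⟩ := mem_filter.1 hS
    have h1 := (mem_filter.1 hSF).2
    have h2 := sum_erase_add S u hpS
    have h3 := hu p hp
    simp only [mem_filter, hF, mem_powerset]
    exact ⟨⟨(erase_subset _ _).trans (hFP S hSF), by linarith⟩, by linarith⟩
  calc _ = ∑ S ∈ F, ∑ p ∈ P with p ∈ S, (∏ p ∈ S, odds g p) * u p := by
        refine sum_congr rfl fun S hS => ?_
        rw [mul_sum, filter_mem_eq_inter, inter_eq_right.2 (hFP S hS)]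
    _ = ∑ p ∈ P, ∑ S ∈ F with p ∈ S, (∏ p ∈ S, odds g p) * u p := by
        simp only [sum_filter]
        exact sum_comm
    _ ≤ ∑ p ∈ P, ∑ T ∈ F with u p ≤ 1 - ∑ q ∈ T, u q,
          (∏ q ∈ T, odds g q) * (odds g p * u p) := sum_le_sum hinner
    _ = ∑ T ∈ F, ∑ p ∈ P with u p ≤ 1 - ∑ q ∈ T, u q,
          (∏ q ∈ T, odds g q) * (odds g p * u p) := by
        simp only [sum_filter (fun T => u _ ≤ 1 - ∑ q ∈ T, u q), sum_filter (fun p => u p ≤ _)]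
        exact sum_comm
    _ ≤ ∑ T ∈ F, 2 * ((∏ q ∈ T, odds g q) * (1 - ∑ q ∈ T, u q)) := by
        refine sum_le_sum fun T hT => ?_
        have h1 := (mem_filter.1 hT).2
        have h2 := sum_nonneg fun p (hp : p ∈ T) => hu p (hFP T hT hp)
        have h3 := mul_le_mul_of_nonneg_left
          (hkey (1 - ∑ q ∈ T, u q) (by linarith) (by linarith)) (prod_odds_pos hg (hFP T hT)).le
        rw [← mul_sum]
        linarith
    _ = _ := (mul_sum _ _ _).symm

lemma mass_le_sqMass (hg : ∀ p ∈ P, 0 < g p ∧ g p ≤ 1 / 2) (hu : ∀ p ∈ P, 0 ≤ u p)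
    (hkey : ∀ t, 0 ≤ t → t ≤ 1 → ∑ p ∈ P with u p ≤ t, odds g p * u p ≤ 2 * t) :
    mass P g u ≤ 9 * sqMass P g u := by
  have h1 := sum_odds_mul_weight_le hg hu hkey
  set F := P.powerset.filter (fun S => ∑ p ∈ S, u p < 1) with hF
  have hFP : ∀ S ∈ F, S ⊆ P := fun S hS => mem_powerset.1 (mem_filter.1 hS).1
  have h2 : mass P g u = ∑ S ∈ F, (∏ p ∈ S, odds g p) * ∑ p ∈ S, u p +
      ∑ S ∈ F, (∏ p ∈ S, odds g p) * (1 - ∑ p ∈ S, u p) := by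
    rw [mass, ← sum_add_distrib]
    exact sum_congr rfl fun S _ => by ring
  have h3 : ∑ S ∈ F, (∏ p ∈ S, odds g p) * (6 * (1 - ∑ p ∈ S, u p) - 1) ≤ 9 * sqMass P g u := by
    rw [sqMass, mul_sum]
    refine (sum_le_sum fun S hS => ?_).trans (sum_le_sum_of_subset_of_nonneg (filter_subset _ _)
      fun S hS _ => mul_nonneg (by norm_num) (mul_nonneg
        (prod_odds_pos hg (mem_powerset.1 hS)).le (sq_nonneg _)))
    have h4 := (mem_filter.1 hS).2
    rw [taper, max_eq_right (by linarith)]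
    have h5 := prod_odds_pos hg (hFP S hS)
    nlinarith [mul_nonneg h5.le (sq_nonneg (3 * (1 - ∑ p ∈ S, u p) - 1))]
  have h4 : ∑ S ∈ F, (∏ p ∈ S, odds g p) * (6 * (1 - ∑ p ∈ S, u p) - 1) =
      6 * (∑ S ∈ F, (∏ p ∈ S, odds g p) * (1 - ∑ p ∈ S, u p)) - mass P g u := by
    rw [mass, mul_sum, ← sum_sub_distrib]
    exact sum_congr rfl fun S _ => by ring
  linarith

lemma sum_taper_diff_sq_le (hg : ∀ p ∈ P, 0 < g p ∧ g p ≤ 1 / 2) (hu : ∀ p ∈ P, 0 ≤ u p)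
    (hkey : ∀ t, 0 ≤ t → t ≤ 1 → ∑ p ∈ P with u p ≤ t, odds g p * u p ≤ 2 * t)
    {p : ℕ} (hp : p ∈ P) :
    ∑ S ∈ (P \ {p}).powerset, (∏ p ∈ S, odds g p) * (taper u S - taper u (insert p S)) ^ 2 ≤
      sqMass P g u * min 1 (9 * u p ^ 2) := by
  have hup := hu p hp
  have hS0 := one_le_sqMass (u := u) hg
  have hdiff : ∀ S ∈ (P \ {p}).powerset, 0 ≤ taper u S - taper u (insert p S) ∧
      taper u S - taper u (insert p S) ≤ u p := by
    intro S hS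
    have hpS : p ∉ S := fun h => by simpa using mem_powerset.1 hS h
    rw [taper, taper, sum_insert hpS]
    constructor
    · have : max 0 (1 - (u p + ∑ x ∈ S, u x)) ≤ max 0 (1 - ∑ x ∈ S, u x) :=
        max_le_max le_rfl (by linarith)
      linarith
    · have h1 := le_max_left 0 (1 - (u p + ∑ x ∈ S, u x))
      have h2 := le_max_right 0 (1 - (u p + ∑ x ∈ S, u x))
      rcases max_cases 0 (1 - ∑ x ∈ S, u x) with h | h <;> linarith
  have hsub : (P \ {p}).powerset ⊆ P.powerset := powerset_mono.2 sdiff_subset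
  rw [mul_min_of_nonneg _ _ (by linarith), mul_one]
  refine le_min ?_ ?_
  · refine (sum_le_sum fun S hS => ?_).trans (sum_le_sum_of_subset_of_nonneg hsub
      fun S hS _ => mul_nonneg (prod_odds_pos hg (mem_powerset.1 hS)).le (sq_nonneg _))
    have h1 := hdiff S hS
    have h2 := taper_nonneg (u := u) (insert p S)
    exact mul_le_mul_of_nonneg_left (pow_le_pow_left₀ h1.1 (by linarith) 2)
      (prod_odds_pos hg (mem_powerset.1 (hsub hS))).le
  · have h1 : ∑ S ∈ (P \ {p}).powerset, (∏ p ∈ S, odds g p) *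
        (taper u S - taper u (insert p S)) ^ 2 ≤ mass P g u * u p ^ 2 := by
      rw [mass, sum_mul]
      calc _ ≤ ∑ S ∈ (P \ {p}).powerset,
            if ∑ p ∈ S, u p < 1 then (∏ p ∈ S, odds g p) * u p ^ 2 else 0 := by
            refine sum_le_sum fun S hS => ?_
            have h1 := hdiff S hS
            have h2 := prod_odds_pos hg (mem_powerset.1 (hsub hS))
            split_ifs with h3
            · exact mul_le_mul_of_nonneg_left (pow_le_pow_left₀ h1.1 h1.2 2) h2.le
            · have h4 := taper_eq_zero (not_lt.1 h3)
              have h5 := taper_nonneg (u := u) (insert p S)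
              rw [h4] at h1 ⊢
              rw [show taper u (insert p S) = 0 by linarith]
              simp
        _ ≤ ∑ S ∈ P.powerset,
              if ∑ p ∈ S, u p < 1 then (∏ p ∈ S, odds g p) * u p ^ 2 else 0 := by
            refine sum_le_sum_of_subset_of_nonneg hsub fun S hS _ => ?_
            have h2 := prod_odds_pos hg (mem_powerset.1 hS)
            split_ifs <;> positivity
        _ = _ := (sum_filter _ _).symm
    have h2 := mul_le_mul_of_nonneg_right (mass_le_sqMass hg hu hkey) (sq_nonneg (u p))
    linarith

/-- Richert's weights on top of a tapered Selberg sieve of dimension two. -/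
theorem weighted_sieve {α : Type*} {c : ℕ → ℝ} {κ : ℝ} (hκ : 4 ≤ κ)
    (hg : ∀ p ∈ P, 0 < g p ∧ g p ≤ 1 / 2) (hu : ∀ p ∈ P, 0 ≤ u p ∧ u p < 1)
    (hkey : ∀ t, 0 ≤ t → t ≤ 1 → ∑ p ∈ P with u p ≤ t, odds g p * u p ≤ 2 * t)
    (hc : ∀ p ∈ P, 0 ≤ c p ∧ c p ≤ κ + 1) (hcu : ∀ p ∈ P, c p * min 1 (9 * u p ^ 2) ≤ 2 * u p)
    (I : Finset α) (W : α → ℝ) {Hf : α → Finset ℕ} (hHf : ∀ q ∈ I, Hf q ⊆ P) {X : ℝ}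
    (hX : 0 ≤ X) :
    (κ - 4) * X ≤ ∑ q ∈ I, W q * sieveFn P g (taper u) (Hf q) ^ 2 * (κ - ∑ p ∈ Hf q, c p) +
      (2 * κ + 1) * (mass P g u ^ 2 * ∑ d ∈ P.powerset with ∑ p ∈ d, u p < 3,
        18 ^ d.card * |∑ q ∈ I with d ⊆ Hf q, W q - X * ∏ p ∈ d, g p|) := by
  have hu0 : ∀ p ∈ P, 0 ≤ u p := fun p hp => (hu p hp).1
  have hg1 : ∀ p ∈ P, 0 < g p ∧ g p < 1 := fun p hp => ⟨(hg p hp).1, by linarith [(hg p hp).2]⟩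
  set f : Finset ℕ → ℝ := fun d => |∑ q ∈ I with d ⊆ Hf q, W q - X * ∏ p ∈ d, g p| with hf
  have hf0 : ∀ d, 0 ≤ f d := fun d => abs_nonneg _
  set E := mass P g u ^ 2 * ∑ d ∈ P.powerset with ∑ p ∈ d, u p < 3, 18 ^ d.card * f d with hE
  set Λ : α → ℝ := fun q => sieveFn P g (taper u) (Hf q) with hΛ
  set S := sqMass P g u with hS
  have hS1 : 1 ≤ S := one_le_sqMass hg
  set e : Finset ℕ → ℝ := fun K => ∑ D ∈ P.powerset, ∑ D' ∈ P.powerset,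
    |coef P g (taper u) D| * |coef P g (taper u) D'| * f (D ∪ D' ∪ K) with he
  have hmain : X * S - e ∅ ≤ ∑ q ∈ I, W q * Λ q ^ 2 := by
    have h := abs_sum_sub_expect_le (empty_subset P) g (taper u) I W Hf X
    simp only [empty_subset, if_true, one_mul, expect_sieveFn_sq hg1] at h
    have := (abs_le.1 h).1
    simp only [he, hf, hS, sqMass, hΛ]
    linarith
  have hprime : ∀ p ∈ P, ∑ q ∈ I, W q * ((if {p} ⊆ Hf q then 1 else 0) * Λ q ^ 2) ≤
      X * (g p * (S * min 1 (9 * u p ^ 2))) + e {p} := by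
    intro p hp
    have h := (abs_le.1 (abs_sum_sub_expect_le (singleton_subset_iff.2 hp) g (taper u) I W Hf X)).2
    rw [expect_mem_mul_sieveFn_sq hg1 _ hp] at h
    have h2 := mul_le_mul_of_nonneg_left (mul_le_mul_of_nonneg_left
      (sum_taper_diff_sq_le hg hu0 hkey hp) (hg p hp).1.le) hX
    simp only [he, hf, hΛ]
    linarith
  have hempty : e ∅ ≤ E := by
    have h := sum_coef_mul_le hg hu0 (𝒦 := {∅}) (by simp) hf0
    rwa [sum_singleton] at h
  have hsingle : ∑ p ∈ P, e {p} ≤ E := by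
    have h := sum_coef_mul_le hg hu0 (𝒦 := P.image fun p => {p}) (fun K hK => by
      obtain ⟨p, hp, rfl⟩ := mem_image.1 hK
      exact ⟨singleton_subset_iff.2 hp, by rw [sum_singleton]; exact (hu p hp).2⟩) hf0
    rwa [sum_image fun _ _ _ _ h => singleton_injective h] at h
  have he0 : ∀ K, 0 ≤ e K := fun K => sum_nonneg fun D _ => sum_nonneg fun D' _ =>
    mul_nonneg (mul_nonneg (abs_nonneg _) (abs_nonneg _)) (hf0 _)
  have hsum4 : ∑ p ∈ P, c p * (g p * min 1 (9 * u p ^ 2)) ≤ 4 := by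
    have h1 := hkey 1 zero_le_one le_rfl
    rw [filter_true_of_mem fun p hp => (hu p hp).2.le] at h1
    calc _ ≤ ∑ p ∈ P, 2 * (odds g p * u p) := by
          refine sum_le_sum fun p hp => ?_
          have h2 := mul_le_mul_of_nonneg_left (hcu p hp) (hg p hp).1.le
          have h3 : g p ≤ odds g p := by
            rw [odds, le_div_iff₀ (by linarith [(hg1 p hp).2])]
            nlinarith [(hg p hp).1]
          have h4 := mul_le_mul_of_nonneg_right h3 (hu0 p hp)
          linarith
      _ ≤ 4 := by
          rw [← mul_sum]
          linarith
  have hsplit : ∑ q ∈ I, W q * Λ q ^ 2 * (κ - ∑ p ∈ Hf q, c p) = κ * ∑ q ∈ I, W q * Λ q ^ 2 -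
      ∑ p ∈ P, c p * ∑ q ∈ I, W q * ((if {p} ⊆ Hf q then 1 else 0) * Λ q ^ 2) := by
    simp only [mul_sum]
    rw [sum_comm, ← sum_sub_distrib]
    refine sum_congr rfl fun q hq => ?_
    rw [← inter_eq_right.2 (hHf q hq), ← filter_mem_eq_inter, sum_filter, mul_sub, mul_sum]
    congr 1
    · ring
    · refine sum_congr rfl fun p hp => ?_
      simp only [filter_mem_eq_inter, inter_eq_right.2 (hHf q hq), singleton_subset_iff]
      split_ifs <;> ring
  have htotal : ∑ p ∈ P, c p * ∑ q ∈ I, W q * ((if {p} ⊆ Hf q then 1 else 0) * Λ q ^ 2) ≤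
      X * S * 4 + (κ + 1) * E := by
    calc _ ≤ ∑ p ∈ P, (X * S * (c p * (g p * min 1 (9 * u p ^ 2))) + (κ + 1) * e {p}) := by
          refine sum_le_sum fun p hp => ?_
          have h1 := mul_le_mul_of_nonneg_left (hprime p hp) (hc p hp).1
          have h2 := mul_le_mul_of_nonneg_right (hc p hp).2 (he0 {p})
          linarith
      _ ≤ _ := by
          rw [sum_add_distrib, ← mul_sum, ← mul_sum]
          exact add_le_add (mul_le_mul_of_nonneg_left hsum4 (by positivity))
            (mul_le_mul_of_nonneg_left hsingle (by linarith))
  have h1 := mul_le_mul_of_nonneg_left hmain (by linarith : 0 ≤ κ)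
  have h2 := mul_le_mul_of_nonneg_left hempty (by linarith : 0 ≤ κ)
  have h3 : (κ - 4) * X ≤ (κ - 4) * (X * S) :=
    mul_le_mul_of_nonneg_left (le_mul_of_one_le_right hX hS1) (by linarith)
  change _ ≤ ∑ q ∈ I, W q * Λ q ^ 2 * (κ - ∑ p ∈ Hf q, c p) + (2 * κ + 1) * E
  rw [hsplit]
  linarith

end

/-- The sifting density at a prime with two roots. -/
noncomputable def twoRootDensity (p : ℕ) : ℝ := 2 / (p - 1)

/-- The size of `p` on the logarithmic scale with unit `R`. -/
noncomputable def logSize (R : ℝ) (p : ℕ) : ℝ := log p / log R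

/-- Richert's weight for a prime of logarithmic size `t`. -/
noncomputable def richertWeight (κ t : ℝ) : ℝ := 1 - t + if 25 * t ≤ 1 then κ else 0

lemma richertWeight_bounds {κ t : ℝ} (hκ : 0 ≤ κ) (h0 : 0 ≤ t) (h1 : t ≤ 1) :
    0 ≤ richertWeight κ t ∧ richertWeight κ t ≤ κ + 1 := by
  rw [richertWeight]
  split_ifs <;> constructor <;> linarith

lemma richertWeight_mul_le {κ t : ℝ} (hκ0 : 0 ≤ κ) (hκ : κ ≤ 9 / 2) (h0 : 0 ≤ t) (h1 : t ≤ 1) :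
    richertWeight κ t * min 1 (9 * t ^ 2) ≤ 2 * t := by
  have h2 := (richertWeight_bounds hκ0 h0 h1).1
  rw [richertWeight] at *
  split_ifs at * with h
  · refine (mul_le_mul_of_nonneg_left (min_le_right _ _) h2).trans ?_
    nlinarith [mul_nonneg h0 h0, mul_nonneg h0 (sub_nonneg.2 h)]
  · rcases le_total t (1 / 3) with h3 | h3
    · refine (mul_le_mul_of_nonneg_left (min_le_right _ _) h2).trans ?_
      nlinarith [mul_nonneg h0 (sub_nonneg.2 h3), mul_nonneg h0 (mul_nonneg (sub_nonneg.2 h3) h0)]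
    · refine (mul_le_mul_of_nonneg_left (min_le_left _ _) h2).trans ?_
      linarith

lemma odds_twoRootDensity {p : ℕ} (hp : 100 ≤ p) : odds twoRootDensity p = 2 / (p - 3) := by
  have h : (100 : ℝ) ≤ p := by exact_mod_cast hp
  have h1 : (p : ℝ) - 1 ≠ 0 := by linarith
  have h2 : (p : ℝ) - 3 ≠ 0 := by linarith
  have h3 : 1 - 2 / ((p : ℝ) - 1) = (p - 3) / (p - 1) := by
    field_simp
    ring
  rw [odds, twoRootDensity, h3]
  field_simp

lemma twoRootDensity_bounds {p : ℕ} (hp : 100 ≤ p) :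
    0 < twoRootDensity p ∧ twoRootDensity p ≤ 1 / 2 := by
  have h : (100 : ℝ) ≤ p := by exact_mod_cast hp
  rw [twoRootDensity]
  refine ⟨div_pos two_pos (by linarith), ?_⟩
  rw [div_le_div_iff₀ (by linarith) two_pos]
  linarith

section

variable {P : Finset ℕ} {R : ℝ}

lemma logSize_bounds (hR : 1 < R) {p : ℕ} (hp0 : 100 ≤ p) (hp : (p : ℝ) < R) :
    0 ≤ logSize R p ∧ logSize R p < 1 := by
  have h0 : (0 : ℝ) < p := by exact_mod_cast (by lia : 0 < p)
  have hl := log_pos hR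
  refine ⟨div_nonneg (log_natCast_nonneg p) hl.le, ?_⟩
  rw [logSize, div_lt_one hl]
  exact log_lt_log h0 hp

lemma sum_odds_mul_logSize_le {p₀ : ℕ} (hp₀ : 100 ≤ p₀)
    (hsum : ∀ t : ℝ, 1 ≤ t → ∑ p ∈ Ioc p₀ ⌊t⌋₊ with p.Prime, 2 * log p / (p - 3) ≤ 2 * log t)
    (hR : 1 < R) (hP : ∀ p ∈ P, p.Prime ∧ p₀ < p) {t : ℝ} (ht : 0 ≤ t) :
    ∑ p ∈ P with logSize R p ≤ t, odds twoRootDensity p * logSize R p ≤ 2 * t := by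
  have hl := log_pos hR
  have h0 : (0 : ℝ) < R := by linarith
  have h1 : (1 : ℝ) ≤ R ^ t := one_le_rpow hR.le ht
  have h2 := hsum _ h1
  rw [log_rpow h0] at h2
  have h3 : ∀ p ∈ P, (p₀ : ℝ) + 1 ≤ p := fun p hp => by exact_mod_cast (hP p hp).2
  have h4 : (100 : ℝ) ≤ p₀ := by exact_mod_cast hp₀
  calc _ = (∑ p ∈ P with logSize R p ≤ t, 2 * log p / (p - 3)) / log R := by
        rw [sum_div]
        refine sum_congr rfl fun p hp => ?_
        rw [odds_twoRootDensity (by have := (hP p (mem_filter.1 hp).1).2; lia), logSize]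
        ring
    _ ≤ (∑ p ∈ Ioc p₀ ⌊R ^ t⌋₊ with p.Prime, 2 * log p / (p - 3)) / log R := by
        refine div_le_div_of_nonneg_right (sum_le_sum_of_subset_of_nonneg ?_ ?_) hl.le
        · intro p hp
          obtain ⟨hpP, hpt⟩ := mem_filter.1 hp
          have h5 := h3 p hpP
          refine mem_filter.2 ⟨mem_Ioc.2 ⟨(hP p hpP).2, Nat.le_floor ?_⟩, (hP p hpP).1⟩
          rw [logSize, div_le_iff₀ hl] at hpt
          rw [← log_le_log_iff (by linarith) (by linarith), log_rpow h0]
          exact hpt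
        · intro p hp _
          have h5 : (p₀ : ℝ) < p := by exact_mod_cast (mem_Ioc.1 (mem_filter.1 hp).1).1
          exact div_nonneg (mul_nonneg two_pos.le (log_natCast_nonneg p)) (by linarith)
    _ ≤ 2 * t := by
        rw [div_le_iff₀ hl]
        linarith

lemma sum_logSize_lt_iff (hR : 1 < R) {S : Finset ℕ} (hS : ∀ p ∈ S, p.Prime) (m : ℕ) :
    ∑ p ∈ S, logSize R p < m ↔ ((∏ p ∈ S, p : ℕ) : ℝ) < R ^ m := by
  have hl := log_pos hR
  have h0 : (0 : ℝ) < (∏ p ∈ S, p : ℕ) := by exact_mod_cast prod_pos fun p hp => (hS p hp).pos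
  simp only [logSize]
  rw [← sum_div, div_lt_iff₀ hl, ← log_pow, ← log_lt_log_iff h0 (by positivity), Nat.cast_prod,
    log_prod fun p hp => by exact_mod_cast (hS p hp).ne_zero]

lemma prod_injOn {F : Finset (Finset ℕ)} (hF : ∀ S ∈ F, ∀ p ∈ S, p.Prime) :
    Set.InjOn (fun S : Finset ℕ => ∏ p ∈ S, p) F := fun S hS T hT h => by
  rw [← Nat.primeFactors_prod (hF S hS), ← Nat.primeFactors_prod (hF T hT)]
  exact congrArg _ h

lemma mass_le (hR : 1 < R) (hP : ∀ p ∈ P, p.Prime ∧ 100 ≤ p) :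
    mass P twoRootDensity (logSize R) ≤ (1 + log R) ^ 3 := by
  have hPF : ∀ S ∈ P.powerset.filter (fun S => ∑ p ∈ S, logSize R p < 1), ∀ p ∈ S, p.Prime ∧ 100 ≤ p :=
    fun S hS p hp => hP p (mem_powerset.1 (mem_filter.1 hS).1 hp)
  have hfl : (1 : ℝ) ≤ ⌊R⌋₊ := by exact_mod_cast Nat.le_floor (by simpa using hR.le)
  calc _ ≤ ∑ S ∈ P.powerset with ∑ p ∈ S, logSize R p < 1,
        (3 : ℝ) ^ ω (∏ p ∈ S, p) / (∏ p ∈ S, p : ℕ) := by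
        refine sum_le_sum fun S hS => ?_
        rw [omega_eq_card_primeFactors, Nat.primeFactors_prod fun p hp => (hPF S hS p hp).1,
          Nat.cast_prod, ← prod_const, ← prod_div_distrib]
        refine prod_le_prod (fun p hp => ?_) fun p hp => ?_
        all_goals
          have h1 := (hPF S hS p hp).2
          have h2 : (100 : ℝ) ≤ p := by exact_mod_cast h1
          rw [odds_twoRootDensity h1]
        · exact div_nonneg two_pos.le (by linarith)
        · rw [div_le_div_iff₀ (by linarith) (by linarith)]
          linarith
    _ = ∑ d ∈ (P.powerset.filter fun S => ∑ p ∈ S, logSize R p < 1).image fun S => ∏ p ∈ S, p,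
        (3 : ℝ) ^ ω d / d :=
        (sum_image (f := fun d : ℕ => (3 : ℝ) ^ ω d / d)
          (prod_injOn fun S hS p hp => (hPF S hS p hp).1)).symm
    _ ≤ ∑ d ∈ Icc 1 ⌊R⌋₊, (3 : ℝ) ^ ω d / d := by
        refine sum_le_sum_of_subset_of_nonneg ?_ fun d _ _ => by positivity
        intro d hd
        obtain ⟨S, hS, rfl⟩ := mem_image.1 hd
        have h1 := fun p hp => (hPF S hS p hp).1
        have h2 := (sum_logSize_lt_iff hR h1 1).1 (by exact_mod_cast (mem_filter.1 hS).2)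
        rw [pow_one] at h2
        exact mem_Icc.2 ⟨prod_pos fun p hp => (h1 p hp).pos, Nat.le_floor h2.le⟩
    _ ≤ (1 + log ⌊R⌋₊) ^ 3 := by exact_mod_cast sum_pow_omega_div_le 3 ⌊R⌋₊
    _ ≤ _ := by
        have h1 := log_le_log (by linarith) (Nat.floor_le (by linarith : 0 ≤ R))
        have h2 := log_nonneg hfl
        gcongr

end

/-- The members of `primeRange n` in a fixed residue class. -/
noncomputable def classRange (n M b : ℕ) : Finset ℕ :=
  (primeRange n).filter fun q => ((q : ℕ) : ZMod M) = (b : ZMod M)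

/-- The primes below `R`, prime to `M * n`, modulo which `n` is a square. -/
noncomputable def sievePrimes (n M : ℕ) (R : ℝ) : Finset ℕ :=
  (Icc 1 ⌊R⌋₊).filter fun p => p.Prime ∧ (p : ℝ) < R ∧ ¬p ∣ M ∧ ¬p ∣ n ∧ rootCount n p = 2

/-- The sifting primes dividing `n - q ^ 2`. -/
noncomputable def sieveDivisors (n M : ℕ) (R : ℝ) (q : ℕ) : Finset ℕ :=
  (sievePrimes n M R).filter fun p => p ∣ n - q ^ 2

lemma prime_of_mem_sievePrimes {n M p : ℕ} {R : ℝ} (hp : p ∈ sievePrimes n M R) : p.Prime :=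
  (mem_filter.1 hp).2.1

lemma sum_classRange_eq (n k M b : ℕ) (R : ℝ) {d : Finset ℕ} (hd : d ⊆ sievePrimes n M R) :
    ∑ q ∈ classRange n M b with d ⊆ sieveDivisors n M R q, W n k q =
      classSum n k M b (∏ p ∈ d, p) := by
  rw [classSum, classRange, filter_filter]
  refine sum_congr (filter_congr fun q _ => and_congr_right fun _ => ?_) fun _ _ => rfl
  constructor
  · intro h
    exact prod_primes_dvd _ (fun p hp => (prime_of_mem_sievePrimes (hd hp)).prime)
      fun p hp => (mem_filter.1 (h hp)).2
  · intro h p hp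
    exact mem_filter.2 ⟨hd hp, (dvd_prod_of_mem _ hp).trans h⟩

lemma prod_twoRootDensity_eq {n M : ℕ} {R : ℝ} {d : Finset ℕ} (hd : d ⊆ sievePrimes n M R) :
    ∏ p ∈ d, twoRootDensity p =
      rootCount n (∏ p ∈ d, p) / ((∏ p ∈ d, p).totient : ℝ) := by
  have hd' : ∀ p ∈ d, p.Prime := fun p hp => prime_of_mem_sievePrimes (hd hp)
  rw [rootCount_prod n hd', totient_prod hd', Nat.cast_prod, Nat.cast_prod, ← prod_div_distrib]
  refine prod_congr rfl fun p hp => ?_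
  rw [(mem_filter.1 (hd hp)).2.2.2.2.2, Nat.cast_sub (hd' p hp).one_lt.le, twoRootDensity]
  norm_num

lemma sum_error_le (n k M b : ℕ) {R : ℝ} (hR : 1 < R) :
    ∑ d ∈ (sievePrimes n M R).powerset with ∑ p ∈ d, logSize R p < 3, (18 : ℝ) ^ d.card *
      |∑ q ∈ classRange n M b with d ⊆ sieveDivisors n M R q, W n k q -
        classSum n k M b 1 * ∏ p ∈ d, twoRootDensity p| ≤
    ∑ d ∈ Icc 1 ⌊R ^ 3⌋₊ with Squarefree d ∧ d.Coprime (M * n), (18 : ℝ) ^ ω d *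
      |classSum n k M b d - rootCount n d / d.totient * classSum n k M b 1| := by
  have hPF : ∀ S ∈ (sievePrimes n M R).powerset.filter (fun d => ∑ p ∈ d, logSize R p < 3),
      ∀ p ∈ S, p.Prime :=
    fun S hS p hp => prime_of_mem_sievePrimes (mem_powerset.1 (mem_filter.1 hS).1 hp)
  calc _ = ∑ S ∈ (sievePrimes n M R).powerset with ∑ p ∈ S, logSize R p < 3,
        (18 : ℝ) ^ ω (∏ p ∈ S, p) * |classSum n k M b (∏ p ∈ S, p) -
          rootCount n (∏ p ∈ S, p) / ((∏ p ∈ S, p).totient : ℝ) * classSum n k M b 1| := by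
        refine sum_congr rfl fun S hS => ?_
        have h1 := mem_powerset.1 (mem_filter.1 hS).1
        rw [omega_eq_card_primeFactors, Nat.primeFactors_prod (hPF S hS), sum_classRange_eq n k M b R h1,
          prod_twoRootDensity_eq h1, mul_comm (classSum n k M b 1)]
    _ = ∑ d ∈ ((sievePrimes n M R).powerset.filter fun S => ∑ p ∈ S, logSize R p < 3).image
          fun S => ∏ p ∈ S, p, (18 : ℝ) ^ ω d *
        |classSum n k M b d - rootCount n d / d.totient * classSum n k M b 1| :=
        (sum_image (f := fun d : ℕ => (18 : ℝ) ^ ω d *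
          |classSum n k M b d - rootCount n d / d.totient * classSum n k M b 1|)
          (prod_injOn hPF)).symm
    _ ≤ _ := by
        refine sum_le_sum_of_subset_of_nonneg ?_ fun d _ _ => by positivity
        intro d hd
        obtain ⟨S, hS, rfl⟩ := mem_image.1 hd
        have h1 := hPF S hS
        have h2 := (sum_logSize_lt_iff hR h1 3).1 (by exact_mod_cast (mem_filter.1 hS).2)
        refine mem_filter.2 ⟨mem_Icc.2 ⟨prod_pos fun p hp => (h1 p hp).pos, Nat.le_floor h2.le⟩,
          ?_, Nat.Coprime.prod_left fun p hp => ?_⟩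
        · exact squarefree_prod_of_pairwise_isCoprime (fun p hp q hq hpq => by
            exact Nat.coprime_iff_isRelPrime.1 ((Nat.coprime_primes (h1 p hp) (h1 q hq)).2 hpq))
            fun p hp => (h1 p hp).prime.squarefree
        · obtain ⟨-, h3, -, h4, h5, -⟩ :=
            mem_filter.1 (mem_powerset.1 (mem_filter.1 hS).1 hp)
          exact (Nat.Coprime.mul_right ((Nat.Prime.coprime_iff_not_dvd h3).2 h4)
            ((Nat.Prime.coprime_iff_not_dvd h3).2 h5))

lemma le_sum_richertWeight {n M q : ℕ} {R κ : ℝ} (hR : 1 < R) (hκ : 0 ≤ κ) (hq : q ^ 2 < n)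
    (hP : ∀ p ∈ sievePrimes n M R, 100 ≤ p)
    (hmem : ∀ p, p.Prime → p ∣ n - q ^ 2 → (p : ℝ) < R → p ∈ sievePrimes n M R)
    (hlog : log n = (18 - κ) * log R) (hΩ : 18 ≤ ArithmeticFunction.cardFactors (n - q ^ 2))
    (hsq : ∀ p ∈ sievePrimes n M R, 1 < 25 * logSize R p → ¬p ^ 2 ∣ n - q ^ 2) :
    κ ≤ ∑ p ∈ sieveDivisors n M R q, richertWeight κ (logSize R p) := by
  have hl := log_pos hR
  have hη : n - q ^ 2 ≠ 0 := by lia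
  have hHP : sieveDivisors n M R q ⊆ sievePrimes n M R := filter_subset _ _
  have hu : ∀ p ∈ sieveDivisors n M R q, 0 ≤ logSize R p ∧ logSize R p < 1 := fun p hp =>
    logSize_bounds hR (hP p (hHP hp)) (mem_filter.1 (hHP hp)).2.2.1
  by_cases hsmall : ∃ p ∈ sieveDivisors n M R q, 25 * logSize R p ≤ 1
  · obtain ⟨p, hp, h⟩ := hsmall
    refine le_trans ?_ (single_le_sum (fun p hp =>
      (richertWeight_bounds hκ (hu p hp).1 (hu p hp).2.le).1) hp)
    rw [richertWeight, if_pos h]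
    linarith [(hu p hp).2]
  push Not at hsmall
  have hsub : sieveDivisors n M R q ⊆ (n - q ^ 2).primeFactors := fun p hp =>
    Nat.mem_primeFactors.2 ⟨prime_of_mem_sievePrimes (hHP hp), (mem_filter.1 hp).2, hη⟩
  have h1 : ∑ p ∈ (n - q ^ 2).primeFactors, ((n - q ^ 2).factorization p : ℝ) * (1 - logSize R p) ≤
      ∑ p ∈ sieveDivisors n M R q, richertWeight κ (logSize R p) := by
    calc _ ≤ ∑ p ∈ (n - q ^ 2).primeFactors,
          if p ∈ sieveDivisors n M R q then richertWeight κ (logSize R p) else 0 := by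
          refine sum_le_sum fun p hp => ?_
          obtain ⟨hpp, hpd, -⟩ := Nat.mem_primeFactors.1 hp
          split_ifs with h
          · have h2 : (n - q ^ 2).factorization p = 1 := by
              refine le_antisymm ?_ ((hpp.dvd_iff_one_le_factorization hη).1 hpd)
              by_contra! h3
              exact hsq p (hHP h) (hsmall p h) ((hpp.pow_dvd_iff_le_factorization hη).2 h3)
            rw [h2, richertWeight, if_neg (not_le.2 (hsmall p h))]
            simp
          · have h2 : R ≤ p := by
              by_contra! h3
              exact h (mem_filter.2 ⟨hmem p hpp hpd h3, hpd⟩)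
            have h3 : 1 ≤ logSize R p := by
              rw [logSize, one_le_div hl]
              exact log_le_log (by linarith) h2
            exact mul_nonpos_of_nonneg_of_nonpos (Nat.cast_nonneg _) (by linarith)
      _ = _ := by rw [← sum_filter, filter_mem_eq_inter, inter_eq_right.2 hsub]
  refine le_trans ?_ h1
  have h2 : (ArithmeticFunction.cardFactors (n - q ^ 2) : ℝ) =
      ∑ p ∈ (n - q ^ 2).primeFactors, ((n - q ^ 2).factorization p : ℝ) := by
    rw [ArithmeticFunction.cardFactors_eq_sum_factorization, Finsupp.sum, Nat.cast_sum,
      Nat.support_factorization]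
  have h3 : log (n - q ^ 2 : ℕ) =
      ∑ p ∈ (n - q ^ 2).primeFactors, ((n - q ^ 2).factorization p : ℝ) * log p := by
    conv_lhs => rw [← Nat.prod_factorization_pow_eq_self hη, Finsupp.prod, Nat.support_factorization]
    rw [Nat.cast_prod, log_prod fun p hp => by
      exact_mod_cast pow_ne_zero _ (Nat.prime_of_mem_primeFactors hp).ne_zero]
    exact sum_congr rfl fun p _ => by rw [Nat.cast_pow, log_pow]
  have h4 : log (n - q ^ 2 : ℕ) ≤ (18 - κ) * log R := by
    rw [← hlog]
    exact log_le_log (by exact_mod_cast Nat.pos_of_ne_zero hη) (by exact_mod_cast Nat.sub_le _ _)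
  have h5 : ∑ p ∈ (n - q ^ 2).primeFactors,
      ((n - q ^ 2).factorization p : ℝ) * (1 - logSize R p) =
      ArithmeticFunction.cardFactors (n - q ^ 2) - log (n - q ^ 2 : ℕ) / log R := by
    rw [h2, h3, sum_div, ← sum_sub_distrib]
    exact sum_congr rfl fun p _ => by rw [logSize]; ring
  have h6 : log (n - q ^ 2 : ℕ) / log R ≤ 18 - κ := (div_le_iff₀ hl).2 h4
  have h7 : (18 : ℝ) ≤ ArithmeticFunction.cardFactors (n - q ^ 2) := by exact_mod_cast hΩ
  linarith

lemma mem_sievePrimes {n M b q p : ℕ} {R : ℝ} (hM : p ≤ 2 → p ∣ M)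
    (hgood : ∀ p, p.Prime → p ∣ M → IsGood n p b) (hqR : R ≤ q) (hq : q ∈ classRange n M b)
    (hp : p.Prime) (hpd : p ∣ n - q ^ 2) (hpR : (p : ℝ) < R) : p ∈ sievePrimes n M R := by
  obtain ⟨hqr, hqb⟩ := mem_filter.1 hq
  have hsq := sq_lt_of_mem_primeRange hqr
  have hroot := (dvd_sub_sq_iff hsq.le).1 hpd
  have hpM : ¬p ∣ M := fun h => by
    have h1 := (ZMod.natCast_eq_natCast_iff _ _ _).2
      (((ZMod.natCast_eq_natCast_iff _ _ _).1 hqb).of_dvd h)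
    exact (hgood p hp h).2 (h1 ▸ hroot)
  have hq2 : ¬p ∣ q := fun h => by
    rcases (Nat.dvd_prime (mem_filter.1 hqr).2).1 h with h1 | h1
    · exact hp.one_lt.ne' h1
    · rw [h1] at hpR
      linarith
  have hpn : ¬p ∣ n := fun h =>
    hq2 (hp.dvd_of_dvd_pow ((Nat.dvd_sub_iff_right hsq.le h).1 hpd))
  refine mem_filter.2 ⟨mem_Icc.2 ⟨hp.pos, Nat.le_floor hpR.le⟩, hp, hpR, hpM, hpn, ?_⟩
  have : Fact p.Prime := ⟨hp⟩
  refine le_antisymm (rootCount_prime_le n hp) ?_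
  rw [rootCount, Nat.card_eq_fintype_card]
  refine Fintype.one_lt_card_iff.2 ⟨⟨q, hroot⟩, ⟨-q, by rw [neg_sq, hroot]⟩, fun h => ?_⟩
  have h1 : ((2 * q : ℕ) : ZMod p) = 0 := by
    have := congrArg Subtype.val h
    simp only at this
    push_cast
    linear_combination this
  rcases hp.dvd_mul.1 ((ZMod.natCast_eq_zero_iff _ _).1 h1) with h2 | h2
  · exact hpM (hM (Nat.le_of_dvd two_pos h2))
  · exact hq2 h2

lemma sum_one_div_residue_le {T : Finset ℕ} {n m : ℕ} {Y : ℝ} (hT : T ⊆ Icc 1 n) (hY : 0 < Y)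
    (hTY : ∀ q ∈ T, Y ≤ q) (hm : 0 < m) (hr : ∀ q ∈ T, ∀ q' ∈ T, q % m = q' % m) :
    ∑ q ∈ T, (1 : ℝ) / q ≤ 1 / Y + (1 + log n) / m := by
  have hinj : Set.InjOn (fun q => q / m) T := fun q hq q' hq' h => by
    rw [← Nat.div_add_mod q m, ← Nat.div_add_mod q' m, hr q hq q' hq']
    exact congrArg (fun x => m * x + _) h
  set f : ℕ → ℝ := fun j => if j = 0 then 1 / Y else 1 / j / m with hf
  have hf0 : ∀ j, 0 ≤ f j := fun j => by
    simp only [hf]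
    split_ifs <;> positivity
  calc _ ≤ ∑ q ∈ T, f (q / m) := by
        refine sum_le_sum fun q hq => ?_
        simp only [hf]
        split_ifs with h
        · exact one_div_le_one_div_of_le hY (hTY q hq)
        · have h1 : (0 : ℝ) < (q / m : ℕ) := by exact_mod_cast Nat.pos_of_ne_zero h
          have h2 : (0 : ℝ) < m := by exact_mod_cast hm
          rw [div_div]
          refine one_div_le_one_div_of_le (by positivity) ?_
          exact_mod_cast Nat.div_mul_le_self q m
    _ = ∑ j ∈ T.image fun q => q / m, f j := (sum_image hinj).symm
    _ ≤ ∑ j ∈ insert 0 (Icc 1 n), f j := by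
        refine sum_le_sum_of_subset_of_nonneg (fun j hj => ?_) fun j _ _ => hf0 j
        obtain ⟨q, hq, rfl⟩ := mem_image.1 hj
        have h1 := mem_Icc.1 (hT hq)
        have h2 := Nat.div_le_self q m
        simp only [mem_insert, mem_Icc]
        lia
    _ = 1 / Y + (∑ j ∈ Icc 1 n, (1 : ℝ) / j) / m := by
        rw [sum_insert (by simp), sum_div]
        refine congrArg₂ _ (if_pos rfl) (sum_congr rfl fun j hj => if_neg ?_)
        have h1 := (mem_Icc.1 hj).1
        lia
    _ ≤ _ := by
        gcongr
        exact sum_Icc_inv_le n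

lemma sum_one_div_sq_dvd_le {n p : ℕ} {Y : ℝ} (hp : p.Prime) (hp2 : 2 < p) (hpn : ¬p ∣ n)
    {T : Finset ℕ} (hT : T ⊆ Icc 1 n) (hTn : ∀ q ∈ T, q ^ 2 ≤ n) (hTd : ∀ q ∈ T, p ^ 2 ∣ n - q ^ 2)
    (hY : 0 < Y) (hTY : ∀ q ∈ T, Y ≤ q) :
    ∑ q ∈ T, (1 : ℝ) / q ≤ 2 * (1 / Y + (1 + log n) / (p : ℝ) ^ 2) := by
  have hlog := log_natCast_nonneg n
  rcases T.eq_empty_or_nonempty with rfl | ⟨a, ha⟩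
  · rw [sum_empty]
    positivity
  have hdvd : ∀ q ∈ T, ((p ^ 2 : ℕ) : ℤ) ∣ n - q ^ 2 := fun q hq => by
    have := Int.natCast_dvd_natCast.2 (hTd q hq)
    rwa [Nat.cast_sub (hTn q hq), Nat.cast_pow q] at this
  have hpZ : Prime (p : ℤ) := Nat.prime_iff_prime_int.1 hp
  have hpa : ¬(p : ℤ) ∣ a := fun h => by
    have h1 : (p : ℤ) ∣ n - a ^ 2 := (Int.natCast_dvd_natCast.2 (dvd_pow_self p two_ne_zero)).trans
      (hdvd a ha)
    have h2 := dvd_add h1 (dvd_pow h two_ne_zero)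
    rw [sub_add_cancel] at h2
    exact hpn (Int.natCast_dvd_natCast.1 h2)
  have hcases : ∀ q ∈ T, q % p ^ 2 = a % p ^ 2 ∨ ((p ^ 2 : ℕ) : ℤ) ∣ q + a := by
    intro q hq
    have h1 : ((p ^ 2 : ℕ) : ℤ) ∣ (q - a) * (q + a) := by
      have := dvd_sub (hdvd a ha) (hdvd q hq)
      rwa [show (n - a ^ 2 - (n - q ^ 2) : ℤ) = (q - a) * (q + a) by ring] at this
    by_cases h2 : (p : ℤ) ∣ q + a
    · right
      have h3 : ¬(p : ℤ) ∣ q - a := fun h3 => by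
        have h4 := dvd_sub h2 h3
        rw [show ((q : ℤ) + a - (q - a)) = 2 * a by ring] at h4
        rcases hpZ.dvd_or_dvd h4 with h5 | h5
        · have := Int.le_of_dvd two_pos h5
          lia
        · exact hpa h5
      have h4 : IsCoprime ((p ^ 2 : ℕ) : ℤ) (q - a) := by
        rw [Nat.cast_pow]
        exact (hpZ.coprime_iff_not_dvd.2 h3).pow_left
      exact h4.dvd_of_dvd_mul_left h1
    · left
      have h4 : IsCoprime ((p ^ 2 : ℕ) : ℤ) (q + a) := by
        rw [Nat.cast_pow]
        exact (hpZ.coprime_iff_not_dvd.2 h2).pow_left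
      have h5 := h4.dvd_of_dvd_mul_right h1
      exact ((Nat.modEq_iff_dvd).2 h5).symm
  have hpos : 0 < p ^ 2 := pow_pos hp.pos 2
  have h1 := sum_one_div_residue_le (T := T.filter fun q => q % p ^ 2 = a % p ^ 2)
    ((filter_subset _ _).trans hT) hY (fun q hq => hTY q (mem_filter.1 hq).1) hpos
    fun q hq q' hq' => (mem_filter.1 hq).2.trans (mem_filter.1 hq').2.symm
  have h2 := sum_one_div_residue_le (T := T.filter fun q => ¬q % p ^ 2 = a % p ^ 2)
    ((filter_subset _ _).trans hT) hY (fun q hq => hTY q (mem_filter.1 hq).1) hpos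
    fun q hq q' hq' => by
      obtain ⟨h3, h4⟩ := mem_filter.1 hq
      obtain ⟨h5, h6⟩ := mem_filter.1 hq'
      have h7 := dvd_sub ((hcases q' h5).resolve_left h6) ((hcases q h3).resolve_left h4)
      rw [add_sub_add_right_eq_sub] at h7
      exact (Nat.modEq_iff_dvd).2 h7
  rw [← sum_filter_add_sum_filter_not T fun q => q % p ^ 2 = a % p ^ 2]
  push_cast at h1 h2
  linarith

lemma sum_sum_sq_dvd_le {n k M b : ℕ} {R Y V : ℝ} (hR : 1 < R) (hY : 0 < Y) (hV : 0 < V)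
    (hVR : V ^ 25 ≤ R) (hTY : ∀ q ∈ primeRange n, Y ≤ q) (hP : ∀ p ∈ sievePrimes n M R, 100 ≤ p) :
    ∑ p ∈ sievePrimes n M R with 1 < 25 * logSize R p,
      ∑ q ∈ classRange n M b with p ^ 2 ∣ n - q ^ 2, W n k q ≤
      2 * log n * (R / Y + (1 + log n) * (1 + log R) / V) := by
  have hlog := log_natCast_nonneg n
  have hl := log_pos hR
  have hfl : (1 : ℝ) ≤ ⌊R⌋₊ := by exact_mod_cast Nat.le_floor (by simpa using hR.le)
  have hle : (⌊R⌋₊ : ℝ) ≤ R := Nat.floor_le (by linarith)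
  have hinner : ∀ p ∈ (sievePrimes n M R).filter fun p => 1 < 25 * logSize R p,
      ∑ q ∈ classRange n M b with p ^ 2 ∣ n - q ^ 2, W n k q ≤
        2 * log n * (1 / Y + (1 + log n) / V * (1 / p)) := by
    intro p hp
    obtain ⟨hpP, hpu⟩ := mem_filter.1 hp
    have hp100 := hP p hpP
    have hp0 : (0 : ℝ) < p := by exact_mod_cast (by lia : 0 < p)
    have hVp : V ≤ p := by
      rw [logSize, mul_div_assoc', one_lt_div hl] at hpu
      have h1 : log (V ^ 25) < log ((p : ℝ) ^ 25) := by
        rw [log_pow (n := 25) (x := (p : ℝ))]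
        exact (log_le_log (by positivity) hVR).trans_lt (by exact_mod_cast hpu)
      have h2 := (log_lt_log_iff (by positivity) (by positivity)).1 h1
      exact (lt_of_pow_lt_pow_left₀ 25 hp0.le h2).le
    set T := (classRange n M b).filter fun q => p ^ 2 ∣ n - q ^ 2 with hT
    have hTr : ∀ q ∈ T, q ∈ primeRange n := fun q hq =>
      (mem_filter.1 (mem_filter.1 hq).1).1
    have hTn : T ⊆ Icc 1 n := fun q hq => by
      have h1 := sq_lt_of_mem_primeRange (hTr q hq)
      have h2 := (mem_filter.1 (hTr q hq)).2.pos
      exact mem_Icc.2 ⟨h2, by nlinarith⟩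
    have hsum := sum_one_div_sq_dvd_le (prime_of_mem_sievePrimes hpP) (by lia)
      (mem_filter.1 hpP).2.2.2.2.1 hTn (fun q hq => (sq_lt_of_mem_primeRange (hTr q hq)).le)
      (fun q hq => (mem_filter.1 hq).2) hY fun q hq => hTY q (hTr q hq)
    calc ∑ q ∈ T, W n k q ≤ ∑ q ∈ T, log n * (1 / q) := by
          refine sum_le_sum fun q hq => ?_
          obtain ⟨h1, h2⟩ := mem_Icc.1 (hTn hq)
          rw [W, mul_comm (log (n : ℝ))]
          exact mul_le_mul (wt_le (by positivity) k q)
            (log_le_log (by exact_mod_cast h1) (by exact_mod_cast h2)) (log_natCast_nonneg q)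
            (by positivity)
      _ ≤ log n * (2 * (1 / Y + (1 + log n) / (p : ℝ) ^ 2)) := by
          rw [← mul_sum]
          gcongr
      _ ≤ log n * (2 * (1 / Y + (1 + log n) / V * (1 / p))) := by
          rw [div_mul_div_comm, mul_one, sq]
          gcongr
      _ = _ := by ring
  refine (sum_le_sum hinner).trans ?_
  rw [← mul_sum]
  refine mul_le_mul_of_nonneg_left ?_ (by positivity)
  have hsub : ((sievePrimes n M R).filter fun p => 1 < 25 * logSize R p) ⊆ Icc 1 ⌊R⌋₊ :=
    (filter_subset _ _).trans (filter_subset _ _)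
  refine (sum_le_sum_of_subset_of_nonneg hsub fun p _ _ => by positivity).trans ?_
  rw [sum_add_distrib, sum_const, Nat.card_Icc, Nat.add_sub_cancel, nsmul_eq_mul, ← mul_sum,
    mul_one_div, mul_div_right_comm]
  have h1 := log_le_log (by linarith) hle
  have h2 := sum_Icc_inv_le ⌊R⌋₊
  gcongr
  linarith

lemma sum_sieve_weight_le {n k M b : ℕ} {R Y V κ B : ℝ} (hR : 1 < R) (hκ : 0 ≤ κ) (hY : 0 < Y)
    (hV : 0 < V) (hVR : V ^ 25 ≤ R) (hTY : ∀ q ∈ primeRange n, Y ≤ q) (hRY : R ≤ Y)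
    (hP : ∀ p, p.Prime → p < 100 → p ∣ M) (hgood : ∀ p, p.Prime → p ∣ M → IsGood n p b)
    (hlog : log n = (18 - κ) * log R) (hB0 : 0 ≤ B)
    (hB : ∀ q ∈ primeRange n, (9 : ℝ) ^ ω (n - q ^ 2) ≤ B)
    (hΩ : ∀ q ∈ primeRange n, 18 ≤ ArithmeticFunction.cardFactors (n - q ^ 2)) :
    ∑ q ∈ classRange n M b, W n k q *
      sieveFn (sievePrimes n M R) twoRootDensity (taper (logSize R)) (sieveDivisors n M R q) ^ 2 *
      (κ - ∑ p ∈ sieveDivisors n M R q, richertWeight κ (logSize R p)) ≤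
    κ * (mass (sievePrimes n M R) twoRootDensity (logSize R) ^ 2 * B) *
      (2 * log n * (R / Y + (1 + log n) * (1 + log R) / V)) := by
  set P := sievePrimes n M R with hPdef
  have hP100 : ∀ p ∈ P, 100 ≤ p := fun p hp => by
    by_contra! h
    exact (mem_filter.1 hp).2.2.2.1 (hP p (prime_of_mem_sievePrimes hp) h)
  have hu : ∀ p ∈ P, 0 ≤ logSize R p ∧ logSize R p < 1 := fun p hp =>
    logSize_bounds hR (hP100 p hp) (mem_filter.1 hp).2.2.1
  have hg : ∀ p ∈ P, 0 < twoRootDensity p ∧ twoRootDensity p ≤ 1 / 2 := fun p hp =>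
    twoRootDensity_bounds (hP100 p hp)
  set G := mass P twoRootDensity (logSize R) with hG
  have hterm : ∀ q ∈ classRange n M b, W n k q *
      sieveFn P twoRootDensity (taper (logSize R)) (sieveDivisors n M R q) ^ 2 *
      (κ - ∑ p ∈ sieveDivisors n M R q, richertWeight κ (logSize R p)) ≤
      κ * (G ^ 2 * B) * ∑ p ∈ P with 1 < 25 * logSize R p,
        if p ^ 2 ∣ n - q ^ 2 then W n k q else 0 := by
    intro q hq
    have hqr := (mem_filter.1 hq).1
    have hsq := sq_lt_of_mem_primeRange hqr
    have hW := W_nonneg n k q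
    have hHP : sieveDivisors n M R q ⊆ P := filter_subset _ _
    have hsum0 : 0 ≤ ∑ p ∈ sieveDivisors n M R q, richertWeight κ (logSize R p) :=
      sum_nonneg fun p hp =>
        (richertWeight_bounds hκ (hu p (hHP hp)).1 (hu p (hHP hp)).2.le).1
    have hnn : ∀ p ∈ P.filter fun p => 1 < 25 * logSize R p,
        0 ≤ if p ^ 2 ∣ n - q ^ 2 then W n k q else 0 := fun p _ => by split_ifs <;> simp [hW]
    by_cases hbad : ∃ p ∈ P, 1 < 25 * logSize R p ∧ p ^ 2 ∣ n - q ^ 2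
    · obtain ⟨p, hp, hpu, hpd⟩ := hbad
      have h1 := single_le_sum hnn (mem_filter.2 ⟨hp, hpu⟩)
      rw [if_pos hpd] at h1
      have h2 : sieveFn P twoRootDensity (taper (logSize R)) (sieveDivisors n M R q) ^ 2 ≤
          G ^ 2 * B := by
        have h3 := abs_sieveFn_le hg (fun p hp => (hu p hp).1) hHP
        have h4 := mass_nonneg (u := logSize R) hg
        have h5 : (sieveDivisors n M R q).card ≤ ω (n - q ^ 2) := by
          rw [omega_eq_card_primeFactors]
          exact card_le_card fun p hp => Nat.mem_primeFactors.2
            ⟨prime_of_mem_sievePrimes (hHP hp), (mem_filter.1 hp).2, by lia⟩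
        rw [← sq_abs]
        calc _ ≤ (G * 3 ^ (sieveDivisors n M R q).card) ^ 2 :=
              pow_le_pow_left₀ (abs_nonneg _) h3 2
          _ = G ^ 2 * 9 ^ (sieveDivisors n M R q).card := by
              rw [mul_pow, ← pow_mul, mul_comm _ 2, pow_mul]
              norm_num
          _ ≤ G ^ 2 * B := by
              refine mul_le_mul_of_nonneg_left ?_ (sq_nonneg _)
              exact (pow_le_pow_right₀ (by norm_num) h5).trans (hB q hqr)
      calc _ ≤ W n k q * sieveFn P twoRootDensity (taper (logSize R))
              (sieveDivisors n M R q) ^ 2 * κ :=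
            mul_le_mul_of_nonneg_left (by linarith) (mul_nonneg hW (sq_nonneg _))
        _ ≤ W n k q * (G ^ 2 * B) * κ :=
            mul_le_mul_of_nonneg_right (mul_le_mul_of_nonneg_left h2 hW) hκ
        _ = κ * (G ^ 2 * B) * W n k q := by ring
        _ ≤ _ := mul_le_mul_of_nonneg_left h1 (by positivity)
    · push Not at hbad
      have h1 := le_sum_richertWeight hR hκ hsq hP100
        (fun p hp hpd hpR => mem_sievePrimes (fun h => hP p hp (by lia)) hgood
          (hRY.trans (hTY q hqr)) hq hp hpd hpR) hlog (hΩ q hqr) hbad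
      exact (mul_nonpos_of_nonneg_of_nonpos (mul_nonneg hW (sq_nonneg _)) (by linarith)).trans
        (mul_nonneg (by positivity) (sum_nonneg hnn))
  refine (sum_le_sum hterm).trans ?_
  rw [← mul_sum, sum_comm]
  simp only [← sum_filter (s := classRange n M b)]
  exact mul_le_mul_of_nonneg_left (sum_sum_sq_dvd_le hR hY hV hVR hTY hP100) (by positivity)

lemma eventually_log_pow_le_rpow (K : ℕ) (C : ℝ) (hC : 0 < C) :
    ∀ᶠ n : ℕ in atTop, C * (1 + log n) ^ K ≤ (n : ℝ) ^ (1 / 2000 : ℝ) := by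
  have hlog := tendsto_log_atTop.comp (tendsto_natCast_atTop_atTop (R := ℝ))
  have hbound := (isLittleO_pow_exp_pos_mul_atTop (k := K)
    (by norm_num : (0 : ℝ) < 1 / 2000)).bound (by positivity : 0 < 1 / (C * 2 ^ K))
  filter_upwards [hlog.eventually hbound, hlog.eventually (eventually_ge_atTop 1),
    eventually_gt_atTop 0] with n h1 h2 h3
  simp only [Function.comp_apply] at h1 h2
  have hn : (0 : ℝ) < n := by exact_mod_cast h3
  rw [norm_of_nonneg (by positivity), norm_of_nonneg (exp_pos _).le, mul_comm (1 / 2000 : ℝ),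
    ← rpow_def_of_pos hn, one_div_mul_eq_div, le_div_iff₀ (by positivity)] at h1
  calc C * (1 + log n) ^ K ≤ C * (2 * log n) ^ K := by gcongr; linarith
    _ = log n ^ K * (C * 2 ^ K) := by ring
    _ ≤ _ := h1

lemma square_divisor_term_le {κ G C v L R ρ X : ℝ} (hκ0 : 0 ≤ κ) (hκ : κ ≤ 9 / 2) (hG0 : 0 ≤ G)
    (hG : G ≤ (1 + L) ^ 6) (hC : 0 ≤ C) (hL : 0 ≤ L) (hv1 : 1 < v)
    (hv : 180 * C * (1 + L) ^ 9 ≤ v) (hR : R ≤ v ^ 975) (hR0 : 0 ≤ R) (hρ0 : 0 ≤ ρ) (hρ : ρ ≤ L)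
    (hX : 1 / v ≤ X) :
    κ * (G * (C * v)) * (2 * L * (R / v ^ 980 + (1 + L) * (1 + ρ) / v ^ 5)) ≤ X / 10 := by
  have hv0 : 0 < v := by linarith
  have h1 : R / v ^ 980 ≤ (1 + L) ^ 2 / v ^ 5 := by
    calc R / v ^ 980 ≤ v ^ 975 / v ^ 980 := by gcongr
      _ = 1 / v ^ 5 := by
          rw [div_eq_div_iff (by positivity) (by positivity), one_mul, ← pow_add]
      _ ≤ _ := by
          gcongr
          exact one_le_pow₀ (by linarith)
  have h2 : (1 + L) * (1 + ρ) / v ^ 5 ≤ (1 + L) ^ 2 / v ^ 5 := by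
    rw [sq]
    gcongr
  have h3 : 2 * L * (R / v ^ 980 + (1 + L) * (1 + ρ) / v ^ 5) ≤ 4 * (1 + L) ^ 3 / v ^ 5 := by
    calc _ ≤ 2 * (1 + L) * ((1 + L) ^ 2 / v ^ 5 + (1 + L) ^ 2 / v ^ 5) := by
          gcongr
          linarith
      _ = _ := by ring
  calc _ ≤ 9 / 2 * ((1 + L) ^ 6 * (C * v)) * (4 * (1 + L) ^ 3 / v ^ 5) := by gcongr
    _ = (180 * C * (1 + L) ^ 9) * (v / v ^ 5) / 10 := by ring
    _ ≤ v * (v / v ^ 5) / 10 := by gcongr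
    _ = (1 / v) * (1 / v ^ 2) / 10 := by field_simp
    _ ≤ (1 / v) * 1 / 10 := by
        gcongr
        rw [div_le_one (by positivity)]
        exact one_le_pow₀ hv1.le
    _ ≤ _ := by linarith

lemma remainder_term_le {κ G L X E : ℝ} (hκ0 : 0 ≤ κ) (hκ : κ ≤ 9 / 2) (hG0 : 0 ≤ G)
    (hG : G ≤ (1 + L) ^ 6) (hL : 6400 ≤ L) (hE : 0 ≤ E) (h : E * L ^ 7 ≤ X) :
    (2 * κ + 1) * (G * E) ≤ X / 10 := by
  have h1 : 100 * (1 + L) ^ 6 ≤ L ^ 7 := by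
    calc 100 * (1 + L) ^ 6 ≤ 100 * (2 * L) ^ 6 := by gcongr; linarith
      _ = 6400 * L ^ 6 := by ring
      _ ≤ L * L ^ 6 := by gcongr
      _ = _ := by ring
  calc _ ≤ 10 * ((1 + L) ^ 6 * E) := by
        gcongr
        linarith
    _ = 100 * (1 + L) ^ 6 * E / 10 := by ring
    _ ≤ L ^ 7 * E / 10 := by gcongr
    _ ≤ _ := by linarith

theorem eventually_exists_cardFactors_lt : ∀ᶠ n : ℕ in atTop, (n % 6 = 0 ∨ n % 6 = 2) →
    ∃ q ∈ primeRange n, ArithmeticFunction.cardFactors (n - q ^ 2) < 18 := by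
  obtain ⟨p₀, hp₀, hsum⟩ := exists_sum_two_log_div_le
  obtain ⟨C, hC1, hC⟩ := pow_omega_le 9 (by norm_num : (0 : ℝ) < 1 / 2000)
  have hlog := tendsto_log_atTop.comp (tendsto_natCast_atTop_atTop (R := ℝ))
  filter_upwards [eventually_exists_class p₀ 7, eventually_log_pow_le_rpow 9 (180 * C) (by positivity),
    hlog.eventually (eventually_ge_atTop 6400), eventually_gt_atTop 1] with n hclass hv hL hn1 hn
  simp only [Function.comp_apply] at hL
  obtain ⟨M, b, k, -, hM, hgood, hX, herr⟩ := hclass hn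
  by_contra! hΩ
  have hn0 : (0 : ℝ) ≤ n := Nat.cast_nonneg n
  set v : ℝ := (n : ℝ) ^ (1 / 2000 : ℝ) with hvdef
  set L := log (n : ℝ) with hLdef
  set X := classSum n k M b 1 with hXdef
  have hv1 : 1 < v := one_lt_rpow (by exact_mod_cast hn1) (by norm_num)
  have hv0 : 0 < v := by linarith
  have hlogv : log v = 1 / 2000 * L := log_rpow (by exact_mod_cast (by lia : 0 < n)) _
  have hvpow : ∀ j : ℕ, v ^ j = (n : ℝ) ^ ((1 / 2000 : ℝ) * j) := fun j => by
    rw [rpow_mul hn0, rpow_natCast]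
  obtain ⟨R, hRdef⟩ : ∃ R, R = v ^ 148 := ⟨_, rfl⟩
  have hR : 1 < R := hRdef ▸ one_lt_pow₀ hv1 (by norm_num)
  have hlogR : log R = 37 / 500 * L := by
    rw [hRdef, log_pow, hlogv]
    push_cast
    ring
  have hP100 : ∀ p ∈ sievePrimes n M R, p.Prime ∧ p₀ < p := fun p hp => by
    refine ⟨prime_of_mem_sievePrimes hp, ?_⟩
    by_contra! h
    exact (mem_filter.1 hp).2.2.2.1 (hM p (prime_of_mem_sievePrimes hp) h)
  have hTY : ∀ q ∈ primeRange n, v ^ 980 ≤ q := fun q hq => by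
    have h1 := (mem_Ioc.1 (mem_filter.1 hq).1).1
    have h2 : (n : ℝ) ^ (49 / 100 : ℝ) ≤ q := (Nat.le_ceil _).trans (by exact_mod_cast h1.le)
    rw [hvpow]
    convert h2 using 2
    norm_num
  have hB : ∀ q ∈ primeRange n, (9 : ℝ) ^ ω (n - q ^ 2) ≤ C * v := fun q hq => by
    have h1 := sq_lt_of_mem_primeRange hq
    have h2 := hC (n - q ^ 2) (by lia)
    push_cast at h2
    refine h2.trans (mul_le_mul_of_nonneg_left ?_ (by linarith))
    exact rpow_le_rpow (Nat.cast_nonneg _) (by exact_mod_cast Nat.sub_le _ _) (by norm_num)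
  obtain ⟨κ, hκ⟩ : ∃ κ : ℝ, κ = 18 - 500 / 37 := ⟨_, rfl⟩
  have hκ4 : 4 + 2 / 5 ≤ κ := by rw [hκ]; norm_num
  have hκ5 : κ ≤ 9 / 2 := by rw [hκ]; norm_num
  have hXpos : 1 / v ≤ X := by rwa [div_le_iff₀ hv0]
  have hX0 : 0 < X := (by positivity : 0 < 1 / v).trans_le hXpos
  have hu : ∀ p ∈ sievePrimes n M R, 0 ≤ logSize R p ∧ logSize R p < 1 := fun p hp =>
    logSize_bounds hR (by have := (hP100 p hp).2; lia) (mem_filter.1 hp).2.2.1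
  have hg : ∀ p ∈ sievePrimes n M R, 0 < twoRootDensity p ∧ twoRootDensity p ≤ 1 / 2 := fun p hp =>
    twoRootDensity_bounds (by have := (hP100 p hp).2; lia)
  have hsieve := weighted_sieve (c := fun p => richertWeight κ (logSize R p)) (by linarith) hg hu
    (fun t ht _ => sum_odds_mul_logSize_le hp₀ hsum hR hP100 ht)
    (fun p hp => richertWeight_bounds (by linarith) (hu p hp).1 (hu p hp).2.le)
    (fun p hp => richertWeight_mul_le (by linarith) hκ5 (hu p hp).1 (hu p hp).2.le)
    (classRange n M b) (W n k) (Hf := sieveDivisors n M R) (fun q _ => filter_subset _ _) hX0.le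
  have hweight := sum_sieve_weight_le (k := k) (b := b) (M := M) (V := v ^ 5) (Y := v ^ 980) hR
    (by linarith : 0 ≤ κ) (by positivity) (by positivity)
    (by rw [hRdef, ← pow_mul]; exact pow_le_pow_right₀ hv1.le (by norm_num)) hTY
    (by rw [hRdef]; exact pow_le_pow_right₀ hv1.le (by norm_num))
    (fun p hp h => hM p hp (by lia)) hgood
    (by rw [hlogR, hκ]; ring) (by positivity) hB hΩ
  have herr' := sum_error_le n k M b hR
  rw [hRdef, ← pow_mul, ← hRdef] at herr'
  have hmass : mass (sievePrimes n M R) twoRootDensity (logSize R) ^ 2 ≤ (1 + L) ^ 6 := by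
    have h1 := mass_le hR fun p hp => ⟨(hP100 p hp).1, by have := (hP100 p hp).2; lia⟩
    have h2 := mass_nonneg (u := logSize R) hg
    calc _ ≤ ((1 + log R) ^ 3) ^ 2 := pow_le_pow_left₀ h2 h1 2
      _ ≤ ((1 + L) ^ 3) ^ 2 := by
          have : 0 ≤ log R := (log_pos hR).le
          gcongr
          rw [hlogR]
          linarith
      _ = _ := by ring
  set G := mass (sievePrimes n M R) twoRootDensity (logSize R) with hG
  have hfirst := square_divisor_term_le (R := R) (ρ := log R) (by linarith) hκ5 (sq_nonneg G) hmass
    (by linarith) (by linarith) hv1 hv (by rw [hRdef]; exact pow_le_pow_right₀ hv1.le (by norm_num))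
    (by linarith) (log_pos hR).le (by linarith) hXpos
  have hsecond := fun E hE => remainder_term_le (κ := κ) (X := X) (E := E) (by linarith) hκ5
    (sq_nonneg G) hmass hL hE
  have hE := hsecond _ (sum_nonneg fun d _ => by positivity) herr
  have hfinal : (κ - 4) * X ≤ X / 10 + X / 10 := by
    refine hsieve.trans (add_le_add (hweight.trans hfirst) (le_trans ?_ hE))
    exact mul_le_mul_of_nonneg_left (mul_le_mul_of_nonneg_left herr' (sq_nonneg _)) (by linarith)
  nlinarith

end PrimeSquareSieve

/-- There is a constant `N` such that every `n > N` with `n ≡ 0` or `2 (mod 6)` can be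
written as `n = q² + η` with `q` prime and `η > 0` having at most `17` prime factors
counted with multiplicity. -/
theorem prime_square_plus_almost_prime :
    ∃ N : ℕ, 0 < N ∧ ∀ n : ℕ, N < n → (n % 6 = 0 ∨ n % 6 = 2) →
      ∃ q η : ℕ, q.Prime ∧ 0 < η ∧ ArithmeticFunction.cardFactors η ≤ 17 ∧
        n = q ^ 2 + η := by
  obtain ⟨N, hN⟩ := Filter.eventually_atTop.1 PrimeSquareSieve.eventually_exists_cardFactors_lt
  refine ⟨N + 1, N.succ_pos, fun n hn h => ?_⟩
  obtain ⟨q, hq, hΩ⟩ := hN n (by lia) h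
  have hsq := PrimeSquareSieve.sq_lt_of_mem_primeRange hq
  exact ⟨q, n - q ^ 2, (Finset.mem_filter.1 hq).2, by lia, by lia, by lia⟩
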